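/- Let n ≥ 3 be a natural number. Then for every continuous map f ∈ C(S^{4n+1}, Γ_{2n+1}⁺), the homotopy group π₂(C(S^{4n+1}, Γ_{2n+1}⁺), f) contains a subgroup isomorphic to ℤ × ℤ. -/

import Mathlib

open Topology

/-- The unit sphere `S^m ⊆ ℝ^{m+1}` centered at the origin. -/
noncomputable def Sph (m : ℕ) : Set (EuclideanSpace ℝ (Fin (m + 1))) :=
  Metric.sphere (0 : EuclideanSpace ℝ (Fin (m + 1))) 1

/-- The north pole `N = (0, …, 0, 1) ∈ S^m`. -/
noncomputable def northPole (m : ℕ) : Sph m :=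
  ⟨EuclideanSpace.single (Fin.last m) (1 : ℝ), by
    simp [Sph, EuclideanSpace.norm_single]⟩

/-- The space `Γ_n` of orthogonal complex structures on `ℝ^{2n}`: real `(2n) × (2n)` matrices
`J` (with `Fin (2n)` identified with `Fin n ⊕ Fin n`) such that `Jᵀ * J = 1` and `J * J = -1`,
with the subspace topology. -/
def Gamma (n : ℕ) : Set (Matrix (Fin n ⊕ Fin n) (Fin n ⊕ Fin n) ℝ) :=
  {J | J.transpose * J = 1 ∧ J * J = -1}

/-- The standard complex structure `J₀` on `ℝ^{2n}`, given by the block matrix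
`[[0, -1], [1, 0]]`. -/
def J0 (n : ℕ) : Matrix (Fin n ⊕ Fin n) (Fin n ⊕ Fin n) ℝ :=
  Matrix.fromBlocks 0 (-1) 1 0

theorem J0_mem (n : ℕ) : J0 n ∈ Gamma n := by
  constructor
  · simp [J0, Matrix.fromBlocks_transpose, Matrix.fromBlocks_multiply, ← Matrix.fromBlocks_one]
  · have h : (-1 : Matrix (Fin n ⊕ Fin n) (Fin n ⊕ Fin n) ℝ)
        = Matrix.fromBlocks (-1) (-0) (-0) (-1) := by
      rw [← Matrix.fromBlocks_neg, Matrix.fromBlocks_one]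
    simp [J0, Matrix.fromBlocks_multiply, h]

/-- `Γ_n⁺`: the path component of the standard complex structure `J₀` in `Γ_n`
(the homogeneous space `SO(2n)/U(n)`). -/
noncomputable def GammaPlus (n : ℕ) : Set (Gamma n) :=
  pathComponent (⟨J0 n, J0_mem n⟩ : Gamma n)

/-- `Γ_n⁺` pointed at `J₀`. -/
noncomputable def J0plus (n : ℕ) : GammaPlus n :=
  ⟨⟨J0 n, J0_mem n⟩, mem_pathComponent_self _⟩

set_option linter.unusedSectionVars false

section MaurerCartan

open ContinuousAlternatingMap

variable {𝒜 : Type*} [NormedRing 𝒜] [NormedAlgebra ℝ 𝒜] {d : ℕ}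

/-- Invariance of an alternating form on an algebra under conjugation by units. -/
def AdInvariant (c : 𝒜 [⋀^Fin d]→L[ℝ] ℝ) : Prop :=
  ∀ (u : 𝒜ˣ) (w : Fin d → 𝒜), c (fun i => u * w i * ↑u⁻¹) = c w

/-- The left invariant form on the units of an algebra with value `c` at `1`. -/
noncomputable def mcForm (c : 𝒜 [⋀^Fin d]→L[ℝ] ℝ) (a : 𝒜) : 𝒜 [⋀^Fin d]→L[ℝ] ℝ :=
  c.compContinuousLinearMap (ContinuousLinearMap.mul ℝ 𝒜 (Ring.inverse a))

theorem mcForm_apply (c : 𝒜 [⋀^Fin d]→L[ℝ] ℝ) (a : 𝒜) (v : Fin d → 𝒜) :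
    mcForm c a v = c (fun i => Ring.inverse a * v i) := rfl

variable [CompleteSpace 𝒜]

theorem differentiableAt_mcForm (c : 𝒜 [⋀^Fin d]→L[ℝ] ℝ) (a : 𝒜ˣ) :
    DifferentiableAt ℝ (mcForm c) a := by
  unfold mcForm
  have h : DifferentiableAt ℝ (fun a : 𝒜 => ContinuousLinearMap.mul ℝ 𝒜 (Ring.inverse a)) a :=
    (ContinuousLinearMap.differentiableAt _).comp _ (differentiableAt_inverse a.isUnit)
  exact (differentiableAt_const c).continuousAlternatingMapCompContinuousLinearMap h

theorem extDeriv_mcForm_one {c : 𝒜 [⋀^Fin d]→L[ℝ] ℝ} (hc : AdInvariant c) :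
    extDeriv (mcForm c) 1 = 0 := by
  have h1 := extDeriv_pullback (𝕜 := ℝ) (x := (1 : 𝒜)) (ω := mcForm c) (f := Ring.inverse) (r := 2)
    (by rw [Ring.inverse_one]; exact differentiableAt_mcForm c 1)
    (by simpa using contDiffAt_ringInverse ℝ (1 : 𝒜ˣ)) (by simp)
  have hev : (fun x : 𝒜 => (mcForm c (Ring.inverse x)).compContinuousLinearMap
      (fderiv ℝ Ring.inverse x)) =ᶠ[𝓝 1] fun x => ((-1 : ℝ) ^ d) • mcForm c x := by
    filter_upwards [Units.isOpen.mem_nhds (isUnit_one : IsUnit (1 : 𝒜))] with x hx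
    obtain ⟨x, rfl⟩ := hx
    ext v
    have h2 := hc x (fun i => - (Ring.inverse (x : 𝒜) * v i))
    simp only [compContinuousLinearMap_apply, ContinuousAlternatingMap.smul_apply, Function.comp_def,
      fderiv_inverse, mcForm_apply, Ring.inverse_unit, Ring.inverse_unit x⁻¹, inv_inv]
    have h3 : (fun i => (x : 𝒜) * (-(ContinuousLinearMap.mulLeftRight ℝ 𝒜) ↑x⁻¹ ↑x⁻¹) (v i)) =
        fun i => (x : 𝒜) * (- (Ring.inverse (x : 𝒜) * v i)) * ↑x⁻¹ := by
      ext i; simp [mul_assoc]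
    rw [h3, h2]
    have := c.toMultilinearMap.map_smul_univ (fun _ => (-1 : ℝ)) (fun i => Ring.inverse (x : 𝒜) * v i)
    simpa [mcForm_apply] using this
  rw [hev.extDeriv_eq] at h1
  have h5 : extDeriv (fun x => ((-1 : ℝ) ^ d) • mcForm c x) 1 =
      ((-1 : ℝ) ^ d) • extDeriv (mcForm c) 1 :=
    extDeriv_fun_smul _ _
  rw [h5] at h1
  have h6 : (fderiv ℝ (Ring.inverse : 𝒜 → 𝒜) 1) = - ContinuousLinearMap.id ℝ 𝒜 := by
    have := fderiv_inverse (𝕜 := ℝ) (1 : 𝒜ˣ)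
    ext v
    simpa using congrArg (fun L => L v) this
  rw [h6, Ring.inverse_one] at h1
  ext v
  have h7 := congrArg (fun L => L v) h1
  simp only [compContinuousLinearMap_apply, ContinuousAlternatingMap.smul_apply, Function.comp_def] at h7
  have := (extDeriv (mcForm c) 1).toMultilinearMap.map_smul_univ (fun _ => (-1 : ℝ)) v
  have h8 : (extDeriv (mcForm c) 1) (fun i => (-ContinuousLinearMap.id ℝ 𝒜) (v i)) =
      (-1) ^ (d + 1) * extDeriv (mcForm c) 1 v := by
    simpa [mcForm_apply] using this
  rw [h8, pow_succ, smul_eq_mul] at h7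
  have h9 : ((-1 : ℝ) ^ d) ≠ 0 := pow_ne_zero _ (by norm_num)
  have h10 : ((-1 : ℝ) ^ d) * (2 * extDeriv (mcForm c) 1 v) = 0 := by linarith
  have := (mul_eq_zero.1 h10).resolve_left h9
  simpa using this

theorem extDeriv_mcForm {c : 𝒜 [⋀^Fin d]→L[ℝ] ℝ} (hc : AdInvariant c) (a : 𝒜ˣ) :
    extDeriv (mcForm c) (a : 𝒜) = 0 := by
  have hf : ∀ x : 𝒜, fderiv ℝ (fun x : 𝒜 => (↑a⁻¹ : 𝒜) * x) x =
      ContinuousLinearMap.mul ℝ 𝒜 (↑a⁻¹ : 𝒜) := fun x =>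
    (ContinuousLinearMap.mul ℝ 𝒜 (↑a⁻¹ : 𝒜)).hasFDerivAt.fderiv
  have h1 := extDeriv_pullback (𝕜 := ℝ) (x := (a : 𝒜)) (ω := mcForm c)
    (f := fun x => (↑a⁻¹ : 𝒜) * x) (r := 2)
    (by rw [Units.inv_mul]; exact differentiableAt_mcForm c 1)
    (contDiff_const.mul contDiff_id).contDiffAt (by simp)
  rw [Units.inv_mul, extDeriv_mcForm_one hc] at h1
  have hev : (fun x : 𝒜 => (mcForm c ((↑a⁻¹ : 𝒜) * x)).compContinuousLinearMap
      (fderiv ℝ (fun x : 𝒜 => (↑a⁻¹ : 𝒜) * x) x)) =ᶠ[𝓝 (a : 𝒜)] mcForm c := by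
    filter_upwards [Units.isOpen.mem_nhds a.isUnit] with x hx
    obtain ⟨x, rfl⟩ := hx
    ext v
    simp only [compContinuousLinearMap_apply, mcForm_apply, Function.comp_def, hf]
    rw [← Units.val_mul, Ring.inverse_unit, Ring.inverse_unit]
    simp [mul_assoc]
  rw [hev.extDeriv_eq] at h1
  rw [h1]
  ext v
  simp

/-- The Maurer-Cartan type integral of a smooth map from `ℝ^d` to the units of an algebra. -/
noncomputable def mcInt (c : 𝒜 [⋀^Fin d]→L[ℝ] ℝ) (g : (Fin d → ℝ) → 𝒜) : ℝ :=
  ∫ y, mcForm c (g y) (fun i => fderiv ℝ g y (Pi.single i 1))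

theorem mcInt_eq_of_smooth_homotopy {c : 𝒜 [⋀^Fin d]→L[ℝ] ℝ} (hc : AdInvariant c)
    {G : (Fin (d + 1) → ℝ) → 𝒜} (hG : ContDiff ℝ 2 G) (hu : ∀ x, IsUnit (G x)) {R : ℝ}
    (hR : ∀ x (i : Fin d), R < |x i.succ| → G x = 1) :
    mcInt c (fun y => G (Fin.cons 0 y)) = mcInt c (fun y => G (Fin.cons 1 y)) := by
  classical
  set η : (Fin (d + 1) → ℝ) → (Fin (d + 1) → ℝ) [⋀^Fin d]→L[ℝ] ℝ :=
    fun x => (mcForm c (G x)).compContinuousLinearMap (fderiv ℝ G x) with hη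
  have hmc : ∀ x, DifferentiableAt ℝ (mcForm c) (G x) := fun x => by
    obtain ⟨u, hu⟩ := hu x
    rw [← hu]; exact differentiableAt_mcForm c u
  have hdG : Differentiable ℝ (fderiv ℝ G) :=
    (hG.fderiv_right (m := 1) (by norm_num)).differentiable (by norm_num)
  have hηd : Differentiable ℝ η := fun x =>
    ((hmc x).comp x (hG.differentiable (by norm_num) x)).continuousAlternatingMapCompContinuousLinearMap
      (hdG x)
  have hclosed : ∀ x, extDeriv η x = 0 := fun x => by
    rw [hη, extDeriv_pullback (hmc x) hG.contDiffAt (by simp)]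
    obtain ⟨u, hu⟩ := hu x
    rw [← hu, extDeriv_mcForm hc]
    ext v; simp
  set e : Fin (d + 1) → Fin (d + 1) → ℝ := fun i => Pi.single i 1 with he
  set F : Fin (d + 1) → (Fin (d + 1) → ℝ) → ℝ := fun i x => (-1) ^ (i : ℕ) * η x (i.removeNth e)
    with hF
  have hFd : ∀ i, Differentiable ℝ (F i) := fun i x => by
    refine DifferentiableAt.const_mul ?_ _
    exact (hηd x).continuousAlternatingMap_apply_const _
  have hsum : ∀ x, ∑ i, fderiv ℝ (F i) x (Pi.single i 1) = 0 := fun x => by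
    have := congrArg (fun L => L e) (hclosed x)
    rw [extDeriv_apply (hηd x)] at this
    simp only [ContinuousAlternatingMap.coe_zero, Pi.zero_apply] at this
    rw [← this]
    refine Finset.sum_congr rfl fun i _ => ?_
    rw [hF]
    rw [fderiv_const_mul ((hηd x).continuousAlternatingMap_apply_const _)]
    simp [he]
  set S : ℝ := |R| + 1 with hS
  set a : Fin (d + 1) → ℝ := Fin.cons 0 (fun _ => -S)
  set b : Fin (d + 1) → ℝ := Fin.cons 1 (fun _ => S)
  have hab : a ≤ b := by
    intro i
    refine Fin.cases ?_ (fun i => ?_) i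
    · simp [a, b]
    · simp only [a, b, Fin.cons_succ, hS]; linarith [abs_nonneg R]
  have hdiv := MeasureTheory.integral_divergence_of_hasFDerivAt_off_countable' a b hab F
    (fun i x => fderiv ℝ (F i) x) ∅ Set.countable_empty
    (fun i => (hFd i).continuous.continuousOn)
    (fun x _ i => (hFd i x).hasFDerivAt) (by simp [hsum])
  simp only [hsum, MeasureTheory.integral_zero] at hdiv
  rw [Fin.sum_univ_succ] at hdiv
  have hzero : ∀ x, (∃ i : Fin d, R < |x i.succ|) → η x = 0 := by
    rintro x ⟨i, hi⟩
    have hev : G =ᶠ[𝓝 x] fun _ => 1 := by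
      filter_upwards [(isOpen_lt continuous_const ((continuous_apply i.succ).abs)).mem_nhds hi]
        with z hz using hR z i hz
    have hd0 : fderiv ℝ G x = 0 := by rw [hev.fderiv_eq]; simp
    have : Nonempty (Fin d) := ⟨i⟩
    ext v
    simp only [hη, hd0, ContinuousAlternatingMap.compContinuousLinearMap_apply,
      ContinuousAlternatingMap.coe_zero, Pi.zero_apply, Function.comp_def,
      zero_apply]
    exact (mcForm c (G x)).map_zero
  have hSR : R < |S| := by
    rw [hS, abs_of_nonneg (by positivity)]; linarith [le_abs_self R]
  have hside : ∀ (i : Fin d) (y : Fin d → ℝ) (r : ℝ), |r| = |S| →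
      F i.succ (i.succ.insertNth r y) = 0 := fun i y r hr => by
    simp only [hF]
    rw [hzero _ ⟨i, by rw [Fin.insertNth_apply_same, hr]; exact hSR⟩]
    simp
  have hend : ∀ r : ℝ, ∫ y in Set.Icc (a ∘ Fin.succ) (b ∘ Fin.succ), F 0 (Fin.insertNth 0 r y) =
      mcInt c (fun y => G (Fin.cons r y)) := fun r => by
    have hder : ∀ y : Fin d → ℝ, ∀ i : Fin d,
        fderiv ℝ (fun y : Fin d → ℝ => G (Fin.cons r y)) y (Pi.single i 1) =
          fderiv ℝ G (Fin.cons r y) (Pi.single i.succ 1) := fun y i => by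
      let L : (Fin d → ℝ) →L[ℝ] (Fin (d + 1) → ℝ) :=
        ContinuousLinearMap.pi (Fin.cons 0 (fun i => ContinuousLinearMap.proj i))
      have hL : HasFDerivAt (fun y : Fin d → ℝ => (Fin.cons r y : Fin (d + 1) → ℝ)) L y := by
        rw [hasFDerivAt_pi]
        intro j
        refine Fin.cases ?_ (fun j => ?_) j
        · simpa using hasFDerivAt_const r y
        · simpa using hasFDerivAt_apply (𝕜 := ℝ) j y
      have h1 := ((hG.differentiable (by norm_num) (Fin.cons r y)).hasFDerivAt.comp y hL).fderiv
      have h2 : L (Pi.single i 1) = Pi.single i.succ 1 := by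
        ext j
        refine Fin.cases ?_ (fun j => ?_) j
        · simp [L]
        · simp [L, Pi.single_apply, Fin.succ_inj]
      rw [← h2]
      exact congrArg (fun M => M (Pi.single i 1)) h1
    have hintegrand : ∀ y : Fin d → ℝ, F 0 (Fin.insertNth 0 r y) =
        mcForm c (G (Fin.cons r y)) (fun i => fderiv ℝ (fun y : Fin d → ℝ => G (Fin.cons r y)) y
          (Pi.single i 1)) := fun y => by
      simp only [hder]
      simp only [hF, hη, Fin.insertNth_zero', Fin.val_zero, pow_zero, one_mul]
      rfl
    rw [MeasureTheory.setIntegral_eq_integral_of_forall_compl_eq_zero]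
    · exact MeasureTheory.integral_congr_ae (Filter.Eventually.of_forall hintegrand)
    · intro y hy
      have : ∃ i, S < |y i| := by
        by_contra! h
        exact hy ⟨fun i => (abs_le.1 (h i)).1, fun i => (abs_le.1 (h i)).2⟩
      obtain ⟨i, hi⟩ := this
      simp only [hF]
      rw [hzero _ ⟨i, by
        rw [Fin.insertNth_zero', Fin.cons_succ]
        refine lt_of_le_of_lt ?_ hi
        rw [hS]; linarith [le_abs_self R]⟩]
      simp
  have hsides : ∑ i : Fin d, ((∫ x in Set.Icc (a ∘ i.succ.succAbove) (b ∘ i.succ.succAbove),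
      F i.succ (i.succ.insertNth (b i.succ) x)) -
      ∫ x in Set.Icc (a ∘ i.succ.succAbove) (b ∘ i.succ.succAbove),
        F i.succ (i.succ.insertNth (a i.succ) x)) = 0 := by
    refine Finset.sum_eq_zero fun i _ => ?_
    simp only [hside i _ (b i.succ) (by simp [b]), hside i _ (a i.succ) (by simp [a])]
    simp
  rw [hsides] at hdiv
  have h1 := hend 1
  have h0 := hend 0
  simp only [add_zero] at hdiv
  have hdiv' := hdiv.symm
  rw [sub_eq_zero] at hdiv'
  rw [← h1, ← h0]
  exact hdiv'.symm

end MaurerCartan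

section MaurerCartanDegree

open unitInterval

theorem isUnit_of_norm_sub_mul_lt_one {𝒜 : Type*} [NormedRing 𝒜] [CompleteSpace 𝒜] (a : 𝒜ˣ) (b : 𝒜) (h : ‖b - a‖ * ‖(↑a⁻¹ : 𝒜)‖ < 1) :
    IsUnit b := by
  have h1 : ‖(↑a⁻¹ : 𝒜) * (a - b)‖ < 1 := by
    refine lt_of_le_of_lt (norm_mul_le _ _) ?_
    rwa [norm_sub_rev, mul_comm]
  have h2 : b = a * (1 - (↑a⁻¹ : 𝒜) * (a - b)) := by
    rw [mul_sub, ← mul_assoc]; simp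
  rw [h2]
  exact a.isUnit.mul (isUnit_one_sub_of_norm_lt_one h1)

variable {𝒜 : Type*} [NormedRing 𝒜] [NormedAlgebra ℝ 𝒜] [CompleteSpace 𝒜] {d : ℕ}

/-- `u` is a smooth map, equal to `1` near infinity, so close to `g` that the segment from `u` to
`g` consists of units. -/
structure IsSmoothApprox (g : (Fin d → ℝ) → 𝒜ˣ) (u : (Fin d → ℝ) → 𝒜) : Prop where
  contDiff : ContDiff ℝ 2 u
  eq_one : ∃ R : ℝ, ∀ x (i : Fin d), R < |x i| → u x = 1
  near : ∀ x, ‖u x - g x‖ * ‖(↑(g x)⁻¹ : 𝒜)‖ < 1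

theorem exists_bound_of_hasCompactMulSupport {α : Type*} [One α] {g : (Fin d → ℝ) → α}
    (hg : HasCompactMulSupport g) : ∃ R : ℝ, ∀ x (i : Fin d), R < |x i| → g x = 1 := by
  obtain ⟨R, hR⟩ := hg.isCompact.isBounded.exists_norm_le
  refine ⟨R, fun x i hi => ?_⟩
  by_contra h
  have h1 := hR x (subset_mulTSupport g h)
  have h2 := norm_le_pi_norm x i
  rw [Real.norm_eq_abs] at h2
  linarith

theorem exists_isSmoothApprox {g : (Fin d → ℝ) → 𝒜ˣ} (hg : Continuous g)
    (hs : HasCompactMulSupport g) {ε : (Fin d → ℝ) → ℝ} (hε : Continuous ε) (hε0 : ∀ x, 0 < ε x) :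
    ∃ u, IsSmoothApprox g u ∧ (∀ x, g x = 1 → u x = 1) ∧ ∀ x, ‖u x - g x‖ < ε x := by
  have hgv : Continuous fun x => ((g x : 𝒜) - 1) := (Units.continuous_val.comp hg).sub continuous_const
  have hgi : Continuous fun x => ‖(↑(g x)⁻¹ : 𝒜)‖ :=
    (Units.continuous_val.comp (continuous_inv.comp hg)).norm
  obtain ⟨v, hv, hvd, hvs⟩ := hgv.exists_contDiff_approx (2 : ℕ)
    (ε := fun x => min (ε x) (1 + ‖(↑(g x)⁻¹ : 𝒜)‖)⁻¹)
    (hε.min ((continuous_const.add hgi).inv₀ fun x =>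
      (add_pos_of_pos_of_nonneg one_pos (norm_nonneg _)).ne'))
    (fun x => lt_min (hε0 x) (by positivity))
  have h1 : ∀ x, g x = 1 → v x + 1 = 1 := fun x hx => by
    by_contra h
    have : x ∈ Function.support v := fun h' => h (by simp [h'])
    exact hvs this (by simp [hx])
  have h2 : ∀ x, ‖v x + 1 - (g x : 𝒜)‖ < min (ε x) (1 + ‖(↑(g x)⁻¹ : 𝒜)‖)⁻¹ := fun x => by
    have h2 := hvd x
    rw [dist_eq_norm] at h2
    have h3 : v x + 1 - (g x : 𝒜) = v x - ((g x : 𝒜) - 1) := by abel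
    rwa [h3]
  refine ⟨fun x => v x + 1, ⟨hv.add contDiff_const, ?_, fun x => ?_⟩, h1,
    fun x => (h2 x).trans_le (min_le_left _ _)⟩
  · obtain ⟨R, hR⟩ := exists_bound_of_hasCompactMulSupport hs
    exact ⟨R, fun x i hi => h1 x (hR x i hi)⟩
  · have h4 : 0 < 1 + ‖(↑(g x)⁻¹ : 𝒜)‖ := by positivity
    have h5 := ((h2 x).trans_le (min_le_right _ _)).le
    calc _ ≤ (1 + ‖(↑(g x)⁻¹ : 𝒜)‖)⁻¹ * ‖(↑(g x)⁻¹ : 𝒜)‖ := by gcongr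
      _ < 1 := by rw [inv_mul_lt_iff₀ h4]; linarith

theorem IsSmoothApprox.mcInt_eq {c : 𝒜 [⋀^Fin d]→L[ℝ] ℝ} (hc : AdInvariant c)
    {g : (Fin d → ℝ) → 𝒜ˣ} {u v : (Fin d → ℝ) → 𝒜} (hu : IsSmoothApprox g u)
    (hv : IsSmoothApprox g v) : mcInt c u = mcInt c v := by
  let G : (Fin (d + 1) → ℝ) → 𝒜 := fun x =>
    (1 - Real.smoothTransition (x 0)) • u (fun i => x i.succ) +
      Real.smoothTransition (x 0) • v (fun i => x i.succ)
  have hT : ContDiff ℝ 2 fun x : Fin (d + 1) → ℝ => Real.smoothTransition (x 0) :=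
    Real.smoothTransition.contDiff.comp (contDiff_apply ℝ ℝ 0)
  have hsucc : ContDiff ℝ 2 fun x : Fin (d + 1) → ℝ => (fun i : Fin d => x i.succ) :=
    contDiff_pi.2 fun i => contDiff_apply ℝ ℝ i.succ
  obtain ⟨R, hR⟩ := hu.eq_one
  obtain ⟨R', hR'⟩ := hv.eq_one
  have h := mcInt_eq_of_smooth_homotopy hc (G := G) (R := max R R')
    (((contDiff_const.sub hT).smul (hu.contDiff.comp hsucc)).add (hT.smul (hv.contDiff.comp hsucc)))
    (fun x => ?_) (fun x i hi => ?_)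
  · simpa [G] using h
  · refine isUnit_of_norm_sub_mul_lt_one (g fun i => x i.succ) _ ?_
    set t := Real.smoothTransition (x 0)
    have ht0 : 0 ≤ t := Real.smoothTransition.nonneg _
    have ht1 : t ≤ 1 := Real.smoothTransition.le_one _
    set y : Fin d → ℝ := fun i => x i.succ
    have h3 : G x - g y = (1 - t) • (u y - g y) + t • (v y - g y) := by
      simp only [G]; module
    have h1 := hu.near y
    have h2 := hv.near y
    rw [h3]
    calc _ ≤ ((1 - t) * ‖u y - g y‖ + t * ‖v y - g y‖) * ‖(↑(g y)⁻¹ : 𝒜)‖ := by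
          gcongr
          refine (norm_add_le _ _).trans ?_
          rw [norm_smul, norm_smul, Real.norm_of_nonneg ht0, Real.norm_of_nonneg (by linarith)]
      _ = (1 - t) * (‖u y - g y‖ * ‖(↑(g y)⁻¹ : 𝒜)‖) + t * (‖v y - g y‖ * ‖(↑(g y)⁻¹ : 𝒜)‖) := by ring
      _ < 1 := by
          have h4 := mul_le_mul_of_nonneg_left (le_max_left (‖u y - g y‖ * ‖(↑(g y)⁻¹ : 𝒜)‖)
            (‖v y - g y‖ * ‖(↑(g y)⁻¹ : 𝒜)‖)) (by linarith : 0 ≤ 1 - t)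
          have h5 := mul_le_mul_of_nonneg_left (le_max_right (‖u y - g y‖ * ‖(↑(g y)⁻¹ : 𝒜)‖)
            (‖v y - g y‖ * ‖(↑(g y)⁻¹ : 𝒜)‖)) ht0
          linarith [max_lt h1 h2]
  · have h1 := hR (fun i => x i.succ) i (lt_of_le_of_lt (le_max_left _ _) hi)
    have h2 := hR' (fun i => x i.succ) i (lt_of_le_of_lt (le_max_right _ _) hi)
    simp only [G, h1, h2]
    module

open Classical in
/-- The degree-type invariant of a compactly supported continuous map to the units of an algebra
determined by an invariant form. -/
noncomputable def mcDeg (c : 𝒜 [⋀^Fin d]→L[ℝ] ℝ) (g : (Fin d → ℝ) → 𝒜ˣ) : ℝ :=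
  if h : ∃ u, IsSmoothApprox g u then mcInt c h.choose else 0

theorem IsSmoothApprox.mcDeg_eq {c : 𝒜 [⋀^Fin d]→L[ℝ] ℝ} (hc : AdInvariant c)
    {g : (Fin d → ℝ) → 𝒜ˣ} {u : (Fin d → ℝ) → 𝒜} (hu : IsSmoothApprox g u) :
    mcDeg c g = mcInt c u := by
  have h : ∃ u, IsSmoothApprox g u := ⟨u, hu⟩
  rw [mcDeg, dif_pos h]
  exact h.choose_spec.mcInt_eq hc hu

theorem mcDeg_eq_of_homotopy {c : 𝒜 [⋀^Fin d]→L[ℝ] ℝ} (hc : AdInvariant c)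
    {H : I × (Fin d → ℝ) → 𝒜ˣ} (hH : Continuous H) {K : Set (Fin d → ℝ)} (hK : IsCompact K)
    (h1 : ∀ s, ∀ y ∉ K, H (s, y) = 1) (s t : I) :
    mcDeg c (fun y => H (s, y)) = mcDeg c (fun y => H (t, y)) := by
  have hloc : IsLocallyConstant fun s : I => mcDeg c (fun y => H (s, y)) := by
    rw [IsLocallyConstant.iff_eventually_eq]
    intro s
    obtain ⟨u, hu, -⟩ := exists_isSmoothApprox (g := fun y => H (s, y))
      (hH.comp (by fun_prop)) (HasCompactMulSupport.intro hK (h1 s))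
      continuous_const (fun _ => one_pos)
    have hev : ∀ᶠ t in 𝓝 s, ∀ y ∈ K, ‖u y - H (t, y)‖ * ‖(↑(H (t, y))⁻¹ : 𝒜)‖ < 1 := by
      refine hK.eventually_forall_of_forall_eventually fun y _ => ?_
      have hcont : Continuous fun z : I × (Fin d → ℝ) =>
          ‖u z.2 - H z‖ * ‖(↑(H z)⁻¹ : 𝒜)‖ :=
        ((hu.contDiff.continuous.comp continuous_snd).sub (Units.continuous_val.comp hH)).norm.mul
          (Units.continuous_val.comp (continuous_inv.comp hH)).norm
      exact (hcont.tendsto (s, y)).eventually (gt_mem_nhds (hu.near y))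
    filter_upwards [hev] with t ht
    have hut : IsSmoothApprox (fun y => H (t, y)) u := ⟨hu.contDiff, hu.eq_one, fun y => by
      by_cases hy : y ∈ K
      · exact ht y hy
      · have := hu.near y
        simp only [h1 s y hy] at this
        simpa only [h1 t y hy] using this⟩
    rw [hut.mcDeg_eq hc, hu.mcDeg_eq hc]
  exact hloc.apply_eq_of_isPreconnected isPreconnected_univ (Set.mem_univ s) (Set.mem_univ t)

end MaurerCartanDegree

section MaurerCartanDegreeProperties

open unitInterval

variable {𝒜 : Type*} [NormedRing 𝒜] [NormedAlgebra ℝ 𝒜] [CompleteSpace 𝒜] {d : ℕ}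

theorem mcInt_integrand_eq_zero [NeZero d] (c : 𝒜 [⋀^Fin d]→L[ℝ] ℝ) {u : (Fin d → ℝ) → 𝒜}
    {y : Fin d → ℝ} (h : u =ᶠ[𝓝 y] fun _ => 1) :
    mcForm c (u y) (fun i => fderiv ℝ u y (Pi.single i 1)) = 0 := by
  have hd0 : fderiv ℝ u y = 0 := by rw [h.fderiv_eq]; simp
  simp only [hd0, _root_.zero_apply]
  exact (mcForm c (u y)).map_zero

theorem IsSmoothApprox.isUnit {g : (Fin d → ℝ) → 𝒜ˣ} {u : (Fin d → ℝ) → 𝒜}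
    (hu : IsSmoothApprox g u) (x : Fin d → ℝ) : IsUnit (u x) :=
  isUnit_of_norm_sub_mul_lt_one _ _ (hu.near x)

theorem eventually_eq_one_of_bound {α : Type*} [One α] {u : (Fin d → ℝ) → α} {R : ℝ}
    (hR : ∀ x (i : Fin d), R < |x i| → u x = 1) {y : Fin d → ℝ} {i : Fin d} (hi : R < |y i|) :
    u =ᶠ[𝓝 y] fun _ => 1 := by
  filter_upwards [(isOpen_lt continuous_const ((continuous_apply i).abs)).mem_nhds hi]
    with z hz using hR z i hz

theorem continuous_mcInt_integrand (c : 𝒜 [⋀^Fin d]→L[ℝ] ℝ) {u : (Fin d → ℝ) → 𝒜}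
    (hu : ContDiff ℝ 2 u) (hunit : ∀ x, IsUnit (u x)) :
    Continuous fun y => mcForm c (u y) (fun i => fderiv ℝ u y (Pi.single i 1)) := by
  simp only [mcForm_apply]
  refine c.cont.comp (continuous_pi (A := fun _ => 𝒜) fun i => Continuous.mul ?_ ?_)
  · refine continuous_iff_continuousAt.2 fun x => ?_
    obtain ⟨v, hv⟩ := hunit x
    have h1 : ContinuousAt (Ring.inverse : 𝒜 → 𝒜) (u x) := by
      rw [← hv]; exact NormedRing.inverse_continuousAt v
    exact h1.comp hu.continuous.continuousAt
  · exact (hu.continuous_fderiv (by norm_num)).clm_apply continuous_const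

theorem integrable_mcInt_integrand [NeZero d] (c : 𝒜 [⋀^Fin d]→L[ℝ] ℝ) {u : (Fin d → ℝ) → 𝒜}
    (hu : ContDiff ℝ 2 u) (hunit : ∀ x, IsUnit (u x)) {R : ℝ}
    (hR : ∀ x (i : Fin d), R < |x i| → u x = 1) :
    MeasureTheory.Integrable
      (fun y => mcForm c (u y) (fun i => fderiv ℝ u y (Pi.single i 1))) := by
  refine Continuous.integrable_of_hasCompactSupport ?_ ?_
  · exact continuous_mcInt_integrand c hu hunit
  · refine HasCompactSupport.intro (isCompact_closedBall (0 : Fin d → ℝ) |R|) fun x hx => ?_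
    rw [Metric.mem_closedBall, dist_zero_right, pi_norm_le_iff_of_nonneg (abs_nonneg R)] at hx
    push Not at hx
    obtain ⟨i, hi⟩ := hx
    exact mcInt_integrand_eq_zero c
      (eventually_eq_one_of_bound hR (lt_of_le_of_lt (le_abs_self R) hi))

theorem mcDeg_mul_of_disjoint [NeZero d] {c : 𝒜 [⋀^Fin d]→L[ℝ] ℝ} (hc : AdInvariant c)
    {g h : (Fin d → ℝ) → 𝒜ˣ} (hg : Continuous g) (hh : Continuous h)
    (hgs : HasCompactMulSupport g) (hhs : HasCompactMulSupport h)
    (hdis : Disjoint (mulTSupport g) (mulTSupport h)) :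
    mcDeg c (fun x => g x * h x) = mcDeg c g + mcDeg c h := by
  obtain ⟨u, hu, hu1, -⟩ := exists_isSmoothApprox hg hgs continuous_const (fun _ => one_pos)
  obtain ⟨v, hv, hv1, -⟩ := exists_isSmoothApprox hh hhs continuous_const (fun _ => one_pos)
  have hloc : ∀ y, (u =ᶠ[𝓝 y] fun _ => 1) ∧ (g y = 1) ∨ (v =ᶠ[𝓝 y] fun _ => 1) ∧ (h y = 1) := by
    intro y
    by_cases hy : y ∈ mulTSupport g
    · right
      have hy' : y ∉ mulTSupport h := Set.disjoint_left.1 hdis hy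
      have := notMem_mulTSupport_iff_eventuallyEq.1 hy'
      exact ⟨this.mono fun z hz => hv1 z hz, this.self_of_nhds⟩
    · left
      have := notMem_mulTSupport_iff_eventuallyEq.1 hy
      exact ⟨this.mono fun z hz => hu1 z hz, this.self_of_nhds⟩
  obtain ⟨R, hR⟩ := hu.eq_one
  obtain ⟨R', hR'⟩ := hv.eq_one
  have huv : IsSmoothApprox (fun x => g x * h x) (fun x => u x * v x) := by
    refine ⟨hu.contDiff.mul hv.contDiff, ⟨max R R', fun x i hi => ?_⟩, fun x => ?_⟩
    · rw [hR x i (lt_of_le_of_lt (le_max_left _ _) hi),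
        hR' x i (lt_of_le_of_lt (le_max_right _ _) hi), one_mul]
    · rcases hloc x with ⟨h1, h2⟩ | ⟨h1, h2⟩
      · simp only [h1.self_of_nhds, h2, one_mul]; exact hv.near x
      · simp only [h1.self_of_nhds, h2, mul_one]; exact hu.near x
  rw [huv.mcDeg_eq hc, hu.mcDeg_eq hc, hv.mcDeg_eq hc, mcInt, mcInt, mcInt,
    ← MeasureTheory.integral_add (integrable_mcInt_integrand c hu.contDiff hu.isUnit hR)
      (integrable_mcInt_integrand c hv.contDiff hv.isUnit hR')]
  refine MeasureTheory.integral_congr_ae (Filter.Eventually.of_forall fun y => ?_)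
  rcases hloc y with ⟨h1, -⟩ | ⟨h1, -⟩
  · have h3 : (fun x => u x * v x) =ᶠ[𝓝 y] v := h1.mono fun z hz => by simp [hz]
    simp only [mcInt_integrand_eq_zero c h1, zero_add, h3.fderiv_eq, h3.self_of_nhds]
  · have h3 : (fun x => u x * v x) =ᶠ[𝓝 y] u := h1.mono fun z hz => by simp [hz]
    simp only [mcInt_integrand_eq_zero c h1, add_zero, h3.fderiv_eq, h3.self_of_nhds]

theorem mcDeg_mul [NeZero d] {c : 𝒜 [⋀^Fin d]→L[ℝ] ℝ} (hc : AdInvariant c)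
    {g h : (Fin d → ℝ) → 𝒜ˣ} (hg : Continuous g) (hh : Continuous h)
    (hgs : HasCompactMulSupport g) (hhs : HasCompactMulSupport h) :
    mcDeg c (fun x => g x * h x) = mcDeg c g + mcDeg c h := by
  obtain ⟨R, hR⟩ := hgs.isCompact.isBounded.exists_norm_le
  obtain ⟨R', hR'⟩ := hhs.isCompact.isBounded.exists_norm_le
  set S : ℝ := |R| + |R'| + 1 with hS
  have hS0 : 0 < S := by positivity
  let w : Fin d → ℝ := fun _ => 2 * S
  have hw : ‖w‖ = 2 * S := by
    rw [pi_norm_const, Real.norm_of_nonneg (by positivity)]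
  have hg1 : ∀ y, S < ‖y‖ → g y = 1 := fun y hy => by
    by_contra h1
    have := hR y (subset_mulTSupport g h1)
    linarith [le_abs_self R, abs_nonneg R']
  have hh1 : ∀ y, S < ‖y‖ → h y = 1 := fun y hy => by
    by_contra h1
    have := hR' y (subset_mulTSupport h h1)
    linarith [le_abs_self R', abs_nonneg R]
  have hcomp := isCompact_closedBall (0 : Fin d → ℝ) (3 * S)
  have hfar : ∀ (s : I) (y : Fin d → ℝ), y ∉ Metric.closedBall (0 : Fin d → ℝ) (3 * S) →
      g y = 1 ∧ h (y - (s : ℝ) • w) = 1 := fun s y hy => by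
    rw [Metric.mem_closedBall, dist_zero_right, not_le] at hy
    refine ⟨hg1 y (by linarith), hh1 _ ?_⟩
    have h1 := norm_sub_norm_le y ((s : ℝ) • w)
    have h2 : ‖(s : ℝ) • w‖ ≤ 2 * S := by
      rw [norm_smul, hw, Real.norm_of_nonneg s.2.1]
      nlinarith [s.2.2]
    linarith
  have hcs : Continuous fun z : I × (Fin d → ℝ) => h (z.2 - (z.1 : ℝ) • w) :=
    hh.comp (by fun_prop)
  have e1 := mcDeg_eq_of_homotopy hc (H := fun z => g z.2 * h (z.2 - (z.1 : ℝ) • w))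
    ((hg.comp continuous_snd).mul hcs) hcomp
    (fun s y hy => by simp [hfar s y hy]) 0 1
  have e2 := mcDeg_eq_of_homotopy hc (H := fun z => h (z.2 - (z.1 : ℝ) • w))
    hcs hcomp (fun s y hy => by simp [hfar s y hy]) 0 1
  simp only [Set.Icc.coe_zero, zero_smul, sub_zero, Set.Icc.coe_one, one_smul] at e1 e2
  rw [e1, e2]
  refine mcDeg_mul_of_disjoint hc hg (hh.comp (by fun_prop)) hgs ?_ ?_
  · refine HasCompactMulSupport.intro hcomp fun y hy => ?_
    simpa using (hfar 1 y hy).2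
  · have h1 : mulTSupport g ⊆ {y | ‖y‖ ≤ |R|} :=
      fun y hy => (hR y hy).trans (le_abs_self R)
    have h2 : mulTSupport (fun x => h (x - w)) ⊆ {y | ‖y - w‖ ≤ |R'|} := by
      refine closure_minimal (fun y hy => ?_) (isClosed_le (by fun_prop) continuous_const)
      exact (hR' _ (subset_mulTSupport h hy)).trans (le_abs_self R')
    refine Set.disjoint_of_subset h1 h2 (Set.disjoint_left.2 fun y hy1 hy2 => ?_)
    simp only [Set.mem_ofPred_eq] at hy1 hy2
    have := norm_sub_norm_le w y
    rw [norm_sub_rev, hw] at this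
    linarith

theorem mcDeg_one [NeZero d] {c : 𝒜 [⋀^Fin d]→L[ℝ] ℝ} (hc : AdInvariant c) :
    mcDeg c (fun _ => 1) = 0 := by
  have h := mcDeg_mul hc (g := fun _ => 1) (h := fun _ => 1) continuous_const continuous_const
    HasCompactMulSupport.one HasCompactMulSupport.one
  simp only [mul_one] at h
  linarith

theorem mcDeg_inv [NeZero d] {c : 𝒜 [⋀^Fin d]→L[ℝ] ℝ} (hc : AdInvariant c)
    {g : (Fin d → ℝ) → 𝒜ˣ} (hg : Continuous g) (hgs : HasCompactMulSupport g) :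
    mcDeg c (fun x => (g x)⁻¹) = - mcDeg c g := by
  have h := mcDeg_mul hc hg (continuous_inv.comp hg) hgs (hgs.comp_left inv_one)
  simp only [Function.comp_def, mul_inv_cancel, mcDeg_one hc] at h
  linarith

theorem mcDeg_map {ℬ : Type*} [NormedRing ℬ] [NormedAlgebra ℝ ℬ] [CompleteSpace ℬ]
    {c : 𝒜 [⋀^Fin d]→L[ℝ] ℝ} (hc : AdInvariant c)
    {c' : ℬ [⋀^Fin d]→L[ℝ] ℝ} (hc' : AdInvariant c')
    (φ : 𝒜 →* ℬ) (q : ℬ) (L : 𝒜 →L[ℝ] ℬ) (hφ : ∀ a, φ a = q + L a)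
    (hL : ∀ a b, φ a * L b = L (a * b)) (hcc : ∀ w, c' (fun i => L (w i)) = c w)
    {g : (Fin d → ℝ) → 𝒜ˣ} (hg : Continuous g) (hgs : HasCompactMulSupport g) :
    mcDeg c' (fun x => Units.map φ (g x)) = mcDeg c g := by
  have hφc : Continuous φ := by
    have : (φ : 𝒜 → ℬ) = fun a => q + L a := funext hφ
    rw [this]; fun_prop
  have hgi : Continuous fun x => ‖φ (↑(g x)⁻¹ : 𝒜)‖ :=
    (hφc.comp (Units.continuous_val.comp (continuous_inv.comp hg))).norm
  obtain ⟨u, hu, -, huε⟩ := exists_isSmoothApprox hg hgs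
    (ε := fun x => (1 + ‖L‖ * ‖φ (↑(g x)⁻¹ : 𝒜)‖)⁻¹)
    ((continuous_const.add (continuous_const.mul hgi)).inv₀ fun x =>
      (add_pos_of_pos_of_nonneg one_pos (mul_nonneg (norm_nonneg _) (norm_nonneg _))).ne')
    (fun x => by positivity)
  have hφu : ∀ x, φ (u x) = q + L (u x) := fun x => hφ _
  have hv : IsSmoothApprox (fun x => Units.map φ (g x)) (fun x => φ (u x)) := by
    refine ⟨?_, ?_, fun x => ?_⟩
    · simp only [hφ]
      exact contDiff_const.add (L.contDiff.comp hu.contDiff)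
    · obtain ⟨R, hR⟩ := hu.eq_one
      exact ⟨R, fun x i hi => by rw [hR x i hi, map_one]⟩
    · have h1 : φ (u x) - (Units.map φ (g x) : ℬˣ) = L (u x - g x) := by
        simp [hφ]
      have h2 : ((Units.map φ (g x))⁻¹ : ℬˣ) = Units.map φ (g x)⁻¹ := by simp
      rw [h1, h2, Units.coe_map]
      have h3 := (huε x).le
      have h4 : 0 < 1 + ‖L‖ * ‖φ (↑(g x)⁻¹ : 𝒜)‖ := by positivity
      calc _ ≤ (‖L‖ * (1 + ‖L‖ * ‖φ (↑(g x)⁻¹ : 𝒜)‖)⁻¹) * ‖φ (↑(g x)⁻¹ : 𝒜)‖ := by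
            refine mul_le_mul_of_nonneg_right ?_ (norm_nonneg _)
            exact (L.le_opNorm _).trans (mul_le_mul_of_nonneg_left h3 (norm_nonneg _))
        _ = (1 + ‖L‖ * ‖φ (↑(g x)⁻¹ : 𝒜)‖)⁻¹ * (‖L‖ * ‖φ (↑(g x)⁻¹ : 𝒜)‖) := by ring
        _ < 1 := by rw [inv_mul_lt_iff₀ h4]; linarith
  rw [hu.mcDeg_eq hc, hv.mcDeg_eq hc', mcInt, mcInt]
  congr 1
  ext y
  have hd : ∀ v, fderiv ℝ (fun x => φ (u x)) y v = L (fderiv ℝ u y v) := fun v => by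
    simp only [hφ]
    rw [fderiv_const_add]
    exact congrArg (fun M => M v) (L.hasFDerivAt.comp y
      (hu.contDiff.differentiable (by norm_num) y).hasFDerivAt).fderiv
  simp only [mcForm_apply, hd]
  rw [← hcc]
  obtain ⟨a, ha⟩ := hu.isUnit y
  congr 1
  ext i
  rw [← ha, Ring.inverse_unit, ← hL]
  have : φ (a : 𝒜) = (Units.map φ a : ℬˣ) := rfl
  rw [this, Ring.inverse_unit]
  simp

theorem mcDeg_comp_equiv {c : 𝒜 [⋀^Fin d]→L[ℝ] ℝ} (hc : AdInvariant c)
    {g : (Fin d → ℝ) → 𝒜ˣ} (hg : Continuous g) (hgs : HasCompactMulSupport g)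
    (A : (Fin d → ℝ) ≃L[ℝ] (Fin d → ℝ)) (hA : LinearMap.det (A : (Fin d → ℝ) →ₗ[ℝ] _) < 0) :
    mcDeg c (fun x => g (A x)) = - mcDeg c g := by
  obtain ⟨u, hu, -⟩ := exists_isSmoothApprox hg hgs continuous_const (fun _ => one_pos)
  have hv : IsSmoothApprox (fun x => g (A x)) (fun x => u (A x)) := by
    refine ⟨hu.contDiff.comp A.contDiff, ?_, fun x => hu.near (A x)⟩
    obtain ⟨R, hR⟩ := hu.eq_one
    have hsupp : HasCompactMulSupport u := by
      refine HasCompactMulSupport.intro (isCompact_closedBall (0 : Fin d → ℝ) |R|) fun x hx => ?_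
      rw [Metric.mem_closedBall, dist_zero_right, pi_norm_le_iff_of_nonneg (abs_nonneg R)] at hx
      push Not at hx
      obtain ⟨i, hi⟩ := hx
      exact hR x i (lt_of_le_of_lt (le_abs_self R) hi)
    exact exists_bound_of_hasCompactMulSupport
      (hsupp.comp_homeomorph A.toHomeomorph)
  rw [hu.mcDeg_eq hc, hv.mcDeg_eq hc]
  set F : (Fin d → ℝ) → ℝ := fun y => mcForm c (u y) (fun i => fderiv ℝ u y (Pi.single i 1)) with hF
  have h1 : ∀ y, mcForm c (u (A y)) (fun i => fderiv ℝ (fun x => u (A x)) y (Pi.single i 1)) =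
      LinearMap.det (A : (Fin d → ℝ) →ₗ[ℝ] _) * F (A y) := fun y => by
    have hd : fderiv ℝ (fun x => u (A x)) y = (fderiv ℝ u (A y)).comp (A : (Fin d → ℝ) →L[ℝ] _) :=
      ((hu.contDiff.differentiable (by norm_num) (A y)).hasFDerivAt.comp y A.hasFDerivAt).fderiv
    let f : (Fin d → ℝ) [⋀^Fin d]→ₗ[ℝ] ℝ :=
      ((mcForm c (u (A y))).compContinuousLinearMap (fderiv ℝ u (A y))).toAlternatingMap
    have h2 := f.eq_smul_basis_det (Pi.basisFun ℝ (Fin d))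
    have h3 : f ((A : (Fin d → ℝ) →ₗ[ℝ] _) ∘ (Pi.basisFun ℝ (Fin d))) =
        LinearMap.det (A : (Fin d → ℝ) →ₗ[ℝ] _) * f (Pi.basisFun ℝ (Fin d)) := by
      conv_lhs => rw [h2]
      rw [AlternatingMap.smul_apply, Module.Basis.det_comp, Module.Basis.det_self, smul_eq_mul]
      ring
    rw [hd]
    have e1 : ((A : (Fin d → ℝ) →ₗ[ℝ] (Fin d → ℝ)) ∘ (Pi.basisFun ℝ (Fin d))) =
        fun i => A (Pi.single i 1) := funext fun i => by simp
    have e2 : (Pi.basisFun ℝ (Fin d) : Fin d → Fin d → ℝ) = fun i => Pi.single i 1 :=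
      funext fun i => by simp
    rw [e1, e2] at h3
    exact h3
  have h4 := MeasureTheory.integral_image_eq_integral_abs_det_fderiv_smul MeasureTheory.volume
    (s := Set.univ) MeasurableSet.univ (f := A) (f' := fun _ => (A : (Fin d → ℝ) →L[ℝ] _))
    (fun x _ => A.hasFDerivAt.hasFDerivWithinAt) A.injective.injOn F
  rw [Set.image_univ, A.surjective.range_eq, MeasureTheory.setIntegral_univ,
    MeasureTheory.setIntegral_univ] at h4
  rw [mcInt, mcInt]
  simp only [h1]
  change _ = - ∫ y, F y
  rw [h4, ← MeasureTheory.integral_neg]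
  congr 1
  ext y
  have : |(A : (Fin d → ℝ) →L[ℝ] (Fin d → ℝ)).det| = - LinearMap.det (A : (Fin d → ℝ) →ₗ[ℝ] _) :=
    abs_of_neg hA
  rw [this]
  simp

end MaurerCartanDegreeProperties

section Ladder

open unitInterval

theorem exists_transport {B Z 𝒢 : Type*} [TopologicalSpace B] [CompactSpace B]
    [PseudoMetricSpace Z] [TopologicalSpace 𝒢] [Monoid 𝒢] [ContinuousMul 𝒢]
    {H : I × B → Z} (hH : Continuous H) (T : Z → Z → 𝒢) {δ : ℝ} (hδ : 0 < δ)
    (hT : ContinuousOn (fun p : Z × Z => T p.1 p.2) {p | dist p.1 p.2 < δ})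
    (hT1 : ∀ a, T a a = 1) :
    ∃ G : I × B → 𝒢, Continuous G ∧ (∀ b, G (0, b) = 1) ∧
      ∀ (b : B) (P : 𝒢 → I → I → Prop), (∀ t, P 1 t t) →
        (∀ g h t t' t'', P g t t' → P h t' t'' → P (h * g) t t'') →
        (∀ t t', dist (H (t, b)) (H (t', b)) < δ → P (T (H (t, b)) (H (t', b))) t t') →
        ∀ t, P (G (t, b)) 0 t := by
  let Hc : C(I, C(B, Z)) := ContinuousMap.curry ⟨H, hH⟩
  have hu := CompactSpace.uniformContinuous_of_continuous Hc.continuous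
  obtain ⟨η, hη, hηδ⟩ := Metric.uniformContinuous_iff.1 hu δ hδ
  have hηδ' : ∀ t t' : I, dist t t' < η → ∀ b, dist (H (t, b)) (H (t', b)) < δ :=
    fun t t' h b => lt_of_le_of_lt (ContinuousMap.dist_apply_le_dist (f := Hc t) (g := Hc t') b)
      (hηδ h)
  obtain ⟨k, hk⟩ := exists_nat_one_div_lt hη
  let c : ℕ → I := fun i => Set.projIcc 0 1 zero_le_one ((i : ℝ) / (k + 1))
  have hstep : ∀ (t : I) (i : ℕ) (b : B),
      dist (H (min t (c i), b)) (H (min t (c (i + 1)), b)) < δ := fun t i b => by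
    refine hηδ' _ _ (lt_of_le_of_lt ?_ hk) b
    rw [Subtype.dist_eq, Real.dist_eq]
    have h1 : |((c i : I) : ℝ) - (c (i + 1) : I)| ≤ 1 / ((k : ℝ) + 1) := by
      simp only [c, Set.coe_projIcc]
      refine (abs_max_sub_max_le_max _ _ _ _).trans ?_
      simp only [sub_self, abs_zero]
      refine max_le (by positivity) ((abs_min_sub_min_le_max _ _ _ _).trans ?_)
      simp only [sub_self, abs_zero]
      refine max_le (by positivity) ?_
      rw [← sub_div, Nat.cast_add, Nat.cast_one, abs_div, abs_of_pos (by positivity : (0:ℝ) < k + 1)]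
      simp
    refine le_trans ?_ h1
    have h2 : ∀ x y : I, ((min x y : I) : ℝ) = min (x : ℝ) y := fun x y => by
      rcases le_total x y with h | h
      · rw [min_eq_left h, min_eq_left (show (x : ℝ) ≤ y from h)]
      · rw [min_eq_right h, min_eq_right (show (y : ℝ) ≤ x from h)]
    rw [h2, h2]
    refine (abs_min_sub_min_le_max _ _ _ _).trans ?_
    simp
  let S : ℕ → I × B → 𝒢 := fun i p => T (H (min p.1 (c i), p.2)) (H (min p.1 (c (i + 1)), p.2))
  have hS : ∀ i, Continuous (S i) := fun i => by
    refine hT.comp_continuous (f := fun p : I × B =>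
      (H (min p.1 (c i), p.2), H (min p.1 (c (i + 1)), p.2))) ?_ fun p => hstep p.1 i p.2
    exact (hH.comp (by fun_prop)).prodMk (hH.comp (by fun_prop))
  let G : ℕ → I × B → 𝒢 := fun n => Nat.rec (fun _ => 1) (fun i g p => S i p * g p) n
  have hG : ∀ i, Continuous (G i) := fun i => by
    induction i with
    | zero => exact continuous_const
    | succ i ih => exact (hS i).mul ih
  have hc0 : c 0 = 0 := by simp [c]
  have hck : c (k + 1) = 1 := by
    simp only [c]
    rw [Nat.cast_add, Nat.cast_one, div_self (by positivity), Set.projIcc_right]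
    rfl
  refine ⟨G (k + 1), hG (k + 1), fun b => ?_, fun b P h1 hmul hstepP t => ?_⟩
  · have : ∀ i, G i (0, b) = 1 := fun i => by
      induction i with
      | zero => rfl
      | succ i ih =>
        change S i (0, b) * G i (0, b) = 1
        rw [ih, mul_one]
        have h0 : ∀ x : I, min 0 x = 0 := fun x => min_eq_left x.2.1
        simp only [S, h0, hT1]
    exact this (k + 1)
  · have : ∀ i, P (G i (t, b)) 0 (min t (c i)) := fun i => by
      induction i with
      | zero =>
        rw [hc0, min_eq_right (show (0 : I) ≤ t from t.2.1)]
        exact h1 0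
      | succ i ih => exact hmul _ _ _ _ _ ih (hstepP _ _ (hstep t i b))
    have h2 := this (k + 1)
    rwa [hck, min_eq_left (show t ≤ 1 from t.2.2)] at h2

end Ladder

section UnitLift

variable {𝒜 : Type*} [NormedRing 𝒜]

open Classical in
/-- A unit as an element of the group of units; non-units are sent to `1`. -/
noncomputable def unitOf (a : 𝒜) : 𝒜ˣ := if h : IsUnit a then h.unit else 1

theorem val_unitOf {a : 𝒜} (h : IsUnit a) : (unitOf a : 𝒜) = a := by
  rw [unitOf, dif_pos h, IsUnit.unit_spec]

theorem unitOf_eq {a : 𝒜} {u : 𝒜ˣ} (h : a = u) : unitOf a = u :=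
  Units.ext (by rw [val_unitOf (h ▸ u.isUnit), h])

variable [CompleteSpace 𝒜]

theorem continuous_units_iff {X : Type*} [TopologicalSpace X] {f : X → 𝒜ˣ} :
    Continuous f ↔ Continuous fun x => (f x : 𝒜) :=
  Units.isOpenEmbedding_val.isInducing.continuous_iff

theorem continuousOn_units_iff {X : Type*} [TopologicalSpace X] {f : X → 𝒜ˣ} {s : Set X} :
    ContinuousOn f s ↔ ContinuousOn (fun x => (f x : 𝒜)) s :=
  Units.isOpenEmbedding_val.isInducing.continuousOn_iff

theorem continuousOn_unitOf_comp {X : Type*} [TopologicalSpace X] {f : X → 𝒜} {s : Set X}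
    (hf : ContinuousOn f s) (h : ∀ x ∈ s, IsUnit (f x)) :
    ContinuousOn (fun x => unitOf (f x)) s :=
  continuousOn_units_iff.2 (hf.congr fun x hx => val_unitOf (h x hx))

theorem continuous_unitOf_comp {X : Type*} [TopologicalSpace X] {f : X → 𝒜}
    (hf : Continuous f) (h : ∀ x, IsUnit (f x)) : Continuous (fun x => unitOf (f x)) := by
  rw [← continuousOn_univ] at hf ⊢
  exact continuousOn_unitOf_comp hf fun x _ => h x

theorem isUnit_of_norm_sub_one_lt {a : 𝒜} (h : ‖a - 1‖ < 1) : IsUnit a := by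
  have := isUnit_one_sub_of_norm_lt_one (x := 1 - a) (by rwa [norm_sub_rev])
  simpa using this

end UnitLift

section Orthogonal

theorem clm_mul_apply {E : Type*} [NormedAddCommGroup E] [NormedSpace ℝ E] (f g : E →L[ℝ] E)
    (x : E) : (f * g) x = f (g x) := rfl

theorem clm_one_apply {E : Type*} [NormedAddCommGroup E] [NormedSpace ℝ E] (x : E) :
    (1 : E →L[ℝ] E) x = x := rfl

open InnerProductSpace

variable {V : Type*} [NormedAddCommGroup V] [InnerProductSpace ℝ V]

/-- The orthogonal group as a subgroup of the group of invertible operators. -/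
def orth (V : Type*) [NormedAddCommGroup V] [InnerProductSpace ℝ V] :
    Subgroup (V →L[ℝ] V)ˣ where
  carrier := {g | ∀ x y, ⟪(g : V →L[ℝ] V) x, (g : V →L[ℝ] V) y⟫_ℝ = ⟪x, y⟫_ℝ}
  mul_mem' {a b} ha hb x y := by
    simp only [Units.val_mul, clm_mul_apply]
    rw [ha, hb]
  one_mem' x y := by simp
  inv_mem' {a} ha x y := by
    have h : ∀ x, (a : V →L[ℝ] V) ((↑a⁻¹ : V →L[ℝ] V) x) = x := fun x => by
      rw [← clm_mul_apply, Units.mul_inv]; rfl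
    rw [← ha, h, h]

theorem mem_orth {g : (V →L[ℝ] V)ˣ} :
    g ∈ orth V ↔ ∀ x y, ⟪(g : V →L[ℝ] V) x, (g : V →L[ℝ] V) y⟫_ℝ = ⟪x, y⟫_ℝ := Iff.rfl

theorem orth_norm {g : (V →L[ℝ] V)ˣ} (h : g ∈ orth V) (x : V) : ‖(g : V →L[ℝ] V) x‖ = ‖x‖ := by
  rw [norm_eq_sqrt_real_inner, mem_orth.1 h, ← norm_eq_sqrt_real_inner]

@[simp] theorem units_inv_apply (g : (V →L[ℝ] V)ˣ) (x : V) :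
    (↑g⁻¹ : V →L[ℝ] V) ((g : V →L[ℝ] V) x) = x := by
  rw [← clm_mul_apply, Units.inv_mul]; rfl

/-- The linear map underlying the reflection in `vᗮ`. -/
noncomputable def reflCLM (v : V) : V →L[ℝ] V :=
  ContinuousLinearMap.id ℝ V - (2 * (‖v‖ ^ 2)⁻¹) • (innerSL ℝ v).smulRight v

theorem reflCLM_apply (v x : V) : reflCLM v x = x - (2 * (‖v‖ ^ 2)⁻¹ * ⟪v, x⟫_ℝ) • v := by
  simp [reflCLM, smul_smul]

theorem reflCLM_mul_self (v : V) : reflCLM v * reflCLM v = 1 := by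
  ext x
  rw [clm_mul_apply, reflCLM_apply, reflCLM_apply]
  rcases eq_or_ne v 0 with rfl | hv
  · simp
  have : ‖v‖ ^ 2 ≠ 0 := by positivity
  rw [inner_sub_right, inner_smul_right, real_inner_self_eq_norm_sq, sub_sub, ← add_smul,
    clm_one_apply, sub_eq_self]
  convert zero_smul ℝ v
  field_simp
  ring

/-- The reflection in `vᗮ`. -/
noncomputable def hrefl (v : V) : (V →L[ℝ] V)ˣ :=
  ⟨reflCLM v, reflCLM v, reflCLM_mul_self v, reflCLM_mul_self v⟩

theorem hrefl_apply (v x : V) :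
    (hrefl v : V →L[ℝ] V) x = x - (2 * (‖v‖ ^ 2)⁻¹ * ⟪v, x⟫_ℝ) • v := reflCLM_apply v x

theorem hrefl_mul_self (v : V) : hrefl v * hrefl v = 1 := Units.ext (reflCLM_mul_self v)

theorem hrefl_inv (v : V) : (hrefl v)⁻¹ = hrefl v := rfl

theorem hrefl_mem_orth (v : V) : hrefl v ∈ orth V := fun x y => by
  rcases eq_or_ne v 0 with rfl | hv
  · simp [hrefl_apply]
  have : ‖v‖ ^ 2 ≠ 0 := by positivity
  simp only [hrefl_apply, inner_sub_left, inner_sub_right, real_inner_smul_left,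
    real_inner_smul_right, real_inner_self_eq_norm_sq, real_inner_comm v x]
  field_simp
  ring

theorem hrefl_apply_of_orthogonal {v x : V} (h : ⟪v, x⟫_ℝ = 0) : (hrefl v : V →L[ℝ] V) x = x := by
  simp [hrefl_apply, h]

theorem hrefl_apply_self (v : V) : (hrefl v : V →L[ℝ] V) v = -v := by
  rcases eq_or_ne v 0 with rfl | hv
  · simp
  have : ‖v‖ ^ 2 ≠ 0 := by positivity
  rw [hrefl_apply, real_inner_self_eq_norm_sq, mul_assoc, inv_mul_cancel₀ this, mul_one, two_smul]
  abel

theorem hrefl_smul {c : ℝ} (hc : c ≠ 0) (v : V) : hrefl (c • v) = hrefl v := by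
  ext x
  rcases eq_or_ne v 0 with rfl | hv
  · simp
  have : ‖v‖ ^ 2 ≠ 0 := by positivity
  rw [hrefl_apply, hrefl_apply, real_inner_smul_left, norm_smul, smul_smul, mul_pow,
    Real.norm_eq_abs, sq_abs]
  congr 2
  field_simp

theorem continuousOn_reflCLM : ContinuousOn (reflCLM : V → V →L[ℝ] V) {0}ᶜ := by
  unfold reflCLM
  refine continuousOn_const.sub (ContinuousOn.fun_smul ?_ ?_)
  · refine continuousOn_const.mul (ContinuousOn.inv₀ (by fun_prop) fun x hx => ?_)
    have : x ≠ 0 := hx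
    positivity
  · exact Continuous.continuousOn (by
      have h : Continuous fun v : V => ContinuousLinearMap.smulRightL ℝ V V (innerSL ℝ v) v := by
        fun_prop
      exact h)

theorem continuousOn_refl [CompleteSpace V] : ContinuousOn (hrefl : V → (V →L[ℝ] V)ˣ) {0}ᶜ :=
  continuousOn_units_iff.2 continuousOn_reflCLM

/-- The rotation carrying the unit vector `a` to the unit vector `b`. -/
noncomputable def rot (a b : V) : (V →L[ℝ] V)ˣ := hrefl (a + b) * hrefl a

theorem rot_mem_orth (a b : V) : rot a b ∈ orth V :=
  mul_mem (hrefl_mem_orth _) (hrefl_mem_orth _)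

theorem rot_self (a : V) : rot a a = 1 := by
  rw [rot, ← two_smul ℝ a, hrefl_smul two_ne_zero, hrefl_mul_self]

theorem rot_apply_of_orthogonal {a b x : V} (ha : ⟪a, x⟫_ℝ = 0) (hb : ⟪b, x⟫_ℝ = 0) :
    (rot a b : V →L[ℝ] V) x = x := by
  rw [rot, Units.val_mul, clm_mul_apply, hrefl_apply_of_orthogonal ha,
    hrefl_apply_of_orthogonal (by rw [inner_add_left, ha, hb, add_zero])]

theorem add_ne_zero_of_norm_sub_lt {a b : V} (ha : ‖a‖ = 1) (h : ‖a - b‖ < 1) : a + b ≠ 0 := by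
  intro h0
  have : a - b = (2 : ℝ) • a := by rw [two_smul, eq_neg_of_add_eq_zero_right h0]; abel
  rw [this, norm_smul, ha] at h
  norm_num at h

theorem hrefl_add_apply {a b : V} (ha : ‖a‖ = ‖b‖) (h : a + b ≠ 0) :
    (hrefl (a + b) : V →L[ℝ] V) a = -b := by
  have h1 : ‖a + b‖ ^ 2 ≠ 0 := by positivity
  have h2 : 2 * (‖a + b‖ ^ 2)⁻¹ * ⟪a + b, a⟫_ℝ = 1 := by
    have : ‖a + b‖ ^ 2 = 2 * ⟪a + b, a⟫_ℝ := by
      rw [norm_add_sq_real, inner_add_left, real_inner_self_eq_norm_sq, ← ha, real_inner_comm a b]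
      ring
    rw [this] at h1 ⊢
    rw [mul_right_comm, mul_inv_cancel₀ h1]
  rw [hrefl_apply, h2, one_smul]; abel

theorem rot_apply {a b : V} (ha : ‖a‖ = ‖b‖) (h : a + b ≠ 0) :
    (rot a b : V →L[ℝ] V) a = b := by
  rw [rot, Units.val_mul, clm_mul_apply, hrefl_apply_self, map_neg,
    hrefl_add_apply ha h, neg_neg]

variable [CompleteSpace V]

theorem exists_rot_transport {B : Type*} [TopologicalSpace B] [CompactSpace B]
    {H : unitInterval × B → Metric.sphere (0 : V) 1} (hH : Continuous H) :
    ∃ G : unitInterval × B → (V →L[ℝ] V)ˣ, Continuous G ∧ (∀ b, G (0, b) = 1) ∧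
      (∀ p, G p ∈ orth V) ∧ (∀ t b, (G (t, b) : V →L[ℝ] V) (H (0, b)) = H (t, b)) ∧
      (∀ b, (∀ t, H (t, b) = H (0, b)) → ∀ t, G (t, b) = 1) ∧
      ∀ (b : B) (x : V), (∀ t, ⟪(H (t, b) : V), x⟫_ℝ = 0) → ∀ t, (G (t, b) : V →L[ℝ] V) x = x := by
  have hne : ∀ a b : Metric.sphere (0 : V) 1, dist a b < 1 → (a : V) + b ≠ 0 := fun a b h =>
    add_ne_zero_of_norm_sub_lt (norm_eq_of_mem_sphere a) (by rwa [Subtype.dist_eq, dist_eq_norm] at h)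
  obtain ⟨G, hG, hG0, hP⟩ := exists_transport hH (fun a b => rot (a : V) (b : V)) one_pos
    (by
      have h1 : ContinuousOn (fun p : Metric.sphere (0 : V) 1 × Metric.sphere (0 : V) 1 =>
          hrefl ((p.1 : V) + p.2)) {p | dist p.1 p.2 < 1} :=
        continuousOn_refl.comp (by fun_prop) fun p hp => hne _ _ hp
      have h2 : ContinuousOn (fun p : Metric.sphere (0 : V) 1 × Metric.sphere (0 : V) 1 =>
          hrefl (p.1 : V)) {p | dist p.1 p.2 < 1} :=
        continuousOn_refl.comp (by fun_prop) fun p hp =>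
          ne_of_apply_ne norm (by rw [norm_eq_of_mem_sphere]; simp)
      exact h1.mul h2) (fun a => rot_self _)
  refine ⟨G, hG, hG0, fun p => ?_, fun t b => ?_, fun b hb t => ?_, fun b x hx t => ?_⟩
  · exact hP p.2 (fun g _ _ => g ∈ orth V) (fun _ => one_mem _)
      (fun g h _ _ _ hg hh => mul_mem hh hg) (fun _ _ _ => rot_mem_orth _ _) p.1
  · refine hP b (fun g t t' => (g : V →L[ℝ] V) (H (t, b)) = H (t', b)) (fun _ => rfl)
      (fun g h t t' t'' hg hh => ?_) (fun t t' h => ?_) t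
    · rw [Units.val_mul, clm_mul_apply, hg, hh]
    · exact rot_apply (by rw [norm_eq_of_mem_sphere, norm_eq_of_mem_sphere]) (hne _ _ h)
  · refine hP b (fun g _ _ => g = 1) (fun _ => rfl)
      (fun g h _ _ _ hg hh => by rw [hg, hh, one_mul]) (fun t t' _ => ?_) t
    rw [hb t, hb t', rot_self]
  · refine hP b (fun g _ _ => (g : V →L[ℝ] V) x = x) (fun _ => rfl)
      (fun g h _ _ _ hg hh => ?_) (fun t t' _ => rot_apply_of_orthogonal (hx t) (hx t')) t
    rw [Units.val_mul, clm_mul_apply, hg, hh]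

end Orthogonal

section Spheres

variable {V : Type*} [NormedAddCommGroup V] [InnerProductSpace ℝ V]

/-- The unit sphere of a real inner product space. -/
abbrev USph (V : Type*) [NormedAddCommGroup V] : Type _ := Metric.sphere (0 : V) 1

theorem USph.norm_eq (x : USph V) : ‖(x : V)‖ = 1 := norm_eq_of_mem_sphere x

theorem USph.ne_zero (x : USph V) : (x : V) ≠ 0 :=
  ne_of_apply_ne norm (by rw [USph.norm_eq]; simp)

theorem USph.inner_self (x : USph V) : inner ℝ (x : V) x = 1 := by
  rw [real_inner_self_eq_norm_sq, USph.norm_eq, one_pow]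

/-- The unit vector of norm one. -/
def USph.mk (x : V) (h : ‖x‖ = 1) : USph V := ⟨x, by simpa using h⟩

@[simp] theorem USph.coe_mk (x : V) (h : ‖x‖ = 1) : ((USph.mk x h : USph V) : V) = x := rfl

@[simp] theorem USph.coe_neg (x : USph V) : ((-x : USph V) : V) = -x := rfl

open Classical in
/-- The direction of a nonzero vector; the zero vector is sent to `N`. -/
noncomputable def dirTo (N : USph V) (x : V) : USph V :=
  if h : x = 0 then N else USph.mk (‖x‖⁻¹ • x) (by
    rw [norm_smul, norm_inv, norm_norm, inv_mul_cancel₀ (norm_ne_zero_iff.2 h)])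

theorem coe_dirTo (N : USph V) {x : V} (h : x ≠ 0) : (dirTo N x : V) = ‖x‖⁻¹ • x := by
  rw [dirTo, dif_neg h, USph.coe_mk]

theorem norm_smul_dirTo (N : USph V) (x : V) : ‖x‖ • (dirTo N x : V) = x := by
  rcases eq_or_ne x 0 with rfl | h
  · simp
  · rw [coe_dirTo N h, smul_smul, mul_inv_cancel₀ (norm_ne_zero_iff.2 h), one_smul]

theorem dirTo_coe (N x : USph V) : dirTo N (x : V) = x :=
  Subtype.ext (by rw [coe_dirTo N x.ne_zero, x.norm_eq, inv_one, one_smul])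

theorem dirTo_smul (N : USph V) {c : ℝ} (hc : 0 < c) (x : V) : dirTo N (c • x) = dirTo N x := by
  rcases eq_or_ne x 0 with rfl | h
  · simp
  · refine Subtype.ext ?_
    rw [coe_dirTo N h, coe_dirTo N (smul_ne_zero hc.ne' h), norm_smul, smul_smul,
      Real.norm_of_nonneg hc.le]
    congr 1
    have := norm_ne_zero_iff.2 h
    field_simp

theorem continuousOn_dirTo (N : USph V) : ContinuousOn (dirTo N) {0}ᶜ := by
  rw [Topology.IsInducing.subtypeVal.continuousOn_iff]
  have : ContinuousOn (fun x : V => ‖x‖⁻¹ • x) {0}ᶜ :=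
    ContinuousOn.fun_smul (ContinuousOn.inv₀ (by fun_prop) fun x hx => norm_ne_zero_iff.2 hx)
      continuousOn_id
  exact this.congr fun x hx => coe_dirTo N hx

theorem continuous_dirTo_comp {X : Type*} [TopologicalSpace X] (N : USph V) {f : X → V}
    (hf : Continuous f) (h : ∀ x, f x ≠ 0) : Continuous fun x => dirTo N (f x) :=
  (continuousOn_dirTo N).comp_continuous hf h

theorem homotopic_dirTo {X : Type*} [TopologicalSpace X] {N : USph V} {f g : C(X, USph V)}
    (F : unitInterval × X → V) (hF : Continuous F) (h : ∀ p, F p ≠ 0)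
    (h0 : ∀ x, f x = dirTo N (F (0, x))) (h1 : ∀ x, g x = dirTo N (F (1, x))) :
    f.Homotopic g :=
  ⟨⟨⟨fun p => dirTo N (F p), continuous_dirTo_comp N hF h⟩, fun x => (h0 x).symm,
    fun x => (h1 x).symm⟩⟩

theorem segment_ne_zero {a b : V} (ha : ‖a‖ = ‖b‖) (h : a + b ≠ 0) (t : ℝ) (ht : t ∈ unitInterval) :
    (1 - t) • a + t • b ≠ 0 := by
  intro h0
  have h1 : (1 - t) • a = -(t • b) := eq_neg_of_add_eq_zero_left h0
  have h2 := congrArg norm h1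
  rw [norm_neg, norm_smul, norm_smul, Real.norm_of_nonneg (sub_nonneg.2 ht.2),
    Real.norm_of_nonneg ht.1, ha] at h2
  rcases eq_or_ne b 0 with rfl | hb
  · rw [norm_zero, norm_eq_zero] at ha
    exact h (by rw [ha, add_zero])
  have h3 := mul_right_cancel₀ (norm_ne_zero_iff.2 hb) h2
  rw [h3, ← smul_add, smul_eq_zero] at h0
  rcases h0 with h0 | h0
  · linarith
  · exact h h0

theorem homotopic_of_add_ne_zero {X : Type*} [TopologicalSpace X] {f g : C(X, USph V)}
    (h : ∀ x, (f x : V) + g x ≠ 0) : f.Homotopic g := by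
  rcases isEmpty_or_nonempty X with hX | ⟨⟨x₀⟩⟩
  · rw [show f = g from ContinuousMap.ext fun x => (hX.false x).elim]
  refine homotopic_dirTo (N := f x₀)
    (fun p => (1 - (p.1 : ℝ)) • (f p.2 : V) + (p.1 : ℝ) • (g p.2 : V)) (by fun_prop)
    (fun p => segment_ne_zero (by rw [USph.norm_eq, USph.norm_eq]) (h _) _ p.1.2)
    (fun x => by simp [dirTo_coe]) (fun x => by simp [dirTo_coe])

theorem continuous_cone {A B : Type*} [NormedAddCommGroup A] [InnerProductSpace ℝ A]
    [FiniteDimensional ℝ A] [NormedAddCommGroup B] [NormedSpace ℝ B] {f : USph A → B}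
    (hf : Continuous f) (N : USph A) {c : A → ℝ} (hc : Continuous c) (h0 : c 0 = 0) :
    Continuous fun x => c x • f (dirTo N x) := by
  refine continuous_iff_continuousAt.2 fun x => ?_
  rcases eq_or_ne x 0 with rfl | hx
  · obtain ⟨C, hC⟩ := (isCompact_range hf).isBounded.exists_norm_le
    rw [ContinuousAt, h0, zero_smul]
    refine squeeze_zero_norm (a := fun x => ‖c x‖ * C) (fun y => ?_) ?_
    · rw [norm_smul]
      exact mul_le_mul_of_nonneg_left (hC _ ⟨_, rfl⟩) (norm_nonneg _)
    · have : Continuous fun x => ‖c x‖ * C := by fun_prop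
      simpa [h0] using this.tendsto 0
  · have h1 : ContinuousAt (dirTo N) x :=
      (continuousOn_dirTo N).continuousAt (isOpen_compl_singleton.mem_nhds hx)
    exact hc.continuousAt.smul (hf.continuousAt.comp h1)

variable {A B : Type*} [NormedAddCommGroup A] [InnerProductSpace ℝ A]
  [FiniteDimensional ℝ A] [NormedAddCommGroup B] [InnerProductSpace ℝ B] [FiniteDimensional ℝ B]

theorem exists_contDiff_sphere_approx (f : C(USph A, B)) {ε : ℝ} (hε : 0 < ε) :
    ∃ F : A → B, ContDiff ℝ 2 F ∧ ∀ x : USph A, ‖F x - f x‖ < ε := by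
  rcases isEmpty_or_nonempty (USph A) with hA | ⟨⟨N⟩⟩
  · exact ⟨fun _ => 0, contDiff_const, fun x => (hA.false x).elim⟩
  obtain ⟨F, hF, hd, -⟩ := (continuous_cone f.continuous N continuous_norm
    norm_zero).exists_contDiff_approx (2 : ℕ) continuous_const (fun _ => hε)
  refine ⟨F, hF, fun x => ?_⟩
  have := hd (x : A)
  rwa [dist_eq_norm, dirTo_coe, x.norm_eq, one_smul] at this

theorem dense_compl_image_of_contDiffAt {A B : Type*} [NormedAddCommGroup A] [NormedSpace ℝ A]
    [FiniteDimensional ℝ A] [NormedAddCommGroup B] [NormedSpace ℝ B] [FiniteDimensional ℝ B]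
    {f : A → B} {U : Set A} (hf : ∀ x ∈ U, ContDiffAt ℝ 1 f x)
    (h : Module.finrank ℝ A < Module.finrank ℝ B) : Dense (f '' U)ᶜ := by
  refine dense_compl_of_dimH_lt_finrank ?_
  refine (dimH_image_le_of_locally_lipschitzOn fun x hx => ?_).trans_lt
    (((dimH_mono (Set.subset_univ U)).trans_eq (Real.dimH_univ_eq_finrank A)).trans_lt
      (by exact_mod_cast h))
  obtain ⟨C, t, ht, hC⟩ := (hf x hx).exists_lipschitzOnWith
  exact ⟨C, t, mem_nhdsWithin_of_mem_nhds ht, hC⟩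

theorem contDiffAt_normed_smul {F : A → B} (hF : ContDiff ℝ 2 F) {x : A} (hx : x ≠ 0) :
    ContDiffAt ℝ 1 (fun x => ‖x‖ • F (‖x‖⁻¹ • x)) x := by
  have h1 : ContDiffAt ℝ 1 (fun x : A => ‖x‖) x := contDiffAt_norm ℝ hx
  refine h1.smul ?_
  exact (hF.of_le (by norm_num)).contDiffAt.comp x
    ((h1.inv (norm_ne_zero_iff.2 hx)).smul contDiffAt_id)

theorem joined_of_two_le (h : 2 ≤ Module.finrank ℝ B) (p q : USph B) : Joined p q := by
  have h1 : IsPathConnected (Metric.sphere (0 : B) 1) :=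
    isPathConnected_sphere (by rw [← Module.finrank_eq_rank]; exact_mod_cast h) 0 zero_le_one
  have := isPathConnected_iff_pathConnectedSpace.1 h1
  exact PathConnectedSpace.joined p q

theorem homotopic_const_of_joined {X Y : Type*} [TopologicalSpace X] [TopologicalSpace Y]
    {p q : Y} (h : Joined p q) :
    (ContinuousMap.const X p).Homotopic (ContinuousMap.const X q) := by
  obtain ⟨γ⟩ := h
  exact ⟨⟨⟨fun z => γ z.1, by fun_prop⟩, fun x => by simp, fun x => by simp⟩⟩

theorem sphere_homotopic_const (h : Module.finrank ℝ A < Module.finrank ℝ B)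
    (f : C(USph A, USph B)) (q : USph B) : f.Homotopic (ContinuousMap.const _ q) := by
  rcases isEmpty_or_nonempty (USph A) with hA | ⟨⟨N⟩⟩
  · rw [show f = ContinuousMap.const _ q from ContinuousMap.ext fun x => (hA.false x).elim]
  have hA1 : 1 ≤ Module.finrank ℝ A := by
    have : Nontrivial A := ⟨⟨N, 0, N.ne_zero⟩⟩
    exact Module.finrank_pos
  obtain ⟨F, hF, hFf⟩ := exists_contDiff_sphere_approx
    (⟨fun x => (f x : B), by fun_prop⟩ : C(USph A, B)) one_pos
  have hdense := dense_compl_image_of_contDiffAt (f := fun x => ‖x‖ • F (‖x‖⁻¹ • x)) (U := {0}ᶜ)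
    (fun x hx => contDiffAt_normed_smul hF hx) h
  have : Nontrivial B := ⟨⟨q, 0, q.ne_zero⟩⟩
  obtain ⟨p, hp0, hp⟩ := hdense.exists_mem_open (isOpen_compl_singleton (x := (0 : B)))
    (exists_ne (0 : B))
  have hF0 : ∀ x : USph A, F x ≠ 0 := fun x h0 => by
    have := hFf x
    rw [h0, zero_sub, norm_neg] at this
    exact absurd this (by simp)
  let P : USph B := dirTo q p
  have hnp : ∀ x : USph A, dirTo q (F x) ≠ P := fun x hx => hp0 (by
    have h1 : 0 < ‖p‖ / ‖F x‖ := div_pos (norm_pos_iff.2 hp) (norm_pos_iff.2 (hF0 x))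
    have h2 : ‖(‖p‖ / ‖F x‖) • (x : A)‖ = ‖p‖ / ‖F x‖ := by
      rw [norm_smul, x.norm_eq, mul_one, Real.norm_of_nonneg h1.le]
    refine ⟨(‖p‖ / ‖F x‖) • (x : A), smul_ne_zero h1.ne' x.ne_zero, ?_⟩
    simp only [h2]
    rw [smul_smul, inv_mul_cancel₀ h1.ne', one_smul, div_eq_mul_inv, mul_smul,
      ← coe_dirTo q (hF0 x), hx, norm_smul_dirTo])
  let g : C(USph A, USph B) := ⟨fun x => dirTo q (F x),
    continuous_dirTo_comp q (hF.continuous.comp continuous_subtype_val) hF0⟩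
  have h1 : f.Homotopic g := homotopic_of_add_ne_zero fun x h0 => by
    have h2 : (dirTo q (F x) : B) = -f x := eq_neg_of_add_eq_zero_right h0
    have h3 := hFf x
    have h4 : F x = ‖F x‖ • -(f x : B) := by rw [← h2, norm_smul_dirTo]
    have h5 : F x - f x = -((‖F x‖ + 1) • (f x : B)) := by
      rw [add_smul, one_smul, neg_add, ← smul_neg, ← h4, sub_eq_add_neg]
    change ‖F x - f x‖ < 1 at h3
    rw [h5, norm_neg, norm_smul, USph.norm_eq, mul_one, Real.norm_of_nonneg (by positivity)] at h3
    linarith [norm_nonneg (F x)]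
  have h2 : g.Homotopic (ContinuousMap.const _ (-P)) := homotopic_of_add_ne_zero fun x h0 =>
    hnp x (Subtype.ext (by
      have := add_eq_zero_iff_eq_neg.1 h0
      rwa [ContinuousMap.const_apply, USph.coe_neg, neg_neg] at this))
  exact (h1.trans h2).trans (homotopic_const_of_joined (joined_of_two_le (by omega) _ _))

end Spheres

section Polar

open unitInterval

variable {A : Type*} [NormedAddCommGroup A] [InnerProductSpace ℝ A]

/-- The hyperplane orthogonal to a unit vector. -/
noncomputable abbrev perp (N : USph A) : Submodule ℝ A := (ℝ ∙ (N : A))ᗮ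

theorem mem_perp {N : USph A} {x : A} : x ∈ perp N ↔ inner ℝ (N : A) x = 0 :=
  Submodule.mem_orthogonal_singleton_iff_inner_right

theorem inner_perp {N : USph A} (x : perp N) : inner ℝ (N : A) (x : A) = 0 := mem_perp.1 x.2

theorem inner_perp' {N : USph A} (x : perp N) : inner ℝ (x : A) (N : A) = 0 := by
  rw [real_inner_comm, inner_perp]

theorem finrank_perp [FiniteDimensional ℝ A] (N : USph A) :
    Module.finrank ℝ (perp N) + 1 = Module.finrank ℝ A := by
  rw [← Submodule.finrank_add_finrank_orthogonal (ℝ ∙ (N : A)), finrank_span_singleton N.ne_zero,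
    add_comm]

theorem norm_add_smul_sq {N : USph A} (x : perp N) (t : ℝ) :
    ‖(x : A) + t • (N : A)‖ ^ 2 = ‖x‖ ^ 2 + t ^ 2 := by
  rw [norm_add_sq_real, real_inner_smul_right, inner_perp', norm_smul, N.norm_eq,
    Submodule.coe_norm]
  simp

/-- The point of the unit sphere at angle `θ` from `N` in the direction of `b`. -/
noncomputable def polar (N : USph A) (θ : ℝ) (b : USph (perp N)) : USph A :=
  USph.mk (Real.cos θ • (N : A) + Real.sin θ • ((b : perp N) : A)) (by
    have h := norm_add_smul_sq (Real.sin θ • (b : perp N)) (Real.cos θ)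
    rw [norm_smul, USph.norm_eq, mul_one, Real.norm_eq_abs, sq_abs, Real.sin_sq_add_cos_sq,
      add_comm] at h
    exact (pow_eq_one_iff_of_nonneg (norm_nonneg _) two_ne_zero).1 h)

theorem coe_polar (N : USph A) (θ : ℝ) (b : USph (perp N)) :
    (polar N θ b : A) = Real.cos θ • (N : A) + Real.sin θ • ((b : perp N) : A) := rfl

theorem continuous_polar (N : USph A) :
    Continuous fun p : ℝ × USph (perp N) => polar N p.1 p.2 := by
  refine Continuous.subtype_mk ?_ _
  exact ((Real.continuous_cos.comp continuous_fst).smul continuous_const).add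
    ((Real.continuous_sin.comp continuous_fst).smul (by fun_prop))

theorem polar_zero (N : USph A) (b : USph (perp N)) : polar N 0 b = N :=
  Subtype.ext (by simp [coe_polar])

theorem polar_pi (N : USph A) (b : USph (perp N)) : polar N Real.pi b = -N :=
  Subtype.ext (by simp [coe_polar])

theorem inner_polar (N : USph A) (θ : ℝ) (b : USph (perp N)) :
    inner ℝ (N : A) (polar N θ b) = Real.cos θ := by
  rw [coe_polar, inner_add_right, real_inner_smul_right, real_inner_smul_right, N.inner_self,
    inner_perp]
  simp

theorem exists_polar (N : USph A) [Nonempty (USph (perp N))] (x : USph A) :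
    ∃ θ ∈ Set.Icc 0 Real.pi, ∃ b, polar N θ b = x := by
  obtain ⟨b₀⟩ := ‹Nonempty (USph (perp N))›
  set c := inner ℝ (N : A) (x : A) with hc
  have hc1 : |c| ≤ 1 := by
    have := abs_real_inner_le_norm (N : A) (x : A)
    rwa [N.norm_eq, x.norm_eq, one_mul] at this
  let w : perp N := ⟨x - c • (N : A), mem_perp.2 (by
    rw [inner_sub_right, real_inner_smul_right, N.inner_self, hc]; ring)⟩
  have hx : (x : A) = w + c • (N : A) := by simp [w]
  have hw : ‖w‖ ^ 2 = 1 - c ^ 2 := by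
    have h := norm_add_smul_sq w c
    rw [← hx, x.norm_eq] at h
    linarith
  refine ⟨Real.arccos c, ⟨Real.arccos_nonneg c, Real.arccos_le_pi c⟩, dirTo b₀ w, Subtype.ext ?_⟩
  rw [coe_polar, Real.cos_arccos (abs_le.1 hc1).1 (abs_le.1 hc1).2, Real.sin_arccos, ← hw,
    Real.sqrt_sq (norm_nonneg w), ← Submodule.coe_smul, norm_smul_dirTo, add_comm]
  exact hx.symm

theorem polar_inj {N : USph A} {θ θ' : ℝ} (h : θ ∈ Set.Icc 0 Real.pi) (h' : θ' ∈ Set.Icc 0 Real.pi)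
    {b b' : USph (perp N)} (he : polar N θ b = polar N θ' b') :
    θ = θ' ∧ (θ = 0 ∨ θ = Real.pi ∨ b = b') := by
  have h1 : θ = θ' := Real.injOn_cos h h' (by rw [← inner_polar N θ b, he, inner_polar])
  refine ⟨h1, ?_⟩
  by_contra! hcon
  obtain ⟨h2, h3, h4⟩ := hcon
  have h5 : 0 < Real.sin θ :=
    Real.sin_pos_of_pos_of_lt_pi (lt_of_le_of_ne h.1 (Ne.symm h2)) (lt_of_le_of_ne h.2 h3)
  have h6 := congrArg (Subtype.val) he
  rw [coe_polar, coe_polar, ← h1, add_right_inj] at h6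
  exact h4 (Subtype.ext (Subtype.ext (smul_right_injective A h5.ne' h6)))

/-- Polar coordinates on the unit sphere. -/
noncomputable def polarMap (N : USph A) (p : I × USph (perp N)) : USph A :=
  polar N (Real.pi * p.1) p.2

theorem continuous_polarMap (N : USph A) : Continuous (polarMap N) :=
  (continuous_polar N).comp (f := fun p : I × USph (perp N) => (Real.pi * (p.1 : ℝ), p.2))
    (by fun_prop)

theorem polarMap_zero (N : USph A) (b : USph (perp N)) : polarMap N (0, b) = N := by
  simp [polarMap, polar_zero]

theorem polarMap_one (N : USph A) (b : USph (perp N)) : polarMap N (1, b) = -N := by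
  simp [polarMap, polar_pi]

theorem surjective_polarMap (N : USph A) [Nonempty (USph (perp N))] :
    Function.Surjective (polarMap N) := fun x => by
  obtain ⟨θ, hθ, b, hb⟩ := exists_polar N x
  refine ⟨(⟨θ / Real.pi, div_nonneg hθ.1 Real.pi_pos.le, div_le_one_of_le₀ hθ.2 Real.pi_pos.le⟩, b),
    ?_⟩
  rw [← hb, polarMap]
  congr 1
  exact mul_div_cancel₀ _ Real.pi_ne_zero

theorem exists_descend [FiniteDimensional ℝ A] {Z : Type*} [TopologicalSpace Z] (N : USph A)
    [Nonempty (USph (perp N))] {g : I × USph (perp N) → Z} (hg : Continuous g)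
    (h0 : ∀ b b', g (0, b) = g (0, b')) (h1 : ∀ b b', g (1, b) = g (1, b')) :
    ∃ G : C(USph A, Z), ∀ p, G (polarMap N p) = g p := by
  let Q : C(I × USph (perp N), USph A) := ⟨polarMap N, continuous_polarMap N⟩
  have hq : IsQuotientMap Q :=
    Topology.IsQuotientMap.of_surjective_continuous (surjective_polarMap N) (continuous_polarMap N)
  have hfac : Function.FactorsThrough g (polarMap N) := by
    rintro ⟨t, b⟩ ⟨t', b'⟩ h
    have hmem : ∀ t : I, Real.pi * (t : ℝ) ∈ Set.Icc 0 Real.pi := fun t =>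
      ⟨mul_nonneg Real.pi_pos.le t.2.1, mul_le_of_le_one_right Real.pi_pos.le t.2.2⟩
    obtain ⟨h2, h3⟩ := polar_inj (hmem t) (hmem t') h
    have h4 : t = t' := Subtype.ext (mul_left_cancel₀ Real.pi_ne_zero h2)
    subst h4
    rcases h3 with h3 | h3 | h3
    · have : t = 0 := Subtype.ext (by simpa [Real.pi_ne_zero] using h3)
      rw [this]; exact h0 _ _
    · have : t = 1 := Subtype.ext (by simpa [Real.pi_ne_zero] using h3)
      rw [this]; exact h1 _ _
    · exact congrArg (fun b => g (t, b)) h3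
  refine ⟨hq.lift ⟨g, hg⟩ hfac, fun p => ?_⟩
  exact congrArg (fun F => F p) (hq.lift_comp ⟨g, hg⟩ hfac)

theorem exists_angle {B : Type*} [TopologicalSpace B] [CompactSpace B] {H : I × B → Circle}
    (hH : Continuous H) : ∃ G : I × B → ℝ, Continuous G ∧ (∀ b, G (0, b) = 0) ∧
      ∀ t b, Circle.exp (G (t, b)) * H (0, b) = H (t, b) := by
  obtain ⟨G, hG, hG0, hP⟩ := exists_transport hH
    (fun a b => Multiplicative.ofAdd (Complex.arg ((b / a : Circle) : ℂ))) one_pos (by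
      refine continuous_ofAdd.comp_continuousOn fun p hp => ?_
      refine ContinuousAt.continuousWithinAt (ContinuousAt.comp (g := Complex.arg)
        (f := fun p : Circle × Circle => ((p.2 / p.1 : Circle) : ℂ))
        (Complex.continuousAt_arg ?_)
        (continuous_subtype_val.comp (continuous_snd.div' continuous_fst)).continuousAt)
      refine Complex.mem_slitPlane_of_norm_lt_one (z := ((p.2 / p.1 : Circle) : ℂ) - 1) ?_ |>
        fun h => by simpa using h
      have h1 : ((p.2 / p.1 : Circle) : ℂ) - 1 = (p.2 - p.1) / p.1 := by
        rw [Circle.coe_div, sub_div, div_self (Circle.coe_ne_zero _)]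
      rw [h1, norm_div, Circle.norm_coe, div_one, norm_sub_rev]
      change dist (p.1 : ℂ) p.2 < 1 at hp
      rwa [dist_eq_norm] at hp) (fun a => by simp)
  refine ⟨fun p => (G p).toAdd, continuous_toAdd.comp hG, fun b => by simp [hG0], fun t b => ?_⟩
  refine hP b (fun g t t' => Circle.exp g.toAdd * H (t, b) = H (t', b)) (fun t => by simp)
    (fun g h t t' t'' hg hh => ?_) (fun t t' _ => ?_) t
  · rw [toAdd_mul, Circle.exp_add, mul_assoc, hg, hh]
  · rw [toAdd_ofAdd, Circle.exp_arg, div_mul_cancel]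

theorem eq_of_circle_exp_eq {B : Type*} [TopologicalSpace B] [PreconnectedSpace B] {g : B → ℝ}
    (hg : Continuous g) (h : ∀ b b', Circle.exp (g b) = Circle.exp (g b')) (b b' : B) :
    g b = g b' := by
  have h1 : ∀ x, ∃ n : ℤ, (n : ℝ) = (g x - g b) / (2 * Real.pi) := fun x => by
    obtain ⟨m, hm⟩ := Circle.exp_eq_exp.1 (h x b)
    exact ⟨m, by rw [hm]; field_simp; ring⟩
  choose n hn using h1
  have hc : Continuous n := by
    rw [Int.isClosedEmbedding_coe_real.isInducing.continuous_iff]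
    have : (Int.cast ∘ n : B → ℝ) = fun x => (g x - g b) / (2 * Real.pi) := funext hn
    rw [this]; fun_prop
  have h2 : n b = n b' := PreconnectedSpace.constant ‹_› hc
  have h3 := hn b
  have h4 := hn b'
  rw [← h2, h3, sub_self, zero_div, eq_comm, div_eq_zero_iff] at h4
  rcases h4 with h4 | h4
  · linarith
  · exact absurd h4 (by positivity)

theorem nonempty_perp_sphere [FiniteDimensional ℝ A] (N : USph A)
    (h : 2 ≤ Module.finrank ℝ A) : Nonempty (USph (perp N)) := by
  have h1 := finrank_perp N
  have : Nontrivial (perp N) := Module.nontrivial_of_finrank_pos (R := ℝ) (by omega)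
  obtain ⟨x, hx⟩ := exists_norm_eq (perp N) zero_le_one
  exact ⟨USph.mk x hx⟩

theorem preconnectedSpace_sphere [FiniteDimensional ℝ A] (h : 2 ≤ Module.finrank ℝ A) :
    PreconnectedSpace (USph A) :=
  isPreconnected_iff_preconnectedSpace.1 (isPreconnected_sphere
    (by rw [← Module.finrank_eq_rank]; exact_mod_cast h) 0 1)

theorem exists_circle_log [FiniteDimensional ℝ A] (h : Module.finrank ℝ A = 3)
    (N : USph A) (f : C(USph A, Circle)) :
    ∃ θ : C(USph A, ℝ), ∀ x, f x = Circle.exp (θ x) * f N := by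
  have hp := finrank_perp N
  have := nonempty_perp_sphere N (by omega)
  have := preconnectedSpace_sphere (A := perp N) (by omega)
  obtain ⟨G, hG, hG0, hGe⟩ := exists_angle (H := fun p => f (polarMap N p))
    (f.continuous.comp (continuous_polarMap N))
  obtain ⟨θ, hθ⟩ := exists_descend N hG (fun b b' => by rw [hG0, hG0]) (fun b b' =>
    eq_of_circle_exp_eq (g := fun b => G (1, b)) (by fun_prop) (fun b b' => by
      have h1 := hGe 1 b
      have h2 := hGe 1 b'
      simp only [polarMap_zero, polarMap_one] at h1 h2
      exact mul_right_cancel (h1.trans h2.symm)) b b')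
  refine ⟨θ, fun x => ?_⟩
  obtain ⟨⟨t, b⟩, rfl⟩ := surjective_polarMap N x
  have h1 := hGe t b
  simp only [polarMap_zero] at h1
  rw [hθ, h1]

variable {B : Type*} [NormedAddCommGroup B] [InnerProductSpace ℝ B] [FiniteDimensional ℝ B]

theorem two_sphere_homotopic_const_circle [FiniteDimensional ℝ A] (hA : Module.finrank ℝ A = 3)
    (hB : Module.finrank ℝ B = 2) (f : C(USph A, USph B)) (q : USph B) :
    f.Homotopic (ContinuousMap.const _ q) := by
  have : Nontrivial A := Module.nontrivial_of_finrank_pos (R := ℝ) (by omega)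
  obtain ⟨x, hx⟩ := exists_norm_eq A zero_le_one
  let N : USph A := USph.mk x hx
  let φ : B ≃ₗᵢ[ℝ] ℂ := ((stdOrthonormalBasis ℝ B).reindex (finCongr hB)).repr.trans
    Complex.orthonormalBasisOneI.repr.symm
  let f' : C(USph A, Circle) := ⟨fun x => ⟨φ (f x), mem_sphere_zero_iff_norm.2
    (by rw [φ.norm_map, (f x).norm_eq])⟩, Continuous.subtype_mk (by fun_prop) _⟩
  obtain ⟨θ, hθ⟩ := exists_circle_log hA N f'
  have hn : ∀ z : Circle, ‖φ.symm (z : ℂ)‖ = 1 := fun z => by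
    rw [LinearIsometryEquiv.norm_map, Circle.norm_coe]
  have hf : ∀ x, φ.symm (f' x : ℂ) = f x := fun x => φ.symm_apply_apply _
  have h1 : f.Homotopic (ContinuousMap.const _ (f N)) := by
    refine ⟨⟨⟨fun p => USph.mk (φ.symm ((Circle.exp ((1 - (p.1 : ℝ)) * θ p.2) * f' N : Circle) : ℂ))
      (hn _), Continuous.subtype_mk (φ.symm.continuous.comp (continuous_subtype_val.comp
        (by fun_prop))) _⟩, fun x => Subtype.ext ?_, fun x => Subtype.ext ?_⟩⟩
    · refine Eq.trans (congrArg (fun z : Circle => φ.symm (z : ℂ)) ?_) (hf x)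
      rw [hθ x]
      simp
    · refine Eq.trans (congrArg (fun z : Circle => φ.symm (z : ℂ)) ?_) (hf N)
      simp
  exact h1.trans (homotopic_const_of_joined (joined_of_two_le hB.ge _ _))

theorem two_sphere_homotopic_const [FiniteDimensional ℝ A] (hA : Module.finrank ℝ A = 3)
    (hB : 2 ≤ Module.finrank ℝ B) (hB3 : Module.finrank ℝ B ≠ 3) (f : C(USph A, USph B))
    (q : USph B) : f.Homotopic (ContinuousMap.const _ q) := by
  rcases hB.eq_or_lt with h | h
  · exact two_sphere_homotopic_const_circle hA h.symm f q
  · exact sphere_homotopic_const (by omega) f q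

end Polar

section Extension

variable {V : Type*} [NormedAddCommGroup V] [InnerProductSpace ℝ V] [FiniteDimensional ℝ V]

theorem isUnit_of_forall_eq_zero {g : V →L[ℝ] V} (h : ∀ x, g x = 0 → x = 0) : IsUnit g := by
  have h1 : IsUnit (g : V →ₗ[ℝ] V) :=
    (LinearMap.isUnit_iff_ker_eq_bot _).2 (LinearMap.ker_eq_bot'.2 h)
  exact h1.map (LinearMap.toContinuousLinearMap (𝕜 := ℝ) (E := V) (F' := V) |>.toEquiv |> fun _ =>
    ({ toFun := LinearMap.toContinuousLinearMap, map_one' := rfl, map_mul' := fun _ _ => rfl } :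
      (V →ₗ[ℝ] V) →* (V →L[ℝ] V)))

theorem eq_zero_of_units_apply {g : (V →L[ℝ] V)ˣ} {x : V} (h : (g : V →L[ℝ] V) x = 0) : x = 0 := by
  rw [← units_inv_apply g x, h, map_zero]

variable (W : Submodule ℝ V)

/-- Extension of an operator on a subspace by zero on the orthogonal complement. -/
noncomputable def extL : (W →L[ℝ] W) →L[ℝ] (V →L[ℝ] V) :=
  (ContinuousLinearMap.compL ℝ V W V W.subtypeL) ∘L
    ((ContinuousLinearMap.compL ℝ V W W).flip W.orthogonalProjectionOnto)

/-- The compression of an operator to a subspace. -/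
noncomputable def compr : (V →L[ℝ] V) →L[ℝ] (W →L[ℝ] W) :=
  (ContinuousLinearMap.compL ℝ W V W W.orthogonalProjectionOnto) ∘L
    ((ContinuousLinearMap.compL ℝ W V V).flip W.subtypeL)

theorem extL_apply (B : W →L[ℝ] W) (v : V) :
    extL W B v = (B (W.orthogonalProjectionOnto v) : V) := rfl

theorem compr_apply (A : V →L[ℝ] V) (w : W) :
    compr W A w = W.orthogonalProjectionOnto (A w) := rfl

theorem extL_mul (B C : W →L[ℝ] W) : extL W (B * C) = extL W B * extL W C := by
  ext v
  rw [clm_mul_apply, extL_apply, extL_apply, extL_apply,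
    W.orthogonalProjectionOnto_mem_subspace_eq_self, clm_mul_apply]

theorem extL_one : extL W 1 = W.starProjection := rfl

/-- Extension of an operator on a subspace by the identity on the orthogonal complement. -/
noncomputable def extHom : (W →L[ℝ] W) →* (V →L[ℝ] V) where
  toFun B := (1 - W.starProjection) + extL W B
  map_one' := by rw [extL_one, sub_add_cancel]
  map_mul' B C := by
    have h1 : ∀ B, extL W B * W.starProjection = extL W B := fun B => by
      rw [← extL_one, ← extL_mul, mul_one]
    have h2 : ∀ B, W.starProjection * extL W B = extL W B := fun B => by
      rw [← extL_one, ← extL_mul, one_mul]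
    have h3 : W.starProjection * W.starProjection = W.starProjection := by
      rw [← extL_one, ← extL_mul, one_mul]
    rw [extL_mul]
    noncomm_ring [h1, h2, h3]

theorem extHom_eq (B : W →L[ℝ] W) : extHom W B = (1 - W.starProjection) + extL W B := rfl

theorem extHom_apply (B : W →L[ℝ] W) (v : V) :
    extHom W B v = (v - W.starProjection v) + (B (W.orthogonalProjectionOnto v) : V) := rfl

theorem extHom_apply_mem (B : W →L[ℝ] W) (w : W) : extHom W B w = B w := by
  rw [extHom_apply, W.orthogonalProjectionOnto_mem_subspace_eq_self,
    W.starProjection_mem_subspace_eq_self, sub_self, zero_add]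

theorem extHom_apply_orth (B : W →L[ℝ] W) {v : V} (hv : v ∈ Wᗮ) : extHom W B v = v := by
  rw [extHom_apply, (W.starProjection_apply_eq_zero_iff).2 hv,
    (W.orthogonalProjectionOnto_eq_zero_iff).2 hv]
  simp

theorem compr_apply_of_mem {A : V →L[ℝ] V} {w : W} (h : A w ∈ W) : (compr W A w : V) = A w := by
  rw [compr_apply, W.coe_orthogonalProjectionOnto_apply]
  exact W.starProjection_eq_self_iff.2 h

variable {W}

theorem clm_ext_of_orthogonal {A B : V →L[ℝ] V} (h : ∀ w ∈ W, A w = B w)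
    (h' : ∀ w ∈ Wᗮ, A w = B w) : A = B := by
  ext v
  obtain ⟨w, hw, u, hu, rfl⟩ := W.exists_add_mem_mem_orthogonal v
  rw [map_add, map_add, h w hw, h' u hu]

theorem extHom_compr {A : V →L[ℝ] V} (h : ∀ w ∈ W, A w ∈ W) (h' : ∀ w ∈ Wᗮ, A w = w) :
    extHom W (compr W A) = A := by
  refine clm_ext_of_orthogonal (W := W) (fun w hw => ?_) fun w hw => ?_
  · rw [extHom_apply_mem W _ ⟨w, hw⟩, compr_apply_of_mem W (h w hw)]
  · rw [extHom_apply_orth W _ hw, h' w hw]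

theorem compr_mul {A B : V →L[ℝ] V} (h : ∀ w ∈ W, B w ∈ W) :
    compr W (A * B) = compr W A * compr W B := by
  ext w
  rw [clm_mul_apply, compr_apply, compr_apply, compr_apply_of_mem W (h w w.2), clm_mul_apply]

theorem compr_one : compr W 1 = 1 := by
  ext w
  rw [compr_apply_of_mem W (by simp)]
  rfl

theorem isUnit_compr {g : (V →L[ℝ] V)ˣ} (h : ∀ w ∈ W, (g : V →L[ℝ] V) w ∈ W) :
    IsUnit (compr W g) := by
  refine isUnit_of_forall_eq_zero fun w hw => Subtype.ext ?_
  have := congrArg Subtype.val hw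
  rw [compr_apply_of_mem W (h w w.2)] at this
  exact eq_zero_of_units_apply this

end Extension

section ComplexStructure

variable {V : Type*} [NormedAddCommGroup V] [InnerProductSpace ℝ V]

/-- Orthogonal complex structures. -/
def IsCS (J : V →L[ℝ] V) : Prop := J * J = -1 ∧ ∀ x y, inner ℝ (J x) (J y) = inner ℝ x y

/-- The space of orthogonal complex structures. -/
abbrev CS (V : Type*) [NormedAddCommGroup V] [InnerProductSpace ℝ V] : Type _ :=
  {J : V →L[ℝ] V // IsCS J}

namespace IsCS

variable {J : V →L[ℝ] V}

theorem apply_apply (hJ : IsCS J) (x : V) : J (J x) = -x := by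
  rw [← clm_mul_apply, hJ.1]; rfl

theorem norm_apply (hJ : IsCS J) (x : V) : ‖J x‖ = ‖x‖ := by
  rw [norm_eq_sqrt_real_inner, hJ.2, ← norm_eq_sqrt_real_inner]

theorem inner_right (hJ : IsCS J) (x y : V) : inner ℝ x (J y) = -inner ℝ (J x) y := by
  rw [← hJ.2 x, hJ.apply_apply, inner_neg_right]

theorem inner_self (hJ : IsCS J) (x : V) : inner ℝ (J x) x = 0 := by
  have := hJ.inner_right x x
  rw [real_inner_comm] at this
  linarith

theorem even_finrank (hJ : IsCS J) [FiniteDimensional ℝ V] : Even (Module.finrank ℝ V) := by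
  have h : (J : V →ₗ[ℝ] V) * (J : V →ₗ[ℝ] V) = (-1 : ℝ) • 1 := by
    ext x
    simpa using hJ.apply_apply x
  have h1 := congrArg LinearMap.det h
  rw [map_mul, LinearMap.det_smul, map_one, mul_one] at h1
  rw [← neg_one_pow_eq_one_iff_even (R := ℝ) (by norm_num)]
  rcases neg_one_pow_eq_or ℝ (Module.finrank ℝ V) with h2 | h2
  · exact h2
  · rw [h2] at h1
    nlinarith [mul_self_nonneg (LinearMap.det (J : V →ₗ[ℝ] V))]

end IsCS

/-- Invertible operators commuting with `J`. -/
def cenS (J : V →L[ℝ] V) : Subgroup (V →L[ℝ] V)ˣ where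
  carrier := {g | (g : V →L[ℝ] V) * J = J * g}
  mul_mem' {a b} (ha : _ = _) (hb : _ = _) := by
    change ((a * b : (V →L[ℝ] V)ˣ) : V →L[ℝ] V) * J = J * (a * b : (V →L[ℝ] V)ˣ)
    rw [Units.val_mul, mul_assoc, hb, ← mul_assoc, ha, mul_assoc]
  one_mem' := by
    change ((1 : (V →L[ℝ] V)ˣ) : V →L[ℝ] V) * J = J * (1 : (V →L[ℝ] V)ˣ)
    simp
  inv_mem' {a} (ha : _ = _) := by
    change ((a⁻¹ : (V →L[ℝ] V)ˣ) : V →L[ℝ] V) * J = J * (a⁻¹ : (V →L[ℝ] V)ˣ)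
    rw [Units.inv_mul_eq_iff_eq_mul, ← mul_assoc, ha, mul_assoc, Units.mul_inv, mul_one]

theorem mem_cenS {J : V →L[ℝ] V} {g : (V →L[ℝ] V)ˣ} :
    g ∈ cenS J ↔ (g : V →L[ℝ] V) * J = J * g := Iff.rfl

theorem apply_of_mem_cenS {J : V →L[ℝ] V} {g : (V →L[ℝ] V)ˣ} (h : g ∈ cenS J) (x : V) :
    (g : V →L[ℝ] V) (J x) = J ((g : V →L[ℝ] V) x) := by
  rw [← clm_mul_apply, mem_cenS.1 h]; rfl

theorem IsCS.conj {J : V →L[ℝ] V} (hJ : IsCS J) {g : (V →L[ℝ] V)ˣ} (hg : g ∈ orth V) :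
    IsCS ((g : V →L[ℝ] V) * J * (↑g⁻¹ : V →L[ℝ] V)) := by
  refine ⟨?_, fun x y => ?_⟩
  · rw [show (g : V →L[ℝ] V) * J * (↑g⁻¹ : V →L[ℝ] V) * ((g : V →L[ℝ] V) * J * (↑g⁻¹ : V →L[ℝ] V))
      = g * J * ((↑g⁻¹ : V →L[ℝ] V) * g) * J * (↑g⁻¹ : V →L[ℝ] V) by simp only [mul_assoc],
      Units.inv_mul, mul_one, mul_assoc (g : V →L[ℝ] V), hJ.1]
    simp
  · simp only [clm_mul_apply]
    rw [mem_orth.1 hg, hJ.2, mem_orth.1 (inv_mem hg)]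

variable [FiniteDimensional ℝ V]

theorem exists_clin_transport {J : V →L[ℝ] V} (hJ : IsCS J) {B : Type*} [TopologicalSpace B]
    [CompactSpace B] {H : unitInterval × B → USph V} (hH : Continuous H) :
    ∃ G : unitInterval × B → (V →L[ℝ] V)ˣ, Continuous G ∧ (∀ b, G (0, b) = 1) ∧
      (∀ p, G p ∈ cenS J) ∧ ∀ t b, (G (t, b) : V →L[ℝ] V) (H (0, b)) = H (t, b) := by
  let S : USph V → USph V → V →L[ℝ] V := fun a b => 1 + (innerSL ℝ (a : V)).smulRight ((b : V) - a)
    + (innerSL ℝ (J a)).smulRight (J ((b : V) - a))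
  have hS : ∀ a b x, S a b x = x + inner ℝ (a : V) x • ((b : V) - a)
      + inner ℝ (J a) x • J ((b : V) - a) := fun a b x => rfl
  have hSu : ∀ a b, dist a b < 1 / 2 → IsUnit (S a b) := fun a b h => by
    refine isUnit_of_norm_sub_one_lt ?_
    have h1 : S a b - 1 = (innerSL ℝ (a : V)).smulRight ((b : V) - a)
      + (innerSL ℝ (J a)).smulRight (J ((b : V) - a)) := by
      simp only [S]; abel
    rw [h1]
    refine (norm_add_le _ _).trans_lt ?_
    rw [ContinuousLinearMap.norm_smulRight_apply, ContinuousLinearMap.norm_smulRight_apply,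
      innerSL_apply_norm, innerSL_apply_norm, hJ.norm_apply, hJ.norm_apply, a.norm_eq]
    rw [Subtype.dist_eq, dist_eq_norm, norm_sub_rev] at h
    linarith
  have hSc : ∀ a b, S a b * J = J * S a b := fun a b => by
    ext x
    rw [clm_mul_apply, clm_mul_apply, hS, hS, map_add, map_add, map_smul, map_smul,
      hJ.apply_apply, hJ.2, hJ.inner_right, neg_smul, smul_neg]
    abel
  obtain ⟨G, hG, hG0, hP⟩ := exists_transport hH (fun a b => unitOf (S a b))
    (by norm_num : (0 : ℝ) < 1 / 2) (by
      refine continuousOn_unitOf_comp (Continuous.continuousOn ?_) fun p hp => hSu _ _ hp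
      have h1 : Continuous fun p : V × V => (1 : V →L[ℝ] V) +
          (innerSL ℝ p.1).smulRight (p.2 - p.1) + (innerSL ℝ (J p.1)).smulRight (J (p.2 - p.1)) := by
        refine (continuous_const.add ?_).add ?_
        · exact ((ContinuousLinearMap.smulRightL ℝ V V).continuous₂).comp
            (f := fun p : V × V => (innerSL ℝ p.1, p.2 - p.1)) (by fun_prop)
        · exact ((ContinuousLinearMap.smulRightL ℝ V V).continuous₂).comp
            (f := fun p : V × V => (innerSL ℝ (J p.1), J (p.2 - p.1))) (by fun_prop)
      exact h1.comp (f := fun p : USph V × USph V => ((p.1 : V), (p.2 : V))) (by fun_prop))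
    (fun a => unitOf_eq (by simp [S]))
  refine ⟨G, hG, hG0, fun p => ?_, fun t b => ?_⟩
  · refine hP p.2 (fun g _ _ => g ∈ cenS J) (fun _ => one_mem _) (fun g h _ _ _ hg hh => mul_mem hh hg)
      (fun t t' h => ?_) p.1
    rw [mem_cenS, val_unitOf (hSu _ _ h), hSc]
  · refine hP b (fun g t t' => (g : V →L[ℝ] V) (H (t, b)) = H (t', b)) (fun t => rfl)
      (fun g h t t' t'' hg hh => ?_) (fun t t' h => ?_) t
    · rw [Units.val_mul, clm_mul_apply, hg, hh]
    · rw [val_unitOf (hSu _ _ h), hS, hJ.inner_self, USph.inner_self]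
      simp

theorem exists_cs_transport {B : Type*} [TopologicalSpace B]
    [CompactSpace B] {H : unitInterval × B → CS V} (hH : Continuous H) :
    ∃ G : unitInterval × B → (V →L[ℝ] V)ˣ, Continuous G ∧ (∀ b, G (0, b) = 1) ∧
      (∀ t b, (G (t, b) : V →L[ℝ] V) * (H (0, b)).1 = (H (t, b)).1 * G (t, b)) ∧
      ∀ b, (∀ t, H (t, b) = H (0, b)) → ∀ t, G (t, b) = 1 := by
  let S : CS V → CS V → V →L[ℝ] V := fun a b => (2⁻¹ : ℝ) • (1 - b.1 * a.1)
  have hS : ∀ a b : CS V, S a b - 1 = (2⁻¹ : ℝ) • ((a.1 - b.1) * a.1) := fun a b => by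
    rw [sub_mul, a.2.1, ← sub_eq_zero]
    simp only [S]
    module
  have hn : ∀ a : CS V, ‖a.1‖ ≤ 1 := fun a =>
    ContinuousLinearMap.opNorm_le_bound _ zero_le_one fun x => by rw [a.2.norm_apply, one_mul]
  have hSu : ∀ a b, dist a b < 1 → IsUnit (S a b) := fun a b h => by
    refine isUnit_of_norm_sub_one_lt ?_
    rw [hS, norm_smul]
    have h1 := (norm_mul_le (a.1 - b.1) a.1).trans
      (mul_le_mul_of_nonneg_left (hn a) (norm_nonneg _))
    rw [Subtype.dist_eq, dist_eq_norm] at h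
    norm_num
    linarith
  have hSJ : ∀ a b : CS V, S a b * a.1 = b.1 * S a b := fun a b => by
    simp only [S]
    rw [smul_mul_assoc, mul_smul_comm, sub_mul, mul_sub, mul_assoc, a.2.1, ← mul_assoc, b.2.1]
    congr 1
    noncomm_ring
  have hS1 : ∀ a : CS V, unitOf (S a a) = 1 := fun a => unitOf_eq (by
    simp only [S]
    rw [a.2.1, Units.val_one]
    module)
  obtain ⟨G, hG, hG0, hP⟩ := exists_transport hH (fun a b => unitOf (S a b)) one_pos (by
      refine continuousOn_unitOf_comp (Continuous.continuousOn ?_) fun p hp => hSu _ _ hp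
      fun_prop) hS1
  refine ⟨G, hG, hG0, fun t b => ?_, fun b hb t => ?_⟩
  · refine hP b (fun g t t' => (g : V →L[ℝ] V) * (H (t, b)).1 = (H (t', b)).1 * g)
      (fun t => by simp) (fun g h t t' t'' hg hh => ?_) (fun t t' h => ?_) t
    · rw [Units.val_mul, mul_assoc, hg, ← mul_assoc, hh, mul_assoc]
    · rw [val_unitOf (hSu _ _ h), hSJ]
  · refine hP b (fun g _ _ => g = 1) (fun _ => rfl) (fun g h _ _ _ hg hh => by rw [hg, hh, one_mul])
      (fun t t' _ => ?_) t
    rw [hb, hb t', hS1]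

theorem IsCS.compr {J : V →L[ℝ] V} (hJ : IsCS J) {W : Submodule ℝ V} (h : ∀ w ∈ W, J w ∈ W) :
    IsCS (compr W J) := by
  refine ⟨?_, fun x y => ?_⟩
  · rw [← compr_mul h, hJ.1, map_neg, compr_one]
  · rw [Submodule.coe_inner, compr_apply_of_mem W (h x x.2), compr_apply_of_mem W (h y y.2), hJ.2,
      Submodule.coe_inner]

/-- Extension of `J`-commuting operators from an invariant subspace. -/
noncomputable def extCen {J : V →L[ℝ] V} {W : Submodule ℝ V} (h : ∀ w ∈ W, J w ∈ W)
    (h' : ∀ w ∈ Wᗮ, J w ∈ Wᗮ) : C(cenS (compr W J), cenS J) where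
  toFun g := ⟨Units.map (extHom W) g, mem_cenS.2 (clm_ext_of_orthogonal (W := W) (fun w hw => by
    rw [clm_mul_apply, clm_mul_apply, Units.coe_map,
      extHom_apply_mem W _ ⟨w, hw⟩, extHom_apply_mem W _ ⟨J w, h w hw⟩,
      ← compr_apply_of_mem W (h _ (Subtype.prop _)), ← apply_of_mem_cenS g.2]
    congr 2
    exact Subtype.ext (compr_apply_of_mem W (w := ⟨w, hw⟩) (h w hw)).symm) (fun w hw => by
    rw [clm_mul_apply, clm_mul_apply, Units.coe_map,
      extHom_apply_orth W _ hw, extHom_apply_orth W _ (h' w hw)]))⟩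
  continuous_toFun := by
    refine Continuous.subtype_mk (continuous_units_iff.2 ?_) _
    exact continuous_const.add ((extL W).continuous.comp
      (Units.continuous_val.comp continuous_subtype_val))

theorem coe_extCen {J : V →L[ℝ] V} {W : Submodule ℝ V} (h : ∀ w ∈ W, J w ∈ W)
    (h' : ∀ w ∈ Wᗮ, J w ∈ Wᗮ) (g : cenS (compr W J)) :
    ((extCen h h' g : (V →L[ℝ] V)ˣ) : V →L[ℝ] V) = extHom W ((g : (W →L[ℝ] W)ˣ) : W →L[ℝ] W) := rfl

theorem homotopic_cenS {X : Type*} [TopologicalSpace X] {J : V →L[ℝ] V} {f g : C(X, cenS J)}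
    (F : unitInterval × X → V →L[ℝ] V) (hF : Continuous F) (hu : ∀ p, IsUnit (F p))
    (hJ : ∀ p, F p * J = J * F p) (h0 : ∀ x, F (0, x) = (f x : (V →L[ℝ] V)ˣ))
    (h1 : ∀ x, F (1, x) = (g x : (V →L[ℝ] V)ˣ)) : f.Homotopic g :=
  ⟨⟨⟨fun p => ⟨unitOf (F p), mem_cenS.2 (by rw [val_unitOf (hu p), hJ])⟩,
    Continuous.subtype_mk (continuous_unitOf_comp hF hu) _⟩,
    fun x => Subtype.ext (unitOf_eq (h0 x)), fun x => Subtype.ext (unitOf_eq (h1 x))⟩⟩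

end ComplexStructure

section TwoSphereUnits

universe u

theorem mem_orthogonal_pair {V : Type*} [NormedAddCommGroup V] [InnerProductSpace ℝ V]
    {a b x : V} : x ∈ (Submodule.span ℝ {a, b})ᗮ ↔ inner ℝ a x = 0 ∧ inner ℝ b x = 0 := by
  rw [Submodule.mem_orthogonal]
  refine ⟨fun h => ⟨h a (Submodule.subset_span (by simp)), h b (Submodule.subset_span (by simp))⟩,
    fun h u hu => ?_⟩
  obtain ⟨s, t, rfl⟩ := Submodule.mem_span_pair.1 hu
  rw [inner_add_left, real_inner_smul_left, real_inner_smul_left, h.1, h.2]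
  ring

theorem two_sphere_cenS_nullhomotopic {A : Type*} [NormedAddCommGroup A] [InnerProductSpace ℝ A]
    [FiniteDimensional ℝ A] (hA : Module.finrank ℝ A = 3) (k : ℕ) :
    ∀ (V : Type u) [NormedAddCommGroup V] [InnerProductSpace ℝ V] [FiniteDimensional ℝ V],
      Module.finrank ℝ V = k → ∀ J : V →L[ℝ] V, IsCS J → ∀ h : C(USph A, cenS J),
        h.Nullhomotopic := by
  induction k using Nat.strong_induction_on with
  | _ k ih =>
  intro V _ _ _ hk J hJ h
  rcases subsingleton_or_nontrivial V with hV | hV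
  · refine ⟨1, ?_⟩
    rw [show h = ContinuousMap.const _ 1 from ContinuousMap.ext fun x =>
      Subtype.ext (Units.ext (ContinuousLinearMap.ext fun v => Subsingleton.elim _ _))]
  obtain ⟨e', he'⟩ := exists_norm_eq V zero_le_one
  let e : USph V := USph.mk e' he'
  have hev := hJ.even_finrank
  have hpos : 0 < Module.finrank ℝ V := Module.finrank_pos
  obtain ⟨m, hm⟩ := hev
  have hcol : Continuous fun x => ((h x : (V →L[ℝ] V)ˣ) : V →L[ℝ] V) e :=
    (ContinuousLinearMap.apply ℝ V (e : V)).continuous.comp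
      (Units.continuous_val.comp (continuous_subtype_val.comp h.continuous))
  have hcol0 : ∀ x, ((h x : (V →L[ℝ] V)ˣ) : V →L[ℝ] V) e ≠ 0 := fun x hx =>
    e.ne_zero (eq_zero_of_units_apply hx)
  let c : C(USph A, USph V) := ⟨fun x => dirTo e (((h x : (V →L[ℝ] V)ˣ) : V →L[ℝ] V) e),
    continuous_dirTo_comp e hcol hcol0⟩
  obtain ⟨H⟩ := two_sphere_homotopic_const hA (by omega) (by omega) c e
  obtain ⟨G, hG, hG0, hGc, hGH⟩ := exists_clin_transport hJ (H := H) H.continuous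
  let G' : C(unitInterval × USph A, cenS J) := ⟨fun p => ⟨G p, hGc p⟩, hG.subtype_mk _⟩
  let h₁ : C(USph A, cenS J) := ⟨fun x => G' (1, x) * h x, by fun_prop⟩
  have hh₁ : h.Homotopic h₁ := ⟨⟨⟨fun p => G' p * h p.2, by fun_prop⟩,
    fun x => Subtype.ext (by simp [G', hG0]), fun x => rfl⟩⟩
  let l : USph A → ℝ := fun x => ‖((h x : (V →L[ℝ] V)ˣ) : V →L[ℝ] V) e‖
  have hl : Continuous l := hcol.norm
  have hl0 : ∀ x, 0 < l x := fun x => norm_pos_iff.2 (hcol0 x)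
  let g : USph A → V →L[ℝ] V := fun x => ((h₁ x : (V →L[ℝ] V)ˣ) : V →L[ℝ] V)
  have hgc : Continuous g := Units.continuous_val.comp (continuous_subtype_val.comp h₁.continuous)
  have hgJ : ∀ x, g x * J = J * g x := fun x => (h₁ x).2
  have hge : ∀ x, g x e = l x • (e : V) := fun x => by
    have h1 := hGH 1 x
    rw [H.apply_zero, H.apply_one] at h1
    change (G (1, x) : V →L[ℝ] V) (((h x : (V →L[ℝ] V)ˣ) : V →L[ℝ] V) e) = _
    rw [← norm_smul_dirTo e (((h x : (V →L[ℝ] V)ˣ) : V →L[ℝ] V) e), map_smul]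
    exact congrArg _ h1
  have hgJe : ∀ x, g x (J e) = l x • J e := fun x => by
    rw [← clm_mul_apply, hgJ, clm_mul_apply, hge, map_smul]
  let W : Submodule ℝ V := (Submodule.span ℝ {(e : V), J e})ᗮ
  have hWW : Wᗮ = Submodule.span ℝ {(e : V), J e} := Submodule.orthogonal_orthogonal _
  have hJW : ∀ w ∈ W, J w ∈ W := fun w hw => by
    obtain ⟨h1, h2⟩ := mem_orthogonal_pair.1 hw
    exact mem_orthogonal_pair.2 ⟨by rw [hJ.inner_right, h2, neg_zero], by rw [hJ.2, h1]⟩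
  have hJW' : ∀ w ∈ Wᗮ, J w ∈ Wᗮ := fun w hw => by
    rw [hWW] at hw ⊢
    obtain ⟨s, t, rfl⟩ := Submodule.mem_span_pair.1 hw
    refine Submodule.mem_span_pair.2 ⟨-t, s, ?_⟩
    rw [map_add, map_smul, map_smul, hJ.apply_apply, smul_neg, neg_smul, add_comm]
  have hgW : ∀ x, ∀ w ∈ Wᗮ, g x w = l x • w := fun x w hw => by
    rw [hWW] at hw
    obtain ⟨s, t, rfl⟩ := Submodule.mem_span_pair.1 hw
    rw [map_add, map_smul, map_smul, hge, hgJe, smul_add, smul_comm, smul_comm t]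
  set P : V →L[ℝ] V := W.starProjection with hP
  have hP1 : ∀ w ∈ W, P w = w := fun w hw => W.starProjection_eq_self_iff.2 hw
  have hP0 : ∀ w ∈ Wᗮ, P w = 0 := fun w hw => (W.starProjection_apply_eq_zero_iff).2 hw
  have hPm : ∀ v, P v ∈ W := fun v => W.starProjection_apply_mem v
  have hPJ : P * J = J * P := clm_ext_of_orthogonal (W := W)
    (fun w hw => by rw [clm_mul_apply, clm_mul_apply, hP1 w hw, hP1 _ (hJW w hw)])
    (fun w hw => by rw [clm_mul_apply, clm_mul_apply, hP0 w hw, hP0 _ (hJW' w hw), map_zero])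
  let F : ℝ → USph A → V →L[ℝ] V := fun t x =>
    ((1 - t) * l x + t) • (1 - P) + (1 - t) • ((1 - P) * (g x * P)) + P * (g x * P)
  have hFW : ∀ t x, ∀ w ∈ W, F t x w = (1 - t) • (g x w - P (g x w)) + P (g x w) := by
    intro t x w hw
    simp [F, hP1 w hw]
  have hFW' : ∀ t x, ∀ w ∈ Wᗮ, F t x w = ((1 - t) * l x + t) • w := by
    intro t x w hw
    simp [F, hP0 w hw]
  have hFJ : ∀ t x, F t x * J = J * F t x := fun t x => by
    have h1 : (1 - P) * J = J * (1 - P) := by rw [sub_mul, mul_sub, hPJ]; simp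
    have h2 : g x * P * J = J * (g x * P) := by rw [mul_assoc, hPJ, ← mul_assoc, hgJ, mul_assoc]
    simp only [F, add_mul, mul_add, smul_mul_assoc, mul_smul_comm]
    rw [h1, mul_assoc, h2, ← mul_assoc (1 - P), h1, mul_assoc, mul_assoc P, h2, ← mul_assoc P J,
      hPJ, mul_assoc J P]
  have hFu : ∀ t ∈ unitInterval, ∀ x, IsUnit (F t x) := fun t ht x => by
    refine isUnit_of_forall_eq_zero fun v hv => ?_
    obtain ⟨w, hw, z, hz, rfl⟩ := W.exists_add_mem_mem_orthogonal v
    have hlp : 0 < (1 - t) * l x + t := by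
      rcases ht.1.eq_or_lt with h0 | h0
      · rw [← h0]; simpa using hl0 x
      · have := mul_nonneg (sub_nonneg.2 ht.2) (hl0 x).le
        linarith
    rw [map_add, hFW t x w hw, hFW' t x z hz] at hv
    have h1 := congrArg P hv
    simp only [map_add, map_smul, map_sub, map_zero, hP1 _ (hPm _), hP0 z hz, sub_self, smul_zero,
      zero_add, add_zero] at h1
    have h2 : g x w ∈ Wᗮ := (W.starProjection_apply_eq_zero_iff).1 h1
    have h3 : w = (l x)⁻¹ • g x w := by
      have h4 : g x (w - (l x)⁻¹ • g x w) = 0 := by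
        rw [map_sub, map_smul, hgW x _ h2, smul_smul, inv_mul_cancel₀ (hl0 x).ne', one_smul,
          sub_self]
      exact sub_eq_zero.1 (eq_zero_of_units_apply (g := (h₁ x : (V →L[ℝ] V)ˣ)) h4)
    have h4 : w = 0 := by
      have h5 : w ∈ Wᗮ := by rw [h3]; exact Wᗮ.smul_mem _ h2
      rw [← hP1 w hw, hP0 w h5]
    rw [h4] at hv ⊢
    simpa [hlp.ne'] using hv
  have hFc : Continuous fun p : unitInterval × USph A => F p.1 p.2 := by
    simp only [F]
    fun_prop
  have hF1W : ∀ x, ∀ w ∈ W, F 1 x w ∈ W := fun x w hw => by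
    rw [hFW 1 x w hw, sub_self, zero_smul, zero_add]; exact hPm _
  have hF1W' : ∀ x, ∀ w ∈ Wᗮ, F 1 x w = w := fun x w hw => by simp [hFW' 1 x w hw]
  have hF1u : ∀ x, IsUnit (F 1 x) := hFu 1 ⟨zero_le_one, le_rfl⟩
  have hF1cu : ∀ x, IsUnit (compr W (F 1 x)) := fun x => by
    rw [← val_unitOf (hF1u x)]
    exact isUnit_compr (by rw [val_unitOf (hF1u x)]; exact hF1W x)
  have hF1c : Continuous (F 1) :=
    hFc.comp (f := fun x => ((1 : unitInterval), x)) (by fun_prop)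
  let h₂ : C(USph A, cenS (compr W J)) := ⟨fun x => ⟨unitOf (compr W (F 1 x)), mem_cenS.2 (by
    rw [val_unitOf (hF1cu x), ← compr_mul hJW, hFJ, compr_mul (hF1W x)])⟩,
    Continuous.subtype_mk (continuous_unitOf_comp ((compr W).continuous.comp hF1c) hF1cu) _⟩
  have hlt : Module.finrank ℝ W < k := by
    rw [← hk]
    refine Submodule.finrank_lt fun htop => ?_
    have : (e : V) ∈ W := htop ▸ Submodule.mem_top
    have h1 := (mem_orthogonal_pair.1 this).1
    rw [e.inner_self] at h1
    exact one_ne_zero h1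
  obtain ⟨u, hu⟩ := ih _ hlt W rfl (compr W J) (hJ.compr hJW) h₂
  refine ⟨extCen hJW hJW' u, hh₁.trans ?_⟩
  have h3 : h₁.Homotopic ((extCen hJW hJW').comp h₂) :=
    homotopic_cenS (fun p => F p.1 p.2) hFc (fun p => hFu _ p.1.2 _) (fun p => hFJ _ _)
      (fun x => by
        refine clm_ext_of_orthogonal (W := W) (fun w hw => ?_) fun w hw => ?_
        · rw [hFW _ _ w hw]; simp [g]
        · rw [hFW' _ _ w hw]; simpa using (hgW x w hw).symm)
      (fun x => by
        rw [ContinuousMap.comp_apply, coe_extCen]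
        change F 1 x = extHom W (unitOf (compr W (F 1 x)) : W →L[ℝ] W)
        rw [val_unitOf (hF1cu x), extHom_compr (hF1W x) (hF1W' x)])
  refine h3.trans ?_
  simpa using (ContinuousMap.Homotopic.refl (extCen hJW hJW')).comp hu

end TwoSphereUnits

section Suspension

open unitInterval

theorem continuous_smul_dirTo {X A B : Type*} [TopologicalSpace X] [NormedAddCommGroup A]
    [InnerProductSpace ℝ A] [NormedAddCommGroup B] [NormedSpace ℝ B] {f : X × USph A → B}
    (hf : Continuous f) {C : ℝ} (hC : ∀ p, ‖f p‖ ≤ C) (N : USph A) {c : X → ℝ} (hc : Continuous c)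
    {v : X → A} (hv : Continuous v) (h0 : ∀ x, v x = 0 → c x = 0) :
    Continuous fun x => c x • f (x, dirTo N (v x)) := by
  refine continuous_iff_continuousAt.2 fun x => ?_
  rcases eq_or_ne (v x) 0 with hx | hx
  · rw [ContinuousAt, h0 x hx, zero_smul]
    refine squeeze_zero_norm (a := fun x => ‖c x‖ * C) (fun y => ?_) ?_
    · rw [norm_smul]
      exact mul_le_mul_of_nonneg_left (hC _) (norm_nonneg _)
    · have : Continuous fun x => ‖c x‖ * C := by fun_prop
      simpa [h0 x hx] using this.tendsto x
  · have h1 : ContinuousAt (fun x => dirTo N (v x)) x :=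
      ((continuousOn_dirTo N).continuousAt (isOpen_compl_singleton.mem_nhds hx)).comp
        hv.continuousAt
    exact hc.continuousAt.smul
      (ContinuousAt.comp (g := f) hf.continuousAt (continuousAt_id.prodMk h1))

variable {A B : Type*} [NormedAddCommGroup A] [InnerProductSpace ℝ A]
  [FiniteDimensional ℝ A] [NormedAddCommGroup B] [InnerProductSpace ℝ B] [FiniteDimensional ℝ B]

/-- The component of a vector orthogonal to the unit vector `N`. -/
noncomputable def wpart (N : USph A) : A →L[ℝ] perp N := (perp N).orthogonalProjectionOnto

theorem coe_wpart (N : USph A) (x : A) : (wpart N x : A) = x - inner ℝ (N : A) x • (N : A) := by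
  rw [wpart, Submodule.coe_orthogonalProjectionOnto_apply,
    Submodule.starProjection_orthogonal_val, Submodule.starProjection_unit_singleton ℝ N.norm_eq]

theorem wpart_add_smul (N : USph A) (x : A) :
    (wpart N x : A) + inner ℝ (N : A) x • (N : A) = x := by
  rw [coe_wpart, sub_add_cancel]

theorem wpart_coe (N : USph A) (w : perp N) : wpart N (w : A) = w :=
  Subtype.ext (by rw [coe_wpart, inner_perp]; simp)

theorem wpart_self (N : USph A) : wpart N (N : A) = 0 :=
  Subtype.ext (by rw [coe_wpart, N.inner_self]; simp)

theorem norm_wpart_sq (N : USph A) (x : USph A) :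
    ‖wpart N x‖ ^ 2 + inner ℝ (N : A) (x : A) ^ 2 = 1 := by
  rw [← norm_add_smul_sq, wpart_add_smul, x.norm_eq, one_pow]

theorem smul_add_smul_ne_zero {y N : USph B} {c t : ℝ} (hc : 0 ≤ c) (h0 : c = 0 → t ≠ 0)
    (hp : c ≠ 0 → 0 < t → y ≠ -N) (hn : c ≠ 0 → t < 0 → y ≠ N) :
    c • (y : B) + t • (N : B) ≠ 0 := by
  intro h
  have h1 : c • (y : B) = -(t • (N : B)) := eq_neg_of_add_eq_zero_left h
  have h2 := congrArg norm h1
  rw [norm_neg, norm_smul, norm_smul, y.norm_eq, N.norm_eq, mul_one, mul_one,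
    Real.norm_of_nonneg hc, Real.norm_eq_abs] at h2
  have ht : t ≠ 0 := fun ht => h0 (by rw [h2, ht, abs_zero]) ht
  have hc0 : c ≠ 0 := by rw [h2]; exact abs_ne_zero.2 ht
  rcases ht.lt_or_gt with h3 | h3
  · refine hn hc0 h3 (Subtype.ext ?_)
    rw [abs_of_neg h3] at h2
    rw [← neg_smul, ← h2] at h1
    exact smul_right_injective B hc0 h1
  · refine hp hc0 h3 (Subtype.ext ?_)
    rw [abs_of_pos h3] at h2
    rw [← h2, ← smul_neg] at h1
    exact smul_right_injective B hc0 h1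

variable {NA : USph A} (b₀ : USph (perp NA)) (N : USph B)

theorem norm_smul_add_smul (x : USph A) (y : USph (perp N)) :
    ‖‖wpart NA x‖ • ((y : perp N) : B) + inner ℝ (NA : A) (x : A) • (N : B)‖ = 1 := by
  have h := norm_add_smul_sq (‖wpart NA x‖ • (y : perp N)) (inner ℝ (NA : A) (x : A))
  rw [norm_smul, norm_norm, y.norm_eq, mul_one, norm_wpart_sq] at h
  exact (pow_eq_one_iff_of_nonneg (norm_nonneg _) two_ne_zero).1 h

theorem continuous_susp_aux {X : Type*} [TopologicalSpace X]
    {f : X × USph A → B} {g : X × USph (perp NA) → B} (hg : Continuous g) {C : ℝ}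
    (hC : ∀ p, ‖g p‖ ≤ C)
    (hf : ∀ p, f p = ‖wpart NA p.2‖ • g (p.1, dirTo b₀ (wpart NA p.2)) +
      inner ℝ (NA : A) (p.2 : A) • (N : B)) : Continuous f := by
  rw [funext hf]
  refine Continuous.add ?_ (by fun_prop)
  exact continuous_smul_dirTo (X := X × USph A) (f := fun q => g (q.1.1, q.2)) (by fun_prop)
    (fun p => hC _) b₀ (c := fun p => ‖wpart NA p.2‖) (v := fun p => wpart NA p.2) (by fun_prop)
    (by fun_prop) fun p hp => by rw [hp, norm_zero]

/-- The suspension of a map between unit spheres. -/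
noncomputable def susp (Y : C(USph (perp NA), USph (perp N))) : C(USph A, USph B) where
  toFun x := USph.mk (‖wpart NA x‖ • ((Y (dirTo b₀ (wpart NA x)) : perp N) : B) +
    inner ℝ (NA : A) (x : A) • (N : B)) (norm_smul_add_smul N x _)
  continuous_toFun := by
    refine Continuous.subtype_mk ?_ _
    have h := continuous_susp_aux (X := Unit) b₀ N (C := 1)
      (g := fun p => ((Y p.2 : perp N) : B)) (by fun_prop)
      (fun p => (USph.norm_eq (V := perp N) _).le) (fun p => rfl)
    exact h.comp (f := fun x => ((), x)) (by fun_prop)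

theorem coe_susp (Y : C(USph (perp NA), USph (perp N))) (x : USph A) :
    (susp b₀ N Y x : B) = ‖wpart NA x‖ • ((Y (dirTo b₀ (wpart NA x)) : perp N) : B) +
      inner ℝ (NA : A) (x : A) • (N : B) := rfl

theorem homotopic_susp {Y Y' : C(USph (perp NA), USph (perp N))} (h : Y.Homotopic Y') :
    (susp b₀ N Y).Homotopic (susp b₀ N Y') := by
  obtain ⟨H⟩ := h
  refine ⟨⟨⟨fun p => USph.mk (‖wpart NA p.2‖ • ((H (p.1, dirTo b₀ (wpart NA p.2)) : perp N) : B) +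
    inner ℝ (NA : A) (p.2 : A) • (N : B)) (norm_smul_add_smul N p.2 _),
    Continuous.subtype_mk ?_ _⟩, fun x => Subtype.ext ?_, fun x => Subtype.ext ?_⟩⟩
  · exact continuous_susp_aux (X := I) b₀ N (C := 1)
      (g := fun p => ((H p : perp N) : B)) (by fun_prop)
      (fun p => (USph.norm_eq (V := perp N) _).le) (fun p => rfl)
  · simp [coe_susp]
  · simp [coe_susp]

theorem exists_homotopic_susp_of_ne (Y : C(USph A, USph B))
    (hp : ∀ x : USph A, 0 ≤ inner ℝ (NA : A) (x : A) → Y x ≠ -N)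
    (hn : ∀ x : USph A, inner ℝ (NA : A) (x : A) ≤ 0 → Y x ≠ N) :
    ∃ Y' : C(USph (perp NA), USph (perp N)), Y.Homotopic (susp b₀ N Y') := by
  let E : C(USph (perp NA), USph A) := ⟨fun b => USph.mk ((b : perp NA) : A) b.norm_eq,
    Continuous.subtype_mk (by fun_prop) _⟩
  have hE : ∀ b, inner ℝ (NA : A) (E b : A) = 0 := fun b => inner_perp _
  have hw0 : ∀ b, wpart N (Y (E b) : B) ≠ 0 := fun b hb => by
    have h1 := wpart_add_smul N (Y (E b) : B)
    have h2 := norm_wpart_sq N (Y (E b))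
    rw [hb] at h1 h2
    rw [norm_zero, zero_pow two_ne_zero, zero_add, sq, mul_self_eq_one_iff] at h2
    rcases h2 with h2 | h2
    · rw [h2, one_smul, Submodule.coe_zero, zero_add] at h1
      exact hn _ (hE b).le (Subtype.ext h1.symm)
    · rw [h2, neg_one_smul, Submodule.coe_zero, zero_add] at h1
      exact hp _ (hE b).ge (Subtype.ext h1.symm)
  obtain ⟨b₁⟩ : Nonempty (USph (perp N)) := ⟨USph.mk (‖wpart N (Y (E b₀) : B)‖⁻¹ • wpart N (Y (E b₀)))
    (by rw [norm_smul, norm_inv, norm_norm, inv_mul_cancel₀ (norm_ne_zero_iff.2 (hw0 b₀))])⟩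
  let Y' : C(USph (perp NA), USph (perp N)) := ⟨fun b => dirTo b₁ (wpart N (Y (E b) : B)),
    continuous_dirTo_comp b₁ (by fun_prop) hw0⟩
  have hbn : ∀ b : USph B, ‖(b : B)‖ ≤ 1 := fun b => b.norm_eq.le
  have htw : ∀ x : USph A, ‖wpart NA x‖ = 0 → inner ℝ (NA : A) (x : A) ≠ 0 := fun x h0 h1 => by
    have := norm_wpart_sq NA x
    rw [h0, h1] at this
    norm_num at this
  have hF₂n : ∀ (τ : I) (x : USph A), ‖wpart NA x‖ • (Y (dirTo NA
      ((wpart NA x : A) + (1 - (τ : ℝ)) • inner ℝ (NA : A) (x : A) • (NA : A))) : B) +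
      inner ℝ (NA : A) (x : A) • (N : B) ≠ 0 := fun τ x => by
    have hne : ‖wpart NA x‖ ≠ 0 → (wpart NA x : A) +
        (1 - (τ : ℝ)) • inner ℝ (NA : A) (x : A) • (NA : A) ≠ 0 := fun h h0 => by
      have := congrArg (wpart NA) h0
      rw [map_add, map_smul, map_smul, wpart_self, wpart_coe, map_zero, smul_zero, smul_zero,
        add_zero] at this
      exact h (by rw [this, norm_zero])
    have hin : ‖wpart NA x‖ ≠ 0 → ∃ c : ℝ, 0 ≤ c ∧ inner ℝ (NA : A) (dirTo NA ((wpart NA x : A) +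
        (1 - (τ : ℝ)) • inner ℝ (NA : A) (x : A) • (NA : A)) : A) = c * inner ℝ (NA : A) (x : A) := by
      intro h
      rw [coe_dirTo _ (hne h), real_inner_smul_right, inner_add_right, inner_perp,
        real_inner_smul_right, real_inner_smul_right, NA.inner_self, zero_add, mul_one, ← mul_assoc]
      exact ⟨_, mul_nonneg (inv_nonneg.2 (norm_nonneg _)) (sub_nonneg.2 τ.2.2), rfl⟩
    refine smul_add_smul_ne_zero (norm_nonneg _) (htw x) (fun h h1 => hp _ ?_) (fun h h1 => hn _ ?_)
    · obtain ⟨c, hc, he⟩ := hin h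
      rw [he]; exact mul_nonneg hc h1.le
    · obtain ⟨c, hc, he⟩ := hin h
      rw [he]; exact mul_nonpos_of_nonneg_of_nonpos hc h1.le
  let F₁ : I × USph A → B := fun p => (1 - (p.1 : ℝ) + p.1 * ‖wpart NA p.2‖) • (Y p.2 : B) +
    ((p.1 : ℝ) * inner ℝ (NA : A) (p.2 : A)) • (N : B)
  let F₂ : I × USph A → B := fun p => ‖wpart NA p.2‖ • (Y (dirTo NA
    ((wpart NA p.2 : A) + (1 - (p.1 : ℝ)) • inner ℝ (NA : A) (p.2 : A) • (NA : A))) : B) +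
      inner ℝ (NA : A) (p.2 : A) • (N : B)
  let F₃ : I × USph A → B := fun p => ‖wpart NA p.2‖ •
    ((1 - (p.1 : ℝ)) • (Y (E (dirTo b₀ (wpart NA p.2))) : B) +
      (p.1 : ℝ) • ((Y' (dirTo b₀ (wpart NA p.2)) : perp N) : B)) +
      inner ℝ (NA : A) (p.2 : A) • (N : B)
  have hF₁c : Continuous F₁ := by fun_prop
  have hF₂c : Continuous F₂ := by
    refine Continuous.add ?_ (by fun_prop)
    refine continuous_smul_dirTo (X := I × USph A) (f := fun q => (Y q.2 : B)) (by fun_prop)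
      (fun p => hbn _) NA (by fun_prop) (by fun_prop) fun p hp => ?_
    have := congrArg (wpart NA) hp
    rw [map_add, map_smul, map_smul, wpart_self, wpart_coe, map_zero, smul_zero, smul_zero,
        add_zero] at this
    rw [this, norm_zero]
  have hF₃c : Continuous F₃ := continuous_susp_aux (X := I) b₀ N (C := 2)
    (g := fun p => (1 - (p.1 : ℝ)) • (Y (E p.2) : B) + (p.1 : ℝ) • ((Y' p.2 : perp N) : B))
    (by fun_prop) (fun p => by
      refine (norm_add_le _ _).trans ?_
      rw [norm_smul, norm_smul, USph.norm_eq, Submodule.norm_coe, USph.norm_eq,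
        Real.norm_of_nonneg (sub_nonneg.2 p.1.2.2), Real.norm_of_nonneg p.1.2.1]
      linarith) fun p => rfl
  have hF₁n : ∀ p, F₁ p ≠ 0 := fun p => by
    have h1 := p.1.2.1
    have h2 := p.1.2.2
    have h3 := norm_nonneg (wpart NA (p.2 : A))
    refine smul_add_smul_ne_zero (add_nonneg (sub_nonneg.2 h2) (mul_nonneg h1 h3)) (fun h h' => ?_)
      (fun _ h => hp _ (pos_of_mul_pos_right h h1).le) (fun _ h => hn _ (neg_of_mul_neg_right h h1).le)
    have h4 := mul_nonneg h1 h3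
    have h5 : (p.1 : ℝ) = 1 := by linarith
    rw [h5, one_mul] at h' h4 h
    exact htw _ (by linarith) h'
  have hF₃n : ∀ p, F₃ p ≠ 0 := fun p h => by
    rcases eq_or_ne ‖wpart NA (p.2 : A)‖ 0 with h0 | h0
    · simp only [F₃] at h
      rw [h0, zero_smul, zero_add, smul_eq_zero] at h
      exact h.elim (htw _ h0) N.ne_zero
    · have h1 := congrArg (wpart N) h
      simp only [F₃, Y', ContinuousMap.coe_mk, map_add, map_smul, wpart_self, wpart_coe, map_zero,
        smul_zero, add_zero, smul_eq_zero, h0, false_or] at h1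
      rw [coe_dirTo _ (hw0 _), smul_smul, ← add_smul, smul_eq_zero] at h1
      refine h1.elim (fun h2 => ?_) (hw0 _)
      have h3 : 0 < ‖wpart N (Y (E (dirTo b₀ (wpart NA (p.2 : A)))) : B)‖⁻¹ :=
        inv_pos.2 (norm_pos_iff.2 (hw0 _))
      rcases p.1.2.1.eq_or_lt with h4 | h4
      · rw [← h4] at h2; norm_num at h2
      · have := mul_pos h4 h3
        linarith [p.1.2.2]
  have hF12 : ∀ x, F₁ (1, x) = F₂ (0, x) := fun x => by
    simp only [F₁, F₂, Set.Icc.coe_one, Set.Icc.coe_zero, sub_zero, one_smul, wpart_add_smul,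
      dirTo_coe, sub_self, zero_add, one_mul]
  have hF23 : ∀ x, F₂ (1, x) = F₃ (0, x) := fun x => by
    simp only [F₃, F₂, Set.Icc.coe_one, Set.Icc.coe_zero, sub_zero, one_smul, sub_self, zero_smul,
      add_zero]
    rcases eq_or_ne (wpart NA (x : A)) 0 with h0 | h0
    · rw [h0, norm_zero, zero_smul, zero_smul]
    · congr 4
      refine Subtype.ext ?_
      rw [coe_dirTo _ (fun h => h0 (Subtype.ext h))]
      change _ = ((dirTo b₀ (wpart NA (x : A)) : perp NA) : A)
      rw [coe_dirTo _ h0]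
      rfl
  refine ⟨Y', ?_⟩
  have e₁ : Y.Homotopic ⟨fun x => dirTo N (F₂ (0, x)), continuous_dirTo_comp N (by fun_prop)
      fun x => hF₂n 0 x⟩ :=
    homotopic_dirTo F₁ hF₁c hF₁n (fun x => by simp [F₁, dirTo_coe]) fun x => by
      rw [hF12]; rfl
  have e₂ : ContinuousMap.Homotopic (⟨fun x => dirTo N (F₂ (0, x)), continuous_dirTo_comp N
      (by fun_prop) fun x => hF₂n 0 x⟩ : C(USph A, USph B)) ⟨fun x => dirTo N (F₃ (0, x)),
        continuous_dirTo_comp N (by fun_prop) fun x => hF₃n _⟩ :=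
    homotopic_dirTo F₂ hF₂c (fun p => hF₂n p.1 p.2) (fun x => rfl) fun x => by
      rw [hF23]; rfl
  refine e₁.trans (e₂.trans (homotopic_dirTo F₃ hF₃c hF₃n (fun x => rfl) fun x => ?_))
  rw [← dirTo_coe N (susp b₀ N Y' x), coe_susp]
  simp [F₃]

end Suspension

section GeneralPosition

open unitInterval

variable {A B : Type*} [NormedAddCommGroup A] [InnerProductSpace ℝ A]
  [FiniteDimensional ℝ A] [NormedAddCommGroup B] [InnerProductSpace ℝ B] [FiniteDimensional ℝ B]

theorem infinite_sphere (h : 2 ≤ Module.finrank ℝ B) : Infinite (USph B) := by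
  have := preconnectedSpace_sphere h
  have : Nontrivial B := Module.nontrivial_of_finrank_pos (R := ℝ) (by omega)
  obtain ⟨x, hx⟩ := exists_norm_eq B zero_le_one
  have : Nontrivial (USph B) := ⟨⟨USph.mk x hx, -USph.mk x hx, fun h => by
    have h1 := congrArg (Subtype.val) h
    simp only [USph.coe_neg, USph.coe_mk] at h1
    rw [eq_neg_iff_add_eq_zero, ← two_smul ℝ, smul_eq_zero] at h1
    have : x = 0 := h1.resolve_left two_ne_zero
    rw [this, norm_zero] at hx
    exact zero_ne_one hx⟩⟩
  exact PreconnectedSpace.infinite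

theorem wpart_ne_zero {N x : USph A} (h1 : x ≠ N) (h2 : x ≠ -N) : wpart N (x : A) ≠ 0 := by
  intro h
  have h3 := wpart_add_smul N (x : A)
  have h4 := norm_wpart_sq N x
  rw [h, norm_zero, zero_pow two_ne_zero, zero_add, sq, mul_self_eq_one_iff] at h4
  rw [h, Submodule.coe_zero, zero_add] at h3
  rcases h4 with h4 | h4
  · rw [h4, one_smul] at h3
    exact h1 (Subtype.ext h3.symm)
  · rw [h4, neg_one_smul] at h3
    exact h2 (Subtype.ext h3.symm)

open Classical in
theorem exists_general_position {k : ℕ} (hk : 3 ≤ k) (hA : Module.finrank ℝ A = k + 2)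
    (hB : Module.finrank ℝ B = k + 1) (Y : C(USph A, USph B)) (N : USph A) :
    ∃ Z : C(USph A, USph B), Y.Homotopic Z ∧ ∃ p q : USph B, p ≠ q ∧
      (∀ x, Z x = p ∨ Z x = q → wpart N (x : A) ≠ 0) ∧
      ∀ x y : USph A, Z x = p → Z y = q → ∀ c : ℝ, 0 < c →
        wpart N (y : A) ≠ c • wpart N (x : A) := by
  obtain ⟨F, hF, hFY⟩ := exists_contDiff_sphere_approx
    (⟨fun x => (Y x : B), by fun_prop⟩ : C(USph A, B)) (one_half_pos (α := ℝ))
  simp only [ContinuousMap.coe_mk] at hFY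
  have hF0 : ∀ x : USph A, F x ≠ 0 := fun x h => by
    have := hFY x
    rw [h, zero_sub, norm_neg, USph.norm_eq] at this
    norm_num at this
  have hFc : Continuous F := hF.continuous
  let Z : C(USph A, USph B) := ⟨fun x => dirTo (Y N) (F x),
    continuous_dirTo_comp _ (by fun_prop) hF0⟩
  have hYZ : Y.Homotopic Z := by
    refine homotopic_dirTo (N := Y N) (fun p => (Y p.2 : B) + (p.1 : ℝ) • (F p.2 - Y p.2))
      (by fun_prop) (fun p h => ?_) (fun x => by simp [dirTo_coe]) fun x => by simp [Z]
    have h1 := congrArg norm (eq_neg_of_add_eq_zero_left h)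
    rw [USph.norm_eq, norm_neg, norm_smul, Real.norm_of_nonneg p.1.2.1] at h1
    have h2 := hFY p.2
    have h3 := p.1.2.2
    nlinarith [norm_nonneg (F p.2 - Y p.2)]
  refine ⟨Z, hYZ, ?_⟩
  let T : A → B := fun x => ‖x‖ • F (‖x‖⁻¹ • x)
  have hT : ∀ (x : USph A) (c : ℝ), 0 < c → T (c • (x : A)) = c • F x := fun x c hc => by
    simp only [T]
    rw [norm_smul, x.norm_eq, mul_one, Real.norm_of_nonneg hc.le, smul_smul, inv_mul_cancel₀ hc.ne',
      one_smul]
  have hZF : ∀ x : USph A, F x = ‖F x‖ • (Z x : B) := fun x => (norm_smul_dirTo _ _).symm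
  let Φ : perp N × ℝ × ℝ × ℝ → B × B := fun v =>
    (T ((v.1 : A) + v.2.1 • (N : A)), v.2.2.2 • T ((v.1 : A) + v.2.2.1 • (N : A)))
  have hdense : Dense (Φ '' {v | v.1 ≠ 0})ᶜ := by
    refine dense_compl_image_of_contDiffAt (fun v hv => ?_) ?_
    · have hne : ∀ s : ℝ, (v.1 : A) + s • (N : A) ≠ 0 := fun s h => by
        have := congrArg (wpart N) h
        rw [map_add, map_smul, wpart_self, wpart_coe, smul_zero, add_zero, map_zero] at this
        exact hv this
      have h1 : ContDiff ℝ 1 fun v : perp N × ℝ × ℝ × ℝ => (v.1 : A) :=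
        (perp N).subtypeL.contDiff.comp contDiff_fst
      refine ContDiffAt.prodMk ?_ (ContDiffAt.smul (by fun_prop) ?_)
      · exact ContDiffAt.comp (f := fun v : perp N × ℝ × ℝ × ℝ => (v.1 : A) + v.2.1 • (N : A)) v
          (contDiffAt_normed_smul hF (hne v.2.1)) (ContDiff.contDiffAt (by fun_prop))
      · exact ContDiffAt.comp (f := fun v : perp N × ℝ × ℝ × ℝ => (v.1 : A) + v.2.2.1 • (N : A)) v
          (contDiffAt_normed_smul hF (hne v.2.2.1)) (ContDiff.contDiffAt (by fun_prop))
    · have := finrank_perp N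
      simp only [Module.finrank_prod, Module.finrank_self]
      omega
  have := infinite_sphere (B := B) (by omega)
  obtain ⟨p₀, hp₀⟩ := Infinite.exists_notMem_finset ({Z N, Z (-N)} : Finset (USph B))
  obtain ⟨q₀, hq₀⟩ := Infinite.exists_notMem_finset ({Z N, Z (-N), p₀} : Finset (USph B))
  simp only [Finset.mem_insert, Finset.mem_singleton, not_or] at hp₀ hq₀
  have hc : ∀ p : USph B, Filter.Tendsto (dirTo p₀) (𝓝 (p : B)) (𝓝 p) := fun p => by
    have := ((continuousOn_dirTo p₀).continuousAt (isOpen_compl_singleton.mem_nhds p.ne_zero)).tendsto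
    rwa [dirTo_coe] at this
  have hc1 := Filter.Tendsto.comp (hc p₀)
    (continuous_fst.tendsto ((p₀ : B), (q₀ : B)))
  have hc2 := Filter.Tendsto.comp (hc q₀)
    (continuous_snd.tendsto ((p₀ : B), (q₀ : B)))
  have hev : ∀ᶠ v : B × B in 𝓝 ((p₀ : B), (q₀ : B)), (v.1 ≠ 0 ∧ v.2 ≠ 0) ∧
      (dirTo p₀ v.1 ≠ Z N ∧ dirTo p₀ v.1 ≠ Z (-N)) ∧ (dirTo p₀ v.2 ≠ Z N ∧ dirTo p₀ v.2 ≠ Z (-N)) ∧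
      dirTo p₀ v.1 ≠ dirTo p₀ v.2 :=
    ((continuousAt_fst.eventually_ne p₀.ne_zero).and (continuousAt_snd.eventually_ne q₀.ne_zero)).and
      (((hc1.eventually_ne hp₀.1).and (hc1.eventually_ne hp₀.2)).and
        (((hc2.eventually_ne hq₀.1).and (hc2.eventually_ne hq₀.2.1)).and
          ((hc1.prodMk_nhds hc2).eventually
            ((isOpen_ne_fun continuous_fst continuous_snd).mem_nhds (Ne.symm hq₀.2.2)))))
  obtain ⟨⟨p, q⟩, hpq, ⟨hp, hq⟩, ⟨hp1, hp2⟩, ⟨hq1, hq2⟩, hne⟩ :=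
    ((mem_closure_iff_frequently.1 (hdense _)).and_eventually hev).exists
  have hw : ∀ x, Z x = dirTo p₀ p ∨ Z x = dirTo p₀ q → wpart N (x : A) ≠ 0 := fun x hx =>
    wpart_ne_zero (fun h => by subst h; rcases hx with hx | hx; exacts [hp1 hx.symm, hq1 hx.symm])
      (fun h => by subst h; rcases hx with hx | hx; exacts [hp2 hx.symm, hq2 hx.symm])
  refine ⟨dirTo p₀ p, dirTo p₀ q, hne, hw, fun x y hx hy c hc0 hxy => hpq ?_⟩
  have hFx : 0 < ‖F x‖ := norm_pos_iff.2 (hF0 x)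
  have hFy : 0 < ‖F y‖ := norm_pos_iff.2 (hF0 y)
  have hp' : 0 < ‖p‖ := norm_pos_iff.2 hp
  have hq' : 0 < ‖q‖ := norm_pos_iff.2 hq
  set l := ‖p‖ / ‖F x‖ with hl
  have hl0 : 0 < l := div_pos hp' hFx
  have hκ : 0 < l / c := div_pos hl0 hc0
  refine ⟨(l • wpart N (x : A), l * inner ℝ (N : A) (x : A),
    l / c * inner ℝ (N : A) (y : A), ‖q‖ / (l / c * ‖F y‖)), smul_ne_zero hl0.ne' (hw x (.inl hx)), ?_⟩
  have e1 : ((l • wpart N (x : A) : perp N) : A) + (l * inner ℝ (N : A) (x : A)) • (N : A) =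
      l • (x : A) := by
    rw [Submodule.coe_smul, mul_smul, ← smul_add, wpart_add_smul]
  have e2 : ((l • wpart N (x : A) : perp N) : A) + (l / c * inner ℝ (N : A) (y : A)) • (N : A) =
      (l / c) • (y : A) := by
    conv_rhs => rw [← wpart_add_smul N (y : A), hxy]
    rw [smul_add, Submodule.coe_smul, Submodule.coe_smul, smul_smul, smul_smul,
      div_mul_cancel₀ _ hc0.ne']
  refine Prod.ext ?_ ?_
  · simp only [Φ]
    rw [e1, hT x l hl0, hZF x, hx, smul_smul, hl, div_mul_cancel₀ _ hFx.ne', norm_smul_dirTo]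
  · simp only [Φ]
    have e3 := hZF y
    rw [hy] at e3
    generalize ‖F y‖ = r at e3 hFy ⊢
    rw [e2, hT y _ hκ, e3, smul_smul, smul_smul, mul_assoc,
      div_mul_cancel₀ _ (mul_pos hκ hFy).ne', norm_smul_dirTo]

end GeneralPosition

section Slide

open unitInterval

variable {A B : Type*} [NormedAddCommGroup A] [InnerProductSpace ℝ A]
  [FiniteDimensional ℝ A] [NormedAddCommGroup B] [InnerProductSpace ℝ B] [FiniteDimensional ℝ B]

theorem exists_slide {N : USph A} (b₀ : USph (perp N)) (Z : C(USph A, USph B)) {p q : USph B}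
    (hw : ∀ x : USph A, Z x = p ∨ Z x = q → wpart N (x : A) ≠ 0)
    (hpq : ∀ x y : USph A, Z x = p → Z y = q → ∀ c : ℝ, 0 < c →
        wpart N (y : A) ≠ c • wpart N (x : A)) :
    ∃ Z' : C(USph A, USph B), Z.Homotopic Z' ∧
      (∀ x : USph A, Z' x = p → 0 < inner ℝ (N : A) (x : A)) ∧
      ∀ x : USph A, Z' x = q → inner ℝ (N : A) (x : A) < 0 := by
  let ω : USph A → USph (perp N) := fun x => dirTo b₀ (wpart N (x : A))
  have hK : ∀ r, IsCompact (Z ⁻¹' {r}) := fun r =>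
    (isClosed_singleton.preimage Z.continuous).isCompact
  have hω : ∀ r, (r = p ∨ r = q) → ContinuousOn ω (Z ⁻¹' {r}) := fun r hr =>
    (continuousOn_dirTo b₀).comp (by fun_prop : Continuous fun x : USph A => wpart N (x : A)).continuousOn
      fun x hx => hw x (by rcases hr with rfl | rfl; exacts [.inl hx, .inr hx])
  have hdisj : Disjoint (ω '' (Z ⁻¹' {q})) (ω '' (Z ⁻¹' {p})) := by
    rw [Set.disjoint_left]
    rintro _ ⟨y, hy, rfl⟩ ⟨x, hx, hxy⟩
    refine hpq x y hx hy (‖wpart N (y : A)‖ * ‖wpart N (x : A)‖⁻¹) (mul_pos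
      (norm_pos_iff.2 (hw y (.inr hy))) (inv_pos.2 (norm_pos_iff.2 (hw x (.inl hx))))) ?_
    have h1 := congrArg Subtype.val hxy
    simp only [ω] at h1
    rw [coe_dirTo _ (hw x (.inl hx)), coe_dirTo _ (hw y (.inr hy))] at h1
    rw [mul_smul, h1, smul_smul, mul_inv_cancel₀ (norm_ne_zero_iff.2 (hw y (.inr hy))), one_smul]
  obtain ⟨f, hf0, hf1, hf01⟩ := exists_continuous_zero_one_of_isClosed
    ((hK q).image_of_continuousOn (hω q (.inr rfl))).isClosed
    ((hK p).image_of_continuousOn (hω p (.inl rfl))).isClosed hdisj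
  obtain ⟨C, hC⟩ := ((hK p).union (hK q)).exists_bound_of_continuousOn
    (f := fun x : USph A => inner ℝ (N : A) (x : A) / ‖wpart N (x : A)‖)
    (ContinuousOn.div₀ (by fun_prop) (by fun_prop) fun x hx => norm_ne_zero_iff.2 (hw x hx))
  have hcont : Continuous fun x : A => ‖wpart N x‖ • (2 * f (dirTo b₀ (wpart N x)) - 1) :=
    continuous_smul_dirTo (X := A) (f := fun q : A × USph (perp N) => 2 * f q.2 - 1) (C := 1)
      (by fun_prop) (fun p => by
        have := hf01 p.2
        rw [Real.norm_eq_abs, abs_le]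
        constructor <;> linarith [this.1, this.2]) b₀ (by fun_prop) (by fun_prop)
      fun x hx => by rw [hx, norm_zero]
  let F : I × USph A → A := fun v => (wpart N (v.2 : A) : A) + (inner ℝ (N : A) (v.2 : A) -
    v.1 * ((C + 1) * (‖wpart N (v.2 : A)‖ • (2 * f (dirTo b₀ (wpart N (v.2 : A))) - 1)))) • (N : A)
  have hFw : ∀ v, wpart N (F v) = wpart N (v.2 : A) := fun v => by
    simp only [F]
    rw [map_add, map_smul, wpart_self, wpart_coe, smul_zero, add_zero]
  have hFi : ∀ v, inner ℝ (N : A) (F v) = inner ℝ (N : A) (v.2 : A) -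
    v.1 * ((C + 1) * (‖wpart N (v.2 : A)‖ • (2 * f (dirTo b₀ (wpart N (v.2 : A))) - 1))) := fun v => by
    simp only [F]
    rw [inner_add_right, inner_perp, real_inner_smul_right, N.inner_self, zero_add, mul_one]
  have hF0 : ∀ v, F v ≠ 0 := fun v h => by
    have h1 := hFw v
    have h2 := hFi v
    have h3 := norm_wpart_sq N v.2
    rw [h, map_zero] at h1
    rw [h, ← h1, norm_zero, zero_smul, mul_zero, mul_zero, sub_zero, inner_zero_right] at h2
    rw [← h1, ← h2] at h3
    norm_num at h3
  have hFc : Continuous F := by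
    have := hcont.comp (f := fun v : I × USph A => (v.2 : A)) (by fun_prop)
    simp only [F]
    exact Continuous.add (by fun_prop) (((by fun_prop : Continuous fun v : I × USph A =>
      inner ℝ (N : A) (v.2 : A)).sub ((by fun_prop : Continuous fun v : I × USph A =>
        (v.1 : ℝ)).mul (continuous_const.mul this))).smul continuous_const)
  let Z' : C(USph A, USph B) := ⟨fun x => Z (dirTo N (F (1, x))),
    Z.continuous.comp (continuous_dirTo_comp N (by fun_prop) fun x => hF0 _)⟩
  have key : ∀ x, Z' x = p ∨ Z' x = q → 0 < ‖wpart N (x : A)‖ ∧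
      |inner ℝ (N : A) (x : A) - (C + 1) * (‖wpart N (x : A)‖ • (2 * f (ω x) - 1))| ≤
        C * ‖wpart N (x : A)‖ ∧ ω (dirTo N (F (1, x))) = ω x := fun x hx => by
    have h1 := hw _ hx
    rw [coe_dirTo N (hF0 _), map_smul, hFw] at h1
    have h2 := (smul_ne_zero_iff.1 h1).2
    have h3 := hC _ hx
    have h4 : 0 < ‖wpart N (x : A)‖ := norm_pos_iff.2 h2
    have h5 : 0 < ‖F (1, x)‖⁻¹ := inv_pos.2 (norm_pos_iff.2 (hF0 _))
    refine ⟨h4, ?_, ?_⟩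
    · rw [coe_dirTo N (hF0 _), map_smul, hFw, real_inner_smul_right, norm_smul,
        Real.norm_of_nonneg h5.le, mul_div_mul_left _ _ h5.ne', hFi, norm_div, norm_norm,
        div_le_iff₀ h4, Set.Icc.coe_one, one_mul] at h3
      exact h3
    · simp only [ω]
      rw [coe_dirTo N (hF0 _), map_smul, hFw, dirTo_smul _ h5]
  refine ⟨Z', ⟨⟨⟨fun v => Z (dirTo N (F v)), Z.continuous.comp (continuous_dirTo_comp N hFc hF0)⟩,
    fun x => ?_, fun x => rfl⟩⟩, fun x hx => ?_, fun x hx => ?_⟩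
  · simp [F, wpart_add_smul, dirTo_coe]
  · obtain ⟨h1, h2, h3⟩ := key x (.inl hx)
    have h4 : f (ω x) = 1 := hf1 ⟨_, hx, h3⟩
    rw [h4, smul_eq_mul] at h2
    nlinarith [(abs_le.1 h2).1]
  · obtain ⟨h1, h2, h3⟩ := key x (.inr hx)
    have h4 : f (ω x) = 0 := hf0 ⟨_, hx, h3⟩
    rw [h4, smul_eq_mul] at h2
    nlinarith [(abs_le.1 h2).2]

end Slide

section Desuspend

open unitInterval

variable {A B : Type*} [NormedAddCommGroup A] [InnerProductSpace ℝ A]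
  [FiniteDimensional ℝ A] [NormedAddCommGroup B] [InnerProductSpace ℝ B] [FiniteDimensional ℝ B]

theorem exists_homotopic_separating_poles {k : ℕ} (hk : 3 ≤ k) (hA : Module.finrank ℝ A = k + 2)
    (hB : Module.finrank ℝ B = k + 1) (Y : C(USph A, USph B)) (N : USph A) :
    ∃ Z : C(USph A, USph B), Y.Homotopic Z ∧ ∃ N' : USph B,
      (∀ x : USph A, Z x = N' → 0 < inner ℝ (N : A) (x : A)) ∧
      ∀ x : USph A, Z x = -N' → inner ℝ (N : A) (x : A) < 0 := by
  obtain ⟨b₀⟩ := nonempty_perp_sphere N (by omega)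
  obtain ⟨Z₀, hYZ, p, q, hpq, hw, hdir⟩ := exists_general_position hk hA hB Y N
  obtain ⟨Z, hZ, hp, hq⟩ := exists_slide b₀ Z₀ hw hdir
  have hpq' : (p : B) - q ≠ 0 := fun h => hpq (Subtype.ext (sub_eq_zero.1 h))
  set N' := dirTo p ((p : B) - q) with hN'
  set h : B := (1 / 2 : ℝ) • ((p : B) + q) with hh
  set r : ℝ := ‖(p : B) - q‖ / 2 with hr
  have hr0 : 0 < r := half_pos (norm_pos_iff.2 hpq')
  have hrN : r • (N' : B) = (1 / 2 : ℝ) • ((p : B) - q) := by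
    rw [hN', coe_dirTo _ hpq', smul_smul, hr]
    congr 1
    field_simp
  have hep : (p : B) = h + r • (N' : B) := by
    rw [hrN, hh]; module
  have heq : (q : B) = h - r • (N' : B) := by
    rw [hrN, hh]; module
  have horth : inner ℝ h (N' : B) = 0 := by
    rw [hN', coe_dirTo _ hpq', hh, real_inner_smul_right, real_inner_smul_left,
      (real_inner_add_sub_eq_zero_iff (p : B) q).2 (by rw [p.norm_eq, q.norm_eq]), mul_zero, mul_zero]
  have hsq : ∀ s : ℝ, ‖h + s • (N' : B)‖ ^ 2 = ‖h‖ ^ 2 + s ^ 2 := fun s => by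
    rw [norm_add_sq_real, real_inner_smul_right, horth, norm_smul s, N'.norm_eq, mul_one,
      Real.norm_eq_abs, sq_abs]
    ring
  have hhr : ‖h‖ ^ 2 + r ^ 2 = 1 := by rw [← hsq, ← hep, p.norm_eq, one_pow]
  have hh1 : ‖h‖ < 1 := by nlinarith [norm_nonneg h]
  let F : I × USph A → B := fun v => (Z v.2 : B) - (v.1 : ℝ) • h
  have hF0 : ∀ v, F v ≠ 0 := fun v hv => by
    have h1 := congrArg norm (sub_eq_zero.1 hv)
    rw [USph.norm_eq, norm_smul, Real.norm_of_nonneg v.1.2.1] at h1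
    have := v.1.2.2
    nlinarith [norm_nonneg h]
  have hF : Continuous F := by fun_prop
  let Y₃ : C(USph A, USph B) := ⟨fun x => dirTo N' (F (1, x)), continuous_dirTo_comp N' (by fun_prop)
    fun x => hF0 _⟩
  have key : ∀ x, ∃ s : ℝ, 0 < s ∧ (Z x : B) = h + s • (Y₃ x : B) := fun x =>
    ⟨‖F (1, x)‖, norm_pos_iff.2 (hF0 _), by
      simp only [Y₃, ContinuousMap.coe_mk, norm_smul_dirTo, F, Set.Icc.coe_one, one_smul]
      rw [add_sub_cancel]⟩
  refine ⟨Y₃, hYZ.trans (hZ.trans (homotopic_dirTo F hF hF0 (fun x => ?_) fun x => rfl)), N',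
    fun x hx => hp x (Subtype.ext ?_), fun x hx => hq x (Subtype.ext ?_)⟩
  · simp [F, dirTo_coe]
  · obtain ⟨s, hs, he⟩ := key x
    have h1 := hsq s
    rw [hx] at he
    rw [← he, USph.norm_eq, one_pow, ← hhr] at h1
    rw [he, hep, show s = r by nlinarith]
  · obtain ⟨s, hs, he⟩ := key x
    have h1 := hsq (-s)
    rw [hx, USph.coe_neg, smul_neg, ← neg_smul] at he
    rw [← he, USph.norm_eq, one_pow, ← hhr] at h1
    rw [he, heq, show s = r by nlinarith, neg_smul, sub_eq_add_neg]

/-- The action of an orthogonal transformation on the unit sphere. -/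
def orthAct (u : orth B) : C(USph B, USph B) :=
  ⟨fun x => USph.mk (((u : (B →L[ℝ] B)ˣ) : B →L[ℝ] B) x) (by rw [orth_norm u.2, x.norm_eq]),
    Continuous.subtype_mk (by fun_prop) _⟩

@[simp] theorem coe_orthAct (u : orth B) (x : USph B) :
    (orthAct u x : B) = ((u : (B →L[ℝ] B)ˣ) : B →L[ℝ] B) x := rfl

theorem continuous_orthAct_apply {X : Type*} [TopologicalSpace X] {u : X → orth B} {f : X → USph B}
    (hu : Continuous u) (hf : Continuous f) : Continuous fun x => orthAct (u x) (f x) := by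
  refine Continuous.subtype_mk ?_ _
  exact ((Units.continuous_val.comp (continuous_subtype_val.comp hu)).clm_apply
    (continuous_subtype_val.comp hf))

theorem homotopic_orthAct_comp {X : Type*} [TopologicalSpace X] {u u' : orth B} (h : Joined u u')
    (f : C(X, USph B)) : ((orthAct u).comp f).Homotopic ((orthAct u').comp f) := by
  obtain ⟨γ⟩ := h
  exact ⟨⟨⟨fun p => orthAct (γ p.1) (f p.2), continuous_orthAct_apply (by fun_prop) (by fun_prop)⟩,
    fun x => by simp, fun x => by simp⟩⟩

theorem exists_orth_joined_one (h : 2 ≤ Module.finrank ℝ B) (p q : USph B) :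
    ∃ u : orth B, Joined 1 u ∧ orthAct u p = q := by
  obtain ⟨γ⟩ := joined_of_two_le h p q
  obtain ⟨G, hG, hG0, hGo, hGm, -, -⟩ := exists_rot_transport (B := Unit)
    (H := fun v => γ v.1) (by fun_prop)
  refine ⟨⟨G (1, ()), hGo _⟩, ⟨⟨⟨fun t => ⟨G (t, ()), hGo _⟩, Continuous.subtype_mk (by fun_prop) _⟩,
    Subtype.ext (hG0 _), rfl⟩⟩, Subtype.ext ?_⟩
  have := hGm 1 ()
  simpa using this

theorem desuspend {k : ℕ} (hk : 3 ≤ k) (hA : Module.finrank ℝ A = k + 2)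
    (hB : Module.finrank ℝ B = k + 1) (Y : C(USph A, USph B)) {NA : USph A}
    (b₀ : USph (perp NA)) (N : USph B) :
    ∃ Y' : C(USph (perp NA), USph (perp N)), Y.Homotopic (susp b₀ N Y') := by
  obtain ⟨Z, hYZ, N', hp, hn⟩ := exists_homotopic_separating_poles hk hA hB Y NA
  obtain ⟨u, hu, hN⟩ := exists_orth_joined_one (by omega) N' N
  have hinj : ∀ x y, orthAct u x = orthAct u y → x = y := fun x y h => by
    have h1 := congrArg (((u⁻¹ : orth B) : (B →L[ℝ] B)ˣ) : B →L[ℝ] B) (congrArg Subtype.val h)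
    exact Subtype.ext (by simpa using h1)
  have hneg : orthAct u (-N') = -N := Subtype.ext (by
    rw [← hN]; simp)
  obtain ⟨Y', hY'⟩ := exists_homotopic_susp_of_ne b₀ N ((orthAct u).comp Z)
    (fun x hx h => (hn x (hinj _ _ (h.trans hneg.symm))).not_ge hx)
    (fun x hx h => (hp x (hinj _ _ (h.trans hN.symm))).not_ge hx)
  refine ⟨Y', hYZ.trans (ContinuousMap.Homotopic.trans ?_ hY')⟩
  have h1 := homotopic_orthAct_comp hu Z
  rwa [show (orthAct (1 : orth B)).comp Z = Z from ContinuousMap.ext fun x => Subtype.ext (by simp)]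
    at h1

end Desuspend

section Antipode

open unitInterval

universe u v

/-- The antipodal map. -/
def antipode (B : Type*) [NormedAddCommGroup B] : C(USph B, USph B) :=
  ⟨fun x => -x, Continuous.subtype_mk (by fun_prop) _⟩

@[simp] theorem antipode_apply {B : Type*} [NormedAddCommGroup B] (x : USph B) :
    antipode B x = -x := rfl

/-- The inclusion of the equator. -/
def perpIncl {A : Type*} [NormedAddCommGroup A] [InnerProductSpace ℝ A] (N : USph A) :
    C(USph (perp N), USph A) :=
  ⟨fun b => USph.mk ((b : perp N) : A) b.norm_eq, Continuous.subtype_mk (by fun_prop) _⟩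

@[simp] theorem coe_perpIncl {A : Type*} [NormedAddCommGroup A] [InnerProductSpace ℝ A]
    (N : USph A) (b : USph (perp N)) : (perpIncl N b : A) = (b : perp N) := rfl

/-- The reflection in the hyperplane orthogonal to `v`, as an orthogonal transformation. -/
noncomputable def orefl {B : Type*} [NormedAddCommGroup B] [InnerProductSpace ℝ B] (v : B) :
    orth B := ⟨hrefl v, hrefl_mem_orth v⟩

theorem orefl_apply {B : Type*} [NormedAddCommGroup B] [InnerProductSpace ℝ B]
    [FiniteDimensional ℝ B] (v x : USph B) :
    (orthAct (orefl (v : B)) x : B) = x - (2 * inner ℝ (v : B) (x : B)) • (v : B) := by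
  rw [coe_orthAct, orefl, hrefl_apply, v.norm_eq, one_pow, inv_one, mul_one]

variable {A : Type u} {B : Type v} [NormedAddCommGroup A] [InnerProductSpace ℝ A]
  [FiniteDimensional ℝ A] [NormedAddCommGroup B] [InnerProductSpace ℝ B] [FiniteDimensional ℝ B]

theorem continuous_orefl : Continuous fun v : USph B => orefl (v : B) := by
  refine Continuous.subtype_mk ?_ _
  exact continuousOn_refl.comp_continuous continuous_subtype_val fun v => v.ne_zero

theorem homotopic_orefl_comp {X : Type*} [TopologicalSpace X] {p q : USph B} (h : Joined p q)
    (f : C(X, USph B)) :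
    ((orthAct (orefl (p : B))).comp f).Homotopic ((orthAct (orefl (q : B))).comp f) :=
  homotopic_orthAct_comp (h.map continuous_orefl) f

theorem homotopic_antipode_of_inner_eq_zero {X : Type*} [TopologicalSpace X] {f g : C(X, USph B)}
    (h : ∀ x, inner ℝ (f x : B) (g x : B) = 0) : f.Homotopic ((antipode B).comp f) := by
  rcases isEmpty_or_nonempty X with hX | ⟨⟨x₀⟩⟩
  · rw [← show f = (antipode B).comp f from ContinuousMap.ext fun x => (hX.false x).elim]
  have hn : ∀ (θ : ℝ) (x : X), ‖Real.cos θ • (f x : B) + Real.sin θ • (g x : B)‖ = 1 := fun θ x => by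
    have h1 : ‖Real.cos θ • (f x : B) + Real.sin θ • (g x : B)‖ ^ 2 = 1 := by
      rw [norm_add_sq_real, real_inner_smul_right, real_inner_smul_left, h, norm_smul, norm_smul,
        USph.norm_eq, USph.norm_eq, mul_one, mul_one, Real.norm_eq_abs, Real.norm_eq_abs, sq_abs,
        sq_abs]
      linarith [Real.sin_sq_add_cos_sq θ]
    exact (pow_eq_one_iff_of_nonneg (norm_nonneg _) two_ne_zero).1 h1
  refine ⟨⟨⟨fun p => USph.mk (Real.cos (Real.pi * p.1) • (f p.2 : B) + Real.sin (Real.pi * p.1) •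
    (g p.2 : B)) (hn _ _), Continuous.subtype_mk (by fun_prop) _⟩, fun x => ?_, fun x => ?_⟩⟩
  · exact Subtype.ext (by simp)
  · exact Subtype.ext (by simp)

theorem homotopic_antipode_comp_three (hA : Module.finrank ℝ A = 4) (hB : Module.finrank ℝ B = 3)
    (g : C(USph A, USph B)) : g.Homotopic ((antipode B).comp g) := by
  have : Nontrivial A := Module.nontrivial_of_finrank_pos (R := ℝ) (by omega)
  obtain ⟨x, hx⟩ := exists_norm_eq A zero_le_one
  set N : USph A := USph.mk x hx
  have := nonempty_perp_sphere N (by omega)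
  let m : I → I := fun t => Set.projIcc 0 1 zero_le_one (2 * (t : ℝ))
  have hm : Continuous m := continuous_projIcc.comp (by fun_prop)
  have hm0 : m 0 = 0 := by simp [m]
  have hm1 : ∀ t : I, 1 / 2 ≤ (t : ℝ) → m t = 1 := fun t ht =>
    Set.projIcc_of_right_le _ (by linarith)
  have hmv : ∀ t : I, (m t : ℝ) = min 1 (2 * (t : ℝ)) := fun t => by
    simp only [m, Set.coe_projIcc]
    exact max_eq_right (le_min zero_le_one (by linarith [t.2.1]))
  obtain ⟨μ, hμ⟩ := exists_descend N (g := fun p => polarMap N (m p.1, p.2))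
    ((continuous_polarMap N).comp (by fun_prop)) (fun b b' => by simp only [hm0, polarMap_zero])
    (fun b b' => by simp only [hm1 1 (by norm_num), polarMap_one])
  have hμ1 : μ.Homotopic (ContinuousMap.id _) := by
    refine homotopic_of_add_ne_zero fun x hx => ?_
    obtain ⟨⟨t, b⟩, rfl⟩ := surjective_polarMap N x
    have h1 : inner ℝ (polarMap N (m t, b) : A) (polarMap N (t, b) : A) =
        Real.cos (Real.pi * m t - Real.pi * t) := by
      have hb : inner ℝ ((b : perp N) : A) ((b : perp N) : A) = 1 := by
        rw [← Submodule.coe_inner, b.inner_self]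
      rw [polarMap, polarMap, coe_polar, coe_polar, inner_add_left, inner_add_right, inner_add_right,
        Real.cos_sub]
      simp only [real_inner_smul_left, real_inner_smul_right, inner_perp, inner_perp', N.inner_self, hb]
      ring
    have h2 : 0 ≤ Real.cos (Real.pi * m t - Real.pi * t) := by
      have h3 := t.2.1
      have h4 := t.2.2
      have h5 : (t : ℝ) ≤ m t ∧ (m t : ℝ) ≤ t + 1 / 2 := by
        rw [hmv]
        refine ⟨le_min h4 (by linarith), ?_⟩
        rcases le_total (t : ℝ) (1 / 2) with h | h
        · exact (min_le_right _ _).trans (by linarith)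
        · exact (min_le_left _ _).trans (by linarith)
      exact Real.cos_nonneg_of_mem_Icc ⟨by nlinarith [Real.pi_pos], by nlinarith [Real.pi_pos]⟩
    rw [hμ, ContinuousMap.id_apply] at hx
    rw [eq_neg_of_add_eq_zero_left hx, inner_neg_left, USph.inner_self] at h1
    linarith
  have hg : g.Homotopic (g.comp μ) := by
    have := (ContinuousMap.Homotopic.refl g).comp hμ1.symm
    rwa [ContinuousMap.comp_id] at this
  obtain ⟨G, hG, hG0, hGo, hGm, -, -⟩ := exists_rot_transport (B := USph (perp N))
    (H := fun p => g (polarMap N p)) (g.continuous.comp (continuous_polarMap N))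
  obtain ⟨w₀⟩ := nonempty_perp_sphere (g N) (by omega)
  let W : I × USph (perp N) → USph B := fun p => orthAct ⟨G p, hGo p⟩ (perpIncl _ w₀)
  have hW : Continuous W := continuous_orthAct_apply (by fun_prop) continuous_const
  have hWo : ∀ p, inner ℝ (g (polarMap N p) : B) (W p : B) = 0 := fun p => by
    have h1 := hGm p.1 p.2
    rw [polarMap_zero] at h1
    simp only [W, coe_orthAct]
    rw [← h1, mem_orth.1 (hGo p), coe_perpIncl, inner_perp]
  let W₁ : C(USph (perp N), USph (perp (g (-N)))) :=
    ⟨fun b => USph.mk ⟨W (1, b), mem_perp.2 (by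
      have := hWo (1, b)
      rwa [polarMap_one] at this)⟩ (W (1, b)).norm_eq,
      Continuous.subtype_mk (Continuous.subtype_mk (by fun_prop) _) _⟩
  have hN := finrank_perp N
  have hN' := finrank_perp (g (-N))
  obtain ⟨q⟩ := nonempty_perp_sphere (g (-N)) (by omega)
  obtain ⟨K⟩ := two_sphere_homotopic_const_circle (by omega) (by omega) W₁ q
  let HW : ContinuousMap.Homotopy (ContinuousMap.const (USph (perp N)) (perpIncl _ w₀))
      ((perpIncl _).comp W₁) := ⟨⟨W, hW⟩, fun b => Subtype.ext (by simp [W, hG0]), fun b => rfl⟩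
  let HK : ContinuousMap.Homotopy ((perpIncl _).comp W₁)
      (ContinuousMap.const (USph (perp N)) (perpIncl _ q)) :=
    ⟨⟨fun p => perpIncl _ (K p), by fun_prop⟩, fun b => by simp, fun b => by simp⟩
  obtain ⟨w, hw⟩ := exists_descend N (HW.trans HK).continuous
    (fun b b' => by simp) (fun b b' => by simp)
  refine hg.trans ((homotopic_antipode_of_inner_eq_zero (f := g.comp μ) (g := w) fun x => ?_).trans
    ((ContinuousMap.Homotopic.refl _).comp hg.symm))
  obtain ⟨⟨t, b⟩, rfl⟩ := surjective_polarMap N x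
  rw [hw, ContinuousMap.comp_apply, hμ, ContinuousMap.Homotopy.trans_apply]
  split_ifs with ht
  · have : m t = ⟨2 * (t : ℝ), (unitInterval.mul_pos_mem_iff zero_lt_two).2 ⟨t.2.1, ht⟩⟩ :=
      Set.projIcc_of_mem _ _
    rw [← this]
    exact hWo _
  · rw [hm1 t (not_le.1 ht).le, polarMap_one]
    exact inner_perp _

theorem susp_orefl {NA : USph A} (b₀ : USph (perp NA)) {N : USph B} (v : USph (perp N))
    (Y : C(USph (perp NA), USph (perp N))) :
    susp b₀ N ((orthAct (orefl (v : perp N))).comp Y) =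
      (orthAct (orefl (perpIncl N v : B))).comp (susp b₀ N Y) := by
  ext x
  rw [ContinuousMap.comp_apply, orefl_apply, coe_susp, coe_susp, ContinuousMap.comp_apply,
    orefl_apply, coe_perpIncl, inner_add_right, real_inner_smul_right, real_inner_smul_right,
    inner_perp', Submodule.coe_sub, Submodule.coe_smul, Submodule.coe_inner]
  module

theorem homotopic_orefl_comp_self {k : ℕ} (hk : 2 ≤ k) : ∀ {A : Type u} {B : Type v}
    [NormedAddCommGroup A] [InnerProductSpace ℝ A] [FiniteDimensional ℝ A] [NormedAddCommGroup B]
    [InnerProductSpace ℝ B] [FiniteDimensional ℝ B], Module.finrank ℝ A = k + 2 →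
    Module.finrank ℝ B = k + 1 → ∀ (g : C(USph A, USph B)) (v : USph B),
    ((orthAct (orefl (v : B))).comp g).Homotopic g := by
  induction k, hk using Nat.le_induction with
  | base =>
    intro A B _ _ _ _ _ _ hA hB g v
    obtain ⟨b, hb⟩ := Orthonormal.exists_orthonormalBasis_extension_of_card_eq (𝕜 := ℝ) (E := B)
      (ι := Fin 3) (by simpa using hB) (v := fun _ => (v : B)) (s := {0}) (by
        rw [orthonormal_iff_ite]
        rintro ⟨i, rfl⟩ ⟨j, rfl⟩
        simp)
    have hb0 : b 0 = v := hb 0 rfl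
    let u : Fin 3 → USph B := fun i => USph.mk (b i) (b.norm_eq_one i)
    have h1 : (orthAct (orefl (v : B))).comp g = (antipode B).comp
        ((orthAct (orefl (u 1 : B))).comp ((orthAct (orefl (u 2 : B))).comp g)) := by
      ext x
      have h2 := b.sum_repr' (g x : B)
      rw [Fin.sum_univ_three, hb0] at h2
      have h12 : inner ℝ (b 1) (b 2) = 0 := b.orthonormal.2 (by decide)
      simp only [ContinuousMap.comp_apply, orefl_apply, antipode_apply, USph.coe_neg]
      simp only [u, USph.coe_mk, inner_sub_right, real_inner_smul_right, h12]
      linear_combination (norm := module) (-2 : ℝ) • h2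
    have h3 : (orthAct (orefl (u 2 : B))).comp ((orthAct (orefl (u 2 : B))).comp g) = g := by
      ext x
      simp only [ContinuousMap.comp_apply, orefl_apply, inner_sub_right, real_inner_smul_right,
        USph.inner_self]
      module
    rw [h1]
    have h4 := (ContinuousMap.Homotopic.refl (antipode B)).comp
      (homotopic_orefl_comp (joined_of_two_le (by omega) (u 1) (u 2))
        ((orthAct (orefl (u 2 : B))).comp g))
    rw [h3] at h4
    exact h4.trans (homotopic_antipode_comp_three hA hB g).symm
  | succ k hk ih =>
    intro A B _ _ _ _ _ _ hA hB g v
    have : Nontrivial A := Module.nontrivial_of_finrank_pos (R := ℝ) (by omega)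
    obtain ⟨x, hx⟩ := exists_norm_eq A zero_le_one
    set NA : USph A := USph.mk x hx
    obtain ⟨b₀⟩ := nonempty_perp_sphere NA (by omega)
    obtain ⟨N⟩ := nonempty_perp_sphere v (by omega)
    have hNA := finrank_perp NA
    have hN := finrank_perp (perpIncl v N)
    obtain ⟨Y, hY⟩ := desuspend (by omega) hA hB g b₀ (perpIncl v N)
    let v' : USph (perp (perpIncl v N)) := USph.mk ⟨v, mem_perp.2 (by
      rw [coe_perpIncl, inner_perp'])⟩ v.norm_eq
    have h1 := homotopic_susp b₀ (perpIncl v N) (ih (by omega) (by omega) Y v')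
    rw [susp_orefl] at h1
    exact ((ContinuousMap.Homotopic.refl _).comp hY).trans (h1.trans hY.symm)

theorem homotopic_antipode_comp {k : ℕ} (hk : 2 ≤ k) (hA : Module.finrank ℝ A = k + 2)
    (hB : Module.finrank ℝ B = k + 1) (g : C(USph A, USph B)) :
    ((antipode B).comp g).Homotopic g := by
  classical
  let b := stdOrthonormalBasis ℝ B
  have key : ∀ s : Finset (Fin (Module.finrank ℝ B)), ∃ h : C(USph A, USph B), h.Homotopic g ∧
      ∀ x, (h x : B) = g x - (2 : ℝ) • ∑ i ∈ s, inner ℝ (b i) (g x : B) • b i := by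
    intro s
    induction s using Finset.induction_on with
    | empty => exact ⟨g, .refl _, fun x => by simp⟩
    | insert j s hj ih =>
      obtain ⟨h, hg, hx⟩ := ih
      let u : USph B := USph.mk (b j) (b.norm_eq_one j)
      refine ⟨(orthAct (orefl (u : B))).comp h, (homotopic_orefl_comp_self hk hA hB h u).trans hg,
        fun x => ?_⟩
      have h0 : inner ℝ (b j) (h x : B) = inner ℝ (b j) (g x : B) := by
        rw [hx, inner_sub_right, real_inner_smul_right, inner_sum, Finset.sum_eq_zero, mul_zero,
          sub_zero]
        intro i hi
        rw [real_inner_smul_right, b.orthonormal.2 (by rintro rfl; exact hj hi), mul_zero]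
      rw [ContinuousMap.comp_apply, orefl_apply]
      simp only [u, USph.coe_mk]
      rw [h0, hx, Finset.sum_insert hj]
      module
  obtain ⟨h, hg, hx⟩ := key Finset.univ
  have : h = (antipode B).comp g := by
    ext x
    rw [hx, b.sum_repr', ContinuousMap.comp_apply, antipode_apply, USph.coe_neg, two_smul]
    abel
  rwa [← this]

end Antipode

section NilpotentTrace

open Polynomial

variable {n R : Type*} [Fintype n] [DecidableEq n] [CommRing R]

theorem derivative_det_eq_trace (M : Matrix n n R[X]) :
    derivative M.det = (M.adjugate * M.map derivative).trace := by
  have h1 : derivative M.det = ∑ i, (M.updateCol i fun j => derivative (M j i)).det := by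
    simp only [Matrix.det_apply', derivative_sum, ← Polynomial.C_eq_intCast, derivative_C_mul]
    rw [Finset.sum_comm]
    refine Finset.sum_congr rfl fun σ _ => ?_
    rw [show derivative (∏ i, M (σ i) i) = _ from derivative_prod_finset, Finset.mul_sum]
    refine Finset.sum_congr rfl fun i _ => ?_
    rw [← Finset.mul_prod_erase _ _ (Finset.mem_univ i), Matrix.updateCol_self, mul_comm (derivative _)]
    congr 2
    refine Finset.prod_congr rfl fun j hj => ?_
    rw [Matrix.updateCol_ne (Finset.ne_of_mem_erase hj)]
  rw [h1, Matrix.trace]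
  refine Finset.sum_congr rfl fun i _ => ?_
  rw [← Matrix.cramer_apply, Matrix.cramer_eq_adjugate_mulVec]
  rfl

variable [Algebra ℚ R]

theorem charpolyRev_eq_one_of_trace_pow {Y : Matrix n n R} (h : ∀ k, (Y ^ (k + 1)).trace = 0) :
    Y.charpolyRev = 1 := by
  set Z : Matrix n n R[X] := Y.map C with hZ
  set D : Matrix n n R[X] := 1 - (X : R[X]) • Z with hD
  have hp : Y.charpolyRev = D.det := rfl
  have hder : D.map derivative = -Z := by
    ext i j : 1
    simp only [hD, hZ, Matrix.map_apply, Matrix.sub_apply, Matrix.smul_apply, smul_eq_mul,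
      derivative_sub, derivative_mul, derivative_X, derivative_C, one_mul, mul_zero, add_zero,
      Matrix.neg_apply]
    rw [Matrix.one_apply]
    split_ifs <;> simp
  have hgeom : ∀ m : ℕ, D * ∑ k ∈ Finset.range m, ((X : R[X]) • Z) ^ k = 1 - ((X : R[X]) • Z) ^ m :=
    fun m => mul_neg_geom_sum _ m
  have htr : ∀ k, (((X : R[X]) • Z) ^ k * Z).trace = 0 := fun k => by
    rw [_root_.smul_pow, smul_mul_assoc, ← pow_succ, Matrix.trace_smul, hZ, ← RingHom.mapMatrix_apply,
      ← map_pow, RingHom.mapMatrix_apply, ← AddMonoidHom.map_trace, h]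
    simp
  have hdvd : ∀ m : ℕ, (X : R[X]) ^ m ∣ derivative D.det := fun m => by
    have h1 : D.det • (∑ k ∈ Finset.range m, ((X : R[X]) • Z) ^ k) =
        D.adjugate - D.adjugate * ((X : R[X]) • Z) ^ m := by
      have := congrArg (D.adjugate * ·) (hgeom m)
      simp only [← mul_assoc, Matrix.adjugate_mul, mul_sub, mul_one] at this
      rw [← this, smul_mul_assoc, one_mul]
    have h2 := congrArg (fun M => (M * Z).trace) h1
    simp only [smul_mul_assoc, Matrix.trace_smul, Finset.sum_mul, Matrix.trace_sum, htr,
      Finset.sum_const_zero, smul_zero, sub_mul, Matrix.trace_sub] at h2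
    rw [derivative_det_eq_trace, hder, mul_neg, Matrix.trace_neg, dvd_neg, sub_eq_zero.1 h2.symm,
      _root_.smul_pow, mul_smul_comm, smul_mul_assoc, Matrix.trace_smul]
    exact Dvd.intro _ rfl
  have hzero : derivative D.det = 0 := by
    ext k
    obtain ⟨q, hq⟩ := hdvd (k + 1)
    rw [hq, mul_comm, coeff_mul_X_pow', if_neg (by omega), coeff_zero]
  rw [hp]
  have h0 : D.det.coeff 0 = 1 := by
    rw [← hp, coeff_zero_eq_eval_zero, Matrix.eval_charpolyRev]
  ext k
  rcases k with _ | k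
  · rw [h0, coeff_one_zero]
  · have h1 := congrArg (fun p => coeff p k) hzero
    simp only [coeff_derivative, coeff_zero] at h1
    rw [coeff_one, if_neg (by omega)]
    have h2 : IsUnit ((k : R) + 1) := by
      have := (IsUnit.mk0 ((k : ℚ) + 1) (by positivity)).map (algebraMap ℚ R)
      simpa using this
    exact (h2.mul_left_eq_zero).1 h1

theorem pow_card_eq_zero_of_trace_pow [Nontrivial R] {Y : Matrix n n R}
    (h : ∀ k, (Y ^ (k + 1)).trace = 0) : Y ^ Fintype.card n = 0 := by
  have h1 := charpolyRev_eq_one_of_trace_pow h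
  rw [← Matrix.reverse_charpoly] at h1
  have h2 : Y.charpoly = X ^ Fintype.card n := by
    have hdeg := Y.charpoly_natDegree_eq_dim
    ext k
    rcases le_or_gt k (Fintype.card n) with hk | hk
    · have h3 := congrArg (fun p => coeff p (Fintype.card n - k)) h1
      simp only [coeff_reverse, hdeg, revAt_le (Nat.sub_le _ _), Nat.sub_sub_self hk] at h3
      rw [h3, coeff_one, coeff_X_pow]
      exact if_congr (by omega) rfl rfl
    · rw [coeff_eq_zero_of_natDegree_lt (hdeg ▸ hk), coeff_X_pow, if_neg (by omega)]
  have h3 := Y.aeval_self_charpoly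
  rwa [h2, map_pow, aeval_X] at h3

end NilpotentTrace

section AmitsurLevitzki

variable {K : Type*} [Field K] [CharZero K] {n : Type*} [Fintype n] [DecidableEq n]

open ExteriorAlgebra

/-- The matrix of one-forms built from a matrix of vectors. -/
noncomputable def extMat (K : Type*) [Field K] {n M : Type*} [AddCommGroup M] [Module K M] (x : n → n → M) :
    Matrix n n (ExteriorAlgebra K M) := Matrix.of fun a b => ι K (x a b)

variable {M : Type*} [AddCommGroup M] [Module K M]

theorem ι_mul_ι_mem_center (v w : M) :
    ι K v * ι K w ∈ Subalgebra.center K (ExteriorAlgebra K M) := by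
  have hsw : ∀ x y : M, ι K x * ι K y = -(ι K y * ι K x) := fun x y =>
    eq_neg_of_add_eq_zero_left (ι_add_mul_swap x y)
  rw [Subalgebra.mem_center_iff]
  intro z
  induction z using ExteriorAlgebra.induction with
  | algebraMap r => exact Algebra.commutes _ _
  | ι u =>
    rw [← mul_assoc, hsw u v, neg_mul, mul_assoc, hsw u w, mul_neg, neg_neg, mul_assoc]
  | mul a b ha hb => rw [mul_assoc, hb, ← mul_assoc, ha, mul_assoc]
  | add a b ha hb => rw [add_mul, mul_add, ha, hb]

theorem exists_extMat_sq (x : n → n → M) :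
    ∃ Y : Matrix n n (Subalgebra.center K (ExteriorAlgebra K M)),
      extMat K x * extMat K x = Y.map Subtype.val := by
  refine ⟨Matrix.of fun a b => ∑ c, ⟨ι K (x a c) * ι K (x c b), ι_mul_ι_mem_center _ _⟩, ?_⟩
  ext a b
  simp [Matrix.mul_apply, extMat]

theorem trace_extMat_pow_odd (x : n → n → M) :
    (extMat K x ^ (2 * Fintype.card n + 1)).trace = 0 := by
  let S := Subalgebra.center K (ExteriorAlgebra K M)
  obtain ⟨Y, hY⟩ : ∃ Y : Matrix n n S, extMat K x * extMat K x = Y.map Subtype.val :=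
    exists_extMat_sq x
  have hpow : ∀ k, extMat K x ^ (2 * k) = (Y ^ k).map Subtype.val := fun k => by
    rw [pow_mul, pow_two, hY]
    exact (map_pow (S.subtype : S →+* ExteriorAlgebra K M).mapMatrix Y k).symm
  have h2 : ∀ z : ExteriorAlgebra K M, z = -z → z = 0 := fun z hz => by
    have h3 : (2 : K) • z = 0 := by rw [two_smul]; nth_rewrite 2 [hz]; exact add_neg_cancel z
    exact (smul_eq_zero.1 h3).resolve_left two_ne_zero
  have htr : ∀ k, (Y ^ (k + 1)).trace = 0 := fun k => by
    apply Subtype.val_injective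
    have h1 : ((Y ^ (k + 1)).trace : ExteriorAlgebra K M) = (extMat K x ^ (2 * (k + 1))).trace := by
      rw [hpow]
      exact AddMonoidHom.map_trace (S.subtype : S →+* ExteriorAlgebra K M) _
    rw [h1]
    refine h2 _ ?_
    have hA : extMat K x ^ (2 * (k + 1)) = extMat K x * (extMat K x * (Y ^ k).map Subtype.val) := by
      rw [← hpow, ← mul_assoc, ← pow_two, ← pow_add]; congr 1; ring
    have hB : extMat K x ^ (2 * (k + 1)) = (extMat K x * (Y ^ k).map Subtype.val) * extMat K x := by
      rw [← hpow, ← pow_succ', ← pow_succ]; rfl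
    nth_rewrite 1 [hA]
    rw [hB]
    simp only [Matrix.trace, Matrix.diag_apply, Matrix.mul_apply (M := extMat K x) (N := extMat K x * _),
      Matrix.mul_apply (M := extMat K x * _) (N := extMat K x)]
    rw [Finset.sum_comm, ← Finset.sum_neg_distrib]
    refine Finset.sum_congr rfl fun b _ => ?_
    rw [← Finset.sum_neg_distrib]
    refine Finset.sum_congr rfl fun a _ => ?_
    rw [Matrix.mul_apply, Finset.mul_sum, Finset.sum_mul, ← Finset.sum_neg_distrib]
    refine Finset.sum_congr rfl fun c _ => ?_
    have hc := Subalgebra.mem_center_iff.1 ((Y ^ k) c a).2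
    simp only [extMat, Matrix.of_apply, Matrix.map_apply]
    rw [mul_assoc, ← hc, ← mul_assoc, ← mul_assoc, eq_neg_of_add_eq_zero_left (ι_add_mul_swap (x a b) (x b c)),
      neg_mul]
  have hnil : Y ^ Fintype.card n = 0 := by
    let : Algebra ℚ S := ((algebraMap K S).comp (algebraMap ℚ K)).toAlgebra
    exact pow_card_eq_zero_of_trace_pow htr
  rw [pow_succ, hpow, hnil]
  simp

/-- A matrix of scalars times a fixed element of the exterior algebra. -/
def extSmul (A : Matrix n n K) (z : ExteriorAlgebra K M) : Matrix n n (ExteriorAlgebra K M) :=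
  A.map fun r => r • z

theorem extSmul_mul (A B : Matrix n n K) (y z : ExteriorAlgebra K M) :
    extSmul A y * extSmul B z = extSmul (A * B) (y * z) := by
  ext a b
  simp only [extSmul, Matrix.mul_apply, Matrix.map_apply, Finset.sum_smul, smul_mul_smul_comm]

theorem prod_extSmul {m : ℕ} (A : Fin m → Matrix n n K) (z : Fin m → M) :
    (List.ofFn fun i => extSmul (A i) (ι K (z i))).prod =
      extSmul (List.ofFn A).prod (ιMulti K m z) := by
  rw [ιMulti_apply]
  induction m with
  | zero => ext a b; simp [extSmul, Matrix.one_apply]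
  | succ m ih =>
    simp only [List.ofFn_succ, List.prod_cons, ih (fun i => A i.succ) fun i => z i.succ, extSmul_mul]

/-- The determinant as a functional on the exterior algebra. -/
noncomputable def detFun (K : Type*) [Field K] (d : ℕ) : ExteriorAlgebra K (Fin d → K) →ₗ[K] K :=
  liftAlternating (R := K) (M := Fin d → K) (N := K) fun i =>
    if h : d = i then (Matrix.detRowAlternating (n := Fin d)).domDomCongr (finCongr h) else 0

theorem detFun_ιMulti (d : ℕ) (v : Fin d → Fin d → K) :
    detFun K d (ιMulti K d v) = Matrix.det (Matrix.of v) := by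
  rw [detFun, liftAlternating_apply_ιMulti, dif_pos rfl]; rfl

theorem detFun_perm {d : ℕ} (σ : Equiv.Perm (Fin d)) :
    detFun K d (ιMulti K d fun i => Pi.single (σ i) 1) = (Equiv.Perm.sign σ : ℤ) := by
  have h2 : (Matrix.of fun i => (Pi.single (σ i) 1 : Fin d → K)) =
      (1 : Matrix (Fin d) (Fin d) K).submatrix σ id := by
    ext i j
    simp [Matrix.one_apply, Pi.single_apply, eq_comm]
  rw [detFun_ιMulti, h2, Matrix.det_permute, Matrix.det_one, mul_one]

theorem prod_ofFn_perm_of_anticommute {d : ℕ} {C : Fin d → Matrix n n K}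
    (hC : ∀ i j, i ≠ j → C i * C j = -(C j * C i)) (σ : Equiv.Perm (Fin d)) :
    (Equiv.Perm.sign σ : ℤ) • (List.ofFn fun i => C (σ i)).prod = (List.ofFn C).prod := by
  let e : Fin d → (Fin d → K) := fun i => Pi.single i 1
  let T := fun i => extSmul (C i) (ι K (e i))
  have hcomm : ∀ i j, Commute (T i) (T j) := fun i j => by
    rcases eq_or_ne i j with rfl | hij
    · exact Commute.refl _
    · change extSmul _ _ * extSmul _ _ = extSmul _ _ * extSmul _ _
      rw [extSmul_mul, extSmul_mul, hC i j hij, eq_neg_of_add_eq_zero_left (ι_add_mul_swap (e i) (e j))]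
      ext a b
      simp [extSmul]
  have h1 : (List.ofFn fun i => T (σ i)).prod = (List.ofFn T).prod := by
    refine List.Perm.prod_eq' (Equiv.Perm.ofFn_comp_perm σ T) ?_
    refine List.pairwise_ofFn.2 fun i j _ => hcomm _ _
  have h2 := prod_extSmul (fun i => C (σ i)) fun i => e (σ i)
  have h3 := prod_extSmul C e
  have h4 := h2.symm.trans (h1.trans h3)
  ext a b
  have h5 := congrArg (fun A => detFun K d (A a b)) h4
  have h6 := detFun_perm (K := K) (1 : Equiv.Perm (Fin d))
  simp only [Equiv.Perm.coe_one, id_eq] at h6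
  simp only [extSmul, Matrix.map_apply, map_smul, smul_eq_mul, e] at h5
  rw [detFun_perm, h6] at h5
  rw [Matrix.smul_apply, zsmul_eq_mul, mul_comm, h5]
  simp

theorem sum_perm_trace_eq_zero {d : ℕ} (hd : d = 2 * Fintype.card n + 1) (X : Fin d → Matrix n n K) :
    ∑ σ : Equiv.Perm (Fin d), Equiv.Perm.sign σ • (List.ofFn fun i => X (σ i)).prod.trace = 0 := by
  classical
  let e : Fin d → (Fin d → K) := fun i => Pi.single i 1
  set 𝕏 := extMat K (fun a b => fun i => X i a b) with h𝕏
  have hsum : 𝕏 = ∑ i, extSmul (X i) (ι K (e i)) := by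
    ext a b
    have : (fun i => X i a b) = ∑ i, X i a b • e i := by
      ext j; simp [e, Finset.sum_apply, Pi.single_apply]
    simp only [h𝕏, extMat, Matrix.of_apply, Matrix.sum_apply, extSmul, Matrix.map_apply]
    rw [this, map_sum]
    simp
  have hexp : 𝕏 ^ d = ∑ f : Fin d → Fin d, extSmul (List.ofFn fun i => X (f i)).prod
      (ιMulti K d fun i => e (f i)) := by
    have h1 := (MultilinearMap.mkPiAlgebraFin K d (Matrix n n (ExteriorAlgebra K (Fin d → K)))).map_sum
      (fun _ j => extSmul (X j) (ι K (e j)))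
    rw [← hsum] at h1
    rw [← MultilinearMap.mkPiAlgebraFin_apply_const (R := K), h1]
    refine Finset.sum_congr rfl fun f _ => ?_
    rw [MultilinearMap.mkPiAlgebraFin_apply, prod_extSmul]
  have h0 := trace_extMat_pow_odd (K := K) (fun a b => fun i => X i a b)
  rw [← hd, ← h𝕏, hexp, Matrix.trace_sum] at h0
  have htr : ∀ (A : Matrix n n K) (z : ExteriorAlgebra K (Fin d → K)), (extSmul A z).trace = A.trace • z := fun A z => by
    simp [extSmul, Matrix.trace, Finset.sum_smul]
  simp only [htr] at h0
  have h1 := congrArg (detFun K d) h0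
  simp only [map_sum, map_smul, map_zero] at h1
  rw [← h1]
  refine Fintype.sum_of_injective (fun σ : Equiv.Perm (Fin d) => (σ : Fin d → Fin d))
    DFunLike.coe_injective _ _ (fun f hf => ?_) (fun σ => ?_)
  · have hf' : ¬ Function.Injective f := fun h =>
      hf ⟨Equiv.ofBijective f (Finite.injective_iff_bijective.1 h), rfl⟩
    obtain ⟨i, j, hij, hne⟩ := Function.not_injective_iff.1 hf'
    rw [detFun_ιMulti, Matrix.det_zero_of_row_eq hne, smul_zero]
    ext k
    simp [hij]
  · rw [detFun_perm, Units.smul_def, zsmul_eq_mul, smul_eq_mul, mul_comm]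

theorem trace_restrictScalars_complex {V : Type*} [AddCommGroup V] [Module ℝ V] [Module ℂ V]
    [IsScalarTower ℝ ℂ V] [FiniteDimensional ℂ V] (f : V →ₗ[ℂ] V) :
    LinearMap.trace ℝ V (f.restrictScalars ℝ) = 2 * (LinearMap.trace ℂ V f).re := by
  let b := Module.finBasis ℂ V
  rw [LinearMap.trace_eq_matrix_trace ℝ (Complex.basisOneI.smulTower b),
    LinearMap.trace_eq_matrix_trace ℂ b, Matrix.trace, Matrix.trace, Fintype.sum_prod_type,
    Fin.sum_univ_two, Complex.re_sum, two_mul]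
  congr 1 <;> refine Finset.sum_congr rfl fun j _ => ?_ <;>
    simp [LinearMap.toMatrix_apply, Module.Basis.smulTower_repr]

end AmitsurLevitzki

section TraceForm

variable {V : Type*} [NormedAddCommGroup V] [InnerProductSpace ℝ V] [FiniteDimensional ℝ V]

/-- The trace as a continuous functional on continuous endomorphisms. -/
noncomputable def trCLM (V : Type*) [NormedAddCommGroup V] [InnerProductSpace ℝ V]
    [FiniteDimensional ℝ V] : (V →L[ℝ] V) →L[ℝ] ℝ :=
  LinearMap.toContinuousLinearMap
    ((LinearMap.trace ℝ V).comp (ContinuousLinearMap.coeLM ℝ))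

theorem trCLM_apply (a : V →L[ℝ] V) : trCLM V a = LinearMap.trace ℝ V a := rfl

theorem trCLM_mul_comm (a b : V →L[ℝ] V) : trCLM V (a * b) = trCLM V (b * a) :=
  LinearMap.trace_mul_comm ℝ _ _

/-- The alternating form `∑ σ, sign σ * tr (X_{σ 1} ⋯ X_{σ d})`. -/
noncomputable def trForm (V : Type*) [NormedAddCommGroup V] [InnerProductSpace ℝ V]
    [FiniteDimensional ℝ V] (d : ℕ) : (V →L[ℝ] V) [⋀^Fin d]→L[ℝ] ℝ :=
  ContinuousMultilinearMap.alternatization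
    ((trCLM V).compContinuousMultilinearMap (ContinuousMultilinearMap.mkPiAlgebraFin ℝ d _))

theorem trForm_apply {d : ℕ} (X : Fin d → V →L[ℝ] V) : trForm V d X =
    ∑ σ : Equiv.Perm (Fin d), Equiv.Perm.sign σ • trCLM V (List.ofFn fun i => X (σ i)).prod := by
  rw [trForm, ContinuousMultilinearMap.alternatization_apply_apply]
  rfl

theorem adInvariant_trForm (d : ℕ) : AdInvariant (trForm V d) := by
  intro u w
  have h : ∀ (m : ℕ) (v : Fin m → V →L[ℝ] V), (List.ofFn fun i => u * v i * ↑u⁻¹).prod =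
      u * (List.ofFn v).prod * ↑u⁻¹ := fun m => by
    induction m with
    | zero => intro v; simp
    | succ m ih =>
      intro v
      simp only [List.ofFn_succ, List.prod_cons, ih fun i => v i.succ]
      simp [mul_assoc]
  rw [trForm_apply, trForm_apply]
  refine Finset.sum_congr rfl fun σ _ => ?_
  rw [h d fun i => w (σ i), trCLM_mul_comm, ← mul_assoc, Units.inv_mul, one_mul]

theorem trForm_eq_zero_of_commute {d : ℕ} (hd : d = Module.finrank ℝ V + 1) {J : V →L[ℝ] V}
    (hJ : J * J = -1) (X : Fin d → V →L[ℝ] V) (hX : ∀ i, X i * J = J * X i) :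
    trForm V d X = 0 := by
  have hJ' : (J : Module.End ℝ V) * J = -1 := congrArg ContinuousLinearMap.toLinearMap hJ
  let _ : Module ℂ V := Module.compHom V (Complex.lift ⟨(J : Module.End ℝ V), hJ'⟩).toRingHom
  have hsmul : ∀ (z : ℂ) (v : V), z • v = z.re • v + z.im • J v := fun z v => by
    change (Complex.lift ⟨(J : Module.End ℝ V), hJ'⟩ z) v = _
    simp [Complex.lift_apply]
  have _ : IsScalarTower ℝ ℂ V := ⟨fun r z v => by
    simp [hsmul, smul_add, mul_smul]⟩
  have _ : FiniteDimensional ℂ V := FiniteDimensional.right ℝ ℂ V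
  have hcomm : ∀ i v, X i (J v) = J (X i v) := fun i v => congrArg (fun T => T v) (hX i)
  let Y : Fin d → V →ₗ[ℂ] V := fun i =>
    { X i with map_smul' := fun z v => by simp [hsmul, hcomm] }
  have hprod : ∀ (m : ℕ) (f : Fin m → Fin d),
      ((List.ofFn fun i => X (f i)).prod : V →ₗ[ℝ] V) =
        ((List.ofFn fun i => Y (f i)).prod).restrictScalars ℝ := fun m => by
    induction m with
    | zero => intro f; simp; rfl
    | succ m ih =>
      intro f
      simp only [List.ofFn_succ, List.prod_cons]
      ext v
      have := congrArg (fun T => T v) (ih fun i => f i.succ)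
      exact congrArg (X (f 0)) this
  let b := Module.finBasis ℂ V
  have h0 := sum_perm_trace_eq_zero (n := Fin (Module.finrank ℂ V)) (d := d) (by
    rw [hd, Fintype.card_fin, ← Module.finrank_mul_finrank ℝ ℂ V, Complex.finrank_real_complex])
    (fun i => LinearMap.toMatrix b b (Y i))
  have h1 : ∀ σ : Equiv.Perm (Fin d), (List.ofFn fun i => LinearMap.toMatrix b b (Y (σ i))).prod.trace =
      LinearMap.trace ℂ V (List.ofFn fun i => Y (σ i)).prod := fun σ => by
    rw [LinearMap.trace_eq_matrix_trace ℂ b]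
    congr 1
    have := map_list_prod (LinearMap.toMatrixAlgEquiv b) (List.ofFn fun i => Y (σ i))
    rw [List.map_ofFn] at this
    exact this.symm
  simp only [h1] at h0
  rw [trForm_apply]
  simp only [trCLM_apply, hprod, trace_restrictScalars_complex]
  have h2 := congrArg Complex.re h0
  rw [Complex.re_sum] at h2
  simp only [Units.smul_def, zsmul_eq_mul] at h2 ⊢
  simp only [← Complex.ofReal_intCast, Complex.re_ofReal_mul, Complex.zero_re] at h2
  rw [← mul_zero (2 : ℝ), ← h2, Finset.mul_sum]
  exact Finset.sum_congr rfl fun σ _ => by ring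

end TraceForm

section Clifford

open Matrix Kronecker

/-- A family of anticommuting skew-symmetric matrices with square `-1`. -/
structure IsCliff {ι : Type*} [Fintype ι] [DecidableEq ι] {d : ℕ} (C : Fin d → Matrix ι ι ℝ) :
    Prop where
  skew : ∀ i, (C i)ᵀ = -C i
  sq : ∀ i, C i * C i = -1
  anti : ∀ i j, i ≠ j → C i * C j = -(C j * C i)

variable {ι κ : Type*} [Fintype ι] [DecidableEq ι] [Fintype κ] [DecidableEq κ]

theorem neg_kron (A : Matrix ι ι ℝ) (B : Matrix κ κ ℝ) : (-A) ⊗ₖ B = -(A ⊗ₖ B) := by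
  ext; simp [kroneckerMap_apply]

theorem kron_neg (A : Matrix ι ι ℝ) (B : Matrix κ κ ℝ) : A ⊗ₖ (-B) = -(A ⊗ₖ B) := by
  ext; simp [kroneckerMap_apply]

theorem IsCliff.append_kron {d k : ℕ} {C : Fin d → Matrix ι ι ℝ} (hC : IsCliff C)
    {e : Fin k → Matrix κ κ ℝ} (he : IsCliff e) {ω : Matrix κ κ ℝ} (hω : ωᵀ = ω) (hω2 : ω * ω = 1)
    (hωe : ∀ j, ω * e j = -(e j * ω)) :
    IsCliff (Fin.append (fun i => C i ⊗ₖ ω) fun j => (1 : Matrix ι ι ℝ) ⊗ₖ e j) := by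
  refine ⟨fun i => ?_, fun i => ?_, fun i j hij => ?_⟩
  · refine Fin.addCases (fun i => ?_) (fun i => ?_) i
    · rw [Fin.append_left, ← kroneckerMap_transpose, hC.skew, hω, neg_kron]
    · rw [Fin.append_right, ← kroneckerMap_transpose, he.skew, transpose_one, kron_neg]
  · refine Fin.addCases (fun i => ?_) (fun i => ?_) i
    · rw [Fin.append_left, ← mul_kronecker_mul, hC.sq, hω2, neg_kron, one_kronecker_one]
    · rw [Fin.append_right, ← mul_kronecker_mul, he.sq, one_mul, kron_neg, one_kronecker_one]
  · revert hij
    refine Fin.addCases (fun i => ?_) (fun i => ?_) i <;>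
      refine Fin.addCases (fun j => ?_) (fun j => ?_) j <;> intro hij <;>
      simp only [Fin.append_left, Fin.append_right, ← mul_kronecker_mul, one_mul, mul_one]
    · rw [hC.anti i j (by rintro rfl; exact hij rfl), neg_kron]
    · rw [hωe, kron_neg]
    · rw [hωe, kron_neg, neg_neg]
    · rw [he.anti i j (by rintro rfl; exact hij rfl), kron_neg]

theorem prod_append_kron {d k : ℕ} (C : Fin d → Matrix ι ι ℝ) (e : Fin k → Matrix κ κ ℝ)
    (ω : Matrix κ κ ℝ) :
    (List.ofFn (Fin.append (fun i => C i ⊗ₖ ω) fun j => (1 : Matrix ι ι ℝ) ⊗ₖ e j)).prod =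
      (List.ofFn C).prod ⊗ₖ (ω ^ d * (List.ofFn e).prod) := by
  have h : ∀ (m : ℕ) (A : Fin m → Matrix ι ι ℝ) (B : Fin m → Matrix κ κ ℝ),
      (List.ofFn fun i => A i ⊗ₖ B i).prod = (List.ofFn A).prod ⊗ₖ (List.ofFn B).prod := fun m => by
    induction m with
    | zero => intro A B; simp
    | succ m ih =>
      intro A B
      simp only [List.ofFn_succ, List.prod_cons, ih (fun i => A i.succ) fun i => B i.succ,
        mul_kronecker_mul]
  rw [List.ofFn_fin_append, List.prod_append, h, h, ← mul_kronecker_mul, List.ofFn_const,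
    List.ofFn_const, List.prod_replicate, List.prod_replicate, one_pow, mul_one]

theorem exists_isCliff_three : ∃ C : Fin 3 → Matrix (Fin 2 × Fin 2) (Fin 2 × Fin 2) ℝ,
    IsCliff C ∧ (List.ofFn C).prod = 1 := by
  let s : Matrix (Fin 2) (Fin 2) ℝ := !![0, 1; 1, 0]
  let ε : Matrix (Fin 2) (Fin 2) ℝ := !![0, -1; 1, 0]
  let t : Matrix (Fin 2) (Fin 2) ℝ := !![1, 0; 0, -1]
  have hs : sᵀ = s := by ext i j; fin_cases i <;> fin_cases j <;> simp [s]
  have ht : tᵀ = t := by ext i j; fin_cases i <;> fin_cases j <;> simp [t]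
  have hε : εᵀ = -ε := by ext i j; fin_cases i <;> fin_cases j <;> simp [ε]
  have hss : s * s = 1 := by ext i j; fin_cases i <;> fin_cases j <;> simp [s]
  have htt : t * t = 1 := by ext i j; fin_cases i <;> fin_cases j <;> simp [t]
  have hεε : ε * ε = -1 := by ext i j; fin_cases i <;> fin_cases j <;> simp [ε]
  have hst : s * t = ε := by ext i j; fin_cases i <;> fin_cases j <;> simp [s, t, ε]
  have hts : t * s = -ε := by ext i j; fin_cases i <;> fin_cases j <;> simp [s, t, ε]
  have hsε : s * ε = t := by ext i j; fin_cases i <;> fin_cases j <;> simp [s, t, ε]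
  have hεs : ε * s = -t := by ext i j; fin_cases i <;> fin_cases j <;> simp [s, t, ε]
  have htε : t * ε = -s := by ext i j; fin_cases i <;> fin_cases j <;> simp [s, t, ε]
  have hεt : ε * t = s := by ext i j; fin_cases i <;> fin_cases j <;> simp [s, t, ε]
  refine ⟨![ε ⊗ₖ s, ε ⊗ₖ t, 1 ⊗ₖ ε], ⟨fun i => ?_, fun i => ?_, fun i j hij => ?_⟩, ?_⟩
  · fin_cases i <;> simp [← kroneckerMap_transpose, hs, ht, hε, neg_kron, kron_neg]
  · fin_cases i <;> simp [← mul_kronecker_mul, hss, htt, hεε, neg_kron, kron_neg]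
  · fin_cases i <;> fin_cases j <;>
      first
        | exact absurd rfl hij
        | simp [← mul_kronecker_mul, hst, hts, hsε, hεs, htε, hεt, hεε, neg_kron, kron_neg]
  · simp [List.ofFn_succ, ← mul_kronecker_mul, hst, ← mul_assoc, hεε, neg_kron, kron_neg]

theorem exists_isCliff_four : ∃ (e : Fin 4 → Matrix ((Fin 2 × Fin 2) × Fin 2) ((Fin 2 × Fin 2) × Fin 2) ℝ)
    (ω : Matrix ((Fin 2 × Fin 2) × Fin 2) ((Fin 2 × Fin 2) × Fin 2) ℝ),
    IsCliff e ∧ ωᵀ = ω ∧ ω * ω = 1 ∧ (∀ j, ω * e j = -(e j * ω)) ∧ (List.ofFn e).prod = ω := by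
  obtain ⟨C, hC, hC1⟩ := exists_isCliff_three
  let s : Matrix (Fin 2) (Fin 2) ℝ := !![0, 1; 1, 0]
  let ε : Matrix (Fin 2) (Fin 2) ℝ := !![0, -1; 1, 0]
  let t : Matrix (Fin 2) (Fin 2) ℝ := !![1, 0; 0, -1]
  have hs : sᵀ = s := by ext i j; fin_cases i <;> fin_cases j <;> simp [s]
  have ht : tᵀ = t := by ext i j; fin_cases i <;> fin_cases j <;> simp [t]
  have hε : εᵀ = -ε := by ext i j; fin_cases i <;> fin_cases j <;> simp [ε]
  have hss : s * s = 1 := by ext i j; fin_cases i <;> fin_cases j <;> simp [s]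
  have htt : t * t = 1 := by ext i j; fin_cases i <;> fin_cases j <;> simp [t]
  have hεε : ε * ε = -1 := by ext i j; fin_cases i <;> fin_cases j <;> simp [ε]
  have hsε : s * ε = t := by ext i j; fin_cases i <;> fin_cases j <;> simp [s, t, ε]
  have hεs : s * ε = -(ε * s) := by ext i j; fin_cases i <;> fin_cases j <;> simp [s, ε]
  have hts : t * s = -(s * t) := by ext i j; fin_cases i <;> fin_cases j <;> simp [s, t]
  have htε : t * ε = -(ε * t) := by ext i j; fin_cases i <;> fin_cases j <;> simp [t, ε]
  have he : IsCliff (fun _ : Fin 1 => ε) :=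
    ⟨fun _ => hε, fun _ => hεε, fun i j h => absurd (Subsingleton.elim i j) h⟩
  refine ⟨Fin.append (fun i => C i ⊗ₖ s) fun _ : Fin 1 => 1 ⊗ₖ ε, 1 ⊗ₖ t,
    hC.append_kron he hs hss fun _ => hεs, ?_, ?_, fun j => ?_, ?_⟩
  · rw [← kroneckerMap_transpose, transpose_one, ht]
  · rw [← mul_kronecker_mul, htt, one_mul, one_kronecker_one]
  · refine Fin.addCases (m := 3) (n := 1) (fun i => ?_) (fun i => ?_) j
    · rw [Fin.append_left, ← mul_kronecker_mul, ← mul_kronecker_mul, one_mul, mul_one, hts, kron_neg]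
    · rw [Fin.append_right, ← mul_kronecker_mul, ← mul_kronecker_mul, one_mul, htε, kron_neg]
  · refine (prod_append_kron (k := 1) C (fun _ => ε) s).trans ?_
    rw [hC1, pow_succ, pow_two, hss, one_mul]
    simp [hsε]

theorem exists_isCliff (n : ℕ) : ∃ (ι : Type) (_ : Fintype ι) (_ : DecidableEq ι)
    (C : Fin (4 * n + 3) → Matrix ι ι ℝ), IsCliff C ∧ (List.ofFn C).prod.trace ≠ 0 := by
  induction n with
  | zero =>
    obtain ⟨C, hC, h1⟩ := exists_isCliff_three
    exact ⟨_, _, _, C, hC, by rw [h1, trace_one]; simp⟩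
  | succ n ih =>
    obtain ⟨ι, _, _, C, hC, h1⟩ := ih
    obtain ⟨e, ω, he, hω, hω2, hωe, hp⟩ := exists_isCliff_four
    have h2 : 4 * n + 3 + 4 = 4 * (n + 1) + 3 := by ring
    rw [← h2]
    refine ⟨_, _, _, _, hC.append_kron he hω hω2 hωe, ?_⟩
    rw [prod_append_kron, trace_kronecker, hp, ← pow_succ, show 4 * n + 3 + 1 = 2 * (2 * n + 2) by ring,
      pow_mul, pow_two, hω2, one_pow, trace_one]
    exact mul_ne_zero h1 (by simp)

end Clifford

section RadialProfile

theorem hasDerivAt_expNegInvGlue {x : ℝ} (hx : 0 < x) :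
    HasDerivAt expNegInvGlue (expNegInvGlue x / x ^ 2) x := by
  have h1 : HasDerivAt (fun x : ℝ => Real.exp (-x⁻¹)) (Real.exp (-x⁻¹) * (-(-(x ^ 2)⁻¹))) x :=
    ((hasDerivAt_inv hx.ne').neg).exp
  have h2 : expNegInvGlue =ᶠ[𝓝 x] fun x : ℝ => Real.exp (-x⁻¹) := by
    filter_upwards [lt_mem_nhds hx] with y hy
    rw [expNegInvGlue, if_neg (not_le.2 hy)]
  rw [h2.eq_of_nhds]
  refine (h1.congr_of_eventuallyEq h2).congr_deriv ?_
  rw [neg_neg, div_eq_mul_inv]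

/-- The radial profile of a compactly supported map of degree one into the unit sphere. -/
theorem exists_radial_profile : ∃ p q : ℝ → ℝ,
    (∀ s, 0 ≤ s → ContDiffAt ℝ 2 p s ∧ ContDiffAt ℝ 2 q s) ∧
    (∀ s, 0 ≤ s → p s ^ 2 + s * q s ^ 2 = 1) ∧ (∀ s, 1 ≤ s → p s = 1 ∧ q s = 0) ∧
    p 0 = -1 ∧
    ∀ s, 0 ≤ s → s < 1 → 2 * p s * q s + 4 * s * (p s * deriv q s - q s * deriv p s) < 0 := by
  set q₀ : ℝ → ℝ := fun s => expNegInvGlue (1 - s) with hq₀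
  set K : ℝ := 2 * Real.exp 1 with hK
  set p₀ : ℝ → ℝ := fun s => 1 - K * q₀ s with hp₀
  set ρ : ℝ → ℝ := fun s => p₀ s ^ 2 + s * q₀ s ^ 2 with hρ
  have hqs : ContDiff ℝ 2 q₀ := expNegInvGlue.contDiff.comp (contDiff_const.sub contDiff_id)
  have hps : ContDiff ℝ 2 p₀ := contDiff_const.sub (contDiff_const.mul hqs)
  have hρs : ContDiff ℝ 2 ρ := (hps.pow 2).add (contDiff_id.mul (hqs.pow 2))
  have hq1 : ∀ s, 1 ≤ s → q₀ s = 0 := fun s hs => expNegInvGlue.zero_of_nonpos (by linarith)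
  have hqpos : ∀ s, s < 1 → 0 < q₀ s := fun s hs => expNegInvGlue.pos_of_pos (by linarith)
  have hKq : ∀ s, s < 1 → K * q₀ s = 2 * Real.exp (-(s / (1 - s))) := fun s hs => by
    have h1 : (1 - s) ≠ 0 := by linarith
    simp only [hq₀, hK, expNegInvGlue, if_neg (show ¬ (1 - s ≤ 0) by linarith)]
    rw [mul_assoc, ← Real.exp_add]
    congr 2
    field_simp
    ring
  have hp0 : p₀ 0 = -1 := by
    simp only [hp₀]; rw [hKq 0 one_pos]; norm_num
  have hρ0 : ∀ s, 0 ≤ s → 0 < ρ s := fun s hs => by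
    rcases hs.eq_or_lt with rfl | hs'
    · simp [hρ, hp0]
    rcases lt_or_ge s 1 with h1 | h1
    · have := hqpos s h1; simp only [hρ]; positivity
    · simp [hρ, hp₀, hq1 s h1]
  have hr : ∀ s, 0 ≤ s → ContDiffAt ℝ 2 (fun s => √(ρ s)) s := fun s hs =>
    hρs.contDiffAt.sqrt (hρ0 s hs).ne'
  have hr0 : ∀ s, 0 ≤ s → √(ρ s) ≠ 0 := fun s hs => (Real.sqrt_pos.2 (hρ0 s hs)).ne'
  refine ⟨fun s => p₀ s / √(ρ s), fun s => q₀ s / √(ρ s), fun s hs =>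
    ⟨hps.contDiffAt.div (hr s hs) (hr0 s hs), hqs.contDiffAt.div (hr s hs) (hr0 s hs)⟩,
    fun s hs => ?_, fun s hs => ?_, ?_, fun s hs hs1 => ?_⟩
  · rw [div_pow, div_pow, Real.sq_sqrt (hρ0 s hs).le, ← mul_div_assoc, ← add_div]
    exact div_self (hρ0 s hs).ne'
  · simp [hρ, hp₀, hq1 s hs]
  · simp [hρ, hp0]
  · have hm : 0 < 1 - s := by linarith
    have hq' : HasDerivAt q₀ (-(q₀ s / (1 - s) ^ 2)) s := by
      have := (hasDerivAt_expNegInvGlue hm).comp s ((hasDerivAt_id s).const_sub 1)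
      refine this.congr_deriv ?_
      simp only [mul_neg, mul_one]; rfl
    have hp' : HasDerivAt p₀ (-(K * -(q₀ s / (1 - s) ^ 2))) s := (hq'.const_mul K).const_sub 1
    have hr' := ((hr s hs).differentiableAt two_ne_zero).hasDerivAt
    have hqd := (hq'.fun_div hr' (hr0 s hs)).deriv
    have hpd := (hp'.fun_div hr' (hr0 s hs)).deriv
    rw [hqd, hpd]
    set r := √(ρ s)
    set r' := deriv (fun s => √(ρ s)) s
    have hrr : r ≠ 0 := hr0 s hs
    have hmain : 1 - K * q₀ s - 2 * s / (1 - s) ^ 2 < 0 := by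
      rw [hKq s hs1]
      set x := s / (1 - s) with hx
      have hx0 : 0 ≤ x := div_nonneg hs hm.le
      have h1 : 2 * s / (1 - s) ^ 2 = 2 * x * (1 + x) := by rw [hx]; field_simp; ring
      have h2 := Real.add_one_le_exp (-x)
      rw [h1]; nlinarith
    have heq : 2 * (p₀ s / r) * (q₀ s / r) + 4 * s * (p₀ s / r * ((-(q₀ s / (1 - s) ^ 2) * r - q₀ s * r') / r ^ 2) -
        q₀ s / r * ((-(K * -(q₀ s / (1 - s) ^ 2)) * r - p₀ s * r') / r ^ 2)) =
        2 * q₀ s / r ^ 2 * (1 - K * q₀ s - 2 * s / (1 - s) ^ 2) := by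
      simp only [hp₀]
      field_simp
      ring
    rw [heq]
    have := hqpos s hs1
    exact mul_neg_of_pos_of_neg (by positivity) hmain

end RadialProfile

section CliffordDegreeDensity

open Matrix

variable {𝒜 : Type*} [NormedRing 𝒜] [NormedAlgebra ℝ 𝒜] {d : ℕ}

theorem hasFDerivAt_dotProduct_self (y : Fin d → ℝ) :
    HasFDerivAt (fun y : Fin d → ℝ => y ⬝ᵥ y)
      (∑ i, (2 * y i) • (ContinuousLinearMap.proj i : (Fin d → ℝ) →L[ℝ] ℝ)) y := by
  simp only [dotProduct]
  refine (HasFDerivAt.fun_sum fun i _ =>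
    (hasFDerivAt_apply i y).mul (hasFDerivAt_apply i y)).congr_fderiv ?_
  refine Finset.sum_congr rfl fun i _ => ?_
  rw [two_mul, add_smul]

theorem AlternatingMap.apply_smul_add_rank_one
    (f : (Fin d → ℝ) [⋀^Fin d]→ₗ[ℝ] ℝ) (α β : ℝ) (y : Fin d → ℝ) (hd : d ≠ 0) :
    f (fun i => α • Pi.single i 1 + (β * y i) • y) =
      (α ^ (d - 1) * (α + β * (y ⬝ᵥ y))) • f fun i => Pi.single i 1 := by
  have h1 := f.eq_smul_basis_det (Pi.basisFun ℝ (Fin d))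
  have h2 : f (fun i => α • Pi.single i 1 + (β * y i) • y) =
      Matrix.det (Matrix.of fun i => α • Pi.single i 1 + (β * y i) • y) • f fun i => Pi.single i 1 := by
    have h6 := congrArg (fun g => g fun i => α • Pi.single i 1 + (β * y i) • y) h1
    simp only [AlternatingMap.smul_apply, Pi.basisFun_det] at h6
    rw [h6, smul_eq_mul, smul_eq_mul, mul_comm]
    congr 1
    exact congrArg (fun e => f e) (funext fun i => Pi.basisFun_apply ℝ (Fin d) i)
  rw [h2]
  congr 1
  have h3 := Matrix.charpoly_vecMulVec (-β • y) y
  have h4 := congrArg (Polynomial.eval α) h3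
  rw [Matrix.eval_charpoly] at h4
  have h5 : (Matrix.of fun i => α • Pi.single i 1 + (β * y i) • y) =
      Matrix.scalar (Fin d) α - vecMulVec (-β • y) y := by
    ext i j
    simp [Matrix.diagonal_apply, vecMulVec_apply, Pi.single_apply, eq_comm, mul_assoc]
  rw [h5, h4]
  obtain ⟨k, rfl⟩ := Nat.exists_eq_succ_of_ne_zero hd
  simp [pow_succ]
  ring

/-- A linear family of Clifford generators. -/
def IsCliffMap (T : (Fin d → ℝ) →L[ℝ] 𝒜) : Prop :=
  ∀ y v, T y * T v + T v * T y = -(2 * (y ⬝ᵥ v)) • (1 : 𝒜)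

theorem IsCliffMap.mul_self {T : (Fin d → ℝ) →L[ℝ] 𝒜} (hT : IsCliffMap T) (y : Fin d → ℝ) :
    T y * T y = -(y ⬝ᵥ y) • (1 : 𝒜) := by
  have h := hT y y
  rw [← two_smul ℝ, neg_smul, mul_smul, ← smul_neg, ← neg_smul] at h
  exact smul_right_injective _ (two_ne_zero (α := ℝ)) h

/-- The map `p + q T` with coefficients depending on the radius. -/
noncomputable def radialMap (p q : ℝ → ℝ) (T : (Fin d → ℝ) →L[ℝ] 𝒜) (y : Fin d → ℝ) : 𝒜 :=
  p (y ⬝ᵥ y) • 1 + q (y ⬝ᵥ y) • T y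

variable {T : (Fin d → ℝ) →L[ℝ] 𝒜} {p q : ℝ → ℝ}

theorem dotProduct_self_nonneg' (y : Fin d → ℝ) : 0 ≤ y ⬝ᵥ y :=
  Finset.sum_nonneg fun i _ => mul_self_nonneg (y i)

/-- `radialMap` as a map to units. -/
noncomputable def radialUnit (hT : IsCliffMap T) (hpq : ∀ s, 0 ≤ s → p s ^ 2 + s * q s ^ 2 = 1)
    (y : Fin d → ℝ) : 𝒜ˣ where
  val := radialMap p q T y
  inv := p (y ⬝ᵥ y) • 1 - q (y ⬝ᵥ y) • T y
  val_inv := by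
    have h1 := hT.mul_self y
    have h2 := hpq _ (dotProduct_self_nonneg' y)
    simp only [radialMap, add_mul, mul_sub, smul_mul_smul_comm, one_mul, mul_one, h1]
    linear_combination (norm := module) h2 • (1 : 𝒜)
  inv_val := by
    have h1 := hT.mul_self y
    have h2 := hpq _ (dotProduct_self_nonneg' y)
    simp only [radialMap, sub_mul, mul_add, smul_mul_smul_comm, one_mul, mul_one, h1]
    linear_combination (norm := module) h2 • (1 : 𝒜)

theorem contDiff_radialMap (hc : ∀ s, 0 ≤ s → ContDiffAt ℝ 2 p s ∧ ContDiffAt ℝ 2 q s) :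
    ContDiff ℝ 2 (radialMap p q T) := by
  have hs : ContDiff ℝ 2 fun y : Fin d → ℝ => y ⬝ᵥ y := by
    simp only [dotProduct]; fun_prop
  refine contDiff_iff_contDiffAt.2 fun y => ?_
  have h := hc _ (dotProduct_self_nonneg' y)
  refine ContDiffAt.add (ContDiffAt.fun_smul ?_ contDiffAt_const) (ContDiffAt.fun_smul ?_ T.contDiff.contDiffAt)
  · exact ContDiffAt.comp y h.1 hs.contDiffAt
  · exact ContDiffAt.comp y h.2 hs.contDiffAt

theorem mcForm_radialMap_sq [CompleteSpace 𝒜] {c : 𝒜 [⋀^Fin d]→L[ℝ] ℝ} (hc : AdInvariant c)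
    (hd : d ≠ 0) (hT : IsCliffMap T)
    (hs : ∀ s, 0 ≤ s → ContDiffAt ℝ 2 p s ∧ ContDiffAt ℝ 2 q s)
    (hpq : ∀ s, 0 ≤ s → p s ^ 2 + s * q s ^ 2 = 1) (y : Fin d → ℝ) {s : ℝ} (hsy : s = y ⬝ᵥ y) :
    mcForm c (radialMap p q T y * radialMap p q T y) (fun i =>
      fderiv ℝ (fun y => radialMap p q T y * radialMap p q T y) y (Pi.single i 1)) =
      ((2 * p s * q s) ^ (d - 1) *
        (2 * p s * q s + 4 * s * (p s * deriv q s - q s * deriv p s))) *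
        c fun i => T (Pi.single i 1) := by
  have hs0 : 0 ≤ s := hsy ▸ dotProduct_self_nonneg' y
  obtain ⟨hps, hqs⟩ := hs s hs0
  have hp' := (hps.differentiableAt two_ne_zero).hasDerivAt
  have hq' := (hqs.differentiableAt two_ne_zero).hasDerivAt
  set p' := deriv p s
  set q' := deriv q s
  have hN := hasFDerivAt_dotProduct_self y
  have hp1 : HasFDerivAt (fun y : Fin d → ℝ => p (y ⬝ᵥ y)) _ y :=
    HasDerivAt.comp_hasFDerivAt (h₂ := p) (f := fun y => y ⬝ᵥ y) y (by rw [← hsy]; exact hp') hN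
  have hq1 : HasFDerivAt (fun y : Fin d → ℝ => q (y ⬝ᵥ y)) _ y :=
    HasDerivAt.comp_hasFDerivAt (h₂ := q) (f := fun y => y ⬝ᵥ y) y (by rw [← hsy]; exact hq') hN
  have hb := (hp1.smul_const (1 : 𝒜)).add (hq1.smul T.hasFDerivAt)
  have hbb := hb.mul' hb
  have hE : fderiv ℝ (fun y => radialMap p q T y * radialMap p q T y) y = _ := hbb.fderiv
  set u := radialUnit hT hpq y with hu
  have huv : (u : 𝒜) = radialMap p q T y := rfl
  have hui : (↑u⁻¹ : 𝒜) = p (y ⬝ᵥ y) • 1 - q (y ⬝ᵥ y) • T y := rfl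
  have hscal : ∀ w : ℝ, (s = 0 → w = 0) → w * (2 * p s * p' + 2 * s * q s * q' + q s ^ 2) = 0 := by
    intro w hw
    rcases hs0.eq_or_lt with h | h
    · rw [hw h.symm, zero_mul]
    · have h1 : HasDerivAt (fun s => p s ^ 2 + s * q s ^ 2)
          (2 * p s * p' + (1 * q s ^ 2 + s * (2 * q s * q'))) s := by
        simpa using (hp'.fun_pow 2).fun_add ((hasDerivAt_id' s).fun_mul (hq'.fun_pow 2))
      have h2 : (fun s => p s ^ 2 + s * q s ^ 2) =ᶠ[𝓝 s] fun _ => 1 := by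
        filter_upwards [lt_mem_nhds h] with t ht using hpq t ht.le
      have h3 := (h1.congr_of_eventuallyEq h2.symm).unique (hasDerivAt_const s (1 : ℝ))
      linear_combination w * h3
  have hkey : ∀ v : Fin d → ℝ, Ring.inverse (radialMap p q T y * radialMap p q T y) *
      fderiv ℝ (fun y => radialMap p q T y * radialMap p q T y) y v =
      ↑u⁻¹ * T ((2 * p s * q s) • v + (4 * (p s * q' - q s * p') * (y ⬝ᵥ v)) • y) * ↑(u⁻¹)⁻¹ := by
    intro v
    set X : 𝒜 := (2 * (y ⬝ᵥ v)) • (p' • 1 + q' • T y) + q s • T v with hX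
    have h1 : fderiv ℝ (fun y => radialMap p q T y * radialMap p q T y) y v = u * X + X * u := by
      have hw : (∑ i, (2 * y i) * v i) = 2 * (y ⬝ᵥ v) := by
        rw [dotProduct, Finset.mul_sum]; exact Finset.sum_congr rfl fun i _ => by ring
      rw [hE, huv, hX, hsy]
      simp [radialMap, hw]
      simp only [add_mul, mul_add, smul_mul_assoc, mul_smul_comm, one_mul, mul_one]
      module
    have h2 : Ring.inverse (radialMap p q T y * radialMap p q T y) = ↑u⁻¹ * ↑u⁻¹ := by
      rw [← huv, ← Units.val_mul, Ring.inverse_unit, _root_.mul_inv_rev, Units.val_mul]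
    rw [h1, h2, inv_inv, map_add, map_smul, map_smul]
    have h3 : (↑u⁻¹ * ↑u⁻¹ * (u * X + X * u) : 𝒜) = ↑u⁻¹ * (X * ↑u⁻¹ + ↑u⁻¹ * X) * u := by
      simp only [mul_add, add_mul, mul_assoc, Units.inv_mul_cancel_left, Units.inv_mul, mul_one]
    rw [h3]
    congr 2
    have hYY := hT.mul_self y
    have hYZ := hT y v
    have h0 := hscal (y ⬝ᵥ v) (fun h => by
      have : y = 0 := dotProduct_self_eq_zero.1 (hsy ▸ h)
      rw [this, zero_dotProduct])
    rw [hui, hX, ← hsy]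
    rw [← hsy] at hYY
    simp only [add_mul, mul_add, sub_mul, mul_sub, smul_add, smul_mul_smul_comm, one_mul, mul_one,
      smul_smul]
    linear_combination (norm := module) (-(4 * (y ⬝ᵥ v) * q s * q')) • hYY - (q s ^ 2) • hYZ +
      (2 : ℝ) • congrArg (fun r : ℝ => r • (1 : 𝒜)) h0
  rw [mcForm_apply]
  simp only [hkey]
  refine (hc u⁻¹ fun i => T ((2 * p s * q s) • Pi.single i 1 +
    (4 * (p s * q' - q s * p') * (y ⬝ᵥ Pi.single i 1)) • y)).trans ?_
  have := (c.toAlternatingMap.compLinearMap (T : (Fin d → ℝ) →ₗ[ℝ] 𝒜)).apply_smul_add_rank_one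
    (2 * p s * q s) (4 * (p s * q' - q s * p')) y hd
  simp only [dotProduct_single, mul_one]
  refine this.trans ?_
  rw [← hsy, smul_eq_mul]
  congr 1
  ring

end CliffordDegreeDensity

section CliffordDegree

open Matrix MeasureTheory

variable {𝒜 : Type*} [NormedRing 𝒜] [NormedAlgebra ℝ 𝒜] [CompleteSpace 𝒜] {d : ℕ}
  {T : (Fin d → ℝ) →L[ℝ] 𝒜} {p q : ℝ → ℝ}

theorem dotProduct_self_ge_of_lt {y : Fin d → ℝ} {i : Fin d} {R : ℝ} (hR : 1 ≤ R)
    (h : R < |y i|) : R ≤ y ⬝ᵥ y := by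
  have h1 : y i * y i ≤ y ⬝ᵥ y :=
    Finset.single_le_sum (f := fun i => y i * y i) (fun i _ => mul_self_nonneg _) (Finset.mem_univ i)
  have h2 : |y i| * |y i| = y i * y i := abs_mul_abs_self _
  nlinarith

theorem mcDeg_radialUnit_sq_ne_zero {c : 𝒜 [⋀^Fin d]→L[ℝ] ℝ} (hc : AdInvariant c)
    (hd : Odd d) (hd1 : d ≠ 1) (hT : IsCliffMap T)
    (hs : ∀ s, 0 ≤ s → ContDiffAt ℝ 2 p s ∧ ContDiffAt ℝ 2 q s)
    (hpq : ∀ s, 0 ≤ s → p s ^ 2 + s * q s ^ 2 = 1) (h1 : ∀ s, 1 ≤ s → p s = 1 ∧ q s = 0)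
    (hneg : ∀ s, 0 ≤ s → s < 1 →
      2 * p s * q s + 4 * s * (p s * deriv q s - q s * deriv p s) < 0)
    (hT0 : c (fun i => T (Pi.single i 1)) ≠ 0) :
    mcDeg c (fun y => radialUnit hT hpq y * radialUnit hT hpq y) ≠ 0 := by
  have hd0 : d ≠ 0 := by rintro rfl; simp at hd
  have heven : Even (d - 1) := by
    obtain ⟨k, rfl⟩ := hd
    simp
  have hd2 : d - 1 ≠ 0 := by omega
  set u : (Fin d → ℝ) → 𝒜 := fun y => radialMap p q T y * radialMap p q T y with hu
  have huc : ContDiff ℝ 2 u := (contDiff_radialMap hs).mul (contDiff_radialMap hs)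
  have hval : ∀ y, ((radialUnit hT hpq y * radialUnit hT hpq y : 𝒜ˣ) : 𝒜) = u y := fun y => rfl
  have hap : IsSmoothApprox (fun y => radialUnit hT hpq y * radialUnit hT hpq y) u := by
    refine ⟨huc, ⟨1, fun y i hi => ?_⟩, fun y => ?_⟩
    · obtain ⟨h2, h3⟩ := h1 _ (dotProduct_self_ge_of_lt le_rfl hi)
      simp [hu, radialMap, h2, h3]
    · simp [hval]
  rw [hap.mcDeg_eq hc, mcInt]
  set φ : (Fin d → ℝ) → ℝ := fun y => (2 * p (y ⬝ᵥ y) * q (y ⬝ᵥ y)) ^ (d - 1) *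
        (2 * p (y ⬝ᵥ y) * q (y ⬝ᵥ y) + 4 * (y ⬝ᵥ y) * (p (y ⬝ᵥ y) * deriv q (y ⬝ᵥ y) -
          q (y ⬝ᵥ y) * deriv p (y ⬝ᵥ y))) with hφ
  have hintegrand : ∀ y, mcForm c (u y) (fun i => fderiv ℝ u y (Pi.single i 1)) =
      φ y * c fun i => T (Pi.single i 1) := fun y =>
    mcForm_radialMap_sq hc hd0 hT hs hpq y rfl
  simp only [hintegrand]
  rw [integral_mul_const]
  refine mul_ne_zero ?_ hT0
  have hφc : Continuous φ := by
    have := (continuous_mcInt_integrand c huc fun y => ⟨_, hval y⟩).div_const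
      (c fun i => T (Pi.single i 1))
    refine this.congr fun y => ?_
    rw [hintegrand, mul_div_cancel_right₀ _ hT0]
  have hz : ∀ y, 1 ≤ y ⬝ᵥ y → φ y = 0 := fun y hy => by
    simp [hφ, h1 _ hy, hd2]
  have hcs : HasCompactSupport (-φ) := by
    refine HasCompactSupport.intro (isCompact_closedBall (0 : Fin d → ℝ) 1) fun y hy => ?_
    rw [Pi.neg_apply, neg_eq_zero]
    refine hz y ?_
    rw [mem_closedBall_zero_iff, pi_norm_le_iff_of_nonneg zero_le_one] at hy
    push Not at hy
    obtain ⟨i, hi⟩ := hy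
    exact dotProduct_self_ge_of_lt le_rfl hi
  have hnn : 0 ≤ -φ := by
    intro y
    rw [Pi.neg_apply, Pi.zero_apply, neg_nonneg]
    rcases le_or_gt 1 (y ⬝ᵥ y) with h | h
    · exact (hz y h).le
    · exact mul_nonpos_of_nonneg_of_nonpos (heven.pow_nonneg _)
        (hneg _ (dotProduct_self_nonneg' y) h).le
  have hx : (-φ) 0 ≠ 0 := by
    have h := hneg 0 le_rfl zero_lt_one
    have h3 : 2 * p 0 * q 0 < 0 := by linarith
    simp only [Pi.neg_apply, hφ, dotProduct_zero, neg_ne_zero]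
    exact mul_ne_zero (pow_ne_zero _ h3.ne) h.ne
  have hpos := Continuous.integral_pos_of_hasCompactSupport_nonneg_nonzero (μ := volume)
    hφc.neg hcs hnn hx
  simp only [Pi.neg_apply, integral_neg] at hpos
  exact (neg_pos.1 hpos).ne

end CliffordDegree

section CliffordOperators

variable {ι : Type*} [Fintype ι] [DecidableEq ι] {d : ℕ}

/-- The linear family of operators attached to Clifford matrices. -/
noncomputable def cliffMap (C : Fin d → Matrix ι ι ℝ) :
    (Fin d → ℝ) →L[ℝ] (EuclideanSpace ℝ ι →L[ℝ] EuclideanSpace ℝ ι) :=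
  ∑ i, (ContinuousLinearMap.proj i : (Fin d → ℝ) →L[ℝ] ℝ).smulRight
    (Matrix.toEuclideanCLM (𝕜 := ℝ) (C i))

theorem cliffMap_apply (C : Fin d → Matrix ι ι ℝ) (y : Fin d → ℝ) :
    cliffMap C y = Matrix.toEuclideanCLM (𝕜 := ℝ) (∑ i, y i • C i) := by
  simp [cliffMap, map_sum]

theorem IsCliff.isCliffMap {C : Fin d → Matrix ι ι ℝ} (hC : IsCliff C) :
    IsCliffMap (cliffMap C) := by
  intro y v
  rw [cliffMap_apply, cliffMap_apply, ← map_mul, ← map_mul, ← map_add,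
    ← map_one (Matrix.toEuclideanCLM (𝕜 := ℝ) (n := ι)), ← map_smul]
  congr 1
  have h : ∀ i j, C i * C j + C j * C i = if i = j then -(2 : ℝ) • (1 : Matrix ι ι ℝ) else 0 := by
    intro i j
    split_ifs with h
    · subst h
      rw [hC.sq]; module
    · rw [hC.anti i j h, neg_add_cancel]
  have h2 : (∑ i, v i • C i) * ∑ i, y i • C i = ∑ i, ∑ j, (y i * v j) • (C j * C i) := by
    rw [Finset.sum_mul_sum, Finset.sum_comm]
    simp only [smul_mul_smul_comm, mul_comm]
  rw [h2, Finset.sum_mul_sum, ← Finset.sum_add_distrib]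
  simp only [← Finset.sum_add_distrib, smul_mul_smul_comm, ← smul_add, h, smul_ite, smul_zero,
    Finset.sum_ite_eq, Finset.mem_univ, if_true, smul_smul, ← Finset.sum_smul]
  congr 1
  rw [dotProduct, Finset.mul_sum, ← Finset.sum_neg_distrib]
  exact Finset.sum_congr rfl fun i _ => by ring

theorem IsCliff.inner_cliffMap {C : Fin d → Matrix ι ι ℝ} (hC : IsCliff C) (y : Fin d → ℝ)
    (u v : EuclideanSpace ℝ ι) : inner ℝ (cliffMap C y u) v = -inner ℝ u (cliffMap C y v) := by
  have h : star (cliffMap C y) = -cliffMap C y := by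
    rw [cliffMap_apply, ← map_star, ← map_neg]
    congr 1
    rw [Matrix.star_eq_conjTranspose, Matrix.conjTranspose_sum, ← Finset.sum_neg_distrib]
    refine Finset.sum_congr rfl fun i _ => ?_
    rw [Matrix.conjTranspose_smul, Matrix.conjTranspose_eq_transpose_of_trivial, hC.skew]
    simp
  rw [← ContinuousLinearMap.adjoint_inner_right, ← ContinuousLinearMap.star_eq_adjoint, h]
  simp

theorem IsCliff.trForm_cliffMap_ne_zero {C : Fin d → Matrix ι ι ℝ} (hC : IsCliff C)
    (h0 : (List.ofFn C).prod.trace ≠ 0) :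
    trForm (EuclideanSpace ℝ ι) d (fun i => cliffMap C (Pi.single i 1)) ≠ 0 := by
  have h1 : ∀ i, cliffMap C (Pi.single i 1) = Matrix.toEuclideanCLM (𝕜 := ℝ) (C i) := by
    intro i
    rw [cliffMap_apply]
    congr 1
    simp [Pi.single_apply, ite_smul]
  have htr : ∀ M : Matrix ι ι ℝ, trCLM (EuclideanSpace ℝ ι) (Matrix.toEuclideanCLM (𝕜 := ℝ) M) =
      M.trace := by
    intro M
    rw [trCLM_apply, LinearMap.trace_eq_matrix_trace ℝ (EuclideanSpace.basisFun ι ℝ).toBasis]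
    congr 1
    ext i j
    simp [LinearMap.toMatrix_apply]
  rw [trForm_apply]
  have h2 : ∀ σ : Equiv.Perm (Fin d), (Equiv.Perm.sign σ : ℤ) • trCLM (EuclideanSpace ℝ ι)
      (List.ofFn fun i => cliffMap C (Pi.single (σ i) 1)).prod = (List.ofFn C).prod.trace := by
    intro σ
    have h3 : (List.ofFn fun i => cliffMap C (Pi.single (σ i) 1)).prod =
        Matrix.toEuclideanCLM (𝕜 := ℝ) (List.ofFn fun i => C (σ i)).prod := by
      rw [map_list_prod, List.map_ofFn]
      simp only [h1]
      rfl
    rw [h3, htr, ← prod_ofFn_perm_of_anticommute hC.anti σ, Matrix.trace_smul]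
  have h4 := Finset.sum_congr (s₁ := Finset.univ) rfl fun σ _ => h2 σ
  intro h5
  have h6 := h4.symm.trans h5
  simp [Finset.card_univ, Fintype.card_perm, Nat.factorial_ne_zero] at h6
  exact h0 h6

end CliffordOperators

section Degree

open unitInterval

variable {V : Type*} [NormedAddCommGroup V] [InnerProductSpace ℝ V] [FiniteDimensional ℝ V]
  {W : Type*} [NormedAddCommGroup W] [InnerProductSpace ℝ W] [FiniteDimensional ℝ W]
  {E : Type*} [NormedAddCommGroup E] [NormedSpace ℝ E] {d : ℕ}

/-- A continuous map equal to `1` outside of a ball. -/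
structure BallSupp {G : Type*} [TopologicalSpace G] [One G] (R : ℝ) (g : E → G) : Prop where
  cont : Continuous g
  eq_one : ∀ y, R ≤ ‖y‖ → g y = 1

namespace BallSupp

variable {G : Type*} [TopologicalSpace G] {R : ℝ}

theorem hasCompactMulSupport [One G] {g : E → G} (h : BallSupp R g) (e : (Fin d → ℝ) ≃L[ℝ] E) :
    HasCompactMulSupport fun y => g (e y) := by
  have hE : FiniteDimensional ℝ E := Module.Finite.equiv e.toLinearEquiv
  have hp : ProperSpace E := FiniteDimensional.proper ℝ E
  refine HasCompactMulSupport.intro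
    (e.toHomeomorph.isCompact_preimage.2 (isCompact_closedBall (0 : E) R)) fun y hy => ?_
  refine h.eq_one _ ?_
  rw [Set.mem_preimage, mem_closedBall_zero_iff, not_le] at hy
  exact hy.le

theorem mul [Monoid G] [ContinuousMul G] {g h : E → G} (hg : BallSupp R g) (hh : BallSupp R h) :
    BallSupp R fun y => g y * h y :=
  ⟨hg.cont.mul hh.cont, fun y hy => by rw [hg.eq_one y hy, hh.eq_one y hy, one_mul]⟩

theorem inv [Group G] [ContinuousInv G] {g : E → G} (hg : BallSupp R g) :
    BallSupp R fun y => (g y)⁻¹ :=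
  ⟨hg.cont.inv, fun y hy => by rw [hg.eq_one y hy, inv_one]⟩

theorem conj [Group G] [ContinuousMul G] {g : E → G} (hg : BallSupp R g) (k : G) :
    BallSupp R fun y => k * g y * k⁻¹ :=
  ⟨(hg.cont.const_mul k).mul_const _, fun y hy => by
    rw [hg.eq_one y hy, mul_one, mul_inv_cancel]⟩

end BallSupp

/-- The degree of a compactly supported family of invertible operators. -/
noncomputable def edeg (e : (Fin d → ℝ) ≃L[ℝ] E) (g : E → (V →L[ℝ] V)ˣ) : ℝ :=
  mcDeg (trForm V d) fun y => g (e y)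

variable {e : (Fin d → ℝ) ≃L[ℝ] E} {g h : E → (V →L[ℝ] V)ˣ} {R : ℝ}

theorem edeg_mul [NeZero d] (hg : BallSupp R g) (hh : BallSupp R h) :
    edeg e (fun y => g y * h y) = edeg e g + edeg e h :=
  mcDeg_mul (adInvariant_trForm d) (hg.cont.comp e.continuous) (hh.cont.comp e.continuous)
    (hg.hasCompactMulSupport e) (hh.hasCompactMulSupport e)

theorem edeg_one [NeZero d] : edeg e (fun _ => (1 : (V →L[ℝ] V)ˣ)) = 0 :=
  mcDeg_one (adInvariant_trForm d)

theorem edeg_inv [NeZero d] (hg : BallSupp R g) : edeg e (fun y => (g y)⁻¹) = -edeg e g :=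
  mcDeg_inv (adInvariant_trForm d) (hg.cont.comp e.continuous) (hg.hasCompactMulSupport e)

theorem edeg_homotopy {H : I × E → (V →L[ℝ] V)ˣ} (hH : Continuous H)
    (h1 : ∀ s y, R ≤ ‖y‖ → H (s, y) = 1) (s t : I) :
    edeg e (fun y => H (s, y)) = edeg e fun y => H (t, y) := by
  have hE : FiniteDimensional ℝ E := Module.Finite.equiv e.toLinearEquiv
  have hp : ProperSpace E := FiniteDimensional.proper ℝ E
  refine mcDeg_eq_of_homotopy (adInvariant_trForm d) (H := fun p => H (p.1, e p.2))
    (hH.comp (by fun_prop))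
    (e.toHomeomorph.isCompact_preimage.2 (isCompact_closedBall (0 : E) R)) (fun s y hy => ?_) s t
  rw [Set.mem_preimage, mem_closedBall_zero_iff, not_le] at hy
  exact h1 _ _ hy.le

theorem edeg_comp_equiv (hg : BallSupp R g) (A : E ≃L[ℝ] E)
    (hA : LinearMap.det (A : E →ₗ[ℝ] E) < 0) : edeg e (fun y => g (A y)) = -edeg e g := by
  have h1 := mcDeg_comp_equiv (adInvariant_trForm d) (hg.cont.comp e.continuous)
    (hg.hasCompactMulSupport e) ((e.trans A).trans e.symm) (by
      rw [← LinearMap.det_conj (A : E →ₗ[ℝ] E) e.symm.toLinearEquiv] at hA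
      exact hA)
  simpa [edeg, Function.comp_def] using h1

theorem edeg_map_equiv (hg : BallSupp R g) (U : V ≃L[ℝ] W) :
    edeg e (fun y => Units.map (U.conjContinuousAlgEquiv : (V →L[ℝ] V) →* (W →L[ℝ] W)) (g y)) =
      edeg e g := by
  refine mcDeg_map (adInvariant_trForm d) (adInvariant_trForm d) _ 0
    (U.conjContinuousAlgEquiv : (V →L[ℝ] V) →L[ℝ] (W →L[ℝ] W)) (fun a => (zero_add _).symm)
    (fun a b => (map_mul U.conjContinuousAlgEquiv a b).symm) (fun w => ?_)
    (hg.cont.comp e.continuous) (hg.hasCompactMulSupport e)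
  rw [trForm_apply, trForm_apply]
  refine Finset.sum_congr rfl fun τ _ => ?_
  congr 1
  have h1 : (List.ofFn fun i => U.conjContinuousAlgEquiv (w (τ i))).prod =
      U.conjContinuousAlgEquiv (List.ofFn fun i => w (τ i)).prod := by
    rw [map_list_prod, List.map_ofFn]; rfl
  refine (congrArg (trCLM W) h1).trans ?_
  rw [trCLM_apply, trCLM_apply]
  exact LinearMap.trace_conj' _ U.toLinearEquiv

theorem edeg_conj (hg : BallSupp R g) (k : (V →L[ℝ] V)ˣ) :
    edeg e (fun y => k * g y * k⁻¹) = edeg e g :=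
  edeg_map_equiv hg (ContinuousLinearEquiv.unitsEquiv ℝ V k)

theorem trCLM_extL (W : Submodule ℝ V) (B : W →L[ℝ] W) : trCLM V (extL W B) = trCLM W B := by
  rw [trCLM_apply, trCLM_apply]
  refine (LinearMap.trace_comp_comm' (W.orthogonalProjectionOnto : V →ₗ[ℝ] W)
    (W.subtype ∘ₗ (B : W →ₗ[ℝ] W))).trans ?_
  congr 1
  ext w
  simp

theorem edeg_extHom [NeZero d] (W : Submodule ℝ V) {g : E → (W →L[ℝ] W)ˣ} (hg : BallSupp R g) :
    edeg e (fun y => Units.map (extHom W) (g y)) = edeg e g := by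
  refine mcDeg_map (adInvariant_trForm d) (adInvariant_trForm d) (extHom W)
    (1 - W.starProjection) (extL W) (fun a => extHom_eq W a) (fun a b => ?_) (fun w => ?_)
    (hg.cont.comp e.continuous) (hg.hasCompactMulSupport e)
  · ext v
    rw [clm_mul_apply, extL_apply, extHom_apply_mem, extL_apply, clm_mul_apply]
  rw [trForm_apply, trForm_apply]
  refine Finset.sum_congr rfl fun τ _ => ?_
  congr 1
  have h1 : ∀ (k : ℕ) (v : Fin (k + 1) → W →L[ℝ] W), (List.ofFn fun i => extL W (v i)).prod =
      extL W (List.ofFn v).prod := by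
    intro k
    induction k with
    | zero => intro v; simp
    | succ k ih =>
      intro v
      rw [List.ofFn_succ, List.prod_cons, ih fun i => v i.succ, ← extL_mul, List.ofFn_succ (f := v),
        List.prod_cons]
  obtain ⟨k, rfl⟩ := Nat.exists_eq_succ_of_ne_zero (NeZero.ne d)
  refine (congrArg (trCLM V) (h1 k fun i => w (τ i))).trans ?_
  exact trCLM_extL W _

theorem edeg_cenS_eq_zero (hd : d = Module.finrank ℝ V + 1) {J : V →L[ℝ] V} (hJ : J * J = -1)
    (hg : BallSupp R g) (hgJ : ∀ y, g y ∈ cenS J) : edeg e g = 0 := by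
  set S : Subalgebra ℝ (V →L[ℝ] V) := Subalgebra.centralizer ℝ {J} with hS
  have hmem : ∀ y, g y ∈ cenS J → (g y : V →L[ℝ] V) ∈ S := fun y h => by
    rw [hS, Subalgebra.mem_centralizer_iff]
    rintro _ rfl
    exact (mem_cenS.1 h).symm
  have hmem' : ∀ y, (↑(g y)⁻¹ : V →L[ℝ] V) ∈ S := fun y => by
    rw [hS, Subalgebra.mem_centralizer_iff]
    rintro _ rfl
    exact (mem_cenS.1 (inv_mem (hgJ y))).symm
  have hfin : FiniteDimensional ℝ S := inferInstance
  have hcomp : CompleteSpace S := FiniteDimensional.complete ℝ S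
  let g' : E → Sˣ := fun y => ⟨⟨g y, hmem y (hgJ y)⟩, ⟨↑(g y)⁻¹, hmem' y⟩,
    Subtype.ext (Units.mul_inv _), Subtype.ext (Units.inv_mul _)⟩
  have hg' : BallSupp R g' := by
    refine ⟨continuous_units_iff.2 ((Units.continuous_val.comp hg.cont).subtype_mk _), fun y hy => ?_⟩
    refine Units.ext (Subtype.ext ?_)
    change (g y : V →L[ℝ] V) = 1
    rw [hg.eq_one y hy]; rfl
  have h0 : AdInvariant (0 : S [⋀^Fin d]→L[ℝ] ℝ) := fun u w => rfl
  have h1 := mcDeg_map h0 (adInvariant_trForm (V := V) d) (S.val : S →* (V →L[ℝ] V)) 0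
    S.toSubmodule.subtypeL (fun a => (zero_add _).symm) (fun a b => rfl) (fun w => ?_)
    (hg'.cont.comp e.continuous) (hg'.hasCompactMulSupport e)
  · refine h1.trans ?_
    rw [mcDeg]
    split_ifs
    · simp [mcInt, mcForm_apply]
    · rfl
  · refine trForm_eq_zero_of_commute hd hJ _ fun i => ?_
    exact (Subalgebra.mem_centralizer_iff ℝ |>.1 (w i).2 J rfl).symm

end Degree

section Exponential

open unitInterval

variable {V : Type*} [NormedAddCommGroup V] [InnerProductSpace ℝ V] [FiniteDimensional ℝ V]
  {E : Type*} [NormedAddCommGroup E] [InnerProductSpace ℝ E] {d : ℕ}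

/-- Radial profiles: the components of a path in the circle ending at `1`. -/
structure IsProfile (p q : ℝ → ℝ) : Prop where
  cont_p : Continuous p
  cont_q : Continuous q
  sq : ∀ r, p r ^ 2 + q r ^ 2 = 1
  zero : q 0 = 0
  one : ∀ r, 1 ≤ r → p r = 1 ∧ q r = 0

theorem IsCS.smul_mul_smul {J : V →L[ℝ] V} (hJ : IsCS J) {a b : ℝ} (h : a ^ 2 + b ^ 2 = 1) :
    (a • (1 : V →L[ℝ] V) + b • J) * (a • 1 - b • J) = 1 ∧
      (a • (1 : V →L[ℝ] V) - b • J) * (a • 1 + b • J) = 1 := by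
  have h1 := hJ.1
  constructor
  · simp only [add_mul, mul_sub, smul_mul_smul_comm, one_mul, mul_one, h1]
    linear_combination (norm := module) h • (1 : V →L[ℝ] V)
  · simp only [sub_mul, mul_add, smul_mul_smul_comm, one_mul, mul_one, h1]
    linear_combination (norm := module) h • (1 : V →L[ℝ] V)

theorem IsCS.isUnit {J : V →L[ℝ] V} (hJ : IsCS J) {a b : ℝ} (h : a ^ 2 + b ^ 2 = 1) :
    IsUnit (a • (1 : V →L[ℝ] V) + b • J) :=
  ⟨⟨_, _, (hJ.smul_mul_smul h).1, (hJ.smul_mul_smul h).2⟩, rfl⟩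

/-- The family of operators `p + q J` on a Euclidean space. -/
noncomputable def csExp (p q : ℝ → ℝ) (J : USph E → CS V) (b₀ : USph E) (y : E) :
    (V →L[ℝ] V)ˣ := unitOf (p ‖y‖ • 1 + q ‖y‖ • (J (dirTo b₀ y)).1)

variable {p q : ℝ → ℝ}

theorem IsProfile.val_csExp (h : IsProfile p q) (J : USph E → CS V) (b₀ : USph E) (y : E) :
    (csExp p q J b₀ y : V →L[ℝ] V) = p ‖y‖ • 1 + q ‖y‖ • (J (dirTo b₀ y)).1 :=
  val_unitOf ((J (dirTo b₀ y)).2.isUnit (h.sq _))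

theorem IsProfile.csExp_apply (h : IsProfile p q) (J : USph E → CS V) (b₀ : USph E) (y : E)
    (v : V) : (csExp p q J b₀ y : V →L[ℝ] V) v = p ‖y‖ • v + q ‖y‖ • (J (dirTo b₀ y)).1 v := by
  rw [h.val_csExp]; rfl

theorem IsProfile.csExp_mem_orth (h : IsProfile p q) (J : USph E → CS V) (b₀ : USph E) (y : E) :
    csExp p q J b₀ y ∈ orth V := by
  intro u v
  have hJ := (J (dirTo b₀ y)).2
  have h1 := hJ.inner_right u v
  have h2 := h.sq ‖y‖
  simp only [h.csExp_apply, inner_add_left, inner_add_right, real_inner_smul_left,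
    real_inner_smul_right, hJ.2, h1]
  linear_combination h2 * inner ℝ u v

theorem IsProfile.csExp_eq_one (h : IsProfile p q) (J : USph E → CS V) (b₀ : USph E) {y : E}
    (hy : 1 ≤ ‖y‖) : csExp p q J b₀ y = 1 := by
  obtain ⟨h1, h2⟩ := h.one _ hy
  refine Units.ext ?_
  rw [h.val_csExp, h1, h2]
  simp

theorem IsProfile.continuous_csExp (h : IsProfile p q) {X : Type*} [TopologicalSpace X]
    {J : X × USph E → CS V} (hJ : Continuous J) (b₀ : USph E) {v : X → E} (hv : Continuous v) :
    Continuous fun x => csExp p q (fun b => J (x, b)) b₀ (v x) := by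
  refine continuous_unitOf_comp ?_ fun x => (J _).2.isUnit (h.sq _)
  refine ((h.cont_p.comp hv.norm).smul continuous_const).add ?_
  refine continuous_smul_dirTo (f := fun p => (J p).1) (continuous_subtype_val.comp hJ) (C := 1)
    (fun p => ?_) b₀ (h.cont_q.comp hv.norm) hv fun x hx => ?_
  · exact ContinuousLinearMap.opNorm_le_bound _ zero_le_one fun x => by
      rw [(J p).2.norm_apply, one_mul]
  · rw [Function.comp_apply, hx, norm_zero, h.zero]

theorem IsProfile.ballSupp_csExp (h : IsProfile p q) (J : C(USph E, CS V)) (b₀ : USph E) :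
    BallSupp 1 (csExp p q J b₀) :=
  ⟨h.continuous_csExp (J := fun x : E × USph E => J x.2) (by fun_prop) b₀ continuous_id,
    fun _ hy => h.csExp_eq_one J b₀ hy⟩

theorem IsProfile.edeg_csExp_homotopic [NeZero d] (h : IsProfile p q)
    {e : (Fin d → ℝ) ≃L[ℝ] E} {J J' : C(USph E, CS V)} (hJ : J.Homotopic J') (b₀ : USph E) :
    edeg e (csExp p q J b₀) = edeg e (csExp p q J' b₀) := by
  obtain ⟨F⟩ := hJ
  have := edeg_homotopy (e := e) (R := 1)
    (H := fun x : I × E => csExp p q (fun b => F (x.1, b)) b₀ x.2)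
    (h.continuous_csExp (J := fun z : (I × E) × USph E => F (z.1.1, z.2)) (by fun_prop) b₀
      continuous_snd) (fun s y hy => h.csExp_eq_one _ b₀ hy) 0 1
  simpa using this

end Exponential

section CliffordSphere

theorem exists_clifford_degree (n : ℕ) {E : Type*} [NormedAddCommGroup E] [InnerProductSpace ℝ E]
    [FiniteDimensional ℝ E] (hE : Module.finrank ℝ E = 4 * n + 3) (b₀ : USph E) :
    ∃ (e : (Fin (4 * n + 3) → ℝ) ≃L[ℝ] E) (V : Type) (_ : NormedAddCommGroup V)
      (_ : InnerProductSpace ℝ V) (_ : FiniteDimensional ℝ V) (J : C(USph E, CS V)) (p q : ℝ → ℝ),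
      IsProfile p q ∧ 4 * n + 4 ≤ Module.finrank ℝ V ∧ edeg e (csExp p q J b₀) ≠ 0 := by
  obtain ⟨ι, _, _, C, hC, hC0⟩ := exists_isCliff n
  obtain ⟨p, q, hs, hpq, h1, -, hneg⟩ := exists_radial_profile
  have : NeZero (4 * n + 3) := ⟨by omega⟩
  let B : OrthonormalBasis (Fin (4 * n + 3)) ℝ E := (stdOrthonormalBasis ℝ E).reindex (finCongr hE)
  let e : (Fin (4 * n + 3) → ℝ) ≃L[ℝ] E :=
    (EuclideanSpace.equiv (Fin (4 * n + 3)) ℝ).symm.trans B.repr.symm.toContinuousLinearEquiv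
  have he : ∀ y, ‖e y‖ ^ 2 = dotProduct y y := fun y => by
    change ‖B.repr.symm (WithLp.toLp 2 y)‖ ^ 2 = _
    rw [LinearIsometryEquiv.norm_map, EuclideanSpace.norm_sq_eq, dotProduct]
    exact Finset.sum_congr rfl fun i _ => by rw [Real.norm_eq_abs, sq_abs, sq]
  set T := cliffMap C with hT
  have hTc : IsCliffMap T := hC.isCliffMap
  have hJ : ∀ x : USph E, IsCS (T (e.symm x)) := by
    intro x
    have hx : dotProduct (e.symm x) (e.symm x) = 1 := by
      rw [← he, e.apply_symm_apply, x.norm_eq, one_pow]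
    have h2 : T (e.symm x) * T (e.symm x) = -1 := by
      rw [hTc.mul_self, hx, neg_smul, one_smul]
    refine ⟨h2, fun u v => ?_⟩
    rw [hC.inner_cliffMap, ← clm_mul_apply, h2]
    simp
  let J : C(USph E, CS (EuclideanSpace ℝ ι)) := ⟨fun x => ⟨T (e.symm x), hJ x⟩,
    (T.continuous.comp (e.symm.continuous.comp continuous_subtype_val)).subtype_mk _⟩
  have hsq : ∀ r : ℝ, 0 ≤ r ^ 2 := sq_nonneg
  have hprof : IsProfile (fun r => p (r ^ 2)) (fun r => r * q (r ^ 2)) := by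
    refine ⟨?_, ?_, fun r => ?_, by simp, fun r hr => ?_⟩
    · exact continuous_iff_continuousAt.2 fun r => ContinuousAt.comp (f := fun r : ℝ => r ^ 2)
        (hs _ (hsq r)).1.continuousAt (by fun_prop)
    · exact continuous_id.mul (continuous_iff_continuousAt.2 fun r =>
        ContinuousAt.comp (f := fun r : ℝ => r ^ 2)
        (hs _ (hsq r)).2.continuousAt (by fun_prop))
    · linear_combination hpq _ (hsq r)
    · have := h1 (r ^ 2) (one_le_pow₀ hr)
      simp [this.1, this.2]
  have hexp : ∀ y, csExp (fun r => p (r ^ 2)) (fun r => r * q (r ^ 2)) J b₀ (e y) =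
      radialUnit hTc hpq y := by
    intro y
    refine unitOf_eq ?_
    change p (‖e y‖ ^ 2) • (1 : EuclideanSpace ℝ ι →L[ℝ] EuclideanSpace ℝ ι) +
      (‖e y‖ * q (‖e y‖ ^ 2)) • T (e.symm (dirTo b₀ (e y))) = radialMap p q T y
    have h6 : ‖e y‖ • e.symm (dirTo b₀ (e y)) = y := by
      rw [← map_smul e.symm, norm_smul_dirTo, e.symm_apply_apply]
    rw [mul_comm ‖e y‖, mul_smul, ← map_smul T, h6, he, radialMap]
  refine ⟨e, EuclideanSpace ℝ ι, inferInstance, inferInstance, inferInstance, J, _, _, hprof, ?_, ?_⟩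
  · have hι : Nonempty ι := by
      by_contra h
      rw [not_nonempty_iff] at h
      exact hC0 (by simp [Matrix.trace])
    obtain ⟨i⟩ := hι
    set u : EuclideanSpace ℝ ι := EuclideanSpace.single i 1 with hu
    have hu0 : u ≠ 0 := by simp [hu]
    let L : (ℝ × (Fin (4 * n + 3) → ℝ)) →ₗ[ℝ] EuclideanSpace ℝ ι :=
      (LinearMap.toSpanSingleton ℝ _ u).coprod
        ((ContinuousLinearMap.apply ℝ (EuclideanSpace ℝ ι) u ∘L T : _ →L[ℝ] _) : _ →ₗ[ℝ] _)
    have hL : Function.Injective L := by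
      rw [← LinearMap.ker_eq_bot, LinearMap.ker_eq_bot']
      rintro ⟨a, y⟩ h
      have h' : a • u + T y u = 0 := h
      have hz : inner ℝ (T y u) u = 0 := by
        have := hC.inner_cliffMap y u u
        rw [real_inner_comm (T y u) u] at this
        linarith
      have ha : a = 0 := by
        have := congrArg (fun w => inner ℝ w u) h'
        simpa [inner_add_left, real_inner_smul_left, hz, hu0] using this
      rw [ha, zero_smul, zero_add] at h'
      have h3 := congrArg (T y) h'
      rw [← clm_mul_apply, hTc.mul_self, map_zero] at h3
      have h4 := congrArg (fun w => inner ℝ w u) h3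
      have h5 : dotProduct y y = 0 := by simpa [real_inner_smul_left, hu0] using h4
      rw [ha, dotProduct_self_eq_zero.1 h5]; rfl
    have := LinearMap.finrank_le_finrank_of_injective hL
    simp only [Module.finrank_prod, Module.finrank_self, Module.finrank_fin_fun] at this
    omega
  · intro h0
    have h2 := hprof.ballSupp_csExp J b₀
    have h3 := edeg_mul (e := e) h2 h2
    rw [h0, add_zero] at h3
    refine mcDeg_radialUnit_sq_ne_zero (adInvariant_trForm _) ⟨2 * n + 1, by omega⟩ (by omega) hTc hs
      hpq h1 hneg (hC.trForm_cliffMap_ne_zero hC0) ?_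
    rw [edeg] at h3
    simpa only [hexp] using h3

end CliffordSphere

section Restriction

universe u

variable {V : Type u} [NormedAddCommGroup V] [InnerProductSpace ℝ V] [FiniteDimensional ℝ V]
  {d : ℕ}

theorem apply_mem_of_mem_orth {W : Submodule ℝ V} {g : (V →L[ℝ] V)ˣ} (ho : g ∈ orth V)
    (hfix : ∀ w ∈ Wᗮ, (g : V →L[ℝ] V) w = w) {w : V} (hw : w ∈ W) : (g : V →L[ℝ] V) w ∈ W := by
  rw [← W.orthogonal_orthogonal, Submodule.mem_orthogonal]
  intro z hz
  rw [← hfix z hz, mem_orth.1 ho]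
  exact Submodule.inner_left_of_mem_orthogonal hw hz

theorem exists_restrict {X : Type*} [TopologicalSpace X] {W : Submodule ℝ V}
    {g : X → (V →L[ℝ] V)ˣ} (hg : Continuous g) (ho : ∀ y, g y ∈ orth V)
    (hfix : ∀ y, ∀ w ∈ Wᗮ, (g y : V →L[ℝ] V) w = w) :
    ∃ g' : X → (W →L[ℝ] W)ˣ, Continuous g' ∧ (∀ y, g' y ∈ orth W) ∧
      (∀ y, Units.map (extHom W : (W →L[ℝ] W) →* (V →L[ℝ] V)) (g' y) = g y) ∧
      ∀ y, g y = 1 → g' y = 1 := by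
  have hm : ∀ y, ∀ w ∈ W, (g y : V →L[ℝ] V) w ∈ W := fun y w hw =>
    apply_mem_of_mem_orth (ho y) (hfix y) hw
  have hu : ∀ y, IsUnit (compr W (g y : V →L[ℝ] V)) := fun y => isUnit_compr (hm y)
  refine ⟨fun y => unitOf (compr W (g y)), continuous_unitOf_comp
    ((compr W).continuous.comp (Units.continuous_val.comp hg)) hu, fun y => ?_, fun y => ?_,
    fun y hy => unitOf_eq ?_⟩
  · refine mem_orth.2 fun a b => ?_
    rw [val_unitOf (hu y), Submodule.coe_inner, compr_apply_of_mem W (hm y a a.2),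
      compr_apply_of_mem W (hm y b b.2), mem_orth.1 (ho y), Submodule.coe_inner]
  · refine Units.ext ?_
    rw [Units.coe_map, val_unitOf (hu y)]
    exact extHom_compr (hm y) (hfix y)
  · rw [hy]; exact compr_one

theorem exists_restrict_edeg {E : Type*} [NormedAddCommGroup E] [NormedSpace ℝ E] [NeZero d]
    {e : (Fin d → ℝ) ≃L[ℝ] E} {R : ℝ} {W : Submodule ℝ V} {g : E → (V →L[ℝ] V)ˣ}
    (hg : BallSupp R g) (ho : ∀ y, g y ∈ orth V)
    (hfix : ∀ y, ∀ w ∈ Wᗮ, (g y : V →L[ℝ] V) w = w) :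
    ∃ g' : E → (W →L[ℝ] W)ˣ, BallSupp R g' ∧ (∀ y, g' y ∈ orth W) ∧ edeg e g' = edeg e g := by
  obtain ⟨g', h1, h2, h3, h4⟩ := exists_restrict hg.cont ho hfix
  have h5 : BallSupp R g' := ⟨h1, fun y hy => h4 y (hg.eq_one y hy)⟩
  refine ⟨g', h5, h2, ?_⟩
  rw [← edeg_extHom W h5]
  simp only [h3]

end Restriction

section Compression

universe u

variable {V : Type u} [NormedAddCommGroup V] [InnerProductSpace ℝ V] [FiniteDimensional ℝ V]
  {E : Type*} [NormedAddCommGroup E] [InnerProductSpace ℝ E] [FiniteDimensional ℝ E]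
  {d : ℕ} [NeZero d] {e : (Fin d → ℝ) ≃L[ℝ] E} {p q : ℝ → ℝ}

/-- The commutator-like square of `csExp` with a reflection. -/
theorem IsProfile.ballSupp_refl_sq (h : IsProfile p q) (J : C(USph E, CS V)) (b₀ : USph E)
    (v : V) : BallSupp 1 fun y =>
      hrefl v * csExp p q J b₀ y * (hrefl v)⁻¹ * csExp p q J b₀ y :=
  ((h.ballSupp_csExp J b₀).conj _).mul (h.ballSupp_csExp J b₀)

theorem IsProfile.edeg_refl_sq (h : IsProfile p q) (J : C(USph E, CS V)) (b₀ : USph E) (v : V) :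
    edeg e (fun y => hrefl v * csExp p q J b₀ y * (hrefl v)⁻¹ * csExp p q J b₀ y) =
      2 * edeg e (csExp p q J b₀) := by
  have hb := h.ballSupp_csExp J b₀
  rw [edeg_mul (hb.conj _) hb, edeg_conj hb, two_mul]

theorem IsProfile.refl_sq_apply_self (h : IsProfile p q) (J : C(USph E, CS V)) (b₀ : USph E)
    (v : V) (y : E) :
    ((hrefl v * csExp p q J b₀ y * (hrefl v)⁻¹ * csExp p q J b₀ y : (V →L[ℝ] V)ˣ) :
      V →L[ℝ] V) v = v := by
  have hJ := (J (dirTo b₀ y)).2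
  have h1 : (hrefl v : V →L[ℝ] V) ((J (dirTo b₀ y)).1 v) = (J (dirTo b₀ y)).1 v :=
    hrefl_apply_of_orthogonal (by rw [hJ.inner_right, hJ.inner_self, neg_zero])
  have h2 := h.sq ‖y‖
  simp only [hrefl_inv, Units.val_mul, clm_mul_apply, h.csExp_apply, map_add, map_smul, h1,
    hrefl_apply_self, hJ.apply_apply, smul_neg, map_neg]
  linear_combination (norm := module) h2 • v

theorem IsProfile.refl_sq_apply_image (h : IsProfile p q) (J : C(USph E, CS V)) (b₀ : USph E)
    (v : V) (y : E) :
    ((hrefl v * csExp p q J b₀ y * (hrefl v)⁻¹ * csExp p q J b₀ y : (V →L[ℝ] V)ˣ) :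
      V →L[ℝ] V) ((J (dirTo b₀ y)).1 v) = (J (dirTo b₀ y)).1 v := by
  have hJ := (J (dirTo b₀ y)).2
  have h1 : (hrefl v : V →L[ℝ] V) ((J (dirTo b₀ y)).1 v) = (J (dirTo b₀ y)).1 v :=
    hrefl_apply_of_orthogonal (by rw [hJ.inner_right, hJ.inner_self, neg_zero])
  have h2 := h.sq ‖y‖
  simp only [hrefl_inv, Units.val_mul, clm_mul_apply, h.csExp_apply, map_add, map_smul, h1,
    hrefl_apply_self, hJ.apply_apply, smul_neg, map_neg]
  linear_combination (norm := module) h2 • ((J (dirTo b₀ y)).1 v)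

theorem IsProfile.exists_compress (h : IsProfile p q) (J : C(USph E, CS V)) (b₀ : USph E)
    (hd : Module.finrank ℝ E + 1 < Module.finrank ℝ V) :
    ∃ (W : Submodule ℝ V) (J' : C(USph E, CS W)), Module.finrank ℝ W < Module.finrank ℝ V ∧
      Module.finrank ℝ V ≤ Module.finrank ℝ W + 2 ∧
      edeg e (csExp p q J' b₀) = edeg e (csExp p q J b₀) := by
  have hV : Nontrivial V := Module.nontrivial_of_finrank_pos (R := ℝ) (by omega)
  obtain ⟨v', hv'⟩ := exists_norm_eq V zero_le_one
  let v : USph V := USph.mk v' hv'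
  have hperp := finrank_perp v
  have hnt : Nontrivial (perp v) := Module.nontrivial_of_finrank_pos (R := ℝ) (by omega)
  obtain ⟨w', hw'⟩ := exists_norm_eq (perp v) zero_le_one
  let w : USph (perp v) := USph.mk w' hw'
  let ν : C(USph E, USph (perp v)) := ⟨fun x => USph.mk ⟨(J x).1 v, mem_perp.2 (by
      rw [(J x).2.inner_right, (J x).2.inner_self, neg_zero])⟩ (by
      rw [Submodule.coe_norm, (J x).2.norm_apply, v.norm_eq]), by
    refine Continuous.subtype_mk (Continuous.subtype_mk ?_ _) _
    exact (ContinuousLinearMap.apply ℝ V (v : V)).continuous.comp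
      (continuous_subtype_val.comp J.continuous)⟩
  obtain ⟨F⟩ := sphere_homotopic_const (by omega) ν w
  let H : unitInterval × USph E → USph V := fun z => USph.mk ((F z : perp v) : V) (by
    rw [← Submodule.coe_norm, (F z).norm_eq])
  have hH : Continuous H := Continuous.subtype_mk (by fun_prop) _
  obtain ⟨G, hG, hG0, hGo, hGH, -, hGx⟩ := exists_rot_transport hH
  have hGv : ∀ t x, (G (t, x) : V →L[ℝ] V) v = v := fun t x =>
    hGx x v (fun t => inner_perp' _) t
  have hH0 : ∀ x, (H (0, x) : V) = (J x).1 v := fun x => by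
    change ((F (0, x) : perp v) : V) = _
    rw [F.apply_zero]; rfl
  have hH1 : ∀ x, (H (1, x) : V) = (w : perp v) := fun x => by
    change ((F (1, x) : perp v) : V) = _
    rw [F.apply_one]; rfl
  let K : C(unitInterval × USph E, CS V) :=
    ⟨fun z => ⟨(G z : V →L[ℝ] V) * (J z.2).1 * (↑(G z)⁻¹ : V →L[ℝ] V), (J z.2).2.conj (hGo z)⟩,
      Continuous.subtype_mk (((Units.continuous_val.comp hG).mul
        (continuous_subtype_val.comp (J.continuous.comp continuous_snd))).mul
        (Units.continuous_val.comp hG.inv)) _⟩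
  let J₁ : C(USph E, CS V) := ⟨fun x => K (1, x), by fun_prop⟩
  have hJ₁ : J.Homotopic J₁ := ⟨⟨K, fun x => Subtype.ext (by
    change (G (0, x) : V →L[ℝ] V) * (J x).1 * (↑(G (0, x))⁻¹ : V →L[ℝ] V) = _
    rw [hG0]; simp), fun x => rfl⟩⟩
  have hJv : ∀ x, (J₁ x).1 v = (w : perp v) := fun x => by
    have h1 : (↑(G (1, x))⁻¹ : V →L[ℝ] V) v = v := by
      conv_lhs => rw [← hGv 1 x]
      simp
    change ((G (1, x) : V →L[ℝ] V) * (J x).1 * (↑(G (1, x))⁻¹ : V →L[ℝ] V)) v = _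
    rw [clm_mul_apply, clm_mul_apply, h1, ← hH0]
    exact (hGH 1 x).trans (hH1 x)
  let W : Submodule ℝ V := (Submodule.span ℝ {(v : V), ((w : perp v) : V)})ᗮ
  have hWW : Wᗮ = Submodule.span ℝ {(v : V), ((w : perp v) : V)} :=
    Submodule.orthogonal_orthogonal _
  have hvW : ∀ z ∈ W, inner ℝ (v : V) z = 0 := fun z hz => (mem_orthogonal_pair.1 hz).1
  have hJW : ∀ x, ∀ z ∈ W, (J₁ x).1 z ∈ W := fun x z hz => by
    obtain ⟨h1, h2⟩ := mem_orthogonal_pair.1 hz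
    refine mem_orthogonal_pair.2 ⟨?_, ?_⟩
    · rw [(J₁ x).2.inner_right, hJv, h2, neg_zero]
    · rw [← hJv x, (J₁ x).2.2, h1]
  let J₂ : C(USph E, CS W) := ⟨fun x => ⟨compr W (J₁ x).1, (J₁ x).2.compr (hJW x)⟩,
    Continuous.subtype_mk ((compr W).continuous.comp
      (continuous_subtype_val.comp J₁.continuous)) _⟩
  refine ⟨W, J₂, ?_, ?_, ?_⟩
  · refine Submodule.finrank_lt fun htop => ?_
    have h1 := hvW v (htop ▸ Submodule.mem_top)
    rw [v.inner_self] at h1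
    exact one_ne_zero h1
  · have h1 := Submodule.finrank_add_finrank_orthogonal
      (Submodule.span ℝ {(v : V), ((w : perp v) : V)})
    classical
    have h2 := finrank_span_finset_le_card (R := ℝ) ({(v : V), ((w : perp v) : V)} : Finset V)
    have h3 := Finset.card_le_two (a := (v : V)) (b := ((w : perp v) : V))
    rw [Finset.coe_pair] at h2
    change _ + Module.finrank ℝ W = _ at h1
    rw [Set.finrank] at h2
    omega
  · rw [h.edeg_csExp_homotopic hJ₁]
    have h1 := h.edeg_refl_sq (e := e) J₁ b₀ v
    have hb := h.ballSupp_csExp J₂ b₀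
    have h2 := edeg_extHom (e := e) W (hb.mul hb)
    rw [edeg_mul hb hb, ← two_mul] at h2
    have h3 : ∀ y, Units.map (extHom W : (W →L[ℝ] W) →* (V →L[ℝ] V))
        (csExp p q J₂ b₀ y * csExp p q J₂ b₀ y) =
        hrefl (v : V) * csExp p q J₁ b₀ y * (hrefl (v : V))⁻¹ * csExp p q J₁ b₀ y := by
      intro y
      have hc : ∀ z : W, (((csExp p q J₂ b₀ y : W →L[ℝ] W) z : W) : V) =
          (csExp p q J₁ b₀ y : V →L[ℝ] V) z := fun z => by
        rw [h.csExp_apply, h.csExp_apply, Submodule.coe_add, Submodule.coe_smul,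
          Submodule.coe_smul]
        congr 2
        exact compr_apply_of_mem W (hJW _ z z.2)
      refine Units.ext (clm_ext_of_orthogonal (W := W) (fun z hz => ?_) fun z hz => ?_)
      · rw [Units.coe_map, extHom_apply_mem W _ ⟨z, hz⟩]
        simp only [hrefl_inv, Units.val_mul, clm_mul_apply, hc]
        rw [← hc ⟨z, hz⟩, hrefl_apply_of_orthogonal (hvW _ (Subtype.prop _)), ← hc,
          hrefl_apply_of_orthogonal (hvW _ (Subtype.prop _))]
      · rw [Units.coe_map, extHom_apply_orth W _ hz]
        rw [hWW] at hz
        obtain ⟨s, t, rfl⟩ := Submodule.mem_span_pair.1 hz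
        have h5 := h.refl_sq_apply_image J₁ b₀ v y
        rw [hJv] at h5
        rw [map_add, map_smul, map_smul, h.refl_sq_apply_self, h5]
    simp only [h3, h1] at h2
    linarith

theorem IsProfile.exists_compress_all (h : IsProfile p q) (b₀ : USph E) {n : ℕ}
    (hE : Module.finrank ℝ E = 4 * n + 3) (k : ℕ) :
    ∀ (V : Type u) [NormedAddCommGroup V] [InnerProductSpace ℝ V] [FiniteDimensional ℝ V]
      (J : C(USph E, CS V)), Module.finrank ℝ V = k → 4 * n + 4 ≤ k →
      ∃ (W : Type u) (_ : NormedAddCommGroup W) (_ : InnerProductSpace ℝ W)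
        (_ : FiniteDimensional ℝ W) (J' : C(USph E, CS W)), Module.finrank ℝ W = 4 * n + 4 ∧
        edeg e (csExp p q J' b₀) = edeg e (csExp p q J b₀) := by
  induction k using Nat.strong_induction_on with
  | _ k ih =>
  intro V _ _ _ J hk hn
  by_cases hk' : k = 4 * n + 4
  · exact ⟨V, _, _, ‹_›, J, hk.trans hk', rfl⟩
  obtain ⟨W, J', h1, h2, h3⟩ := h.exists_compress (e := e) J b₀ (by omega)
  obtain ⟨a, ha⟩ := (J b₀).2.even_finrank
  obtain ⟨b, hb⟩ := (J' b₀).2.even_finrank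
  obtain ⟨W', i1, i2, i3, J'', h4, h5⟩ := ih _ (by omega) W J' rfl (by omega)
  exact ⟨W', i1, i2, i3, J'', h4, h5.trans h3⟩

end Compression

section UnitDimension

theorem exists_orth_degree_of_finrank (n : ℕ) {E : Type*} [NormedAddCommGroup E]
    [InnerProductSpace ℝ E] [FiniteDimensional ℝ E] (hE : Module.finrank ℝ E = 4 * n + 3) :
    ∃ (e : (Fin (4 * n + 3) → ℝ) ≃L[ℝ] E) (W : Type) (_ : NormedAddCommGroup W)
      (_ : InnerProductSpace ℝ W) (_ : FiniteDimensional ℝ W) (g : E → (W →L[ℝ] W)ˣ),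
      Module.finrank ℝ W = 4 * n + 3 ∧ BallSupp 1 g ∧ (∀ y, g y ∈ orth W) ∧ edeg e g ≠ 0 := by
  have hnt : Nontrivial E := Module.nontrivial_of_finrank_pos (R := ℝ) (by omega)
  obtain ⟨b', hb'⟩ := exists_norm_eq E zero_le_one
  let b₀ : USph E := USph.mk b' hb'
  have : NeZero (4 * n + 3) := ⟨by omega⟩
  obtain ⟨e, V, _, _, _, J, p, q, h, hV, hne⟩ := exists_clifford_degree n hE b₀
  obtain ⟨W, _, _, _, J', hW, hJ'⟩ := h.exists_compress_all (e := e) b₀ hE _ V J rfl hV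
  rw [← hJ'] at hne
  have hnt' : Nontrivial W := Module.nontrivial_of_finrank_pos (R := ℝ) (by omega)
  obtain ⟨v', hv'⟩ := exists_norm_eq W zero_le_one
  let v : USph W := USph.mk v' hv'
  have hvo : (perp v)ᗮ = Submodule.span ℝ {(v : W)} := Submodule.orthogonal_orthogonal _
  obtain ⟨g, h1, h2, h3⟩ := exists_restrict_edeg (e := e) (W := perp v)
    (h.ballSupp_refl_sq J' b₀ v) (fun y => mul_mem (mul_mem (mul_mem (hrefl_mem_orth _)
      (h.csExp_mem_orth _ _ _)) (inv_mem (hrefl_mem_orth _))) (h.csExp_mem_orth _ _ _))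
    fun y w hw => by
      rw [hvo] at hw
      obtain ⟨s, rfl⟩ := Submodule.mem_span_singleton.1 hw
      rw [map_smul, h.refl_sq_apply_self]
  refine ⟨e, perp v, inferInstance, inferInstance, inferInstance, g, ?_, h1, h2, ?_⟩
  · have := finrank_perp v; omega
  · rw [h3, h.edeg_refl_sq]
    exact mul_ne_zero two_ne_zero hne

end UnitDimension

section Collapse

open unitInterval

variable {A : Type*} [NormedAddCommGroup A] [InnerProductSpace ℝ A]

/-- The map collapsing the complement of the unit ball of the hyperplane `perp N` to the
pole `N`. -/
noncomputable def collapse (N : USph A) (y : perp N) : USph A :=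
  USph.mk ((-Real.cos (Real.pi * min ‖y‖ 1)) • (N : A) +
    (Real.pi * Real.sinc (Real.pi * min ‖y‖ 1)) • (y : A)) (by
    have h := norm_add_smul_sq ((Real.pi * Real.sinc (Real.pi * min ‖y‖ 1)) • y)
      (-Real.cos (Real.pi * min ‖y‖ 1))
    have h1 : ‖((Real.pi * Real.sinc (Real.pi * min ‖y‖ 1)) • y)‖ ^ 2 =
        Real.sin (Real.pi * min ‖y‖ 1) ^ 2 := by
      rw [norm_smul, mul_pow, Real.norm_eq_abs, sq_abs, ← mul_pow]
      congr 1
      rcases le_total ‖y‖ 1 with hy | hy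
      · rw [min_eq_left hy, mul_right_comm, mul_comm, Real.sinc]
        split_ifs with h0
        · rw [h0]; simp
        · have := (mul_ne_zero_iff.1 h0).2
          field_simp
      · rw [min_eq_right hy, mul_one, Real.sinc_of_ne_zero Real.pi_ne_zero]
        simp
    rw [h1, neg_sq, Real.sin_sq_add_cos_sq] at h
    rw [add_comm]
    exact (pow_eq_one_iff_of_nonneg (norm_nonneg _) two_ne_zero).1 h)

theorem coe_collapse (N : USph A) (y : perp N) :
    (collapse N y : A) = (-Real.cos (Real.pi * min ‖y‖ 1)) • (N : A) +
      (Real.pi * Real.sinc (Real.pi * min ‖y‖ 1)) • (y : A) := rfl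

theorem continuous_collapse (N : USph A) : Continuous (collapse N) := by
  refine Continuous.subtype_mk ?_ _
  have h := Real.continuous_sinc.comp
    (f := fun y : perp N => Real.pi * min ‖y‖ 1) (by fun_prop)
  simp only [Function.comp_def] at h
  fun_prop

theorem collapse_eq_pole {N : USph A} {y : perp N} (hy : 1 ≤ ‖y‖) : collapse N y = N := by
  ext
  rw [coe_collapse, min_eq_right hy, mul_one, Real.sinc_of_ne_zero Real.pi_ne_zero]
  simp

theorem collapse_smul (N : USph A) (t : I) (b : USph (perp N)) :
    collapse N ((t : ℝ) • (b : perp N)) = polarMap N (unitInterval.symm t, b) := by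
  ext
  rw [coe_collapse, norm_smul, b.norm_eq, mul_one, Real.norm_eq_abs, abs_of_nonneg t.2.1,
    min_eq_left t.2.2, polarMap, coe_polar, unitInterval.coe_symm_eq, mul_sub, mul_one,
    Real.cos_pi_sub, Real.sin_pi_sub, Submodule.coe_smul, smul_smul, mul_right_comm]
  congr 2
  rw [Real.sinc]
  split_ifs with h0
  · rw [h0]; simp
  · have := (mul_ne_zero_iff.1 h0).2
    field_simp

theorem exists_collapse_lift [FiniteDimensional ℝ A] {Z : Type*} [TopologicalSpace Z]
    {N : USph A} [Nonempty (USph (perp N))] {g : perp N → Z} (hg : Continuous g) {z₀ : Z}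
    (h1 : ∀ y, 1 ≤ ‖y‖ → g y = z₀) : ∃ G : C(USph A, Z), ∀ y, G (collapse N y) = g y := by
  obtain ⟨G, hG⟩ := exists_descend N
    (g := fun p : I × USph (perp N) => g ((unitInterval.symm p.1 : ℝ) • (p.2 : perp N)))
    (hg.comp (by fun_prop)) (fun b b' => by
      rw [h1 _ (by simp), h1 _ (by simp)]) (fun b b' => by simp)
  have key : ∀ (t : I) (b : USph (perp N)), G (collapse N ((t : ℝ) • (b : perp N))) =
      g ((t : ℝ) • (b : perp N)) := fun t b => by
    rw [collapse_smul, hG, unitInterval.symm_symm]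
  obtain ⟨b₀⟩ := ‹Nonempty (USph (perp N))›
  refine ⟨G, fun y => ?_⟩
  rcases le_total 1 ‖y‖ with hy | hy
  · have h2 := key 1 b₀
    rw [collapse_eq_pole (by simp), h1 _ (by simp)] at h2
    rw [collapse_eq_pole hy, h2, h1 y hy]
  · have h2 := key ⟨‖y‖, norm_nonneg y, hy⟩ (dirTo b₀ y)
    rwa [norm_smul_dirTo] at h2

end Collapse

section Reflection

variable {A : Type*} [NormedAddCommGroup A] [InnerProductSpace ℝ A]

/-- The reflection in `vᗮ` as a continuous linear equivalence. -/
noncomputable def reflEquiv (v : A) : A ≃L[ℝ] A := ContinuousLinearEquiv.unitsEquiv ℝ A (hrefl v)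

theorem reflEquiv_apply (v x : A) : reflEquiv v x = (hrefl v : A →L[ℝ] A) x := rfl

theorem reflEquiv_perp {N : USph A} (v : USph (perp N)) (y : perp N) :
    ((reflEquiv (v : perp N) y : perp N) : A) = (hrefl ((v : perp N) : A) : A →L[ℝ] A) y := by
  rw [reflEquiv_apply, hrefl_apply, hrefl_apply, Submodule.coe_norm, Submodule.coe_inner]
  rfl

variable [FiniteDimensional ℝ A]

theorem det_reflEquiv_neg {v : A} (hv : v ≠ 0) :
    LinearMap.det (reflEquiv v : A →ₗ[ℝ] A) < 0 := by
  have h : (reflEquiv v : A →ₗ[ℝ] A) = ((ℝ ∙ v)ᗮ).reflection.toLinearMap := by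
    ext x
    change reflEquiv v x = ((ℝ ∙ v)ᗮ).reflection x
    rw [Submodule.reflection_orthogonal_apply, Submodule.reflection_singleton_apply,
      reflEquiv_apply, hrefl_apply]
    simp only [RCLike.ofReal_real_eq_id, id_eq]
    module
  rw [h, Submodule.det_reflection, Submodule.orthogonal_orthogonal, finrank_span_singleton hv]
  norm_num

theorem collapse_reflEquiv {N : USph A} (v : USph (perp N)) (y : perp N) :
    collapse N (reflEquiv (v : perp N) y) = orthAct (orefl ((v : perp N) : A)) (collapse N y) := by
  have h1 : ‖reflEquiv (v : perp N) y‖ = ‖y‖ := orth_norm (hrefl_mem_orth _) y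
  ext
  rw [coe_collapse, coe_orthAct, coe_collapse, h1, map_add, map_smul, map_smul, reflEquiv_perp]
  congr 2
  exact (hrefl_apply_of_orthogonal (inner_perp' _)).symm

end Reflection

section Codimension

open unitInterval

theorem exists_orth_degree (n : ℕ) (hn : 1 ≤ n) {A : Type*} [NormedAddCommGroup A]
    [InnerProductSpace ℝ A] [FiniteDimensional ℝ A] (hA : Module.finrank ℝ A = 4 * n + 4)
    (P : USph A) :
    ∃ (e : (Fin (4 * n + 3) → ℝ) ≃L[ℝ] perp P) (W : Type) (_ : NormedAddCommGroup W)
      (_ : InnerProductSpace ℝ W) (_ : FiniteDimensional ℝ W) (h : perp P → (W →L[ℝ] W)ˣ),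
      Module.finrank ℝ W = 4 * n + 2 ∧ BallSupp 1 h ∧ (∀ y, h y ∈ orth W) ∧ edeg e h ≠ 0 := by
  have : NeZero (4 * n + 3) := ⟨by omega⟩
  have hP := finrank_perp P
  obtain ⟨e, W, _, _, _, g, hW, hg, hgo, hne⟩ := exists_orth_degree_of_finrank n
    (E := perp P) (by omega)
  obtain ⟨v₀⟩ := nonempty_perp_sphere P (by omega)
  have hv : Nonempty (USph (perp P)) := ⟨v₀⟩
  obtain ⟨Q, hQ⟩ := exists_collapse_lift hg.cont hg.eq_one
  have hQo : ∀ x, Q x ∈ orth W := fun x => by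
    obtain ⟨⟨t, b⟩, rfl⟩ := surjective_polarMap P x
    rw [← unitInterval.symm_symm t, ← collapse_smul, hQ]
    exact hgo _
  have hpole : collapse P (v₀ : perp P) = P := collapse_eq_pole v₀.norm_eq.ge
  have hQP : Q P = 1 := by
    rw [← hpole, hQ, hg.eq_one _ v₀.norm_eq.ge]
  have hnt : Nontrivial W := Module.nontrivial_of_finrank_pos (R := ℝ) (by omega)
  obtain ⟨w', hw'⟩ := exists_norm_eq W zero_le_one
  let w : USph W := USph.mk w' hw'
  obtain ⟨ν⟩ := nonempty_perp_sphere w (by omega)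
  let N : USph W := perpIncl w ν
  let NA : USph A := perpIncl P v₀
  obtain ⟨b₀⟩ := nonempty_perp_sphere NA (by omega)
  let Y : C(USph A, USph W) := ⟨fun x => USph.mk ((Q x : W →L[ℝ] W) w) (by
      rw [orth_norm (hQo x), w.norm_eq]), by
    refine Continuous.subtype_mk ?_ _
    exact (ContinuousLinearMap.apply ℝ W (w : W)).continuous.comp
      (Units.continuous_val.comp Q.continuous)⟩
  obtain ⟨Y', ⟨H⟩⟩ := desuspend (k := 4 * n + 2) (by omega) (by omega) (by omega) Y b₀ N
  obtain ⟨T, hT, hT0, hTo, hTH, -, -⟩ := exists_rot_transport (V := W) (H := H) H.continuous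
  have hTH' : ∀ t x, (T (t, x) : W →L[ℝ] W) ((Q x : W →L[ℝ] W) w) = H (t, x) := fun t x => by
    rw [← hTH, H.apply_zero]; rfl
  let G : I × USph A → (W →L[ℝ] W)ˣ := fun z => T z * Q z.2
  have hG : Continuous G := hT.mul (Q.continuous.comp continuous_snd)
  have hGo : ∀ z, G z ∈ orth W := fun z => mul_mem (hTo z) (hQo _)
  let g' : perp P → (W →L[ℝ] W)ˣ := fun y => (G (1, P))⁻¹ * G (1, collapse P y)
  have hg'1 : ∀ (t : I) (y : perp P), 1 ≤ ‖y‖ → (G (t, P))⁻¹ * G (t, collapse P y) = 1 :=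
    fun t y hy => by rw [collapse_eq_pole hy, inv_mul_cancel]
  have hcc := continuous_collapse P
  have hGc : Continuous fun z : I × perp P => (G (z.1, P))⁻¹ * G (z.1, collapse P z.2) :=
    (hG.comp (f := fun z : I × perp P => (z.1, P)) (by fun_prop)).inv.mul
      (hG.comp (f := fun z : I × perp P => (z.1, collapse P z.2)) (by fun_prop))
  have hg' : BallSupp 1 g' := ⟨hGc.comp (f := fun y : perp P => ((1 : I), y)) (by fun_prop),
    hg'1 1⟩
  have hdeg : edeg e g' = edeg e g := by
    have h1 := edeg_homotopy (e := e) hGc hg'1 1 0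
    refine h1.trans (congrArg (edeg e) (funext fun y => ?_))
    simp only [G, hT0, hQP, hQ]
    simp
  let r : (W →L[ℝ] W)ˣ := hrefl (N : W)
  let r' : perp P ≃L[ℝ] perp P := reflEquiv (v₀ : perp P)
  let k : (W →L[ℝ] W)ˣ := (G (1, P))⁻¹ * r * G (1, P)
  let h : perp P → (W →L[ℝ] W)ˣ := fun y => (g' (r' y))⁻¹ * (k * g' y * k⁻¹)
  have hr'n : ∀ y, ‖r' y‖ = ‖y‖ := fun y => orth_norm (hrefl_mem_orth _) y
  have hg'r : BallSupp 1 fun y => g' (r' y) :=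
    ⟨hg'.cont.comp r'.continuous, fun y hy => hg'.eq_one _ (by rwa [hr'n])⟩
  have hh : BallSupp 1 h := hg'r.inv.mul (hg'.conj k)
  have hho : ∀ y, h y ∈ orth W := fun y => by
    have h1 : ∀ y, g' y ∈ orth W := fun y => mul_mem (inv_mem (hGo _)) (hGo _)
    have h2 : k ∈ orth W := mul_mem (mul_mem (inv_mem (hGo _)) (hrefl_mem_orth _)) (hGo _)
    exact mul_mem (inv_mem (h1 _)) (mul_mem (mul_mem h2 (h1 _)) (inv_mem h2))
  have hhdeg : edeg e h = 2 * edeg e g := by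
    rw [edeg_mul hg'r.inv (hg'.conj k), edeg_inv hg'r, edeg_conj hg', edeg_comp_equiv hg' r'
      (det_reflEquiv_neg v₀.ne_zero), hdeg]
    ring
  -- the equivariant family of operators fixing `w`
  let m : USph A → (W →L[ℝ] W)ˣ := fun x =>
    (G (1, orthAct (orefl (NA : A)) x))⁻¹ * r * G (1, x) * r⁻¹
  have hm : ∀ x, (m x : W →L[ℝ] W) w = w := fun x => by
    have h1 : ∀ x, (G (1, x) : W →L[ℝ] W) w = susp b₀ N Y' x := fun x => by
      rw [← H.apply_one, ← hTH']; rfl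
    have h2 : (↑r⁻¹ : W →L[ℝ] W) w = w :=
      hrefl_apply_of_orthogonal (inner_perp' _)
    have h3 : (r : W →L[ℝ] W) (susp b₀ N Y' x) = susp b₀ N Y' (orthAct (orefl (NA : A)) x) := by
      have h4 := orefl_apply N (susp b₀ N Y' x)
      rw [coe_orthAct] at h4
      refine h4.trans ?_
      rw [coe_susp, coe_susp, orefl_apply, map_sub, map_smul, wpart_self, smul_zero, sub_zero,
        inner_sub_right, inner_add_right, real_inner_smul_right, real_inner_smul_right,
        real_inner_smul_right, inner_perp, N.inner_self, NA.inner_self]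
      module
    simp only [m, Units.val_mul, clm_mul_apply]
    rw [h2, h1, h3, ← h1, units_inv_apply]
  have hmh : ∀ y, h y = m (collapse P y) * (m P)⁻¹ := fun y => by
    have h1 : orthAct (orefl (NA : A)) P = P := by
      ext
      rw [coe_orthAct]
      exact hrefl_apply_of_orthogonal (inner_perp' _)
    simp only [h, m, g', h1, k, r', collapse_reflEquiv]
    group
    rfl
  have hfix : ∀ y, (h y : W →L[ℝ] W) w = w := fun y => by
    have h1 : (↑(m P)⁻¹ : W →L[ℝ] W) w = w := by
      conv_lhs => rw [← hm P]
      simp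
    rw [hmh, Units.val_mul, clm_mul_apply, h1, hm]
  have hwo : (perp w)ᗮ = Submodule.span ℝ {(w : W)} := Submodule.orthogonal_orthogonal _
  obtain ⟨f, h1, h2, h3⟩ := exists_restrict_edeg (e := e) (W := perp w) hh hho fun y x hx => by
    rw [hwo] at hx
    obtain ⟨s, rfl⟩ := Submodule.mem_span_singleton.1 hx
    rw [map_smul, hfix]
  refine ⟨e, perp w, inferInstance, inferInstance, inferInstance, f, ?_, h1, h2, ?_⟩
  · have := finrank_perp w; omega
  · rw [h3, hhdeg]
    exact mul_ne_zero two_ne_zero hne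

end Codimension

section Cube

open unitInterval

/-- The retraction of the plane onto the square `[-1, 1]²`, identified with the unit square. -/
noncomputable def cubeClamp (s : Fin 2 → ℝ) : Fin 2 → I := fun i =>
  Set.projIcc 0 1 zero_le_one ((s i + 1) / 2)

/-- The affine identification of the unit square with `[-1, 1]²`. -/
def cubeCoord (s : Fin 2 → I) : Fin 2 → ℝ := fun i => 2 * (s i : ℝ) - 1

@[fun_prop]
theorem continuous_cubeClamp : Continuous cubeClamp :=
  continuous_pi fun i => continuous_projIcc.comp (by fun_prop)

@[fun_prop]
theorem continuous_cubeCoord : Continuous cubeCoord :=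
  continuous_pi fun i => by unfold cubeCoord; fun_prop

theorem cubeCoord_cubeClamp {s : Fin 2 → ℝ} (h : ‖s‖ ≤ 1) : cubeCoord (cubeClamp s) = s := by
  ext i
  have h1 := abs_le.1 ((norm_le_pi_norm s i).trans h)
  simp only [cubeClamp, cubeCoord]
  rw [Set.projIcc_of_mem _ ⟨by linarith, by linarith⟩]
  ring

theorem cubeClamp_mem_boundary {s : Fin 2 → ℝ} (h : 1 ≤ ‖s‖) :
    cubeClamp s ∈ Cube.boundary (Fin 2) := by
  obtain ⟨i, hi⟩ : ∃ i, 1 ≤ ‖s i‖ := by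
    by_contra! h1
    exact absurd ((pi_norm_lt_iff one_pos).2 h1) (not_lt.2 h)
  refine ⟨i, ?_⟩
  rcases le_abs.1 hi with h1 | h1
  · exact Or.inr (Set.projIcc_of_right_le _ (by linarith))
  · exact Or.inl (Set.projIcc_of_le_left _ (by linarith))

theorem one_le_norm_cubeCoord {s : Fin 2 → I} (h : s ∈ Cube.boundary (Fin 2)) :
    1 ≤ ‖cubeCoord s‖ := by
  obtain ⟨i, hi⟩ := h
  refine le_trans ?_ (norm_le_pi_norm _ i)
  rcases hi with hi | hi
  · simp [cubeCoord, hi]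
  · norm_num [cubeCoord, hi]

end Cube

section RelativeNullhomotopy

open unitInterval

variable {V : Type*} [NormedAddCommGroup V] [InnerProductSpace ℝ V] [FiniteDimensional ℝ V]

theorem exists_continuousLinearEquiv_norm_le {E F : Type*} [NormedAddCommGroup E]
    [NormedSpace ℝ E] [FiniteDimensional ℝ E] [NormedAddCommGroup F] [NormedSpace ℝ F]
    [FiniteDimensional ℝ F] (h : Module.finrank ℝ E = Module.finrank ℝ F) :
    ∃ L : E ≃L[ℝ] F, ∀ x, ‖x‖ ≤ ‖L x‖ := by
  let L₀ := ContinuousLinearEquiv.ofFinrankEq h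
  let C : ℝ := ‖(L₀.symm : F →L[ℝ] E)‖ + 1
  have hC : 0 < C := by positivity
  refine ⟨L₀.trans (ContinuousLinearEquiv.smulLeft (Units.mk0 C hC.ne')), fun x => ?_⟩
  change ‖x‖ ≤ ‖C • L₀ x‖
  rw [norm_smul, Real.norm_of_nonneg hC.le]
  have h1 := (L₀.symm : F →L[ℝ] E).le_opNorm (L₀ x)
  rw [ContinuousLinearEquiv.coe_coe, L₀.symm_apply_apply] at h1
  refine h1.trans (mul_le_mul_of_nonneg_right ?_ (norm_nonneg _))
  simp [C]

theorem exists_rel_nullhomotopy {J : V →L[ℝ] V} (hJ : IsCS J) (h : C(Fin 2 → I, cenS J))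
    (h1 : ∀ s ∈ Cube.boundary (Fin 2), h s = 1) :
    ∃ (R : ℝ) (k : C(I × (Fin 2 → ℝ), cenS J)), (∀ s, k (0, s) = h (cubeClamp s)) ∧
      (∀ s, k (1, s) = 1) ∧ ∀ t s, R ≤ ‖s‖ → k (t, s) = 1 := by
  let A := EuclideanSpace ℝ (Fin 3)
  have hA : Module.finrank ℝ A = 3 := finrank_euclideanSpace_fin
  have hn : Nontrivial A := Module.nontrivial_of_finrank_pos (R := ℝ) (by omega)
  obtain ⟨v, hv⟩ := exists_norm_eq A zero_le_one
  let N : USph A := USph.mk v hv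
  have hN := finrank_perp N
  have hne : Nonempty (USph (perp N)) := nonempty_perp_sphere N (by omega)
  obtain ⟨L, hL⟩ := exists_continuousLinearEquiv_norm_le (E := perp N) (F := Fin 2 → ℝ)
    (by rw [Module.finrank_fin_fun]; omega)
  obtain ⟨g, hg⟩ := exists_collapse_lift (N := N) (g := fun y => h (cubeClamp (L y)))
    (h.continuous.comp (continuous_cubeClamp.comp L.continuous)) (z₀ := 1)
    fun y hy => h1 _ (cubeClamp_mem_boundary (hy.trans (hL y)))
  obtain ⟨y₀, ⟨H⟩⟩ := two_sphere_cenS_nullhomotopic hA _ V rfl J hJ g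
  have hgN : g N = 1 := by
    obtain ⟨b⟩ := hne
    have h2 : 1 ≤ ‖(b : perp N)‖ := b.norm_eq.ge
    have h3 := hg (b : perp N)
    rw [collapse_eq_pole h2] at h3
    rw [h3]
    exact h1 _ (cubeClamp_mem_boundary (h2.trans (hL _)))
  have hc := continuous_collapse N
  refine ⟨‖(L : perp N →L[ℝ] (Fin 2 → ℝ))‖, ⟨fun z => H (z.1, collapse N (L.symm z.2)) *
    (H (z.1, N))⁻¹, ?_⟩, fun s => ?_, fun s => ?_, fun t s hs => ?_⟩
  · have h2 : Continuous fun z : I × (Fin 2 → ℝ) => H (z.1, N) := by fun_prop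
    have h3 : Continuous fun z : I × (Fin 2 → ℝ) => H (z.1, collapse N (L.symm z.2)) :=
      H.continuous.comp (continuous_fst.prodMk (hc.comp (by fun_prop)))
    exact h3.mul h2.inv
  · simp [hg, hgN]
  · simp
  · have h2 : 1 ≤ ‖L.symm s‖ := by
      have h3 := (L : perp N →L[ℝ] (Fin 2 → ℝ)).le_opNorm (L.symm s)
      rw [ContinuousLinearEquiv.coe_coe, L.apply_symm_apply] at h3
      have h4 : 0 < ‖(L : perp N →L[ℝ] (Fin 2 → ℝ))‖ := by
        have hnt : Nontrivial (perp N) := by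
          obtain ⟨b⟩ := hne
          exact ⟨⟨b, 0, b.ne_zero⟩⟩
        exact L.norm_pos
      by_contra! h5
      have := mul_lt_mul_of_pos_left h5 h4
      linarith
    change H (t, collapse N (L.symm s)) * (H (t, N))⁻¹ = 1
    rw [collapse_eq_pole h2, mul_inv_cancel]

end RelativeNullhomotopy

section Detection

open unitInterval

variable {V : Type*} [NormedAddCommGroup V] [InnerProductSpace ℝ V] [FiniteDimensional ℝ V]
  {A : Type*} [NormedAddCommGroup A] [InnerProductSpace ℝ A] [FiniteDimensional ℝ A]

/-- A family of automorphisms commuting with a family of complex structures pulled back along the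
collapse map has degree zero. -/
theorem edeg_eq_zero_of_commute_collapse {d : ℕ} (hd : d = Module.finrank ℝ V + 1) {p : USph A}
    (e : (Fin d → ℝ) ≃L[ℝ] (Fin 2 → ℝ) × perp p) (f : C(USph A, CS V)) {R : ℝ}
    {h : (Fin 2 → ℝ) × perp p → (V →L[ℝ] V)ˣ} (hh : BallSupp R h)
    (hc : ∀ z, h z ∈ cenS (f (collapse p z.2)).1) : edeg e h = 0 := by
  have hκ := continuous_collapse p
  have hprop : ProperSpace (perp p) := FiniteDimensional.proper ℝ _
  let B := Metric.closedBall (0 : perp p) 1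
  have hB : CompactSpace B := isCompact_iff_compactSpace.1 (isCompact_closedBall _ _)
  obtain ⟨K, hK, hK0, hKt, -⟩ := exists_cs_transport (V := V) (B := B)
    (H := fun q => f (collapse p ((q.1 : ℝ) • (q.2 : perp p))))
    (f.continuous.comp (hκ.comp (by fun_prop)))
  have hpos : ∀ y : perp p, 0 < max 1 ‖y‖ := fun y => lt_max_of_lt_left one_pos
  have hnr : ∀ y : perp p, ‖(max 1 ‖y‖)⁻¹ • y‖ = (max 1 ‖y‖)⁻¹ * ‖y‖ := fun y => by
    rw [norm_smul, norm_inv, Real.norm_of_nonneg (hpos y).le]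
  let r : perp p → B := fun y => ⟨(max 1 ‖y‖)⁻¹ • y, by
    rw [mem_closedBall_zero_iff, hnr, inv_mul_le_one₀ (hpos y)]
    exact le_max_right _ _⟩
  have hr : Continuous r := by
    refine Continuous.subtype_mk (Continuous.smul (Continuous.inv₀ (by fun_prop)
      fun y => (hpos y).ne') continuous_id) _
  have hrκ : ∀ y, collapse p (r y : perp p) = collapse p y := fun y => by
    change collapse p ((max 1 ‖y‖)⁻¹ • y) = _
    rcases le_total 1 ‖y‖ with h1 | h1
    · rw [collapse_eq_pole h1, collapse_eq_pole]
      rw [hnr, max_eq_right h1, inv_mul_cancel₀ (by positivity)]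
    · rw [max_eq_left h1, inv_one, one_smul]
  have h1 := edeg_homotopy (e := e) (R := R)
    (H := fun q => (K (q.1, r q.2.2))⁻¹ * h q.2 * K (q.1, r q.2.2)) (by
      have h2 : Continuous fun q : I × (Fin 2 → ℝ) × perp p => K (q.1, r q.2.2) := by fun_prop
      exact (h2.inv.mul (hh.cont.comp continuous_snd)).mul h2)
    (fun s y hy => by simp [hh.eq_one y hy]) 0 1
  simp only [hK0, inv_one, one_mul, mul_one] at h1
  rw [h1]
  have h2 : Continuous fun q : (Fin 2 → ℝ) × perp p => K (1, r q.2) := by fun_prop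
  refine edeg_cenS_eq_zero (R := R) hd (f (collapse p (0 : perp p))).2.1
    ⟨(h2.inv.mul hh.cont).mul h2, fun y hy => by simp [hh.eq_one y hy]⟩ fun z => ?_
  have h3 := hKt 1 (r z.2)
  simp only [Set.Icc.coe_zero, zero_smul, Set.Icc.coe_one, one_smul, hrκ] at h3
  have h4 := mem_cenS.1 (hc z)
  rw [mem_cenS]
  simp only [Units.val_mul]
  generalize (f (collapse p z.2)).1 = a at h3 h4
  generalize (f (collapse p (0 : perp p))).1 = b at h3
  generalize K (1, r z.2) = k at h3
  have h5 : (↑k⁻¹ : V →L[ℝ] V) * a = b * ↑k⁻¹ := by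
    rw [Units.inv_mul_eq_iff_eq_mul, ← mul_assoc, h3, mul_assoc, Units.mul_inv, mul_one]
  rw [mul_assoc, h3, ← mul_assoc, mul_assoc (↑k⁻¹ : V →L[ℝ] V), h4, ← mul_assoc, h5]
  simp only [mul_assoc]

/-- If `β` moves a family of complex structures through a null homotopy relative to the boundary
of the square, then the degree of `β` vanishes. -/
theorem edeg_eq_zero_of_homotopy {d : ℕ} (hd : d = Module.finrank ℝ V + 1) {p : USph A}
    (e : (Fin d → ℝ) ≃L[ℝ] (Fin 2 → ℝ) × perp p) (f : C(USph A, CS V))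
    {β : (Fin 2 → I) × USph A → (V →L[ℝ] V)ˣ} (hβ : Continuous β)
    (hβ1 : ∀ s ∈ Cube.boundary (Fin 2), ∀ x, β (s, x) = 1) (hβp : ∀ s, β (s, p) = 1)
    {H : I × ((Fin 2 → I) × USph A) → CS V} (hH : Continuous H)
    (hH0 : ∀ s (x : USph A), H (0, s, x) = f x)
    (hH1 : ∀ s (x : USph A), (H (1, s, x)).1 * (β (s, x) : V →L[ℝ] V) = β (s, x) * (f x).1)
    (hHb : ∀ t, ∀ s ∈ Cube.boundary (Fin 2), ∀ x : USph A, H (t, s, x) = f x) :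
    edeg e (fun z => β (cubeClamp z.1, collapse p z.2)) = 0 := by
  have hd0 : NeZero d := ⟨by omega⟩
  have hκ := continuous_collapse p
  have hprop : ProperSpace A := FiniteDimensional.proper ℝ _
  obtain ⟨G, hG, hG0, hGt, hG1⟩ := exists_cs_transport hH
  have hGb : ∀ t, ∀ s ∈ Cube.boundary (Fin 2), ∀ x, G (t, s, x) = 1 := fun t s hs x =>
    hG1 _ (fun t => by rw [hHb _ s hs, hHb _ s hs]) t
  have hGf : ∀ s x, (G (1, s, x) : V →L[ℝ] V) * (f x).1 = (H (1, s, x)).1 * G (1, s, x) :=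
    fun s x => by rw [← hGt, hH0]
  obtain ⟨R, k, hk0, hk1, hkR⟩ := exists_rel_nullhomotopy (f p).2
    ⟨fun s => ⟨G (1, s, p), mem_cenS.2 <| by
      have h1 := hH1 s p
      rw [hβp, Units.val_one, mul_one, one_mul] at h1
      rw [hGf, h1]⟩, Continuous.subtype_mk (by fun_prop) _⟩
    fun s hs => Subtype.ext (hGb 1 s hs p)
  let c : ℝ → I := fun x => Set.projIcc 0 1 zero_le_one (x - 1)
  have hc : Continuous c := continuous_projIcc.comp (by fun_prop)
  let kk : (Fin 2 → ℝ) × perp p → (V →L[ℝ] V)ˣ := fun z => k (c ‖z.2‖, z.1)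
  have hkc : Continuous kk := by
    have : Continuous fun z : (Fin 2 → ℝ) × perp p => k (c ‖z.2‖, z.1) := by fun_prop
    exact continuous_subtype_val.comp this
  have hcase : ∀ z : (Fin 2 → ℝ) × perp p, max R 2 ≤ ‖z‖ →
      (1 ≤ ‖z.1‖ ∧ R ≤ ‖z.1‖) ∨ (1 ≤ ‖z.2‖ ∧ 2 ≤ ‖z.2‖) := fun z hz => by
    have h1 := le_max_left R 2
    have h2 := le_max_right R 2
    rw [Prod.norm_def, le_max_iff] at hz
    rcases hz with hz | hz
    · exact Or.inl ⟨by linarith, by linarith⟩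
    · exact Or.inr ⟨by linarith, by linarith⟩
  have hkk1 : ∀ z, max R 2 ≤ ‖z‖ → kk z = 1 := fun z hz => by
    rcases hcase z hz with ⟨-, h1⟩ | ⟨-, h1⟩
    · simp only [kk, hkR _ _ h1, OneMemClass.coe_one]
    · have h2 : c ‖z.2‖ = 1 := Set.projIcc_of_right_le _ (by linarith)
      simp only [kk, h2, hk1, OneMemClass.coe_one]
  have hGG : ∀ t (z : (Fin 2 → ℝ) × perp p), max R 2 ≤ ‖z‖ →
      G (t, cubeClamp z.1, collapse p z.2) * (G (t, cubeClamp z.1, p))⁻¹ = 1 := fun t z hz => by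
    rcases hcase z hz with ⟨h1, -⟩ | ⟨h1, -⟩
    · simp [hGb t _ (cubeClamp_mem_boundary h1)]
    · rw [collapse_eq_pole h1, mul_inv_cancel]
  have hββ : BallSupp (max R 2) fun z : (Fin 2 → ℝ) × perp p =>
      β (cubeClamp z.1, collapse p z.2) := by
    refine ⟨by fun_prop, fun z hz => ?_⟩
    rcases hcase z hz with ⟨h1, -⟩ | ⟨h1, -⟩
    · exact hβ1 _ (cubeClamp_mem_boundary h1) _
    · rw [collapse_eq_pole h1, hβp]
  have hcont : Continuous fun q : I × (Fin 2 → ℝ) × perp p =>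
      G (q.1, cubeClamp q.2.1, collapse p q.2.2) * (G (q.1, cubeClamp q.2.1, p))⁻¹ * kk q.2 := by
    have h1 : Continuous fun q : I × (Fin 2 → ℝ) × perp p =>
      G (q.1, cubeClamp q.2.1, collapse p q.2.2) := by fun_prop
    have h2 : Continuous fun q : I × (Fin 2 → ℝ) × perp p =>
      G (q.1, cubeClamp q.2.1, p) := by fun_prop
    exact (h1.mul h2.inv).mul (hkc.comp continuous_snd)
  have h1 := edeg_homotopy (e := e) (R := max R 2) hcont
    (fun t z hz => by rw [hGG t z hz, hkk1 z hz, one_mul]) 0 1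
  simp only [hG0, inv_one, one_mul] at h1
  rw [edeg_cenS_eq_zero (R := max R 2) hd (f p).2.1 ⟨hkc, hkk1⟩ fun z =>
    (k (c ‖z.2‖, z.1)).2] at h1
  have hg : BallSupp (max R 2) fun z : (Fin 2 → ℝ) × perp p =>
      G (1, cubeClamp z.1, collapse p z.2) * (G (1, cubeClamp z.1, p))⁻¹ * kk z :=
    ⟨hcont.comp (Continuous.prodMk_right (1 : I)),
      fun z hz => by rw [hGG 1 z hz, hkk1 z hz, one_mul]⟩
  have h2 := edeg_eq_zero_of_commute_collapse hd e f (hββ.inv.mul hg) fun z => by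
    rw [mem_cenS]
    rcases le_total 1 ‖z.2‖ with h3 | h3
    · rw [collapse_eq_pole h3, hβp, inv_one, one_mul, mul_inv_cancel, one_mul]
      exact mem_cenS.1 (k (c ‖z.2‖, z.1)).2
    · have h4 : c ‖z.2‖ = 0 := Set.projIcc_of_le_left _ (by linarith)
      have h5 : kk z = G (1, cubeClamp z.1, p) := by
        simp only [kk, h4, hk0]
        rfl
      rw [h5, inv_mul_cancel_right]
      have h6 := hGf (cubeClamp z.1) (collapse p z.2)
      have h7 := hH1 (cubeClamp z.1) (collapse p z.2)
      rw [Units.val_mul, mul_assoc, h6, Units.inv_mul_eq_iff_eq_mul, ← mul_assoc, ← mul_assoc,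
        ← h7, mul_assoc _ (β _ : V →L[ℝ] V), Units.mul_inv, mul_one]
  rw [edeg_mul hββ.inv hg, ← h1, edeg_inv hββ] at h2
  linarith

end Detection

section ZPow

variable {E : Type*} [NormedAddCommGroup E] [NormedSpace ℝ E]

theorem BallSupp.zpow {G : Type*} [TopologicalSpace G] [Group G] [IsTopologicalGroup G]
    {g : E → G} {R : ℝ} (hg : BallSupp R g) (j : ℤ) : BallSupp R fun y => g y ^ j :=
  ⟨hg.cont.zpow j, fun y hy => by rw [hg.eq_one y hy, one_zpow]⟩

theorem edeg_zpow {V : Type*} [NormedAddCommGroup V] [InnerProductSpace ℝ V]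
    [FiniteDimensional ℝ V] {d : ℕ} [NeZero d] {e : (Fin d → ℝ) ≃L[ℝ] E}
    {g : E → (V →L[ℝ] V)ˣ} {R : ℝ} (hg : BallSupp R g) (j : ℤ) :
    edeg e (fun y => g y ^ j) = j * edeg e g := by
  induction j with
  | zero => simpa using edeg_one
  | succ i ih =>
    simp only [zpow_add_one]
    rw [edeg_mul (hg.zpow _) hg, ih]
    push_cast
    ring
  | pred i ih =>
    simp only [zpow_sub_one]
    rw [edeg_mul (hg.zpow _) hg.inv, ih, edeg_inv hg]
    push_cast
    ring

end ZPow

section TopDegreeFamily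

open unitInterval

variable {V : Type*} [NormedAddCommGroup V] [InnerProductSpace ℝ V] [FiniteDimensional ℝ V]
  {A : Type*} [NormedAddCommGroup A] [InnerProductSpace ℝ A] [FiniteDimensional ℝ A]

theorem exists_family_of_top_degree {n : ℕ} (hn : 1 ≤ n) (hV : Module.finrank ℝ V = 4 * n + 2)
    (hA : Module.finrank ℝ A = 4 * n + 2) (p : USph A) :
    ∃ β : C((Fin 2 → I) × USph A, orth V),
      (∀ s ∈ Cube.boundary (Fin 2), ∀ x, β (s, x) = 1) ∧ (∀ s, β (s, p) = 1) ∧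
      ∀ (f : C(USph A, CS V)) (j : ℤ) (H : I × ((Fin 2 → I) × USph A) → CS V), Continuous H →
        (∀ s (x : USph A), H (0, s, x) = f x) →
        (∀ s (x : USph A), (H (1, s, x)).1 * ((β (s, x) ^ j : orth V) : (V →L[ℝ] V)ˣ) =
          (((β (s, x) ^ j : orth V) : (V →L[ℝ] V)ˣ) : V →L[ℝ] V) * (f x).1) →
        (∀ t, ∀ s ∈ Cube.boundary (Fin 2), ∀ x : USph A, H (t, s, x) = f x) → j = 0 := by
  let A₀ := EuclideanSpace ℝ (Fin (4 * n + 4))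
  have hA₀ : Module.finrank ℝ A₀ = 4 * n + 4 := finrank_euclideanSpace_fin
  have hnt : Nontrivial A₀ := Module.nontrivial_of_finrank_pos (R := ℝ) (by omega)
  obtain ⟨v, hv⟩ := exists_norm_eq A₀ zero_le_one
  let P : USph A₀ := USph.mk v hv
  obtain ⟨e, W, _, _, _, h, hW, hh, hho, hdeg⟩ := exists_orth_degree n hn hA₀ P
  let U : W ≃ₗᵢ[ℝ] V := (stdOrthonormalBasis ℝ W).equiv (stdOrthonormalBasis ℝ V)
    (finCongr (hW.trans hV.symm))
  let g : perp P → (V →L[ℝ] V)ˣ := fun y => Units.map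
    (U.toContinuousLinearEquiv.conjContinuousAlgEquiv : (W →L[ℝ] W) →* (V →L[ℝ] V)) (h y)
  have hgapp : ∀ y x, (g y : V →L[ℝ] V) x = U ((h y : W →L[ℝ] W) (U.symm x)) := fun y x => rfl
  have hg : BallSupp 1 g := by
    refine ⟨Continuous.units_map _ ?_ |>.comp hh.cont, fun y hy => by
      simp only [g, hh.eq_one y hy, map_one]⟩
    exact U.toContinuousLinearEquiv.conjContinuousAlgEquiv.continuous
  have hgo : ∀ y, g y ∈ orth V := fun y => by
    rw [mem_orth]
    intro x x'
    rw [hgapp, hgapp, U.inner_map_map, mem_orth.1 (hho y), U.symm.inner_map_map]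
  have hp := finrank_perp p
  have hP := finrank_perp P
  have hne : Nonempty (USph (perp p)) := nonempty_perp_sphere p (by omega)
  obtain ⟨L, hL⟩ := exists_continuousLinearEquiv_norm_le (E := (Fin 2 → ℝ) × perp p)
    (F := perp P) (by rw [Module.finrank_prod, Module.finrank_fin_fun]; omega)
  have hL1 : ∀ s y, 1 ≤ ‖s‖ ∨ 1 ≤ ‖y‖ → g (L (s, y)) = 1 := fun s y hsy =>
    hg.eq_one _ ((le_max_iff.2 hsy).trans (hL (s, y)))
  let γ : C(perp p, C(Fin 2 → ℝ, orth V)) := ContinuousMap.curry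
    ⟨fun q : perp p × (Fin 2 → ℝ) => ⟨g (L (q.2, q.1)), hgo _⟩,
      Continuous.subtype_mk (hg.cont.comp (by fun_prop)) _⟩
  have hγ : ∀ y s, ((γ y s : orth V) : (V →L[ℝ] V)ˣ) = g (L (s, y)) := fun y s => rfl
  obtain ⟨Γ, hΓ⟩ := exists_collapse_lift (N := p) γ.continuous (z₀ := 1) fun y hy => by
    ext1 s
    exact Subtype.ext (hL1 s y (Or.inr hy))
  let β : C((Fin 2 → I) × USph A, orth V) :=
    ⟨fun q => Γ q.2 (cubeCoord q.1), by fun_prop⟩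
  have hβ : ∀ s x, β (s, x) = Γ x (cubeCoord s) := fun s x => rfl
  have hpole : ∀ s : Fin 2 → ℝ, Γ p s = 1 := fun s => by
    obtain ⟨b⟩ := hne
    rw [← collapse_eq_pole (N := p) (y := b) b.norm_eq.ge, hΓ]
    exact Subtype.ext (hL1 s b (Or.inr b.norm_eq.ge))
  have hβb : ∀ s ∈ Cube.boundary (Fin 2), ∀ x, β (s, x) = 1 := fun s hs x => by
    obtain ⟨⟨t, b⟩, rfl⟩ := surjective_polarMap p x
    rw [hβ, ← unitInterval.symm_symm t, ← collapse_smul, hΓ]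
    exact Subtype.ext (hL1 _ _ (Or.inl (one_le_norm_cubeCoord hs)))
  refine ⟨β, hβb, fun s => hpole _, fun f j H hH hH0 hH1 hHb => ?_⟩
  have hc : Continuous fun q : (Fin 2 → I) × USph A =>
      ((β q ^ j : orth V) : (V →L[ℝ] V)ˣ) :=
    continuous_subtype_val.comp (β.continuous.zpow j)
  have h1 := edeg_eq_zero_of_homotopy (hV ▸ rfl) (e.trans L.symm) f hc
    (fun s hs x => by rw [hβb s hs, one_zpow, OneMemClass.coe_one])
    (fun s => by rw [hβ, hpole, one_zpow, OneMemClass.coe_one]) hH hH0 hH1 hHb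
  have hgL : BallSupp 1 fun z => g (L z) :=
    ⟨hg.cont.comp L.continuous, fun z hz => hg.eq_one _ (hz.trans (hL z))⟩
  have h2 : (fun z : (Fin 2 → ℝ) × perp p =>
      ((β (cubeClamp z.1, collapse p z.2) ^ j : orth V) : (V →L[ℝ] V)ˣ)) =
      fun z => g (L z) ^ j := by
    ext1 z
    rw [Subgroup.coe_zpow, hβ, hΓ, hγ]
    congr 1
    rcases le_total ‖z.1‖ 1 with h3 | h3
    · rw [cubeCoord_cubeClamp h3]
    · rw [hL1 z.1 z.2 (Or.inl h3), hL1 _ _ (Or.inl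
        (one_le_norm_cubeCoord (cubeClamp_mem_boundary h3)))]
  rw [h2, edeg_zpow hgL] at h1
  have h3 : edeg (e.trans L.symm) (fun z => g (L z)) = edeg e h := by
    rw [← edeg_map_equiv (e := e) hh U.toContinuousLinearEquiv]
    simp only [edeg, ContinuousLinearEquiv.trans_apply, ContinuousLinearEquiv.apply_symm_apply]
    rfl
  rw [h3] at h1
  exact_mod_cast (mul_eq_zero.1 h1).resolve_right hdeg

end TopDegreeFamily

section Rotation

variable {𝒜 : Type*} [NormedRing 𝒜] [NormedAlgebra ℝ 𝒜]

/-- The one-parameter group of rotations generated by an element with `K ^ 3 = -K`. -/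
noncomputable def planeRot (K : 𝒜) (θ : ℝ) : 𝒜 := 1 + Real.sin θ • K + (1 - Real.cos θ) • (K * K)

theorem planeRot_mul {K : 𝒜} (hK : K * K * K = -K) (θ φ : ℝ) :
    planeRot K θ * planeRot K φ = planeRot K (θ + φ) := by
  have h1 : K * (K * K) = -K := by rw [← mul_assoc, hK]
  have h2 : K * K * (K * K) = -(K * K) := by rw [← mul_assoc, hK, neg_mul]
  simp only [planeRot, mul_add, add_mul, one_mul, mul_one, smul_mul_assoc, mul_smul_comm, hK, h1,
    h2, Real.sin_add, Real.cos_add]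
  module

theorem planeRot_zero (K : 𝒜) : planeRot K 0 = 1 := by simp [planeRot]

theorem planeRot_two_pi_mul (K : 𝒜) (k : ℕ) : planeRot K (k * (2 * Real.pi)) = 1 := by
  have h1 : Real.sin (k * (2 * Real.pi)) = 0 := by
    have := Real.sin_nat_mul_pi (2 * k)
    rw [← this]
    push_cast
    ring_nf
  rw [planeRot, h1, Real.cos_nat_mul_two_pi]
  simp

/-- Rotations as units. -/
noncomputable def planeRotUnit {K : 𝒜} (hK : K * K * K = -K) (θ : ℝ) : 𝒜ˣ :=
  ⟨planeRot K θ, planeRot K (-θ), by rw [planeRot_mul hK, add_neg_cancel, planeRot_zero],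
    by rw [planeRot_mul hK, neg_add_cancel, planeRot_zero]⟩

theorem hasDerivAt_planeRot (K : 𝒜) (θ : ℝ) :
    HasDerivAt (planeRot K) (Real.cos θ • K + Real.sin θ • (K * K)) θ := by
  have h1 := ((Real.hasDerivAt_sin θ).smul_const K).const_add 1
  have h2 := ((Real.hasDerivAt_cos θ).const_sub 1).smul_const (K * K)
  rw [neg_neg] at h2
  exact h1.add h2

theorem contDiff_planeRot (K : 𝒜) {n : ℕ∞} : ContDiff ℝ n (planeRot K) :=
  (contDiff_const.add (Real.contDiff_sin.smul contDiff_const)).add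
    ((contDiff_const.sub Real.contDiff_cos).smul contDiff_const)

theorem planeRot_neg_mul_deriv {K : 𝒜} (hK : K * K * K = -K) (θ : ℝ) :
    planeRot K (-θ) * (Real.cos θ • K + Real.sin θ • (K * K)) = K := by
  have h1 : K * (K * K) = -K := by rw [← mul_assoc, hK]
  have h2 : K * K * (K * K) = -(K * K) := by rw [← mul_assoc, hK, neg_mul]
  simp only [planeRot, mul_add, add_mul, one_mul, smul_mul_assoc, mul_smul_comm, hK, h1,
    h2, Real.sin_neg, Real.cos_neg]
  linear_combination (norm := module) (Real.cos_sq_add_sin_sq θ) • K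

variable [CompleteSpace 𝒜]

theorem mcDeg_planeRot {c : 𝒜 [⋀^Fin 1]→L[ℝ] ℝ} (hc : AdInvariant c) {K : 𝒜}
    (hK : K * K * K = -K) (k : ℕ) :
    mcDeg c (fun y : Fin 1 → ℝ => planeRotUnit hK
      (k * (2 * Real.pi) * Real.smoothTransition (y 0))) = k * (2 * Real.pi) * c fun _ => K := by
  let ψ : ℝ → ℝ := fun x => k * (2 * Real.pi) * Real.smoothTransition x
  have hψ : ContDiff ℝ 2 ψ := contDiff_const.mul (Real.smoothTransition.contDiff (n := 2))
  have hu : IsSmoothApprox (fun y : Fin 1 → ℝ => planeRotUnit hK (ψ (y 0)))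
      fun y => planeRot K (ψ (y 0)) := by
    refine ⟨((contDiff_planeRot K (n := 2)).comp hψ).comp (contDiff_apply ℝ ℝ 0),
      ⟨1, fun x i hi => ?_⟩, fun x => ?_⟩
    · rw [Subsingleton.elim i 0, lt_abs] at hi
      rcases hi with hi | hi
      · simp only [ψ, Real.smoothTransition.one_of_one_le hi.le, mul_one]
        exact planeRot_two_pi_mul K k
      · simp only [ψ, Real.smoothTransition.zero_of_nonpos (by linarith : x 0 ≤ 0), mul_zero]
        exact planeRot_zero K
    · change ‖planeRot K (ψ (x 0)) - planeRot K (ψ (x 0))‖ * _ < 1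
      rw [sub_self, norm_zero, zero_mul]
      exact one_pos
  rw [hu.mcDeg_eq hc, mcInt]
  have hd : ∀ x, HasDerivAt ψ (deriv ψ x) x := fun x =>
    (hψ.differentiable (by norm_num)).differentiableAt.hasDerivAt
  have h1 : ∀ y : Fin 1 → ℝ, mcForm c (planeRot K (ψ (y 0)))
      (fun i => fderiv ℝ (fun y : Fin 1 → ℝ => planeRot K (ψ (y 0))) y (Pi.single i 1)) =
      deriv ψ (y 0) * c fun _ => K := fun y => by
    rw [mcForm_apply]
    have h2 := HasFDerivAt.comp (f := fun y : Fin 1 → ℝ => y 0) y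
      ((hasDerivAt_planeRot K (ψ (y 0))).scomp (y 0) (hd (y 0))).hasFDerivAt
      (ContinuousLinearMap.proj (R := ℝ) (φ := fun _ : Fin 1 => ℝ) 0).hasFDerivAt
    have h3 : fderiv ℝ (fun y : Fin 1 → ℝ => planeRot K (ψ (y 0))) y = _ := h2.fderiv
    have h4 : Ring.inverse (planeRot K (ψ (y 0))) = planeRot K (-ψ (y 0)) :=
      Ring.inverse_unit (planeRotUnit hK (ψ (y 0)))
    have h5 : (fun i => Ring.inverse (planeRot K (ψ (y 0))) *
        fderiv ℝ (fun y : Fin 1 → ℝ => planeRot K (ψ (y 0))) y (Pi.single i 1)) =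
        fun i : Fin 1 => deriv ψ (y 0) • K := by
      ext1 i
      rw [h3, h4, Subsingleton.elim i 0]
      change planeRot K (-ψ (y 0)) * ((Pi.single (M := fun _ : Fin 1 => ℝ) 0 1 0 : ℝ) • deriv ψ (y 0) •
        (Real.cos (ψ (y 0)) • K + Real.sin (ψ (y 0)) • (K * K))) = _
      rw [Pi.single_eq_same, one_smul, mul_smul_comm, planeRot_neg_mul_deriv hK]
    rw [h5]
    have h6 := c.map_update_smul (fun _ => K) 0 (deriv ψ (y 0)) K
    rw [Function.update_eq_const_of_subsingleton, Function.update_eq_const_of_subsingleton] at h6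
    exact h6
  simp_rw [h1]
  have h7 : Filter.Tendsto ψ Filter.atBot (𝓝 0) := by
    refine tendsto_const_nhds.congr' ?_
    filter_upwards [Filter.eventually_le_atBot 0] with x hx
    simp [ψ, Real.smoothTransition.zero_of_nonpos hx]
  have h8 : Filter.Tendsto ψ Filter.atTop (𝓝 (k * (2 * Real.pi))) := by
    refine tendsto_const_nhds.congr' ?_
    filter_upwards [Filter.eventually_ge_atTop 1] with x hx
    simp [ψ, Real.smoothTransition.one_of_one_le hx]
  have h9 : HasCompactSupport (deriv ψ) := by
    refine HasCompactSupport.intro (isCompact_Icc (a := (0 : ℝ)) (b := 1)) fun x hx => ?_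
    rw [Set.mem_Icc, not_and_or, not_le, not_le] at hx
    rcases hx with hx | hx
    · refine (Filter.EventuallyEq.deriv_eq (f := fun _ => (0 : ℝ)) ?_).trans (deriv_const _ _)
      filter_upwards [Iio_mem_nhds hx] with z hz
      simp [ψ, Real.smoothTransition.zero_of_nonpos hz.le]
    · refine (Filter.EventuallyEq.deriv_eq (f := fun _ => k * (2 * Real.pi)) ?_).trans
        (deriv_const _ _)
      filter_upwards [Ioi_mem_nhds hx] with z hz
      simp [ψ, Real.smoothTransition.one_of_one_le hz.le]
  have h10 := MeasureTheory.integral_of_hasDerivAt_of_tendsto hd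
    ((hψ.continuous_deriv (by norm_num)).integrable_of_hasCompactSupport h9) h7 h8
  have h11 := (MeasureTheory.volume_preserving_funUnique (Fin 1) ℝ).integral_comp'
    (fun x => deriv ψ x * c fun _ => K)
  refine Eq.trans ?_ (h11.trans ?_)
  · rfl
  · rw [MeasureTheory.integral_mul_const, h10, sub_zero]

end Rotation

section ComplexLine

open unitInterval RealInnerProductSpace

variable {V : Type*} [NormedAddCommGroup V] [InnerProductSpace ℝ V]

/-- The restriction of `J` to the complex line spanned by `v`, extended by zero. -/
noncomputable def lineGen (J : V →L[ℝ] V) (v : V) : V →L[ℝ] V :=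
  InnerProductSpace.rankOne ℝ (J v) v - InnerProductSpace.rankOne ℝ v (J v)

theorem lineGen_apply (J : V →L[ℝ] V) (v x : V) :
    lineGen J v x = ⟪v, x⟫ • J v - ⟪J v, x⟫ • v := rfl

variable {J : V →L[ℝ] V} {v : V}

theorem lineGen_mul_comm (hJ : IsCS J) : lineGen J v * J = J * lineGen J v := by
  ext x
  simp only [clm_mul_apply, lineGen_apply, map_sub, map_smul, hJ.apply_apply, hJ.2]
  rw [hJ.inner_right]
  module

theorem lineGen_mul_self_apply (hJ : IsCS J) (hv : ‖v‖ = 1) (x : V) :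
    lineGen J v (lineGen J v x) = -(⟪v, x⟫ • v) - ⟪J v, x⟫ • J v := by
  have h1 : ⟪v, v⟫ = 1 := by rw [real_inner_self_eq_norm_sq, hv, one_pow]
  have h2 : ⟪J v, v⟫ = 0 := hJ.inner_self v
  have h3 : ⟪v, J v⟫ = 0 := by rw [real_inner_comm, h2]
  simp only [lineGen_apply, inner_sub_right, inner_smul_right, hJ.2, h1, h2, h3]
  module

theorem lineGen_cube (hJ : IsCS J) (hv : ‖v‖ = 1) :
    lineGen J v * lineGen J v * lineGen J v = -lineGen J v := by
  have h1 : ⟪v, v⟫ = 1 := by rw [real_inner_self_eq_norm_sq, hv, one_pow]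
  have h2 : ⟪J v, v⟫ = 0 := hJ.inner_self v
  have h3 : ⟪v, J v⟫ = 0 := by rw [real_inner_comm, h2]
  ext x
  rw [clm_mul_apply, clm_mul_apply, lineGen_mul_self_apply hJ hv, _root_.neg_apply]
  simp only [lineGen_apply, inner_sub_right, inner_smul_right, hJ.2, h1, h2, h3]
  module

/-- The composite of the reflections in `v` and `cos u • v + sin u • J v` is the rotation by `2 u`
in the complex line spanned by `v`. -/
theorem hrefl_mul_hrefl_eq_planeRot (hJ : IsCS J) (hv : ‖v‖ = 1) (u : ℝ) :
    ((hrefl (Real.cos u • v + Real.sin u • J v) * hrefl v : (V →L[ℝ] V)ˣ) : V →L[ℝ] V) =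
      planeRot (lineGen J v) (2 * u) := by
  have h1 : ⟪v, v⟫ = 1 := by rw [real_inner_self_eq_norm_sq, hv, one_pow]
  have h2 : ⟪J v, v⟫ = 0 := hJ.inner_self v
  have h3 : ⟪v, J v⟫ = 0 := by rw [real_inner_comm, h2]
  have h4 : ‖Real.cos u • v + Real.sin u • J v‖ ^ 2 = 1 := by
    rw [← real_inner_self_eq_norm_sq]
    simp only [inner_add_left, inner_add_right, inner_smul_left, inner_smul_right, hJ.2, h1, h2, h3,
      RCLike.conj_to_real]
    linear_combination Real.cos_sq_add_sin_sq u
  have hs := Real.sin_sq u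
  ext x
  simp only [Units.val_mul, clm_mul_apply, hrefl_apply, hv, h4, planeRot,
    _root_.add_apply, _root_.smul_apply, clm_one_apply,
    lineGen_apply, hJ.2, inner_add_left, inner_sub_right, inner_smul_left,
    inner_smul_right, h1, h2, h3, Real.sin_two_mul, Real.cos_two_mul, RCLike.conj_to_real,
    one_pow, inv_one, mul_one, mul_zero]
  linear_combination (norm := module)
    (2 * ⟪J v, x⟫) • congrArg (fun r : ℝ => -(r • J v)) hs

variable [FiniteDimensional ℝ V]

theorem trCLM_mul_lineGen (hJ : IsCS J) (hv : ‖v‖ = 1) : trCLM V (J * lineGen J v) = -2 := by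
  have h : J * lineGen J v =
      -(InnerProductSpace.rankOne ℝ v v + InnerProductSpace.rankOne ℝ (J v) (J v)) := by
    ext x
    simp only [clm_mul_apply, lineGen_apply, map_sub, map_smul, hJ.apply_apply,
      _root_.neg_apply, _root_.add_apply,
      InnerProductSpace.rankOne_apply]
    module
  have h1 : ⟪v, v⟫ = 1 := by rw [real_inner_self_eq_norm_sq, hv, one_pow]
  rw [h, map_neg, map_add, trCLM_apply, trCLM_apply, InnerProductSpace.trace_rankOne,
    InnerProductSpace.trace_rankOne, hJ.2, h1]
  norm_num

/-- Powers of a rotation loop in a complex line are not null homotopic among the automorphisms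
commuting with `J`. -/
theorem eq_zero_of_loop_nullhomotopy (hJ : IsCS J) (hv : ‖v‖ = 1) {k : ℕ} (hk : k ≠ 0) {i : ℤ}
    {c : C(Fin 2 → I, cenS J)} (h0 : ∀ s, s 0 = 0 → c s = 1)
    (h1 : ∀ s, s 1 = 0 ∨ s 1 = 1 → c s = 1)
    (h2 : ∀ s, s 0 = 1 → (c s : (V →L[ℝ] V)ˣ) = planeRotUnit (lineGen_cube hJ hv)
      (k * (2 * Real.pi) * Real.smoothTransition (s 1)) ^ i) : i = 0 := by
  let S : Subalgebra ℝ (V →L[ℝ] V) := Subalgebra.centralizer ℝ {J}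
  have hS : ∀ a : V →L[ℝ] V, a * J = J * a → a ∈ S := fun a h => by
    rw [Subalgebra.mem_centralizer_iff]
    rintro _ rfl
    exact h.symm
  have hS' : ∀ a : S, (a : V →L[ℝ] V) * J = J * a := fun a =>
    (Subalgebra.mem_centralizer_iff ℝ |>.1 a.2 J rfl).symm
  have hcomp : CompleteSpace S := FiniteDimensional.complete ℝ S
  let toS : cenS J →* Sˣ :=
    { toFun := fun g => ⟨⟨(g : (V →L[ℝ] V)ˣ), hS _ (mem_cenS.1 g.2)⟩,
        ⟨↑(g : (V →L[ℝ] V)ˣ)⁻¹, hS _ (mem_cenS.1 (inv_mem g.2))⟩,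
        Subtype.ext (Units.mul_inv _), Subtype.ext (Units.inv_mul _)⟩
      map_one' := rfl
      map_mul' := fun _ _ => rfl }
  have htoS : Continuous toS :=
    continuous_units_iff.2 ((Units.continuous_val.comp continuous_subtype_val).subtype_mk _)
  let K : S := ⟨lineGen J v, hS _ (lineGen_mul_comm hJ)⟩
  have hK : K * K * K = -K := Subtype.ext (lineGen_cube hJ hv)
  let tr : S →L[ℝ] ℝ := (trCLM V ∘L ContinuousLinearMap.mul ℝ (V →L[ℝ] V) J) ∘L
    S.toSubmodule.subtypeL
  have htr : ∀ a : S, tr a = trCLM V (J * a) := fun a => rfl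
  let ω : S [⋀^Fin 1]→L[ℝ] ℝ := ContinuousAlternatingMap.ofSubsingleton ℝ S ℝ (0 : Fin 1) tr
  have hω : ∀ w, ω w = trCLM V (J * w 0) := fun w => rfl
  have hinv : AdInvariant ω := fun u w => by
    rw [hω, hω]
    change trCLM V (J * (((u : S) : V →L[ℝ] V) * w 0 * ((↑u⁻¹ : S) : V →L[ℝ] V))) = _
    rw [← mul_assoc, ← mul_assoc, ← hS', mul_assoc ((u : S) : V →L[ℝ] V) J, trCLM_mul_comm,
      ← mul_assoc, ← MulMemClass.coe_mul, u.inv_mul, OneMemClass.coe_one, one_mul]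
  let cl : (Fin 1 → ℝ) → I := fun y => Set.projIcc 0 1 zero_le_one (y 0)
  have hcl : Continuous cl := continuous_projIcc.comp (by fun_prop)
  let q : I × (Fin 1 → ℝ) → Fin 2 → I := fun z => ![z.1, cl z.2]
  have hq : Continuous q := continuous_pi fun j => by
    fin_cases j
    · exact continuous_fst
    · exact hcl.comp continuous_snd
  let rot : (Fin 1 → ℝ) → Sˣ := fun y =>
    planeRotUnit hK (k * (2 * Real.pi) * Real.smoothTransition (y 0))
  have hdeg : mcDeg ω rot = k * (2 * Real.pi) * (-2) := by
    rw [mcDeg_planeRot hinv hK, hω, trCLM_mul_lineGen hJ hv]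
  have hcomp' : IsCompact ((fun y : Fin 1 → ℝ => y 0) ⁻¹' Set.Icc 0 1) :=
    (Homeomorph.funUnique (Fin 1) ℝ).isCompact_preimage.2 isCompact_Icc
  have hout : ∀ y ∉ (fun y : Fin 1 → ℝ => y 0) ⁻¹' Set.Icc (0 : ℝ) 1, y 0 ≤ 0 ∨ 1 ≤ y 0 :=
    fun y hy => by
      rw [Set.mem_preimage, Set.mem_Icc, not_and_or, not_le, not_le] at hy
      exact hy.imp le_of_lt le_of_lt
  have hrot : Continuous rot := by
    refine continuous_units_iff.2 ?_
    exact (contDiff_planeRot K (n := 0)).continuous.comp (continuous_const.mul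
      (Real.smoothTransition.continuous.comp (continuous_apply 0)))
  have hrots : HasCompactMulSupport rot := HasCompactMulSupport.intro hcomp' fun y hy => by
    rcases hout y hy with h3 | h3
    · refine Units.ext ?_
      change planeRot K (k * (2 * Real.pi) * Real.smoothTransition (y 0)) = 1
      rw [Real.smoothTransition.zero_of_nonpos h3, mul_zero, planeRot_zero]
    · refine Units.ext ?_
      change planeRot K (k * (2 * Real.pi) * Real.smoothTransition (y 0)) = 1
      rw [Real.smoothTransition.one_of_one_le h3, mul_one, planeRot_two_pi_mul]
  have hpow : ∀ j : ℤ, mcDeg ω (fun y => rot y ^ j) = j * mcDeg ω rot := fun j => by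
    have hz : ∀ j : ℤ, HasCompactMulSupport fun y => rot y ^ j := fun j =>
      hrots.comp_left (g := fun x => x ^ j) (one_zpow j)
    have hzc : ∀ j : ℤ, Continuous fun y => rot y ^ j := fun j => hrot.zpow j
    have hi : Continuous fun y => (rot y)⁻¹ := hrot.inv
    induction j with
    | zero => simpa using mcDeg_one hinv
    | succ i ih =>
      simp only [zpow_add_one]
      rw [mcDeg_mul hinv (hzc _) hrot (hz _) hrots, ih]
      push_cast
      ring
    | pred i ih =>
      simp only [zpow_sub_one]
      rw [mcDeg_mul hinv (hzc _) hi (hz _) (hrots.comp_left inv_one), ih,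
        mcDeg_inv hinv hrot hrots]
      push_cast
      ring
  have h3 := mcDeg_eq_of_homotopy hinv (H := fun z => toS (c (q z)))
    (htoS.comp (c.continuous.comp hq)) hcomp' (fun t y hy => by
      rw [h1 _ ?_, map_one]
      rcases hout y hy with h3 | h3
      · exact Or.inl (Set.projIcc_of_le_left zero_le_one h3)
      · exact Or.inr (Set.projIcc_of_right_le zero_le_one h3)) 0 1
  have h4 : (fun y => toS (c (q (0, y)))) = fun _ => 1 := by
    ext1 y
    rw [h0 _ rfl, map_one]
  have h5 : (fun y => toS (c (q (1, y)))) = fun y => rot y ^ i := by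
    ext1 y
    have h6 := h2 (q (1, y)) rfl
    have h7 : Real.smoothTransition (q (1, y) 1) = Real.smoothTransition (y 0) :=
      Real.smoothTransition.projIcc
    rw [h7] at h6
    have h8 : planeRotUnit (lineGen_cube hJ hv)
        (k * (2 * Real.pi) * Real.smoothTransition (y 0)) ∈ cenS J := by
      rw [mem_cenS]
      exact hS' (rot y : S)
    have h9 : c (q (1, y)) = (⟨_, h8⟩ : cenS J) ^ i := Subtype.ext h6
    rw [h9, map_zpow]
    congr 1
  rw [h4, h5, mcDeg_one hinv, hpow, hdeg] at h3
  have h6 : (k : ℝ) * (2 * Real.pi) * (-2) ≠ 0 := by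
    have := Real.pi_pos
    have : (k : ℝ) ≠ 0 := by exact_mod_cast hk
    positivity
  exact_mod_cast (mul_eq_zero.1 h3.symm).resolve_right h6

end ComplexLine

theorem commute_planeRot {𝒜 : Type*} [NormedRing 𝒜] [NormedAlgebra ℝ 𝒜] {K J : 𝒜}
    (h : K * J = J * K) (θ : ℝ) : planeRot K θ * J = J * planeRot K θ := by
  have h2 : K * K * J = J * (K * K) := by rw [mul_assoc, h, ← mul_assoc, h, mul_assoc]
  simp only [planeRot, add_mul, mul_add, smul_mul_assoc, mul_smul_comm, h, h2, one_mul, mul_one]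

section RotationFamily

open unitInterval

variable {V : Type*} [NormedAddCommGroup V] [InnerProductSpace ℝ V] [FiniteDimensional ℝ V]

/-- A loop of great circles `u ↦ cos u • N + sin u • g x` contracts when `g` is homotopic to its
antipode. -/
theorem exists_circle_contraction {X : Type*} [TopologicalSpace X] (N : USph V)
    (g : C(X, USph (perp N))) (hg : ((antipode (perp N)).comp g).Homotopic g) :
    ∃ P : C(I × ℝ × X, USph V), (∀ t x, P (t, 0, x) = N) ∧
      (∀ t x, P (t, 2 * Real.pi, x) = N) ∧ (∀ u x, P (1, u, x) = N) ∧
      ∀ u x, (P (0, u, x) : V) = Real.cos u • (N : V) + Real.sin u • ((g x : perp N) : V) := by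
  obtain ⟨M⟩ := hg
  let w : ℝ → ℝ := fun u => min u (2 * Real.pi - u)
  let r : I → ℝ := fun t => min 1 (2 - 2 * (t : ℝ))
  let m : I → I := fun t => Set.projIcc 0 1 zero_le_one (2 * (t : ℝ))
  have hw : Continuous w := by fun_prop
  have hr : Continuous r := by fun_prop
  have hm : Continuous m := continuous_projIcc.comp (by fun_prop)
  have hpol := continuous_polar N
  have hpi := Real.pi_pos
  have hr0 : r 0 = 1 := by norm_num [r]
  have hr1 : r 1 = 0 := by norm_num [r]
  have hwle : ∀ u, u ≤ Real.pi → w u = u := fun u hu => min_eq_left (by linarith)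
  have hwge : ∀ u, Real.pi ≤ u → w u = 2 * Real.pi - u := fun u hu => min_eq_right (by linarith)
  have hm0 : m 0 = 0 := Set.projIcc_of_le_left zero_le_one (by simp)
  refine ⟨⟨fun q => if q.2.1 ≤ Real.pi then polar N (w q.2.1 * r q.1) (g q.2.2) else
    polar N (w q.2.1 * r q.1) (M (m q.1, q.2.2)), ?_⟩, fun t x => ?_, fun t x => ?_, fun u x => ?_,
    fun u x => ?_⟩
  · refine Continuous.if_le ?_ ?_ (by fun_prop) continuous_const fun q hq => ?_
    · exact hpol.comp (f := fun q : I × ℝ × X => (w q.2.1 * r q.1, g q.2.2)) (by fun_prop)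
    · exact hpol.comp (f := fun q : I × ℝ × X => (w q.2.1 * r q.1, M (m q.1, q.2.2)))
        (by fun_prop)
    · rw [hq, hwle _ le_rfl]
      rcases le_total (2 * (q.1 : ℝ)) 1 with h | h
      · have h1 : r q.1 = 1 := min_eq_left (by linarith)
        rw [h1, mul_one, polar_pi, polar_pi]
      · have h1 : m q.1 = 1 := Set.projIcc_of_right_le _ h
        rw [h1, M.apply_one]
  · change (if (0 : ℝ) ≤ Real.pi then _ else _) = _
    rw [if_pos hpi.le, hwle _ hpi.le, zero_mul, polar_zero]
  · change (if 2 * Real.pi ≤ Real.pi then _ else _) = _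
    rw [if_neg (by linarith), hwge _ (by linarith), sub_self, zero_mul, polar_zero]
  · change (if u ≤ Real.pi then polar N (w u * r 1) _ else polar N (w u * r 1) _) = _
    rw [hr1, mul_zero, polar_zero, polar_zero, ite_self]
  · change ((if u ≤ Real.pi then polar N (w u * r 0) (g x) else
      polar N (w u * r 0) (M (m 0, x)) : USph V) : V) = _
    rw [hr0, mul_one, hm0, M.apply_zero]
    split_ifs with h
    · rw [hwle u h, coe_polar]
    · rw [hwge u (by linarith), coe_polar, Real.cos_two_pi_sub, Real.sin_two_pi_sub]
      simp

theorem exists_family_of_rotations {A : Type*} [NormedAddCommGroup A] [InnerProductSpace ℝ A]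
    [FiniteDimensional ℝ A] {k : ℕ} (hk : 2 ≤ k) (hV : Module.finrank ℝ V = k + 2)
    (hA : Module.finrank ℝ A = k + 2) (f : C(USph A, CS V)) :
    ∃ β : C((Fin 2 → I) × USph A, orth V),
      (∀ s x, s 0 = 0 ∨ s 1 = 0 ∨ s 1 = 1 → β (s, x) = 1) ∧
      (∀ s (x : USph A), s 0 = 1 → (β (s, x) : (V →L[ℝ] V)ˣ) ∈ cenS (f x).1) ∧
      ∀ (p : USph A) (i : ℤ) (H : I × (Fin 2 → I) → CS V), Continuous H →
        (∀ s, H (0, s) = f p) →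
        (∀ s, (H (1, s)).1 * ((β (s, p) ^ i : orth V) : (V →L[ℝ] V)ˣ) =
          (((β (s, p) ^ i : orth V) : (V →L[ℝ] V)ˣ) : V →L[ℝ] V) * (f p).1) →
        (∀ t, ∀ s ∈ Cube.boundary (Fin 2), H (t, s) = f p) → i = 0 := by
  have hnt : Nontrivial V := Module.nontrivial_of_finrank_pos (R := ℝ) (by omega)
  obtain ⟨v, hv⟩ := exists_norm_eq V zero_le_one
  let N : USph V := USph.mk v hv
  have hN := finrank_perp N
  let g : C(USph A, USph (perp N)) :=
    ⟨fun x => USph.mk ⟨(f x).1 v, mem_perp.2 (by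
      rw [real_inner_comm]; exact (f x).2.inner_self v)⟩ (by
      change ‖(f x).1 v‖ = 1
      rw [(f x).2.norm_apply, hv]), by
      refine Continuous.subtype_mk (Continuous.subtype_mk ?_ _) _
      exact (ContinuousLinearMap.apply ℝ V v).continuous.comp
        (continuous_subtype_val.comp f.continuous)⟩
  obtain ⟨P, hP0, hP2, hP1, hPt⟩ := exists_circle_contraction N g
    (homotopic_antipode_comp hk hA (by omega) g)
  let u : I → ℝ := fun y => 2 * Real.pi * Real.smoothTransition y
  have hu : Continuous u :=
    continuous_const.mul (Real.smoothTransition.continuous.comp continuous_subtype_val)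
  let β : C((Fin 2 → I) × USph A, orth V) :=
    ⟨fun q => ⟨hrefl (P (unitInterval.symm (q.1 0), u (q.1 1), q.2) : V) * hrefl v,
      mul_mem (hrefl_mem_orth _) (hrefl_mem_orth _)⟩, by
      refine Continuous.subtype_mk (Continuous.mul ?_ continuous_const) _
      exact continuousOn_refl.comp_continuous (by fun_prop) fun q => USph.ne_zero _⟩
  have hβ : ∀ s x, (β (s, x) : (V →L[ℝ] V)ˣ) =
    hrefl (P (unitInterval.symm (s 0), u (s 1), x) : V) * hrefl v := fun s x => rfl
  have hβ1 : ∀ s x, s 0 = 0 ∨ s 1 = 0 ∨ s 1 = 1 → β (s, x) = 1 := fun s x hs => by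
    refine Subtype.ext ?_
    have h1 : P (unitInterval.symm (s 0), u (s 1), x) = N := by
      rcases hs with hs | hs | hs
      · rw [hs, unitInterval.symm_zero, hP1]
      · simp only [hs, u, Set.Icc.coe_zero, Real.smoothTransition.zero, mul_zero, hP0]
      · simp only [hs, u, Set.Icc.coe_one, Real.smoothTransition.one, mul_one, hP2]
    rw [hβ, h1]
    exact hrefl_mul_self v
  have hβr : ∀ s (x : USph A), s 0 = 1 → (β (s, x) : (V →L[ℝ] V)ˣ) =
      planeRotUnit (lineGen_cube (f x).2 hv)
        ((2 : ℕ) * (2 * Real.pi) * Real.smoothTransition (s 1)) := fun s x hs => by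
    refine Units.ext ?_
    rw [hβ, hs, unitInterval.symm_one, hPt]
    refine (hrefl_mul_hrefl_eq_planeRot (f x).2 hv (u (s 1))).trans ?_
    change planeRot _ _ = planeRot _ _
    congr 1
    simp only [u]
    push_cast
    ring
  have hβc : ∀ s (x : USph A), s 0 = 1 → (β (s, x) : (V →L[ℝ] V)ˣ) ∈ cenS (f x).1 :=
    fun s x hs => by
      rw [hβr s x hs, mem_cenS]
      exact commute_planeRot (lineGen_mul_comm (f x).2) _
  refine ⟨β, hβ1, hβc, fun p i H hH hH0 hH1 hHb => ?_⟩
  obtain ⟨G, hG, -, hGt, hG1⟩ := exists_cs_transport hH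
  have hGb : ∀ t, ∀ s ∈ Cube.boundary (Fin 2), G (t, s) = 1 := fun t s hs =>
    hG1 _ (fun t => by rw [hHb _ s hs, hHb _ s hs]) t
  have hc : ∀ s, (G (1, s))⁻¹ * ((β (s, p) ^ i : orth V) : (V →L[ℝ] V)ˣ) ∈ cenS (f p).1 :=
    fun s => by
      have h1 := hGt 1 s
      rw [hH0] at h1
      rw [mem_cenS, Units.val_mul, mul_assoc, ← hH1, ← mul_assoc, ← mul_assoc]
      congr 1
      rw [Units.inv_mul_eq_iff_eq_mul, ← mul_assoc, h1, mul_assoc, Units.mul_inv, mul_one]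
  refine eq_zero_of_loop_nullhomotopy (f p).2 hv two_ne_zero (c := ⟨fun s => ⟨_, hc s⟩, ?_⟩)
    (fun s hs => Subtype.ext ?_) (fun s hs => Subtype.ext ?_) fun s hs => ?_
  · refine Continuous.subtype_mk (Continuous.mul (Continuous.inv (by fun_prop)) ?_) _
    have : Continuous fun s => β (s, p) := by fun_prop
    exact continuous_subtype_val.comp (this.zpow i)
  · change (G (1, s))⁻¹ * ((β (s, p) ^ i : orth V) : (V →L[ℝ] V)ˣ) = 1
    rw [hGb 1 s ⟨0, Or.inl hs⟩, hβ1 s p (Or.inl hs), one_zpow, inv_one, one_mul]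
    rfl
  · change (G (1, s))⁻¹ * ((β (s, p) ^ i : orth V) : (V →L[ℝ] V)ˣ) = 1
    rw [hGb 1 s ⟨1, hs⟩, hβ1 s p (Or.inr hs), one_zpow, inv_one, one_mul]
    rfl
  · change (G (1, s))⁻¹ * ((β (s, p) ^ i : orth V) : (V →L[ℝ] V)ˣ) = _
    rw [hGb 1 s ⟨0, Or.inr hs⟩, inv_one, one_mul, Subgroup.coe_zpow, hβr s p hs]

end RotationFamily

section OrbitLoops

open unitInterval

variable {T Z Y : Type*} [Group T] [TopologicalSpace T] [IsTopologicalGroup T]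
  [TopologicalSpace Z] [TopologicalSpace Y] [MulAction T Z] [ContinuousSMul T Z]

/-- The group of maps from the square to a topological group acting on `Z` that are trivial on
three sides of the square and stabilize `z` on the fourth. -/
def squareStabilizer (T : Type*) {Z : Type*} [Group T] [TopologicalSpace T] [IsTopologicalGroup T]
    [MulAction T Z] (z : Z) : Subgroup C(Fin 2 → I, T) where
  carrier := {β | (∀ s, s 0 = 0 ∨ s 1 = 0 ∨ s 1 = 1 → β s = 1) ∧ ∀ s, s 0 = 1 → β s • z = z}
  one_mem' := ⟨fun _ _ => rfl, fun _ _ => one_smul _ _⟩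
  mul_mem' := by
    rintro a b ⟨ha, ha'⟩ ⟨hb, hb'⟩
    refine ⟨fun s hs => ?_, fun s hs => ?_⟩
    · rw [ContinuousMap.mul_apply, ha s hs, hb s hs, one_mul]
    · rw [ContinuousMap.mul_apply, mul_smul, hb' s hs, ha' s hs]
  inv_mem' := by
    rintro a ⟨ha, ha'⟩
    refine ⟨fun s hs => ?_, fun s hs => ?_⟩
    · rw [ContinuousMap.inv_apply, ha s hs, inv_one]
    · rw [ContinuousMap.inv_apply, inv_smul_eq_iff, ha' s hs]

theorem squareStabilizer_smul_of_mem_boundary {z : Z} {β : C(Fin 2 → I, T)}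
    (hβ : β ∈ squareStabilizer T z) {s : Fin 2 → I} (hs : s ∈ Cube.boundary (Fin 2)) :
    β s • z = z := by
  obtain ⟨i, hi⟩ := hs
  by_cases h : s 0 = 0 ∨ s 1 = 0 ∨ s 1 = 1
  · rw [hβ.1 s h, one_smul]
  · apply hβ.2 s
    fin_cases i
    · exact hi.resolve_left fun h' => h (Or.inl h')
    · exact absurd (Or.inr hi) h

variable {ι : Y → Z} {f : Y}

theorem squareStabilizer_smul_mem_range (hpath : ∀ γ : C(I, Z), γ 0 ∈ Set.range ι →
    ∀ t, γ t ∈ Set.range ι) {β : C(Fin 2 → I, T)} (hβ : β ∈ squareStabilizer T (ι f))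
    (s : Fin 2 → I) : β s • ι f ∈ Set.range ι := by
  let γ : C(I, Z) := ⟨fun t => β ![t * s 0, s 1] • ι f, by
    refine Continuous.smul (β.continuous.comp ?_) continuous_const
    refine continuous_pi fun i => ?_
    fin_cases i <;> simp <;> fun_prop⟩
  have h0 : γ 0 = ι f := by
    change β ![0 * s 0, s 1] • ι f = ι f
    rw [hβ.1 _ (Or.inl (by simp)), one_smul]
  have h1 := hpath γ (h0 ▸ ⟨f, rfl⟩) 1
  have h2 : γ 1 = β s • ι f := by
    change β ![1 * s 0, s 1] • ι f = β s • ι f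
    congr 2
    ext i
    fin_cases i <;> simp
  rwa [h2] at h1

/-- The loop in `Y` swept out by the orbit of `ι f` under a map in the square stabilizer. -/
noncomputable def orbitLoop (hι : IsEmbedding ι) (hpath : ∀ γ : C(I, Z), γ 0 ∈ Set.range ι →
    ∀ t, γ t ∈ Set.range ι) (β : squareStabilizer T (ι f)) : GenLoop (Fin 2) Y f :=
  ⟨⟨fun s => (squareStabilizer_smul_mem_range hpath β.2 s).choose, by
    rw [hι.continuous_iff]
    have : (ι ∘ fun s => (squareStabilizer_smul_mem_range hpath β.2 s).choose) =
        fun s => β.1 s • ι f := by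
      funext s
      exact (squareStabilizer_smul_mem_range hpath β.2 s).choose_spec
    rw [this]
    exact β.1.continuous.smul continuous_const⟩, by
    intro s hs
    apply hι.injective
    refine ((squareStabilizer_smul_mem_range hpath β.2 s).choose_spec).trans ?_
    exact squareStabilizer_smul_of_mem_boundary β.2 hs⟩

variable {hι : IsEmbedding ι} {hpath : ∀ γ : C(I, Z), γ 0 ∈ Set.range ι →
    ∀ t, γ t ∈ Set.range ι}

theorem orbitLoop_spec (β : squareStabilizer T (ι f)) (s : Fin 2 → I) :
    ι (orbitLoop hι hpath β s) = β.1 s • ι f :=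
  (squareStabilizer_smul_mem_range hpath β.2 s).choose_spec

theorem orbitLoop_homotopic {p q : GenLoop (Fin 2) Y f} (H : I × (Fin 2 → I) → T)
    (hH : Continuous H)
    (hL : ∀ t, (∀ s : Fin 2 → I, s 0 = 0 ∨ s 1 = 0 ∨ s 1 = 1 → H (t, s) = 1) ∧
      ∀ s : Fin 2 → I, s 0 = 1 → H (t, s) • ι f = ι f)
    (h0 : ∀ s, ι (p s) = H (0, s) • ι f) (h1 : ∀ s, ι (q s) = H (1, s) • ι f)
    (hι : IsEmbedding ι) (hpath : ∀ γ : C(I, Z), γ 0 ∈ Set.range ι → ∀ t, γ t ∈ Set.range ι) :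
    GenLoop.Homotopic p q := by
  let B : I → squareStabilizer T (ι f) := fun t =>
    ⟨⟨fun s => H (t, s), by fun_prop⟩, hL t⟩
  have hB : ∀ t s, ι (orbitLoop hι hpath (B t) s) = H (t, s) • ι f := fun t s =>
    orbitLoop_spec (B t) s
  have hcont : Continuous fun x : I × (Fin 2 → I) => orbitLoop hι hpath (B x.1) x.2 := by
    rw [hι.continuous_iff]
    have : (ι ∘ fun x : I × (Fin 2 → I) => orbitLoop hι hpath (B x.1) x.2) =
        fun x => H x • ι f := by
      funext x
      exact hB _ _
    rw [this]
    exact hH.smul continuous_const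
  refine ⟨⟨⟨⟨_, hcont⟩, fun s => ?_, fun s => ?_⟩, fun t s hs => ?_⟩⟩
  · exact hι.injective ((hB 0 s).trans (h0 s).symm)
  · exact hι.injective ((hB 1 s).trans (h1 s).symm)
  · exact ((orbitLoop hι hpath (B t)).2 s hs).trans (p.2 s hs).symm

/-- Linear interpolation on the unit interval. -/
noncomputable def unitInterp (x : I × I × I) : I :=
  Set.projIcc 0 1 zero_le_one ((1 - (x.1 : ℝ)) * x.2.1 + x.1 * x.2.2)

theorem continuous_unitInterp : Continuous unitInterp :=
  continuous_projIcc.comp (by fun_prop)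

theorem unitInterp_self (t y : I) : unitInterp (t, y, y) = y := by
  have : (1 - (t : ℝ)) * y + t * y = y := by ring
  simp [unitInterp, this]

theorem unitInterp_zero (y y' : I) : unitInterp (0, y, y') = y := by
  simp [unitInterp]

theorem unitInterp_one (y y' : I) : unitInterp (1, y, y') = y' := by
  simp [unitInterp]

/-- The reparametrization running through the unit interval during its first half. -/
noncomputable def firstHalf (y : I) : I := Set.projIcc 0 1 zero_le_one (2 * (y : ℝ))

/-- The reparametrization running through the unit interval during its second half. -/
noncomputable def secondHalf (y : I) : I := Set.projIcc 0 1 zero_le_one (2 * (y : ℝ) - 1)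

theorem continuous_firstHalf : Continuous firstHalf := continuous_projIcc.comp (by fun_prop)

theorem continuous_secondHalf : Continuous secondHalf := continuous_projIcc.comp (by fun_prop)

theorem firstHalf_zero : firstHalf 0 = 0 :=
  Set.projIcc_of_le_left zero_le_one (by simp)

theorem secondHalf_zero : secondHalf 0 = 0 :=
  Set.projIcc_of_le_left zero_le_one (by simp)

theorem firstHalf_one : firstHalf 1 = 1 :=
  Set.projIcc_of_right_le zero_le_one (by simp)

theorem secondHalf_one : secondHalf 1 = 1 :=
  Set.projIcc_of_right_le zero_le_one (by norm_num)

theorem continuous_reparam (r : I → I) (hr : Continuous r) :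
    Continuous fun x : I × (Fin 2 → I) => ![x.2 0, unitInterp (x.1, x.2 1, r (x.2 1))] := by
  refine continuous_pi fun i => ?_
  fin_cases i
  · simp only [Fin.zero_eta, Matrix.cons_val_zero]
    fun_prop
  · simp only [Fin.mk_one, Matrix.cons_val_one]
    exact continuous_unitInterp.comp (by fun_prop)

theorem transAt_orbitLoop_homotopic (a b : squareStabilizer T (ι f)) :
    GenLoop.Homotopic (orbitLoop hι hpath (a * b))
      (GenLoop.transAt 1 (orbitLoop hι hpath b) (orbitLoop hι hpath a)) := by
  have hb : ∀ {r : I → I}, r 0 = 0 → r 1 = 1 → ∀ (c : squareStabilizer T (ι f)) (t : I),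
      (∀ s : Fin 2 → I, s 0 = 0 ∨ s 1 = 0 ∨ s 1 = 1 →
        c.1 ![s 0, unitInterp (t, s 1, r (s 1))] = 1) ∧
      ∀ s : Fin 2 → I, s 0 = 1 → c.1 ![s 0, unitInterp (t, s 1, r (s 1))] • ι f = ι f := by
    intro r h0 h1 c t
    refine ⟨fun s hs => c.2.1 _ ?_, fun s hs => c.2.2 _ (by simpa using hs)⟩
    rcases hs with h | h | h
    · exact Or.inl (by simpa using h)
    · exact Or.inr (Or.inl (by simp [h, h0, unitInterp_self]))
    · exact Or.inr (Or.inr (by simp [h, h1, unitInterp_self]))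
  refine orbitLoop_homotopic (fun x => a.1 ![x.2 0, unitInterp (x.1, x.2 1, secondHalf (x.2 1))] *
      b.1 ![x.2 0, unitInterp (x.1, x.2 1, firstHalf (x.2 1))])
    ((a.1.continuous.comp (continuous_reparam _ continuous_secondHalf)).mul
      (b.1.continuous.comp (continuous_reparam _ continuous_firstHalf)))
    (fun t => ⟨fun s hs => ?_, fun s hs => ?_⟩) (fun s => ?_) (fun s => ?_) hι hpath
  · simp only [(hb secondHalf_zero secondHalf_one a t).1 s hs,
      (hb firstHalf_zero firstHalf_one b t).1 s hs, mul_one]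
  · simp only [mul_smul]
    rw [(hb firstHalf_zero firstHalf_one b t).2 s hs,
      (hb secondHalf_zero secondHalf_one a t).2 s hs]
  · refine (orbitLoop_spec _ _).trans ?_
    have : ![s 0, s 1] = s := by ext i; fin_cases i <;> simp
    simp only [unitInterp_zero, this]
    rfl
  · simp only [unitInterp_one]
    have hu : ∀ y : I, Function.update s 1 y = ![s 0, y] := by
      intro y; ext i; fin_cases i <;> simp
    rw [GenLoop.transAt, GenLoop.coe_copy]
    split_ifs with h
    · refine (orbitLoop_spec _ _).trans ?_
      rw [hu]
      have h1 : secondHalf (s 1) = 0 := Set.projIcc_of_le_left zero_le_one (by linarith)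
      have h2 : a.1 ![s 0, 0] = 1 := a.2.1 _ (Or.inr (Or.inl (by simp)))
      rw [h1, h2, one_mul]
      rfl
    · refine (orbitLoop_spec _ _).trans ?_
      rw [hu]
      have h1 : firstHalf (s 1) = 1 := Set.projIcc_of_right_le zero_le_one (by linarith)
      have h2 : b.1 ![s 0, 1] = 1 := b.2.1 _ (Or.inr (Or.inr (by simp)))
      rw [h1, h2, mul_one]
      rfl

/-- The homomorphism to the second homotopy group sending a map in the square stabilizer to the
class of its orbit loop. -/
noncomputable def orbitHom (T : Type*) {Z Y : Type*} [Group T] [TopologicalSpace T]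
    [IsTopologicalGroup T] [TopologicalSpace Z] [TopologicalSpace Y] [MulAction T Z]
    [ContinuousSMul T Z] {ι : Y → Z} (f : Y) (hι : IsEmbedding ι)
    (hpath : ∀ γ : C(I, Z), γ 0 ∈ Set.range ι → ∀ t, γ t ∈ Set.range ι) :
    squareStabilizer T (ι f) →* π_ 2 Y f :=
  MonoidHom.mk' (fun β => (⟦orbitLoop hι hpath β⟧ : π_ 2 Y f)) fun a b => by
    have h := HomotopyGroup.mul_spec (i := (1 : Fin 2)) (p := orbitLoop hι hpath a)
      (q := orbitLoop hι hpath b)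
    refine Eq.trans ?_ h.symm
    exact Quotient.sound (transAt_orbitLoop_homotopic a b)

theorem exists_subgroup_of_orbitLoops {f : Y} (hι : IsEmbedding ι)
    (hpath : ∀ γ : C(I, Z), γ 0 ∈ Set.range ι → ∀ t, γ t ∈ Set.range ι)
    (a b : squareStabilizer T (ι f))
    (key : ∀ (i j : ℤ) (H : I × (Fin 2 → I) → Z), Continuous H → (∀ s, H (0, s) = ι f) →
      (∀ s, H (1, s) = (a.1 s ^ i * b.1 s ^ j) • ι f) →
      (∀ t, ∀ s ∈ Cube.boundary (Fin 2), H (t, s) = ι f) → i = 0 ∧ j = 0) :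
    ∃ K : Subgroup (π_ 2 Y f), Nonempty (K ≃* Multiplicative ℤ × Multiplicative ℤ) := by
  let φ := orbitHom T f hι hpath
  have hcomm : ∀ x y : π_ 2 Y f, Commute x y := fun x y =>
    @mul_comm _ (HomotopyGroup.commGroup (N := Fin 2) (X := Y) (x := f)).toCommMagma x y
  let ψ : Multiplicative ℤ × Multiplicative ℤ →* π_ 2 Y f :=
    MonoidHom.noncommCoprod (zpowersHom _ (φ a)) (zpowersHom _ (φ b)) fun _ _ => hcomm _ _
  have hψ : ∀ x, ψ x = φ (a ^ x.1.toAdd * b ^ x.2.toAdd) := by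
    intro x
    rw [map_mul, map_zpow, map_zpow]
    rfl
  have hinj : Function.Injective ψ := by
    rw [injective_iff_map_eq_one]
    intro x hx
    rw [hψ] at hx
    have h1 : (1 : π_ 2 Y f) = ⟦GenLoop.const⟧ := HomotopyGroup.one_def
    rw [h1] at hx
    obtain ⟨H⟩ : GenLoop.Homotopic (orbitLoop hι hpath _) GenLoop.const := Quotient.exact hx
    have H' := H.symm
    obtain ⟨h, h'⟩ := key x.1.toAdd x.2.toAdd (fun y => ι (H' y))
      (hι.continuous.comp H'.continuous) (fun s => by
        rw [H'.apply_zero]; rfl) (fun s => by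
        rw [H'.apply_one]
        exact orbitLoop_spec _ s) (fun t s hs => by
        rw [H'.eq_fst t hs]; rfl)
    exact Prod.ext h h'
  exact ⟨ψ.range, ⟨(MonoidHom.ofInjective hinj).symm⟩⟩

end OrbitLoops

/-- Continuous maps to a topological group form a topological group. -/
instance {X G : Type*} [TopologicalSpace X] [LocallyCompactSpace X] [TopologicalSpace G] [Group G]
    [IsTopologicalGroup G] :
    IsTopologicalGroup C(X, G) where
  continuous_mul := ContinuousMap.continuous_of_continuous_uncurry _ (by
    change Continuous fun y : (C(X, G) × C(X, G)) × X => y.1.1 y.2 * y.1.2 y.2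
    fun_prop)
  continuous_inv := ContinuousMap.continuous_postcomp ⟨fun g : G => g⁻¹, continuous_inv⟩

section ConjugationAction

open unitInterval

variable {V : Type*} [NormedAddCommGroup V] [InnerProductSpace ℝ V]

/-- The conjugation action of the orthogonal group on complex structures. -/
noncomputable instance : MulAction (orth V) (CS V) where
  smul g J := ⟨_, J.2.conj g.2⟩
  one_smul J := Subtype.ext (by
    change ((1 : (V →L[ℝ] V)ˣ) : V →L[ℝ] V) * J.1 * ((1⁻¹ : (V →L[ℝ] V)ˣ) : V →L[ℝ] V) = J.1
    simp)
  mul_smul g h J := Subtype.ext (by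
    change ((g.1 * h.1 : (V →L[ℝ] V)ˣ) : V →L[ℝ] V) * J.1 *
      (((g.1 * h.1)⁻¹ : (V →L[ℝ] V)ˣ) : V →L[ℝ] V) =
      (g.1 : V →L[ℝ] V) * ((h.1 : V →L[ℝ] V) * J.1 * ((h.1⁻¹ : (V →L[ℝ] V)ˣ) : V →L[ℝ] V)) *
        ((g.1⁻¹ : (V →L[ℝ] V)ˣ) : V →L[ℝ] V)
    simp only [mul_inv_rev, Units.val_mul, mul_assoc])

theorem orth_smul_val (g : orth V) (J : CS V) :
    (g • J).1 = (g.1 : V →L[ℝ] V) * J.1 * ((g.1⁻¹ : (V →L[ℝ] V)ˣ) : V →L[ℝ] V) := rfl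

theorem orth_smul_mul (g : orth V) (J : CS V) :
    (g • J).1 * (g.1 : V →L[ℝ] V) = (g.1 : V →L[ℝ] V) * J.1 := by
  rw [orth_smul_val, mul_assoc, Units.inv_mul, mul_one]

theorem orth_smul_eq_self {g : orth V} {J : CS V} (h : (g : (V →L[ℝ] V)ˣ) ∈ cenS J.1) :
    g • J = J := by
  apply Subtype.ext
  rw [orth_smul_val, mem_cenS.1 h, mul_assoc, Units.mul_inv, mul_one]

instance : ContinuousSMul (orth V) (CS V) where
  continuous_smul := by
    refine Continuous.subtype_mk ?_ _
    have h1 : Continuous fun x : orth V × CS V => x.1.1 := by fun_prop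
    exact ((Units.continuous_val.comp h1).mul (by fun_prop)).mul
      (Units.continuous_val.comp h1.inv)

variable {X : Type*} [TopologicalSpace X]

/-- The pointwise action of maps to the orthogonal group on maps to complex structures. -/
noncomputable instance : SMul C(X, orth V) C(X, CS V) :=
  ⟨fun g F => ⟨fun x => g x • F x, g.continuous.smul F.continuous⟩⟩

noncomputable instance : MulAction C(X, orth V) C(X, CS V) where
  one_smul _ := ContinuousMap.ext fun _ => one_smul _ _
  mul_smul _ _ _ := ContinuousMap.ext fun _ => mul_smul _ _ _

theorem orthMap_smul_apply (g : C(X, orth V)) (F : C(X, CS V)) (x : X) :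
    (g • F) x = g x • F x := rfl

instance [LocallyCompactSpace X] : ContinuousSMul C(X, orth V) C(X, CS V) where
  continuous_smul := by
    refine ContinuousMap.continuous_of_continuous_uncurry _ ?_
    change Continuous fun y : (C(X, orth V) × C(X, CS V)) × X => y.1.1 y.2 • y.1.2 y.2
    fun_prop

end ConjugationAction

section GammaComparison

open unitInterval

theorem isCS_toEuclideanCLM_iff {m : Type*} [Fintype m] [DecidableEq m] (J : Matrix m m ℝ) :
    IsCS (Matrix.toEuclideanCLM (𝕜 := ℝ) J) ↔ J.transpose * J = 1 ∧ J * J = -1 := by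
  have hinj : Function.Injective (Matrix.toEuclideanCLM (n := m) (𝕜 := ℝ)) :=
    EquivLike.injective _
  have h1 : Matrix.toEuclideanCLM (𝕜 := ℝ) J * Matrix.toEuclideanCLM (𝕜 := ℝ) J = -1 ↔
      J * J = -1 := by
    rw [← map_mul, ← hinj.eq_iff (b := -1),
      map_neg, map_one]
  have h2 : (∀ x y, inner ℝ (Matrix.toEuclideanCLM (𝕜 := ℝ) J x)
      (Matrix.toEuclideanCLM (𝕜 := ℝ) J y) = inner ℝ x y) ↔ J.transpose * J = 1 := by
    rw [← Matrix.conjTranspose_eq_transpose_of_trivial, ← Matrix.star_eq_conjTranspose,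
      ← hinj.eq_iff (b := 1), map_mul, map_star,
      map_one, ContinuousLinearMap.star_eq_adjoint]
    constructor
    · intro h
      ext1 y
      refine ext_inner_left ℝ fun x => ?_
      rw [clm_mul_apply, ContinuousLinearMap.adjoint_inner_right, h]
      rfl
    · intro h x y
      rw [← ContinuousLinearMap.adjoint_inner_right, ← clm_mul_apply, h]
      rfl
  rw [IsCS, h1, h2, and_comm]

/-- The identification of the space of orthogonal complex structures, seen as matrices, with the
one of operators. -/
noncomputable def gammaHomeo (N : ℕ) : Gamma N ≃ₜ CS (EuclideanSpace ℝ (Fin N ⊕ Fin N)) where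
  toFun J := ⟨Matrix.toEuclideanCLM (𝕜 := ℝ) J.1, (isCS_toEuclideanCLM_iff J.1).2 J.2⟩
  invFun T := ⟨(Matrix.toEuclideanCLM (𝕜 := ℝ)).symm T.1, (isCS_toEuclideanCLM_iff _).1 (by
    rw [StarAlgEquiv.apply_symm_apply]; exact T.2)⟩
  left_inv J := Subtype.ext (StarAlgEquiv.symm_apply_apply _ _)
  right_inv T := Subtype.ext (StarAlgEquiv.apply_symm_apply _ _)
  continuous_toFun := by
    refine Continuous.subtype_mk ?_ _
    exact ((Matrix.toEuclideanCLM (n := Fin N ⊕ Fin N) (𝕜 := ℝ)).toAlgEquiv.toLinearMap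
      |>.continuous_of_finiteDimensional).comp continuous_subtype_val
  continuous_invFun := by
    refine Continuous.subtype_mk ?_ _
    exact ((Matrix.toEuclideanCLM (n := Fin N ⊕ Fin N) (𝕜 := ℝ)).symm.toAlgEquiv.toLinearMap
      |>.continuous_of_finiteDimensional).comp continuous_subtype_val

/-- The inclusion of `Γ_N⁺` into the space of orthogonal complex structures. -/
noncomputable def gammaPlusIncl (N : ℕ) :
    C(GammaPlus N, CS (EuclideanSpace ℝ (Fin N ⊕ Fin N))) :=
  ⟨fun y => gammaHomeo N y.1, (gammaHomeo N).continuous.comp continuous_subtype_val⟩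

theorem isEmbedding_gammaPlusIncl (N : ℕ) : IsEmbedding (gammaPlusIncl N) :=
  (gammaHomeo N).isEmbedding.comp IsEmbedding.subtypeVal

theorem mem_range_gammaPlusIncl_of_path {N : ℕ}
    (γ : C(I, CS (EuclideanSpace ℝ (Fin N ⊕ Fin N)))) (h : γ 0 ∈ Set.range (gammaPlusIncl N))
    (t : I) : γ t ∈ Set.range (gammaPlusIncl N) := by
  obtain ⟨y, hy⟩ := h
  have hj : Joined y.1 ((gammaHomeo N).symm (γ t)) := by
    refine ⟨⟨⟨fun s => (gammaHomeo N).symm (γ (s * t)), by fun_prop⟩, ?_, ?_⟩⟩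
    · change (gammaHomeo N).symm (γ (0 * t)) = y.1
      rw [zero_mul, ← hy]
      exact (gammaHomeo N).symm_apply_apply _
    · change (gammaHomeo N).symm (γ (1 * t)) = _
      rw [one_mul]
  refine ⟨⟨_, Joined.trans y.2 hj⟩, ?_⟩
  exact (gammaHomeo N).apply_symm_apply _

theorem mem_range_postcomp_of_path {X Y Z : Type*} [TopologicalSpace X] [TopologicalSpace Y]
    [TopologicalSpace Z] {j : C(Y, Z)} (hj : IsEmbedding j)
    (hpath : ∀ γ : C(I, Z), γ 0 ∈ Set.range j → ∀ t, γ t ∈ Set.range j) (γ : C(I, C(X, Z)))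
    (h : γ 0 ∈ Set.range (ContinuousMap.comp j : C(X, Y) → C(X, Z))) (t : I) :
    γ t ∈ Set.range (ContinuousMap.comp j : C(X, Y) → C(X, Z)) := by
  have hx : ∀ x, γ t x ∈ Set.range j := fun x => by
    refine hpath ⟨fun s => γ s x, by fun_prop⟩ ?_ t
    obtain ⟨y, hy⟩ := h
    exact ⟨y x, congrArg (fun F : C(X, Z) => F x) hy⟩
  choose y hy using hx
  refine ⟨⟨y, hj.continuous_iff.2 ?_⟩, ContinuousMap.ext hy⟩
  have : j ∘ y = γ t := funext hy
  rw [this]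
  exact (γ t).continuous

end GammaComparison

/-- For `n ≥ 3` and every `f ∈ C(S^{4n+1}, Γ_{2n+1}⁺)`, the homotopy group
`π₂(C(S^{4n+1}, Γ_{2n+1}⁺), f)` contains a subgroup isomorphic to `ℤ × ℤ`. -/
theorem stmt11 (n : ℕ) (hn : 3 ≤ n) (f : C(Sph (4 * n + 1), GammaPlus (2 * n + 1))) :
    ∃ H : Subgroup (π_ 2 C(Sph (4 * n + 1), GammaPlus (2 * n + 1)) f),
      Nonempty (H ≃* Multiplicative ℤ × Multiplicative ℤ) := by
  open unitInterval in
  let N := 2 * n + 1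
  let V := EuclideanSpace ℝ (Fin N ⊕ Fin N)
  let A := EuclideanSpace ℝ (Fin (4 * n + 1 + 1))
  have hV : Module.finrank ℝ V = 4 * n + 2 := by
    rw [finrank_euclideanSpace, Fintype.card_sum, Fintype.card_fin]
    omega
  have hA : Module.finrank ℝ A = 4 * n + 2 := finrank_euclideanSpace_fin
  let ι : C(USph A, GammaPlus N) → C(USph A, CS V) := ContinuousMap.comp (gammaPlusIncl N)
  have hι : IsEmbedding ι := ContinuousMap.isEmbedding_postcomp _ (isEmbedding_gammaPlusIncl N)
  let p : USph A := northPole (4 * n + 1)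
  obtain ⟨b, hb, hbp, hbkey⟩ := exists_family_of_top_degree (V := V) (by omega) hV hA p
  obtain ⟨a, ha, ha', hakey⟩ := exists_family_of_rotations (V := V) (by omega) hV hA (ι f)
  have hmemb : b.curry ∈ squareStabilizer C(USph A, orth V) (ι f) := by
    refine ⟨fun s hs => ContinuousMap.ext fun x => hb s ?_ x, fun s hs => ContinuousMap.ext
      fun x => ?_⟩
    · rcases hs with h | h | h
      exacts [⟨0, Or.inl h⟩, ⟨1, Or.inl h⟩, ⟨1, Or.inr h⟩]
    · rw [orthMap_smul_apply, ContinuousMap.curry_apply, hb s ⟨0, Or.inr hs⟩ x, one_smul]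
  have hmema : a.curry ∈ squareStabilizer C(USph A, orth V) (ι f) :=
    ⟨fun s hs => ContinuousMap.ext fun x => ha s x hs,
      fun s hs => ContinuousMap.ext fun x => orth_smul_eq_self (ha' s x hs)⟩
  refine exists_subgroup_of_orbitLoops (f := f) hι
    (mem_range_postcomp_of_path (isEmbedding_gammaPlusIncl N) mem_range_gammaPlusIncl_of_path)
    ⟨_, hmema⟩ ⟨_, hmemb⟩ fun i j H hH h0 h1 hbd => ?_
  have h1' : ∀ s (x : USph A), H (1, s) x = (a (s, x) ^ i * b (s, x) ^ j) • ι f x := by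
    intro s x
    rw [h1 s]
    rfl
  have hi : i = 0 := by
    refine hakey p i (fun y => H y p) (by fun_prop) (fun s => by rw [h0]) (fun s => ?_)
      fun t s hs => by rw [hbd t s hs]
    rw [h1', hbp, one_zpow, mul_one]
    exact orth_smul_mul _ _
  subst hi
  refine ⟨rfl, hbkey (ι f) j (fun y => H (y.1, y.2.1) y.2.2) (by fun_prop) (fun s x => by
    rw [h0]) (fun s x => ?_) fun t s hs x => by rw [hbd t s hs]⟩
  rw [h1', zpow_zero, one_mul]
  exact orth_smul_mul _ _
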